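/- Let Ω be a bounded smooth strictly pseudoconvex domain of ℂⁿ and T > 0. Let φ ∈ C^∞(Ω̄×[0,T)), f ∈ C^∞([0,T)×Ω̄×ℝ), and let u ∈ C^∞(Ω×(0,T)) ∩ C^{2;1}(Ω̄×[0,T)), strictly plurisubharmonic with respect to z, solve ∂u/∂t = log det(u_{αβ̄}) + f(t,z,u) on Ω×(0,T). Assume u = φ on ∂Ω×[0,T), sup_Ω |u(z,0)| ≤ C_u, ∂f/∂u ≤ 0 everywhere, ‖f‖_{C²((0,T)×Ω×ℝ)} ≤ C_f, and ‖φ‖_{C⁴(Ω×(0,T))} ≤ C_φ. Then there exists M₀ = M₀(Ω,T,C_u,C_φ,C_f) and, for any 0 < ε < T, a constant C = C(Ω,ε,T,C_u,C_φ,C_f) such that |u| ≤ M₀ on Ω×(0,T) and |∇u| + |∂u/∂t| + Δu ≤ C on Ω×(ε,T). -/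

import Mathlib

open Set Metric Complex Topology Filter Bornology
open scoped ComplexOrder

noncomputable section

/-- `ℂⁿ` with its Euclidean structure. -/
abbrev Cn (n : ℕ) := EuclideanSpace ℂ (Fin n)

/-- The `α`-th coordinate vector scaled by `c`. -/
def cvec (n : ℕ) (α : Fin n) (c : ℂ) : Cn n := EuclideanSpace.single α c

variable {n : ℕ}

/-- Wirtinger derivative `∂/∂z_α` (within a set), via the real Fréchet derivative. -/
def wderW (s : Set (Cn n)) (α : Fin n) (u : Cn n → ℂ) (z : Cn n) : ℂ :=
  (fderivWithin ℝ u s z (cvec n α 1) - Complex.I * fderivWithin ℝ u s z (cvec n α Complex.I)) / 2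

/-- Conjugate Wirtinger derivative `∂/∂z̄_β` (within a set). -/
def wderBarW (s : Set (Cn n)) (β : Fin n) (u : Cn n → ℂ) (z : Cn n) : ℂ :=
  (fderivWithin ℝ u s z (cvec n β 1) + Complex.I * fderivWithin ℝ u s z (cvec n β Complex.I)) / 2

/-- The complex Hessian matrix `u_{αβ̄} = ∂²u/∂z_α ∂z̄_β` of a real valued function,
computed within a set `s`. -/
def cHessW (s : Set (Cn n)) (u : Cn n → ℝ) (z : Cn n) : Matrix (Fin n) (Fin n) ℂ :=
  Matrix.of fun α β => wderW s α (wderBarW s β fun w => (u w : ℂ)) z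

/-- The complex Hessian matrix `u_{αβ̄}`. -/
def cHess (u : Cn n → ℝ) : Cn n → Matrix (Fin n) (Fin n) ℂ := cHessW univ u

/-- The Euclidean Laplacian (within a set) of `v : ℂⁿ → ℝ`, i.e. the sum of all pure second
derivatives in the `2n` underlying real coordinate directions. -/
def lapW (s : Set (Cn n)) (v : Cn n → ℝ) (z : Cn n) : ℝ :=
  ∑ α : Fin n,
    (fderivWithin ℝ (fun y => fderivWithin ℝ v s y (cvec n α 1)) s z (cvec n α 1) +
      fderivWithin ℝ (fun y => fderivWithin ℝ v s y (cvec n α Complex.I)) s z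
        (cvec n α Complex.I))

/-- The Euclidean Laplacian of `v : ℂⁿ → ℝ`. -/
def lap (v : Cn n → ℝ) : Cn n → ℝ := lapW univ v

/-- A bounded smooth strictly pseudoconvex domain of `ℂⁿ`: a bounded (nonempty) domain with a
smooth strictly plurisubharmonic defining function `ρ` on a bounded neighbourhood of its closure,
with nonvanishing differential on the boundary. -/
def IsSPCDomain (Ω : Set (Cn n)) : Prop :=
  IsOpen Ω ∧ Ω.Nonempty ∧ IsBounded Ω ∧
    ∃ (U : Set (Cn n)) (ρ : Cn n → ℝ), IsOpen U ∧ IsBounded U ∧ closure Ω ⊆ U ∧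
      ContDiffOn ℝ (⊤ : ℕ∞) ρ U ∧ (∀ z ∈ U, (cHess ρ z).PosDef) ∧
      Ω = {z ∈ U | ρ z < 0} ∧ ∀ z ∈ frontier Ω, fderiv ℝ ρ z ≠ 0

/-- Membership in `C^{2;1}(Ω̄ × [0,T))`: `u(·,t) ∈ C²(Ω̄)` for each `t ∈ [0,T)`,
`u(z,·) ∈ C¹([0,T))` for each `z ∈ Ω̄`, and `∂u/∂t` together with all second spatial
derivatives are continuous on `Ω̄ × [0,T)`. -/
def C21 (n : ℕ) (Ω : Set (Cn n)) (T : ℝ) (u : Cn n × ℝ → ℝ) : Prop :=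
  (∀ t ∈ Ico (0 : ℝ) T, ContDiffOn ℝ 2 (fun z => u (z, t)) (closure Ω)) ∧
  (∀ z ∈ closure Ω, ContDiffOn ℝ 1 (fun s => u (z, s)) (Ico (0 : ℝ) T)) ∧
  ContinuousOn (fun p : Cn n × ℝ => derivWithin (fun s => u (p.1, s)) (Ico (0 : ℝ) T) p.2)
    (closure Ω ×ˢ Ico (0 : ℝ) T) ∧
  ∀ v w : Cn n, ContinuousOn
    (fun p : Cn n × ℝ =>
      fderivWithin ℝ (fun y => fderivWithin ℝ (fun x => u (x, p.2)) (closure Ω) y v)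
        (closure Ω) p.1 w)
    (closure Ω ×ˢ Ico (0 : ℝ) T)

/-- The hypotheses of the a priori estimates theorem: `φ ∈ C^∞(Ω̄×[0,T))`,
`f ∈ C^∞([0,T)×Ω̄×ℝ)`, `u ∈ C^∞(Ω×(0,T)) ∩ C^{2;1}(Ω̄×[0,T))` is strictly plurisubharmonic
in `z` and solves `∂u/∂t = log det(u_{αβ̄}) + f(t,z,u)` on `Ω×(0,T)` with `u = φ` on
`∂Ω×[0,T)`, `sup_Ω |u(·,0)| ≤ Cu`, `f` nonincreasing in the last variable,
`‖f‖_{C²((0,T)×Ω×ℝ)} ≤ Cf` and `‖φ‖_{C⁴(Ω×(0,T))} ≤ Cφv` (parabolic norm). -/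
def AprioriHyps (n : ℕ) (Ω : Set (Cn n)) (T Cu Cφv Cf : ℝ)
    (u φ : Cn n × ℝ → ℝ) (f : ℝ × Cn n × ℝ → ℝ) : Prop :=
  ContDiffOn ℝ (⊤ : ℕ∞) φ (closure Ω ×ˢ Ico (0 : ℝ) T) ∧
  ContDiffOn ℝ (⊤ : ℕ∞) f (Ico (0 : ℝ) T ×ˢ closure Ω ×ˢ (univ : Set ℝ)) ∧
  ContDiffOn ℝ (⊤ : ℕ∞) u (Ω ×ˢ Ioo (0 : ℝ) T) ∧
  C21 n Ω T u ∧
  (∀ t ∈ Ioo (0 : ℝ) T, ∀ z ∈ Ω, (cHess (fun w => u (w, t)) z).PosDef) ∧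
  (∀ z ∈ Ω, ∀ t ∈ Ioo (0 : ℝ) T,
    deriv (fun s => u (z, s)) t
      = Real.log ((cHess (fun w => u (w, t)) z).det.re) + f (t, z, u (z, t))) ∧
  (∀ z ∈ frontier Ω, ∀ t ∈ Ico (0 : ℝ) T, u (z, t) = φ (z, t)) ∧
  (∀ z ∈ Ω, |u (z, 0)| ≤ Cu) ∧
  (∀ t ∈ Ioo (0 : ℝ) T, ∀ z ∈ Ω, ∀ r : ℝ, deriv (fun y => f (t, z, y)) r ≤ 0) ∧
  (∀ k : ℕ, k ≤ 2 → ∀ p ∈ Ioo (0 : ℝ) T ×ˢ Ω ×ˢ (univ : Set ℝ),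
    ‖iteratedFDeriv ℝ k f p‖ ≤ Cf) ∧
  (∀ j l : ℕ, j + 2 * l ≤ 4 → ∀ z ∈ Ω, ∀ t ∈ Ioo (0 : ℝ) T,
    ‖iteratedFDeriv ℝ j (fun w => iteratedDeriv l (fun s => φ (w, s)) t) z‖ ≤ Cφv)



/-! ### Linear algebra of Levi forms -/

/-- Real bilinear forms on `ℂⁿ`. -/
abbrev RB (n : ℕ) := Cn n →ₗ[ℝ] Cn n →ₗ[ℝ] ℝ

/-- `J`-symmetrization of a real bilinear form. -/
def hb (B : RB n) (x y : Cn n) : ℝ := B x y + B (I • x) (I • y)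

/-- The sesquilinear form attached to a real bilinear form. -/
def Hf (B : RB n) (x y : Cn n) : ℂ := ((hb B x y : ℂ) - I * (hb B x (I • y) : ℂ)) / 4

/-- Its matrix. -/
def HM (B : RB n) : Matrix (Fin n) (Fin n) ℂ :=
  Matrix.of fun α β => Hf B (cvec n α 1) (cvec n β 1)

/-- The Levi form. -/
def lv (B : RB n) (x : Cn n) : ℝ := hb B x x / 4

lemma II_smul (x : Cn n) : I • (I • x) = -x := by
  rw [smul_smul, I_mul_I, neg_one_smul]

lemma csmul_eq (c : ℂ) (x : Cn n) : c • x = c.re • x + c.im • (I • x) := by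
  conv_lhs => rw [← re_add_im c, add_smul, mul_smul]
  simp only [Complex.coe_smul]

lemma I_smul_real (r : ℝ) (x : Cn n) : I • (r • x) = r • (I • x) := smul_comm _ _ _

lemma hb_add_left (B : RB n) (x x' y : Cn n) : hb B (x + x') y = hb B x y + hb B x' y := by
  simp only [hb, smul_add, map_add, LinearMap.add_apply]; ring

lemma hb_add_right (B : RB n) (x y y' : Cn n) : hb B x (y + y') = hb B x y + hb B x y' := by
  simp only [hb, smul_add, map_add]; ring

lemma hb_smul_left (B : RB n) (r : ℝ) (x y : Cn n) : hb B (r • x) y = r * hb B x y := by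
  simp only [hb, I_smul_real, map_smul, LinearMap.smul_apply, smul_eq_mul]; ring

lemma hb_smul_right (B : RB n) (r : ℝ) (x y : Cn n) : hb B x (r • y) = r * hb B x y := by
  simp only [hb, I_smul_real, map_smul, smul_eq_mul]; ring

lemma hb_I_I (B : RB n) (x y : Cn n) : hb B (I • x) (I • y) = hb B x y := by
  simp only [hb, II_smul, map_neg, LinearMap.neg_apply]; ring

lemma hb_neg_right (B : RB n) (x y : Cn n) : hb B x (-y) = - hb B x y := by
  simp only [hb, smul_neg, map_neg]; ring

lemma hb_neg_left (B : RB n) (x y : Cn n) : hb B (-x) y = - hb B x y := by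
  simp only [hb, smul_neg, map_neg, LinearMap.neg_apply]; ring

lemma hb_I_left (B : RB n) (x y : Cn n) : hb B (I • x) y = - hb B x (I • y) := by
  rw [← hb_I_I B x (I • y), II_smul, hb_neg_right, neg_neg]

lemma hb_symm {B : RB n} (hB : ∀ x y, B x y = B y x) (x y : Cn n) : hb B x y = hb B y x := by
  simp only [hb, hB x y, hB (I • x) (I • y)]

lemma hb_self_I {B : RB n} (hB : ∀ x y, B x y = B y x) (x : Cn n) : hb B x (I • x) = 0 := by
  have h1 := hb_I_left B x x
  have h2 := hb_symm hB x (I • x)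
  linarith

lemma hb_csmul_right (B : RB n) (c : ℂ) (x y : Cn n) :
    hb B x (c • y) = c.re * hb B x y + c.im * hb B x (I • y) := by
  rw [csmul_eq, hb_add_right, hb_smul_right, hb_smul_right]

lemma hb_csmul_left (B : RB n) (c : ℂ) (x y : Cn n) :
    hb B (c • x) y = c.re * hb B x y - c.im * hb B x (I • y) := by
  rw [csmul_eq, hb_add_left, hb_smul_left, hb_smul_left, hb_I_left]; ring

/-- The sesquilinear form as a bundled map. -/
def HS (B : RB n) : Cn n →ₗ⋆[ℂ] Cn n →ₗ[ℂ] ℂ :=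
  LinearMap.mk₂'ₛₗ (starRingEnd ℂ) (RingHom.id ℂ) (Hf B)
    (by intro x x' y; simp only [Hf, hb_add_left]; push_cast; ring)
    (by
      intro c x y
      apply Complex.ext <;>
      simp [Hf, hb_csmul_left, II_smul, hb_neg_right] <;> ring)
    (by intro x y y'; simp only [Hf, smul_add, hb_add_right]; push_cast; ring)
    (by
      intro c x y
      have h1 := hb_csmul_right B c x y
      have h2 : hb B x (I • (c • y)) = c.re * hb B x (I • y) - c.im * hb B x y := by
        rw [smul_comm I c y, hb_csmul_right, II_smul, hb_neg_right]; ring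
      simp only [Hf, h1, h2]
      apply Complex.ext <;> simp <;> ring)

lemma HS_apply (B : RB n) (x y : Cn n) : HS B x y = Hf B x y := rfl

lemma sum_cvec (x : Cn n) : x = ∑ α, x α • cvec n α 1 := by
  ext i
  simp [cvec, Finset.sum_apply, Pi.single_apply]

lemma Hf_eq (B : RB n) (x y : Cn n) :
    Hf B x y = star (x : Fin n → ℂ) ⬝ᵥ (HM B).mulVec y := by
  rw [← HS_apply]
  conv_lhs => rw [sum_cvec x, sum_cvec y]
  simp only [map_sum, LinearMap.sum_apply, LinearMap.map_smulₛₗ, LinearMap.smul_apply,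
    smul_eq_mul, HS_apply, RingHom.id_apply, dotProduct, Matrix.mulVec, HM, Matrix.of_apply,
    Pi.star_apply, Finset.mul_sum]
  rw [Finset.sum_comm]
  refine Finset.sum_congr rfl fun α _ => Finset.sum_congr rfl fun β _ => ?_
  simp only [starRingEnd_apply]; ring

lemma Hf_symm {B : RB n} (hB : ∀ x y, B x y = B y x) (x y : Cn n) :
    Hf B y x = star (Hf B x y) := by
  have h2 : hb B y (I • x) = - hb B x (I • y) := by
    rw [hb_symm hB, hb_I_left]
  apply Complex.ext <;> simp [Hf, hb_symm hB y x, h2]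

lemma HM_herm {B : RB n} (hB : ∀ x y, B x y = B y x) : (HM B).IsHermitian := by
  ext α β
  simp only [HM, Matrix.conjTranspose_apply, Matrix.of_apply]
  rw [← Hf_symm hB]

lemma Hf_self {B : RB n} (hB : ∀ x y, B x y = B y x) (x : Cn n) :
    Hf B x x = (lv B x : ℂ) := by
  simp [Hf, lv, hb_self_I hB]

lemma Hf_re (B : RB n) (x y : Cn n) : (Hf B x y).re = hb B x y / 4 := by
  simp [Hf]

lemma Hf_im (B : RB n) (x y : Cn n) : (Hf B x y).im = - hb B x (I • y) / 4 := by
  simp [Hf]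

/-- Diagonalization of a Levi form in an orthonormal basis. -/
lemma LA_diag {B : RB n} (hB : ∀ x y, B x y = B y x) :
    ∃ (e : OrthonormalBasis (Fin n) ℂ (Cn n)) (l : Fin n → ℝ),
      (∀ i j, Hf B (e i) (e j) = if i = j then (l j : ℂ) else 0) ∧
      (HM B).det = ((∏ k, l k : ℝ) : ℂ) := by
  have hH := HM_herm hB
  refine ⟨hH.eigenvectorBasis, hH.eigenvalues, ?_, ?_⟩
  · intro i j
    rw [Hf_eq, hH.mulVec_eigenvectorBasis j]
    have := orthonormal_iff_ite.mp hH.eigenvectorBasis.orthonormal i j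
    rw [EuclideanSpace.inner_eq_star_dotProduct, dotProduct_comm] at this
    rw [dotProduct_smul, this]
    split_ifs <;> simp
  · rw [hH.det_eq_prod_eigenvalues]; push_cast; rfl

lemma log_det_le {A : Matrix (Fin n) (Fin n) ℂ} (hA : A.PosDef) :
    Real.log A.det.re ≤ A.trace.re - n := by
  have hd : A.det.re = ∏ k, hA.1.eigenvalues k := by
    rw [hA.1.det_eq_prod_eigenvalues]
    have : (∏ i, (RCLike.ofReal (hA.1.eigenvalues i) : ℂ)) = ((∏ k, hA.1.eigenvalues k : ℝ) : ℂ) := by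
      push_cast; rfl
    rw [this, ofReal_re]
  have ht : A.trace.re = ∑ k, hA.1.eigenvalues k := by
    rw [hA.1.trace_eq_sum_eigenvalues]
    have : (∑ i, (RCLike.ofReal (hA.1.eigenvalues i) : ℂ)) = ((∑ k, hA.1.eigenvalues k : ℝ) : ℂ) := by
      push_cast; rfl
    rw [this, ofReal_re]
  have hp := hA.eigenvalues_pos
  rw [hd, ht, Real.log_prod (fun i _ => (hp i).ne')]
  have : ∑ i, Real.log (hA.1.eigenvalues i) ≤ ∑ i, (hA.1.eigenvalues i - 1) :=
    Finset.sum_le_sum fun i _ => Real.log_le_sub_one_of_pos (hp i)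
  simpa using this

/-- Concavity of `log det`, at a diagonal form. -/
lemma log_det_concave {B' : RB n} (hB : ∀ x y, B' x y = B' y x)
    (hpd : (HM B').PosDef) (e : OrthonormalBasis (Fin n) ℂ (Cn n)) (l : Fin n → ℝ)
    (hl : ∀ k, 0 < l k) :
    Real.log (HM B').det.re ≤ Real.log (∏ k, l k) + ∑ k, lv B' (e k) / l k - n := by
  set E : Matrix (Fin n) (Fin n) ℂ := Matrix.of fun i k => ((Real.sqrt (l k))⁻¹ : ℂ) * (e k) i with hE
  have hsq : ∀ k, ((Real.sqrt (l k) : ℂ))⁻¹ * ((Real.sqrt (l k) : ℂ))⁻¹ = ((l k)⁻¹ : ℂ) := by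
    intro k
    rw [← mul_inv]
    congr 1
    exact_mod_cast Real.mul_self_sqrt (hl k).le
  have hcol : ∀ k, (fun i => E i k) = ((Real.sqrt (l k))⁻¹ : ℂ) • (e k : Fin n → ℂ) := by
    intro k; ext i; simp [hE]
  have hEE : E.conjTranspose * E = Matrix.diagonal fun k => ((l k)⁻¹ : ℂ) := by
    ext i j
    have h := orthonormal_iff_ite.mp e.orthonormal i j
    rw [EuclideanSpace.inner_eq_star_dotProduct] at h
    simp only [Matrix.mul_apply, Matrix.conjTranspose_apply, Matrix.diagonal_apply, hE,
      Matrix.of_apply]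
    simp only [dotProduct, Pi.star_apply] at h
    have : ∀ x, star (((Real.sqrt (l i))⁻¹ : ℂ) * (e i) x) * (((Real.sqrt (l j))⁻¹ : ℂ) * (e j) x)
        = ((Real.sqrt (l i))⁻¹ : ℂ) * ((Real.sqrt (l j))⁻¹ : ℂ) * ((e j) x * star ((e i) x)) := by
      intro x
      simp only [star_mul', star_inv₀]
      rw [show star ((Real.sqrt (l i) : ℂ)) = (Real.sqrt (l i) : ℂ) from Complex.conj_ofReal _]
      ring
    rw [Finset.sum_congr rfl fun x _ => this x, ← Finset.mul_sum, h]
    split_ifs with hij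
    · subst hij; rw [mul_one, hsq]
    · simp
  have hdet : (star E.det) * E.det = (∏ k, (l k)⁻¹ : ℝ) := by
    have := congrArg Matrix.det hEE
    rw [Matrix.det_mul, Matrix.det_conjTranspose, Matrix.det_diagonal] at this
    rw [this]; push_cast; rfl
  have hprod : 0 < ∏ k, l k := Finset.prod_pos fun k _ => hl k
  have hE0 : E.det ≠ 0 := by
    intro h0
    rw [h0, mul_zero] at hdet
    have : (∏ k, (l k)⁻¹ : ℝ) = 0 := by exact_mod_cast hdet.symm
    rw [Finset.prod_inv_distrib] at this
    exact (inv_ne_zero hprod.ne') this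
  have hinj : Function.Injective E.mulVec :=
    Matrix.mulVec_injective_iff_isUnit.mpr ((Matrix.isUnit_iff_isUnit_det E).mpr (isUnit_iff_ne_zero.mpr hE0))
  have hN : (E.conjTranspose * HM B' * E).PosDef := hpd.conjTranspose_mul_mul_same hinj
  have h1 := log_det_le hN
  have hdN : (E.conjTranspose * HM B' * E).det.re = (∏ k, l k)⁻¹ * (HM B').det.re := by
    rw [Matrix.det_mul, Matrix.det_mul, Matrix.det_conjTranspose]
    rw [show star E.det * (HM B').det * E.det = (star E.det * E.det) * (HM B').det by ring, hdet,
      Complex.re_ofReal_mul, Finset.prod_inv_distrib]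
  have htr : (E.conjTranspose * HM B' * E).trace.re = ∑ k, lv B' (e k) / l k := by
    rw [Matrix.trace, Complex.re_sum]
    refine Finset.sum_congr rfl fun k _ => ?_
    have hk : (E.conjTranspose * HM B' * E) k k
        = star (fun i => E i k) ⬝ᵥ (HM B').mulVec (fun i => E i k) := by
      rw [Matrix.mul_assoc]
      simp only [Matrix.mul_apply, dotProduct, Matrix.conjTranspose_apply, Matrix.mulVec,
        Pi.star_apply]
    rw [Matrix.diag_apply, hk, hcol, Matrix.mulVec_smul, dotProduct_smul, star_smul, smul_dotProduct,
      ← Hf_eq, Hf_self hB]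
    simp only [smul_eq_mul, star_inv₀]
    rw [show star ((Real.sqrt (l k) : ℂ)) = (Real.sqrt (l k) : ℂ) from Complex.conj_ofReal _,
      ← mul_assoc, hsq, ← Complex.ofReal_inv, ← Complex.ofReal_mul, Complex.ofReal_re]
    ring
  have hpos : 0 < (HM B').det.re := by
    have := hpd.det_pos
    exact (Complex.pos_iff.mp this).1
  rw [hdN, htr, Real.log_mul (inv_ne_zero hprod.ne') hpos.ne', Real.log_inv] at h1
  linarith

lemma lv_expand {B : RB n} (e : OrthonormalBasis (Fin n) ℂ (Cn n)) (l : Fin n → ℝ)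
    (h : ∀ i j, Hf B (e i) (e j) = if i = j then (l j : ℂ) else 0) (x : Cn n) :
    lv B x = ∑ k, l k * ‖inner ℂ (e k) x‖ ^ 2 := by
  have h1 : lv B x = (Hf B x x).re := by rw [Hf_re, lv]
  rw [h1, ← HS_apply]
  conv_lhs => rw [← e.sum_repr' x]
  simp only [map_sum, LinearMap.sum_apply, LinearMap.map_smulₛₗ, LinearMap.smul_apply,
    smul_eq_mul, HS_apply, RingHom.id_apply, h, mul_ite, mul_zero, Finset.sum_ite_eq,
    Finset.sum_ite_eq', Finset.mem_univ, if_true, Complex.re_sum]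
  refine Finset.sum_congr rfl fun k _ => ?_
  rw [← mul_assoc, mul_comm _ ((starRingEnd ℂ) _), Complex.conj_mul', ← Complex.ofReal_pow,
    ← Complex.ofReal_mul, Complex.ofReal_re, mul_comm]

lemma norm_expand (e : OrthonormalBasis (Fin n) ℂ (Cn n)) (x : Cn n) :
    ‖x‖ ^ 2 = ∑ k, ‖inner ℂ (e k) x‖ ^ 2 := (e.sum_sq_norm_inner_right x).symm

lemma lv_diag {B : RB n} (e : OrthonormalBasis (Fin n) ℂ (Cn n)) (l : Fin n → ℝ)
    (h : ∀ i j, Hf B (e i) (e j) = if i = j then (l j : ℂ) else 0) (k : Fin n) :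
    lv B (e k) = l k := by
  have h1 : lv B (e k) = (Hf B (e k) (e k)).re := by rw [Hf_re, lv]
  rw [h1, h, if_pos rfl, Complex.ofReal_re]

lemma prod_eq_mul_erase (l : Fin n → ℝ) (j : Fin n) :
    ∏ k, l k = l j * ∏ k ∈ Finset.univ.erase j, l k :=
  (Finset.mul_prod_erase _ _ (Finset.mem_univ j)).symm

lemma prod_ge (l : Fin n → ℝ) {m : ℝ} (hm : 0 ≤ m) (h : ∀ k, m ≤ l k) : m ^ n ≤ ∏ k, l k := by
  have := Finset.prod_le_prod (s := (Finset.univ : Finset (Fin n))) (f := fun _ => m) (g := l)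
    (fun _ _ => hm) (fun k _ => h k)
  simpa using this

lemma prod_ge' (l : Fin n → ℝ) {m : ℝ} (hm : 0 ≤ m) (h : ∀ k, m ≤ l k) (j : Fin n) :
    m ^ (n - 1) * l j ≤ ∏ k, l k := by
  rw [prod_eq_mul_erase l j, mul_comm]
  refine mul_le_mul_of_nonneg_left ?_ (hm.trans (h j))
  have := Finset.prod_le_prod (s := (Finset.univ.erase j : Finset (Fin n))) (f := fun _ => m) (g := l)
    (fun _ _ => hm) (fun k _ => h k)
  simpa using this

lemma prod_le' (l : Fin n → ℝ) {L : ℝ} (h0 : ∀ k, 0 ≤ l k) (h : ∀ k, l k ≤ L) (j : Fin n) :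
    ∏ k, l k ≤ L ^ (n - 1) * l j := by
  rw [prod_eq_mul_erase l j, mul_comm]
  refine mul_le_mul_of_nonneg_right ?_ (h0 j)
  have := Finset.prod_le_prod (s := (Finset.univ.erase j : Finset (Fin n))) (f := l) (g := fun _ => L)
    (fun k _ => h0 k) (fun k _ => h k)
  simpa using this

lemma norm_onb (e : OrthonormalBasis (Fin n) ℂ (Cn n)) (k : Fin n) : ‖e k‖ = 1 :=
  e.orthonormal.1 k

lemma det_lower {B : RB n} (hB : ∀ x y, B x y = B y x) {m : ℝ} (hm : 0 ≤ m)
    (h : ∀ x, m * ‖x‖ ^ 2 ≤ lv B x) : m ^ n ≤ (HM B).det.re := by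
  obtain ⟨e, l, h1, h2⟩ := LA_diag hB
  rw [h2, Complex.ofReal_re]
  refine prod_ge l hm fun k => ?_
  have := h (e k)
  rwa [lv_diag e l h1, norm_onb, one_pow, mul_one] at this

lemma det_lower' {B : RB n} (hB : ∀ x y, B x y = B y x) {m : ℝ} (hm : 0 ≤ m)
    (h : ∀ x, m * ‖x‖ ^ 2 ≤ lv B x) (x : Cn n) :
    m ^ (n - 1) * lv B x ≤ (HM B).det.re * ‖x‖ ^ 2 := by
  obtain ⟨e, l, h1, h2⟩ := LA_diag hB
  rw [h2, Complex.ofReal_re, lv_expand e l h1, norm_expand e, Finset.mul_sum, Finset.mul_sum]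
  refine Finset.sum_le_sum fun k _ => ?_
  rw [← mul_assoc]
  refine mul_le_mul_of_nonneg_right (prod_ge' l hm (fun k => ?_) k) (by positivity)
  have := h (e k)
  rwa [lv_diag e l h1, norm_onb, one_pow, mul_one] at this

lemma det_upper' {B : RB n} (hB : ∀ x y, B x y = B y x) {L : ℝ} (h0 : ∀ x, 0 ≤ lv B x)
    (h : ∀ x, lv B x ≤ L * ‖x‖ ^ 2) (x : Cn n) :
    (HM B).det.re * ‖x‖ ^ 2 ≤ L ^ (n - 1) * lv B x := by
  obtain ⟨e, l, h1, h2⟩ := LA_diag hB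
  rw [h2, Complex.ofReal_re, lv_expand e l h1, norm_expand e, Finset.mul_sum, Finset.mul_sum]
  refine Finset.sum_le_sum fun k _ => ?_
  rw [← mul_assoc]
  refine mul_le_mul_of_nonneg_right (prod_le' l (fun k => ?_) (fun k => ?_) k) (by positivity)
  · have := h0 (e k)
    rwa [lv_diag e l h1] at this
  · have := h (e k)
    rwa [lv_diag e l h1, norm_onb, one_pow, mul_one] at this

lemma HM_posDef {B : RB n} (hB : ∀ x y, B x y = B y x) (h : ∀ x, x ≠ 0 → 0 < lv B x) :
    (HM B).PosDef := by
  refine Matrix.PosDef.of_dotProduct_mulVec_pos (HM_herm hB) fun x hx => ?_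
  have h1 := Hf_eq B (WithLp.toLp 2 x) (WithLp.toLp 2 x)
  rw [Hf_self hB] at h1
  simp only at h1
  rw [← h1]
  have : 0 < lv B (WithLp.toLp 2 x) := h _ (by
    intro h0; apply hx
    have := congrArg WithLp.ofLp h0
    simpa using this)
  exact_mod_cast this

lemma lv_pos_of_posDef {B : RB n} (hB : ∀ x y, B x y = B y x) (h : (HM B).PosDef)
    (x : Cn n) (hx : x ≠ 0) : 0 < lv B x := by
  have h1 := h.dotProduct_mulVec_pos (x := (x : Fin n → ℂ)) (by
    intro h0; apply hx; ext i; simpa using congrFun h0 i)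
  rw [← Hf_eq, Hf_self hB] at h1
  exact_mod_cast h1

/-- A frame diagonalizing the Levi form. -/
structure IsFrame (B : RB n) (a : Fin n → Cn n) : Prop where
  orth : ∀ i j, hb B (a i) (a j) = if i = j then 1 else 0
  expand : ∀ x, x = ∑ k, (hb B (a k) x • a k + hb B (I • a k) x • (I • a k))
  det_pos : 0 < (HM B).det.re
  concave : ∀ B' : RB n, (∀ x y, B' x y = B' y x) → (HM B').PosDef →
    Real.log (HM B').det.re ≤ Real.log (HM B).det.re + ∑ k, hb B' (a k) (a k) - n
  upper : ∀ x, lv B x ≤ (HM B).det.re * (4 * ∑ k, ‖a k‖ ^ 2) ^ (n - 1) * ‖x‖ ^ 2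
  Slow : ∀ C, 1 ≤ C → (HM B).det.re ≤ C → 0 < n → 1 / (4 * C) ≤ ∑ k, ‖a k‖ ^ 2
  sumsq : ∀ x, ∑ k, ((hb B (a k) x) ^ 2 + (hb B (I • a k) x) ^ 2) = hb B x x

lemma frame_exists {B : RB n} (hB : ∀ x y, B x y = B y x) (hpos : ∀ x, x ≠ 0 → 0 < lv B x) :
    ∃ a, IsFrame B a := by
  obtain ⟨e, l, h1, h2⟩ := LA_diag hB
  have hl : ∀ k, 0 < l k := fun k => by
    rw [← lv_diag e l h1 k]
    exact hpos _ (by intro h; have := norm_onb e k; rw [h, norm_zero] at this; exact zero_ne_one this)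
  have hd : (HM B).det.re = ∏ k, l k := by rw [h2, Complex.ofReal_re]
  have hs : ∀ k, 0 < Real.sqrt (l k) := fun k => Real.sqrt_pos.mpr (hl k)
  have hss : ∀ k, Real.sqrt (l k) * Real.sqrt (l k) = l k := fun k => Real.mul_self_sqrt (hl k).le
  set s : Fin n → ℝ := fun k => (2 * Real.sqrt (l k))⁻¹ with hsdef
  have hs2 : ∀ k, s k * s k * (4 * l k) = 1 := by
    intro k
    have h3 := (hs k).ne'
    simp only [hsdef]
    have h4 := hss k
    field_simp
    linear_combination (-4) * h4
  have hs0 : ∀ k, 0 < s k := fun k => by have := hs k; simp only [hsdef]; positivity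
  have hna : ∀ k, ‖s k • e k‖ ^ 2 = 1 / (4 * l k) := by
    intro k
    rw [norm_smul, norm_onb, mul_one, Real.norm_eq_abs, sq_abs, eq_div_iff (by have := hl k; positivity),
      sq, hs2]
  have hhb : ∀ i x, hb B (e i) x = 4 * l i * (inner ℂ (e i) x : ℂ).re := by
    intro i x
    have h3 : hb B (e i) x = 4 * (Hf B (e i) x).re := by rw [Hf_re]; ring
    rw [h3, ← HS_apply]
    conv_lhs => rw [← e.sum_repr' x]
    simp only [map_sum, LinearMap.map_smulₛₗ, smul_eq_mul, HS_apply, RingHom.id_apply, h1, mul_ite,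
      mul_zero, Finset.sum_ite_eq, Finset.mem_univ, if_true, Complex.re_mul_ofReal]
    ring
  have hhI : ∀ i x, hb B (I • e i) x = 4 * l i * (inner ℂ (e i) x : ℂ).im := by
    intro i x
    rw [hb_I_left, hhb, inner_smul_right]
    simp
  have hA : ∀ i x, hb B (s i • e i) x = s i * (4 * l i * (inner ℂ (e i) x : ℂ).re) := by
    intro i x; rw [hb_smul_left, hhb]
  have hAI : ∀ i x, hb B (I • (s i • e i)) x = s i * (4 * l i * (inner ℂ (e i) x : ℂ).im) := by
    intro i x; rw [I_smul_real, hb_smul_left, hhI]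
  have hS : ∑ k, ‖s k • e k‖ ^ 2 = ∑ k, 1 / (4 * l k) := Finset.sum_congr rfl fun k _ => hna k
  have hlb : ∀ k, 1 / (4 * l k) ≤ ∑ k, ‖s k • e k‖ ^ 2 := by
    intro k
    rw [hS]
    exact Finset.single_le_sum (f := fun k => 1 / (4 * l k))
      (fun i _ => by have := hl i; positivity) (Finset.mem_univ k)
  refine ⟨fun k => s k • e k, ?_, ?_, ?_, ?_, ?_, ?_, ?_⟩
  · intro i j
    rw [hA, inner_smul_right_eq_smul, orthonormal_iff_ite.mp e.orthonormal i j]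
    split_ifs with hij
    · subst hij
      have := hs2 i
      simp; linarith
    · simp
  · intro x
    conv_lhs => rw [← e.sum_repr' x]
    refine Finset.sum_congr rfl fun k _ => ?_
    rw [hA, hAI, I_smul_real, smul_smul, smul_smul, csmul_eq]
    have h4 := hs2 k
    congr 2
    · linear_combination (- (inner ℂ (e k) x : ℂ).re) * h4
    · linear_combination (- (inner ℂ (e k) x : ℂ).im) * h4
  · rw [hd]; exact Finset.prod_pos fun k _ => hl k
  · intro B' hB' hpd
    have := log_det_concave hB' hpd e l hl
    rw [hd]
    refine this.trans (le_of_eq ?_)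
    congr 2
    refine Finset.sum_congr rfl fun k _ => ?_
    rw [hb_smul_left, hb_smul_right, lv, div_div, div_eq_iff (by have := hl k; positivity)]
    linear_combination (- hb B' (e k) (e k)) * hs2 k
  · intro x
    rw [hd, lv_expand e l h1, norm_expand e, Finset.mul_sum]
    refine Finset.sum_le_sum fun k _ => mul_le_mul_of_nonneg_right ?_ (by positivity)
    set S := ∑ k, ‖s k • e k‖ ^ 2 with hSdef
    have hSpos : 0 < S := lt_of_lt_of_le (by have := hl k; positivity) (hlb k)
    have hge : ∀ j, 1 / (4 * S) ≤ l j := by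
      intro j
      have h5 := hlb j
      have h6 := hl j
      rw [div_le_iff₀ (by positivity)] at h5 ⊢
      linarith
    have h7 := prod_ge' l (by positivity) hge k
    rw [div_pow, one_pow, div_mul_eq_mul_div, one_mul, div_le_iff₀ (by positivity)] at h7
    exact h7
  · intro C hC hdC hn
    by_contra hcon
    push Not at hcon
    have hgt : ∀ k, C < l k := by
      intro k
      have h5 := (hlb k).trans_lt hcon
      have h6 := hl k
      rw [div_lt_div_iff₀ (by positivity) (by positivity)] at h5
      linarith
    have h8 := prod_ge' l (by linarith) (fun k => (hgt k).le) ⟨0, hn⟩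
    have h9 : 1 ≤ C ^ (n - 1) := one_le_pow₀ hC
    have h10 := hgt ⟨0, hn⟩
    have h11 := hl ⟨0, hn⟩
    nlinarith
  · intro x
    have : hb B x x = 4 * lv B x := by rw [lv]; ring
    rw [this, lv_expand e l h1, Finset.mul_sum]
    refine Finset.sum_congr rfl fun k _ => ?_
    rw [hA, hAI, Complex.sq_norm, Complex.normSq_apply]
    linear_combination (4 * l k * ((inner ℂ (e k) x : ℂ).re ^ 2 + (inner ℂ (e k) x : ℂ).im ^ 2)) * hs2 k


/-! ### Directional calculus -/

/-- Space-time. -/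
abbrev Xn (n : ℕ) := Cn n × ℝ

/-- Directional derivative. -/
def pd (a : Xn n) (F : Xn n → ℝ) (p : Xn n) : ℝ := fderiv ℝ F p a

/-- Spatial direction. -/
def sv (v : Cn n) : Xn n := (v, 0)

/-- Time direction. -/
def eT : Xn n := (0, 1)

/-- Smoothness on a set. -/
abbrev Sm (O : Set (Xn n)) (F : Xn n → ℝ) : Prop := ContDiffOn ℝ ((⊤ : ℕ∞) : WithTop ℕ∞) F O

section Calculus
variable {O : Set (Xn n)} {F G : Xn n → ℝ} {p : Xn n}

lemma Sm.cda (hO : IsOpen O) (hF : Sm O F) (hp : p ∈ O) :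
    ContDiffAt ℝ ((⊤ : ℕ∞) : WithTop ℕ∞) F p := hF.contDiffAt (hO.mem_nhds hp)

lemma Sm.da (hO : IsOpen O) (hF : Sm O F) (hp : p ∈ O) : DifferentiableAt ℝ F p :=
  (hF.cda hO hp).differentiableAt (by simp)

lemma Sm.pd (hO : IsOpen O) (hF : Sm O F) (a : Xn n) : Sm O (pd a F) := by
  have h : ContDiffOn ℝ ((⊤ : ℕ∞) : WithTop ℕ∞) (fderiv ℝ F) O :=
    hF.fderiv_of_isOpen hO (by simp)
  exact h.clm_apply contDiffOn_const

lemma Sm.add (hF : Sm O F) (hG : Sm O G) : Sm O (fun q => F q + G q) := ContDiffOn.add hF hG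
lemma Sm.sub (hF : Sm O F) (hG : Sm O G) : Sm O (fun q => F q - G q) := ContDiffOn.sub hF hG
lemma Sm.mul (hF : Sm O F) (hG : Sm O G) : Sm O (fun q => F q * G q) := ContDiffOn.mul hF hG
lemma Sm.neg (hF : Sm O F) : Sm O (fun q => - F q) := ContDiffOn.neg hF
lemma Sm.const (r : ℝ) : Sm O (fun _ => r) := contDiffOn_const
lemma Sm.cmul (r : ℝ) (hF : Sm O F) : Sm O (fun q => r * F q) := Sm.mul (Sm.const r) hF

lemma pd_eqOn (hO : IsOpen O) (h : EqOn F G O) (a : Xn n) : EqOn (pd a F) (pd a G) O := by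
  intro q hq
  have : F =ᶠ[𝓝 q] G := by filter_upwards [hO.mem_nhds hq] with x hx using h hx
  simp only [pd, this.fderiv_eq]

lemma pd_add (hO : IsOpen O) (hF : Sm O F) (hG : Sm O G) (hp : p ∈ O) (a : Xn n) :
    pd a (fun q => F q + G q) p = pd a F p + pd a G p := by
  simp only [pd]; rw [fderiv_fun_add (hF.da hO hp) (hG.da hO hp)]; rfl

lemma pd_sub (hO : IsOpen O) (hF : Sm O F) (hG : Sm O G) (hp : p ∈ O) (a : Xn n) :
    pd a (fun q => F q - G q) p = pd a F p - pd a G p := by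
  simp only [pd]; rw [fderiv_fun_sub (hF.da hO hp) (hG.da hO hp)]; rfl

lemma pd_neg (a : Xn n) : pd a (fun q => - F q) p = - pd a F p := by
  simp only [pd]; rw [fderiv_fun_neg]; rfl

lemma pd_const (r : ℝ) (a : Xn n) : pd a (fun _ => r) p = 0 := by
  simp [pd]

lemma pd_mul (hO : IsOpen O) (hF : Sm O F) (hG : Sm O G) (hp : p ∈ O) (a : Xn n) :
    pd a (fun q => F q * G q) p = F p * pd a G p + pd a F p * G p := by
  simp only [pd]; rw [fderiv_fun_mul (hF.da hO hp) (hG.da hO hp)]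
  simp; ring

lemma pd_cmul (hO : IsOpen O) (hF : Sm O F) (hp : p ∈ O) (r : ℝ) (a : Xn n) :
    pd a (fun q => r * F q) p = r * pd a F p := by
  rw [pd_mul hO (Sm.const r) hF hp, pd_const]; ring

lemma pd_dir_add (a b : Xn n) : pd (a + b) F p = pd a F p + pd b F p := by simp [pd]
lemma pd_dir_smul (r : ℝ) (a : Xn n) : pd (r • a) F p = r * pd a F p := by simp [pd]
lemma pd_dir_neg (a : Xn n) : pd (-a) F p = - pd a F p := by simp [pd]

lemma sv_add (v w : Cn n) : sv (v + w) = sv v + sv w := by simp [sv]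
lemma sv_smul (r : ℝ) (v : Cn n) : sv (r • v) = r • sv v := by simp [sv]
lemma sv_neg (v : Cn n) : sv (-v) = - sv v := by simp [sv]

/-- second derivative as a fderiv of fderiv -/
lemma pd_pd_eq (hO : IsOpen O) (hF : Sm O F) (hp : p ∈ O) (a b : Xn n) :
    pd a (pd b F) p = fderiv ℝ (fderiv ℝ F) p a b := by
  have h : DifferentiableAt ℝ (fderiv ℝ F) p :=
    ((hF.fderiv_of_isOpen hO (m := ((⊤ : ℕ∞) : WithTop ℕ∞)) (by simp)).contDiffAt
      (hO.mem_nhds hp)).differentiableAt (by simp)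
  change fderiv ℝ (fun p => (fderiv ℝ F p) ((fun _ => b) p)) p a = _
  rw [fderiv_clm_apply h (differentiableAt_const b)]
  simp

lemma two_le_top' : minSmoothness ℝ 2 ≤ ((⊤ : ℕ∞) : WithTop ℕ∞) := by
  simp only [minSmoothness_of_isRCLikeNormedField]
  exact WithTop.coe_le_coe.mpr (le_top : (2 : ℕ∞) ≤ ⊤)

lemma pd_comm (hO : IsOpen O) (hF : Sm O F) (hp : p ∈ O) (a b : Xn n) :
    pd a (pd b F) p = pd b (pd a F) p := by
  rw [pd_pd_eq hO hF hp, pd_pd_eq hO hF hp]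
  exact ((hF.cda hO hp).isSymmSndFDerivAt two_le_top') a b

lemma pd_eqOn_comm (hO : IsOpen O) (hF : Sm O F) (a b : Xn n) :
    EqOn (pd a (pd b F)) (pd b (pd a F)) O := fun _ hq => pd_comm hO hF hq a b

lemma pd2_add (hO : IsOpen O) (hF : Sm O F) (hG : Sm O G) (hp : p ∈ O) (a b : Xn n) :
    pd b (pd a (fun q => F q + G q)) p = pd b (pd a F) p + pd b (pd a G) p := by
  rw [pd_eqOn hO (fun q hq => pd_add hO hF hG hq a) b hp, pd_add hO (hF.pd hO a) (hG.pd hO a) hp]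

lemma pd2_sub (hO : IsOpen O) (hF : Sm O F) (hG : Sm O G) (hp : p ∈ O) (a b : Xn n) :
    pd b (pd a (fun q => F q - G q)) p = pd b (pd a F) p - pd b (pd a G) p := by
  rw [pd_eqOn hO (fun q hq => pd_sub hO hF hG hq a) b hp, pd_sub hO (hF.pd hO a) (hG.pd hO a) hp]

lemma pd2_cmul (hO : IsOpen O) (hF : Sm O F) (hp : p ∈ O) (r : ℝ) (a b : Xn n) :
    pd b (pd a (fun q => r * F q)) p = r * pd b (pd a F) p := by
  rw [pd_eqOn hO (fun q hq => pd_cmul hO hF hq r a) b hp, pd_cmul hO (hF.pd hO a) hp]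

lemma pd2_mul (hO : IsOpen O) (hF : Sm O F) (hG : Sm O G) (hp : p ∈ O) (a b : Xn n) :
    pd b (pd a (fun q => F q * G q)) p = F p * pd b (pd a G) p + pd b F p * pd a G p
      + pd a F p * pd b G p + pd b (pd a F) p * G p := by
  rw [pd_eqOn hO (fun q hq => pd_mul hO hF hG hq a) b hp,
    pd_add hO (hF.mul (hG.pd hO a)) ((hF.pd hO a).mul hG) hp,
    pd_mul hO hF (hG.pd hO a) hp, pd_mul hO (hF.pd hO a) hG hp]
  ring

lemma Sm.exp (hF : Sm O F) : Sm O (fun q => Real.exp (F q)) := ContDiffOn.exp hF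

lemma pd_exp (hO : IsOpen O) (hF : Sm O F) (hp : p ∈ O) (a : Xn n) :
    pd a (fun q => Real.exp (F q)) p = Real.exp (F p) * pd a F p := by
  simp only [pd]; rw [fderiv_exp (hF.da hO hp)]; simp

lemma pd2_exp (hO : IsOpen O) (hF : Sm O F) (hp : p ∈ O) (a : Xn n) :
    pd a (pd a (fun q => Real.exp (F q))) p
      = Real.exp (F p) * (pd a (pd a F) p + (pd a F p) ^ 2) := by
  rw [pd_eqOn hO (fun q hq => pd_exp hO hF hq a) a hp, pd_mul hO hF.exp (hF.pd hO a) hp,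
    pd_exp hO hF hp]
  ring

/-- functions of time only -/
lemma Sm.time {q : ℝ → ℝ} (hq : ContDiff ℝ ((⊤ : ℕ∞) : WithTop ℕ∞) q) :
    Sm O (fun p => q p.2) := (hq.comp contDiff_snd).contDiffOn

lemma pd_time {q : ℝ → ℝ} (hq : Differentiable ℝ q) (a : Xn n) :
    pd a (fun x => q x.2) p = a.2 * deriv q p.2 := by
  simp only [pd]
  have h : HasFDerivAt (fun x : Xn n => q x.2) _ p :=
    (hq p.2).hasDerivAt.hasFDerivAt.comp p hasFDerivAt_snd
  rw [h.fderiv]; simp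

lemma pd_time_sv {q : ℝ → ℝ} (hq : Differentiable ℝ q) (v : Cn n) :
    pd (sv v) (fun x => q x.2) p = 0 := by rw [pd_time hq]; simp [sv]

lemma pd2_time_sv {q : ℝ → ℝ} (hq : Differentiable ℝ q) (v w : Cn n) :
    pd (sv v) (pd (sv w) (fun x => q x.2)) p = 0 := by
  have : pd (sv w) (fun x : Xn n => q x.2) = fun _ => 0 := by
    ext x; exact pd_time_sv hq w
  rw [this, pd_const]

lemma pd_time_eT {q : ℝ → ℝ} (hq : Differentiable ℝ q) :
    pd eT (fun x : Xn n => q x.2) p = deriv q p.2 := by rw [pd_time hq]; simp [eT]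

variable {ι : Type} [Fintype ι] {c : ι → Cn n}

/-- Heat operator in a family of directions. -/
def heat (c : ι → Cn n) (F : Xn n → ℝ) (p : Xn n) : ℝ :=
  pd eT F p - ∑ i, pd (sv (c i)) (pd (sv (c i)) F) p

/-- Carre du champ. -/
def Gam (c : ι → Cn n) (F G : Xn n → ℝ) (p : Xn n) : ℝ :=
  ∑ i, pd (sv (c i)) F p * pd (sv (c i)) G p

lemma heat_add (hO : IsOpen O) (hF : Sm O F) (hG : Sm O G) (hp : p ∈ O) :
    heat c (fun q => F q + G q) p = heat c F p + heat c G p := by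
  simp only [heat, pd_add hO hF hG hp, pd2_add hO hF hG hp, Finset.sum_add_distrib]; ring

lemma heat_sub (hO : IsOpen O) (hF : Sm O F) (hG : Sm O G) (hp : p ∈ O) :
    heat c (fun q => F q - G q) p = heat c F p - heat c G p := by
  simp only [heat, pd_sub hO hF hG hp, pd2_sub hO hF hG hp, Finset.sum_sub_distrib]; ring

lemma heat_cmul (hO : IsOpen O) (hF : Sm O F) (hp : p ∈ O) (r : ℝ) :
    heat c (fun q => r * F q) p = r * heat c F p := by
  simp only [heat, pd_cmul hO hF hp, pd2_cmul hO hF hp, ← Finset.mul_sum]; ring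

lemma heat_mul (hO : IsOpen O) (hF : Sm O F) (hG : Sm O G) (hp : p ∈ O) :
    heat c (fun q => F q * G q) p = F p * heat c G p + G p * heat c F p - 2 * Gam c F G p := by
  simp only [heat, pd_mul hO hF hG hp, pd2_mul hO hF hG hp, Gam, Finset.sum_add_distrib,
    ← Finset.mul_sum, ← Finset.sum_mul]
  ring

lemma heat_eqOn (hO : IsOpen O) (h : EqOn F G O) (hp : p ∈ O) : heat c F p = heat c G p := by
  simp only [heat, pd_eqOn hO h _ hp, pd_eqOn hO (pd_eqOn hO h _) _ hp]

lemma heat_const (r : ℝ) : heat c (fun _ => r) p = 0 := by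
  have h : ∀ a : Xn n, pd a (fun _ : Xn n => r) = fun _ => 0 := fun a => by ext q; exact pd_const r a
  simp [heat, h, pd_const]

lemma heat_time {q : ℝ → ℝ} (hq : Differentiable ℝ q) :
    heat c (fun x => q x.2) p = deriv q p.2 := by
  simp [heat, pd_time_eT hq, pd2_time_sv hq]

lemma Gam_self_nonneg : 0 ≤ Gam c F F p := Finset.sum_nonneg fun _ _ => mul_self_nonneg _

lemma Gam_le (e : ℝ) (he : 0 < e) :
    |2 * Gam c F G p| ≤ e * Gam c F F p + e⁻¹ * Gam c G G p := by
  have hee : e * e⁻¹ = 1 := mul_inv_cancel₀ he.ne'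
  have hi : 0 < e⁻¹ := inv_pos.mpr he
  have key : ∀ x y : ℝ, 2 * (x * y) ≤ e * (x * x) + e⁻¹ * (y * y) := by
    intro x y
    have : e * (x * x) + e⁻¹ * (y * y) - 2 * (x * y) = e⁻¹ * (e * x - y) ^ 2 := by
      linear_combination (-(x*x*e) + 2 * x * y) * hee
    nlinarith [mul_nonneg hi.le (sq_nonneg (e * x - y))]
  simp only [Gam, Finset.mul_sum, ← Finset.sum_add_distrib]
  rw [abs_le]
  constructor
  · rw [← Finset.sum_neg_distrib]
    refine Finset.sum_le_sum fun i _ => ?_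
    have := key (-(pd (sv (c i)) F p)) (pd (sv (c i)) G p)
    linarith
  · exact Finset.sum_le_sum fun i _ => key _ _

lemma Gam_sub_right (hO : IsOpen O) {K : Xn n → ℝ} (hF : Sm O F) (hG : Sm O G) (hp : p ∈ O) :
    Gam c K (fun q => F q - G q) p = Gam c K F p - Gam c K G p := by
  simp only [Gam, pd_sub hO hF hG hp, mul_sub, Finset.sum_sub_distrib]

lemma Gam_add_right (hO : IsOpen O) {K : Xn n → ℝ} (hF : Sm O F) (hG : Sm O G) (hp : p ∈ O) :
    Gam c K (fun q => F q + G q) p = Gam c K F p + Gam c K G p := by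
  simp only [Gam, pd_add hO hF hG hp, mul_add, Finset.sum_add_distrib]

lemma Gam_comm : Gam c F G p = Gam c G F p := by simp only [Gam, mul_comm]

lemma Gam_cmul_right (hO : IsOpen O) {K : Xn n → ℝ} (hF : Sm O F) (hp : p ∈ O) (r : ℝ) :
    Gam c K (fun q => r * F q) p = r * Gam c K F p := by
  simp only [Gam, pd_cmul hO hF hp, Finset.mul_sum]
  exact Finset.sum_congr rfl fun i _ => by ring

lemma Gam_mul_right (hO : IsOpen O) {K : Xn n → ℝ} (hF : Sm O F) (hG : Sm O G) (hp : p ∈ O) :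
    Gam c K (fun q => F q * G q) p = F p * Gam c K G p + G p * Gam c K F p := by
  simp only [Gam, pd_mul hO hF hG hp, Finset.mul_sum, ← Finset.sum_add_distrib]
  exact Finset.sum_congr rfl fun i _ => by ring

lemma Gam_le_norm {K : ℝ} (hK : ∀ v : Cn n, |pd (sv v) F p| ≤ K * ‖v‖) :
    Gam c F F p ≤ K ^ 2 * ∑ i, ‖c i‖ ^ 2 := by
  rw [Gam, Finset.mul_sum]
  refine Finset.sum_le_sum fun i _ => ?_
  have := hK (c i)
  nlinarith [abs_mul_abs_self (pd (sv (c i)) F p), abs_nonneg (pd (sv (c i)) F p), norm_nonneg (c i)]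

end Calculus

/-! ### Maximum principles -/

lemma pd_line {F : Xn n → ℝ} {O : Set (Xn n)} (hO : IsOpen O) (hF : Sm O F) {p : Xn n} (a : Xn n)
    {s : ℝ} (hs : p + s • a ∈ O) : HasDerivAt (fun s : ℝ => F (p + s • a)) (pd a F (p + s • a)) s := by
  have h1 : HasDerivAt (fun s : ℝ => p + s • a) a s := by
    simpa using ((hasDerivAt_id s).smul_const a).const_add p
  exact (hF.da hO hs).hasFDerivAt.comp_hasDerivAt s h1

/-- one variable second order condition -/
lemma second_deriv_nonpos {g g' : ℝ → ℝ} {g2 : ℝ}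
    (h1 : ∀ᶠ s in 𝓝 (0 : ℝ), HasDerivAt g (g' s) s) (h2 : HasDerivAt g' g2 0)
    (hmax : IsLocalMax g 0) : g' 0 = 0 ∧ g2 ≤ 0 := by
  have hd0 : g' 0 = 0 := hmax.hasDerivAt_eq_zero h1.self_of_nhds
  refine ⟨hd0, ?_⟩
  by_contra hcon
  push Not at hcon
  have hder : deriv g =ᶠ[𝓝 0] g' := h1.mono fun s hs => hs.deriv
  have hdd : deriv (deriv g) 0 = g2 := by rw [hder.deriv_eq, h2.deriv]
  have hmin : IsLocalMin g 0 := isLocalMin_of_deriv_deriv_pos (by rw [hdd]; exact hcon)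
    (by rw [h1.self_of_nhds.deriv, hd0]) h1.self_of_nhds.continuousAt
  have hc : g =ᶠ[𝓝 0] fun _ => g 0 := by
    filter_upwards [hmin, hmax] with s a b using le_antisymm b a
  have h3 : deriv g =ᶠ[𝓝 0] deriv (fun _ : ℝ => g 0) := hc.deriv
  have h4 := h3.deriv_eq
  simp at h4
  rw [hdd] at h4
  linarith

lemma pd_max {F : Xn n → ℝ} {O : Set (Xn n)} (hO : IsOpen O) (hF : Sm O F) {p : Xn n} (hp : p ∈ O)
    (a : Xn n) (hmax : IsLocalMax (fun s : ℝ => F (p + s • a)) 0) :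
    pd a F p = 0 ∧ pd a (pd a F) p ≤ 0 := by
  have hcont : ContinuousAt (fun s : ℝ => p + s • a) 0 := by fun_prop
  have hev : ∀ᶠ s in 𝓝 (0 : ℝ), p + s • a ∈ O := by
    apply hcont.eventually_mem
    simpa using hO.mem_nhds hp
  have h2 := pd_line hO (hF.pd hO a) (p := p) a (s := 0) (by simpa using hp)
  have := second_deriv_nonpos (g := fun s : ℝ => F (p + s • a)) (g' := fun s => pd a F (p + s • a))
    (hev.mono fun s hs => pd_line hO hF a hs) h2 hmax
  simpa using this

/-- Parabolic maximum principle, as a case distinction. -/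
lemma pmax {Ω : Set (Cn n)} (hΩ : IsOpen Ω) (hb : IsBounded Ω) {T t1 t2 : ℝ}
    (h1 : 0 ≤ t1) (h2 : t2 < T) {F : Xn n → ℝ} (hF : Sm (Ω ×ˢ Ioo 0 T) F)
    (hc : ContinuousOn F (closure Ω ×ˢ Icc t1 t2)) {M : ℝ}
    (hfr : ∀ z ∈ frontier Ω, ∀ t ∈ Icc t1 t2, F (z, t) ≤ M)
    (hini : ∀ z ∈ closure Ω, F (z, t1) ≤ M)
    (hInter : ∀ z ∈ Ω, ∀ t ∈ Ioc t1 t2, (∀ v, pd (sv v) F (z, t) = 0) →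
      (∀ v, pd (sv v) (pd (sv v) F) (z, t) ≤ 0) → 0 ≤ pd eT F (z, t) → F (z, t) ≤ M) :
    ∀ z ∈ closure Ω, ∀ t ∈ Icc t1 t2, F (z, t) ≤ M := by
  intro z hz t ht
  have hcomp : IsCompact (closure Ω ×ˢ Icc t1 t2) := hb.isCompact_closure.prod isCompact_Icc
  obtain ⟨⟨y, s⟩, ⟨hy, hs⟩, hm⟩ := hcomp.exists_isMaxOn ⟨(z, t), hz, ht⟩ hc
  simp only at hy hs
  refine (hm (⟨hz, ht⟩ : (z, t) ∈ closure Ω ×ˢ Icc t1 t2)).trans ?_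
  change F (y, s) ≤ M
  by_cases hyf : y ∈ frontier Ω
  · exact hfr y hyf s hs
  have hyΩ : y ∈ Ω := by
    by_contra hno
    exact hyf ⟨hy, by rwa [hΩ.interior_eq]⟩
  rcases hs.1.eq_or_lt with h | h
  · rw [← h]; exact hini y hy
  have hO : IsOpen (Ω ×ˢ Ioo 0 T) := hΩ.prod isOpen_Ioo
  have hp : (y, s) ∈ Ω ×ˢ Ioo 0 T := ⟨hyΩ, by simp only [mem_Ioo]; constructor <;> linarith [hs.2]⟩
  have hsp : ∀ v, pd (sv v) F (y, s) = 0 ∧ pd (sv v) (pd (sv v) F) (y, s) ≤ 0 := by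
    intro v
    apply pd_max hO hF hp
    have hcont : ContinuousAt (fun r : ℝ => y + r • v) 0 := by fun_prop
    have : ∀ᶠ r in 𝓝 (0 : ℝ), y + r • v ∈ Ω :=
      hcont.eventually_mem (by simpa using hΩ.mem_nhds hyΩ)
    filter_upwards [this] with r hr
    have := hm (⟨subset_closure hr, hs⟩ : (y + r • v, s) ∈ closure Ω ×ˢ Icc t1 t2)
    simpa [sv] using this
  refine hInter y hyΩ s ⟨h, hs.2⟩ (fun v => (hsp v).1) (fun v => (hsp v).2) ?_
  by_contra hneg
  push Not at hneg
  have hd := pd_line hO hF (p := (y, s)) eT (s := 0) (by simpa using hp)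
  have hsl := hd.hasDerivWithinAt (s := Iio 0)
  simp only [zero_smul, add_zero] at hsl
  rw [hasDerivWithinAt_iff_tendsto_slope' (by simp)] at hsl
  have hlt := hsl.eventually (Iio_mem_nhds hneg)
  have hev : ∀ᶠ r in 𝓝[<] (0 : ℝ), t1 - s < r :=
    nhdsWithin_le_nhds (Ioi_mem_nhds (by linarith))
  obtain ⟨r, hr1, hr2, hr3⟩ := (hlt.and (hev.and self_mem_nhdsWithin)).exists
  change r < 0 at hr3
  have hmem : (y, s + r) ∈ closure Ω ×ˢ Icc t1 t2 :=
    ⟨hy, by simp only [mem_Icc]; constructor <;> linarith [hs.2]⟩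
  have hle := hm hmem
  rw [slope_def_field] at hr1
  simp only [eT, Prod.smul_mk, smul_zero, smul_eq_mul, mul_one, Prod.mk_add_mk, add_zero,
    sub_zero, mul_zero] at hr1
  change F (y, s + r) ≤ F (y, s) at hle
  have : 0 ≤ (F (y, s + r) - F (y, s)) / r := div_nonneg_of_nonpos (by linarith) hr3.le
  linarith

/-- Elliptic maximum principle at a fixed time. -/
lemma emax {Ω : Set (Cn n)} (hΩ : IsOpen Ω) (hb : IsBounded Ω) {T t : ℝ}
    (ht : t ∈ Ioo 0 T) {F : Xn n → ℝ} (hF : Sm (Ω ×ˢ Ioo 0 T) F)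
    (hc : ContinuousOn (fun z => F (z, t)) (closure Ω)) {M : ℝ}
    (hfr : ∀ z ∈ frontier Ω, F (z, t) ≤ M)
    (hInter : ∀ z ∈ Ω, (∀ v, pd (sv v) (pd (sv v) F) (z, t) ≤ 0) → F (z, t) ≤ M) :
    ∀ z ∈ closure Ω, F (z, t) ≤ M := by
  intro z hz
  obtain ⟨y, hy, hm⟩ := hb.isCompact_closure.exists_isMaxOn ⟨z, hz⟩ hc
  refine (hm hz).trans ?_
  change F (y, t) ≤ M
  by_cases hyf : y ∈ frontier Ω
  · exact hfr y hyf
  have hyΩ : y ∈ Ω := by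
    by_contra hno
    exact hyf ⟨hy, by rwa [hΩ.interior_eq]⟩
  have hO : IsOpen (Ω ×ˢ Ioo 0 T) := hΩ.prod isOpen_Ioo
  refine hInter y hyΩ fun v => (pd_max hO hF (⟨hyΩ, ht⟩ : (y, t) ∈ Ω ×ˢ Ioo 0 T) (sv v) ?_).2
  have hcont : ContinuousAt (fun r : ℝ => y + r • v) 0 := by fun_prop
  have : ∀ᶠ r in 𝓝 (0 : ℝ), y + r • v ∈ Ω :=
    hcont.eventually_mem (by simpa using hΩ.mem_nhds hyΩ)
  filter_upwards [this] with r hr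
  have := hm (subset_closure hr)
  simpa [sv] using this


/-! ### Domains -/

/-- A continuous bilinear form as a bilinear form. -/
def rb (B : Cn n →L[ℝ] Cn n →L[ℝ] ℝ) : RB n :=
  LinearMap.mk₂ ℝ (fun x y => B x y) (by intros; simp) (by intros; simp) (by intros; simp)
    (by intros; simp)

lemma rb_apply (B : Cn n →L[ℝ] Cn n →L[ℝ] ℝ) (x y : Cn n) : rb B x y = B x y := rfl

lemma lv_rb (B : Cn n →L[ℝ] Cn n →L[ℝ] ℝ) (x : Cn n) :
    lv (rb B) x = (B x x + B (I • x) (I • x)) / 4 := rfl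

lemma cvec_I (α : Fin n) : cvec n α I = I • cvec n α 1 := by
  ext i
  simp [cvec, Pi.single_apply]

lemma norm_I_smul (x : Cn n) : ‖I • x‖ = ‖x‖ := by rw [norm_smul]; simp

lemma cHess_eq {g : Cn n → ℝ} {z : Cn n} (hg : ContDiffAt ℝ ((⊤ : ℕ∞) : WithTop ℕ∞) g z) :
    cHess g z = (HM (rb (fderiv ℝ (fderiv ℝ g) z))).transpose := by
  set B := fderiv ℝ (fderiv ℝ g) z with hBdef
  have hsymm : ∀ x y, rb B x y = rb B y x := fun x y => hg.isSymmSndFDerivAt two_le_top' x y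
  have h2 : ContDiffAt ℝ ((⊤ : ℕ∞) : WithTop ℕ∞) (fderiv ℝ g) z := hg.fderiv_right (by simp)
  have hd : DifferentiableAt ℝ (fderiv ℝ g) z := h2.differentiableAt (by simp)
  have hev : ∀ᶠ y in 𝓝 z, DifferentiableAt ℝ g y := by
    have := (hg.of_le (m := 1) (WithTop.coe_le_coe.mpr le_top)).eventually (by simp)
    filter_upwards [this] with y hy using hy.differentiableAt (by simp)
  have hbar : ∀ β, (wderBarW univ β fun w => (g w : ℂ)) =ᶠ[𝓝 z]
      fun y => ((fderiv ℝ g y (cvec n β 1) : ℂ) + I * (fderiv ℝ g y (I • cvec n β 1) : ℂ)) / 2 := by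
    intro β
    filter_upwards [hev] with y hy
    have h3 : HasFDerivAt (fun w => (g w : ℂ)) (Complex.ofRealCLM.comp (fderiv ℝ g y)) y :=
      Complex.ofRealCLM.hasFDerivAt.comp y hy.hasFDerivAt
    simp only [wderBarW, fderivWithin_univ, h3.fderiv, cvec_I]
    simp
  have hder : ∀ x : Cn n, HasFDerivAt (fun y => (fderiv ℝ g y x : ℂ))
      (Complex.ofRealCLM.comp ((ContinuousLinearMap.apply ℝ ℝ x).comp B)) z := by
    intro x
    have h4 : HasFDerivAt (fun y => fderiv ℝ g y x) ((ContinuousLinearMap.apply ℝ ℝ x).comp B) z :=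
      (ContinuousLinearMap.apply ℝ ℝ x).hasFDerivAt.comp z hd.hasFDerivAt
    exact Complex.ofRealCLM.hasFDerivAt.comp z h4
  ext α β
  rw [Matrix.transpose_apply]
  simp only [cHess, cHessW, Matrix.of_apply, HM]
  rw [wderW, fderivWithin_univ, (hbar β).fderiv_eq]
  have h5 := (((hder (cvec n β 1)).add ((hder (I • cvec n β 1)).const_mul I)).mul_const ((2 : ℂ)⁻¹))
  have h6 : fderiv ℝ (fun y => ((fderiv ℝ g y (cvec n β 1) : ℂ)
      + I * (fderiv ℝ g y (I • cvec n β 1) : ℂ)) / 2) z = ((2 : ℂ)⁻¹ •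
      (ofRealCLM ∘SL (ContinuousLinearMap.apply ℝ ℝ) (cvec n β 1) ∘SL B +
        I • ofRealCLM ∘SL (ContinuousLinearMap.apply ℝ ℝ) (I • cvec n β 1) ∘SL B)) := by
    simp only [div_eq_mul_inv]; exact h5.fderiv
  rw [h6, Hf_symm hsymm (cvec n α 1)]
  rw [cvec_I]
  apply Complex.ext <;>
  simp [Hf, hb, rb_apply, II_smul] <;> ring

/-- Domain data with a global defining function. -/
structure Dom (Ω : Set (Cn n)) (ρ : Cn n → ℝ) (c : ℝ) : Prop where
  op : IsOpen Ω
  ne : Ω.Nonempty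
  bd : IsBounded Ω
  sm : ContDiff ℝ ((⊤ : ℕ∞) : WithTop ℕ∞) ρ
  neg : ∀ z ∈ Ω, ρ z < 0
  loc : ∃ V, IsOpen V ∧ closure Ω ⊆ V ∧ ∀ z ∈ V, ρ z < 0 → z ∈ Ω
  zero : ∀ z ∈ frontier Ω, ρ z = 0
  cpos : 0 < c
  levi : ∀ z ∈ closure Ω, ∀ x, c * ‖x‖ ^ 2 ≤ lv (rb (fderiv ℝ (fderiv ℝ ρ) z)) x
  grad : ∀ z ∈ frontier Ω, fderiv ℝ ρ z ≠ 0

lemma lv_smul (B : RB n) (r : ℝ) (x : Cn n) : lv B (r • x) = r ^ 2 * lv B x := by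
  simp only [lv, hb_smul_left, hb_smul_right]; ring

lemma exists_dom {Ω : Set (Cn n)} (h : IsSPCDomain Ω) : ∃ ρ c, Dom Ω ρ c := by
  obtain ⟨hop, hne, hbd, U, r, hU, -, hcl, hr, hpd, hΩ, hgr⟩ := h
  obtain ⟨χ, hχ1, hχ0, -⟩ := exists_contMDiffMap_zero_one_nhds_of_isClosed
    (n := ⊤) (modelWithCornersSelf ℝ (Cn n)) (s := Uᶜ) (t := closure Ω) hU.isClosed_compl
    isClosed_closure (by rw [Set.disjoint_left]; exact fun x hx hx' => hx (hcl hx'))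
  have hχs : ContDiff ℝ ((⊤ : ℕ∞) : WithTop ℕ∞) χ := χ.contMDiff.contDiff
  set ρ : Cn n → ℝ := fun z => χ z * r z with hρ
  have hρs : ContDiff ℝ ((⊤ : ℕ∞) : WithTop ℕ∞) ρ := by
    rw [contDiff_iff_contDiffAt]
    intro z
    by_cases hz : z ∈ U
    · exact hχs.contDiffAt.mul (hr.contDiffAt (hU.mem_nhds hz))
    · have h0 : ∀ᶠ x in 𝓝 z, χ x = 0 := hχ1.filter_mono (nhds_le_nhdsSet (by exact hz))
      refine (contDiffAt_const (c := (0 : ℝ))).congr_of_eventuallyEq ?_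
      filter_upwards [h0] with x hx
      simp [hρ, hx]
  obtain ⟨V0, hV0, hclV0, hV01⟩ : ∃ V0, IsOpen V0 ∧ closure Ω ⊆ V0 ∧ ∀ x ∈ V0, χ x = 1 := by
    obtain ⟨V0, h1, h2, h3⟩ := mem_nhdsSet_iff_exists.mp hχ0
    exact ⟨V0, h1, h2, fun x hx => h3 hx⟩
  have hloc : ∀ z ∈ closure Ω, ρ =ᶠ[𝓝 z] r := by
    intro z hz
    filter_upwards [hV0.mem_nhds (hclV0 hz)] with x hx
    simp [hρ, hV01 x hx]
  have hrz : ∀ z ∈ closure Ω, ρ z = r z := fun z hz => (hloc z hz).self_of_nhds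
  have hfd : ∀ z ∈ closure Ω, fderiv ℝ ρ z = fderiv ℝ r z := fun z hz => (hloc z hz).fderiv_eq
  have hfd2 : ∀ z ∈ closure Ω, fderiv ℝ (fderiv ℝ ρ) z = fderiv ℝ (fderiv ℝ r) z :=
    fun z hz => (hloc z hz).fderiv.fderiv_eq
  have hsy : ∀ z x y, rb (fderiv ℝ (fderiv ℝ ρ) z) x y = rb (fderiv ℝ (fderiv ℝ ρ) z) y x :=
    fun z x y => hρs.contDiffAt.isSymmSndFDerivAt two_le_top' x y
  have hlevpos : ∀ z ∈ closure Ω, ∀ x, x ≠ 0 → 0 < lv (rb (fderiv ℝ (fderiv ℝ ρ) z)) x := by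
    intro z hz
    have h1 := hpd z (hcl hz)
    rw [cHess_eq (hr.contDiffAt (hU.mem_nhds (hcl hz))), ← hfd2 z hz] at h1
    have h2 : (HM (rb (fderiv ℝ (fderiv ℝ ρ) z))).PosDef := by simpa using h1.transpose
    exact lv_pos_of_posDef (hsy z) h2
  have hc2 : Continuous (fderiv ℝ (fderiv ℝ ρ)) :=
    ((hρs.fderiv_right (m := ((⊤ : ℕ∞) : WithTop ℕ∞)) (by simp)).fderiv_right
      (m := ((⊤ : ℕ∞) : WithTop ℕ∞)) (by simp)).continuous
  have hcont : Continuous fun q : Cn n × Cn n => lv (rb (fderiv ℝ (fderiv ℝ ρ) q.1)) q.2 := by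
    simp only [lv_rb]
    have : Continuous fun q : Cn n × Cn n => fderiv ℝ (fderiv ℝ ρ) q.1 := hc2.comp continuous_fst
    fun_prop
  have hlev : ∃ c, 0 < c ∧ ∀ z ∈ closure Ω, ∀ x, c * ‖x‖ ^ 2 ≤ lv (rb (fderiv ℝ (fderiv ℝ ρ) z)) x := by
    have hK : IsCompact (closure Ω ×ˢ sphere (0 : Cn n) 1) :=
      hbd.isCompact_closure.prod (isCompact_sphere 0 1)
    rcases (closure Ω ×ˢ sphere (0 : Cn n) 1).eq_empty_or_nonempty with he | hne'
    · refine ⟨1, one_pos, fun z hz x => ?_⟩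
      have hx : x = 0 := by
        by_contra hx
        have : (z, (‖x‖⁻¹ : ℝ) • x) ∈ closure Ω ×ˢ sphere (0 : Cn n) 1 :=
          ⟨hz, by simp [norm_smul, hx]⟩
        rw [he] at this; exact this
      subst hx; simp [lv_rb]
    · obtain ⟨⟨z0, x0⟩, ⟨hz0, hx0⟩, hmin⟩ := hK.exists_isMinOn hne' hcont.continuousOn
      have hx0' : x0 ≠ 0 := by
        intro h0; simp only at hx0; rw [h0] at hx0; simp at hx0
      refine ⟨_, hlevpos z0 hz0 x0 hx0', fun z hz x => ?_⟩
      by_cases hx : x = 0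
      · subst hx; simp [lv_rb]
      have hxn : 0 < ‖x‖ := norm_pos_iff.mpr hx
      have := hmin (⟨hz, by simp [norm_smul, hx]⟩ :
        (z, (‖x‖⁻¹ : ℝ) • x) ∈ closure Ω ×ˢ sphere (0 : Cn n) 1)
      simp only [mem_setOf_eq, lv_smul] at this
      rw [inv_pow, ← div_eq_inv_mul, le_div_iff₀ (by positivity)] at this
      exact this
  obtain ⟨c, hc, hlev⟩ := hlev
  have hfrU : ∀ z ∈ frontier Ω, ρ z = 0 := by
    intro z hz
    have hzc : z ∈ closure Ω := frontier_subset_closure hz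
    have hle : ρ z ≤ 0 := by
      have : closure Ω ⊆ {x | ρ x ≤ 0} := by
        apply closure_minimal _ (isClosed_le hρs.continuous continuous_const)
        intro x hx
        have h1 := hrz x (subset_closure hx)
        rw [hΩ] at hx
        simp only [mem_setOf_eq]; rw [h1]; exact hx.2.le
      exact this hzc
    refine le_antisymm hle ?_
    by_contra hlt
    push Not at hlt
    have : z ∈ Ω := by
      rw [hΩ]; exact ⟨hcl hzc, by rw [← hrz z hzc]; exact hlt⟩
    rw [hop.frontier_eq] at hz
    exact hz.2 this
  refine ⟨ρ, c, hop, hne, hbd, hρs, ?_, ⟨V0 ∩ U, hV0.inter hU, ?_, ?_⟩, hfrU, hc, hlev, ?_⟩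
  · intro z hz
    rw [hrz z (subset_closure hz)]
    rw [hΩ] at hz; exact hz.2
  · exact fun z hz => ⟨hclV0 hz, hcl hz⟩
  · rintro z ⟨h1, h2⟩ h3
    rw [hΩ]; refine ⟨h2, ?_⟩
    simpa [hρ, hV01 z h1] using h3
  · intro z hz
    rw [hfd z (frontier_subset_closure hz)]; exact hgr z hz


/-! ### Boundary geometry and regularity up to the boundary -/

/-- Inward direction at a point. -/
def Inw (Ω : Set (Cn n)) (z0 v : Cn n) : Prop :=
  ∃ r > 0, ∀ z ∈ closure Ω, dist z z0 < r → ∀ s ∈ Ioo (0 : ℝ) r, z + s • v ∈ Ω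

lemma Dom.cont_fd {Ω : Set (Cn n)} {ρ : Cn n → ℝ} {c : ℝ} (h : Dom Ω ρ c) :
    Continuous (fderiv ℝ ρ) := h.sm.continuous_fderiv (by simp)

lemma Dom.le {Ω : Set (Cn n)} {ρ : Cn n → ℝ} {c : ℝ} (h : Dom Ω ρ c) {z : Cn n}
    (hz : z ∈ closure Ω) : ρ z ≤ 0 :=
  closure_minimal (fun x hx => (h.neg x hx).le)
    (isClosed_le h.sm.continuous continuous_const) hz

lemma Dom.inw_frontier {Ω : Set (Cn n)} {ρ : Cn n → ℝ} {c : ℝ} (h : Dom Ω ρ c) {z0 v : Cn n}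
    (hz : z0 ∈ frontier Ω) (hv : fderiv ℝ ρ z0 v < 0) : Inw Ω z0 v := by
  obtain ⟨V, hV, hcl, hVΩ⟩ := h.loc
  have hopen : IsOpen {y | fderiv ℝ ρ y v < 0} :=
    isOpen_lt (h.cont_fd.clm_apply continuous_const) continuous_const
  have hnb : V ∩ {y | fderiv ℝ ρ y v < 0} ∈ 𝓝 z0 :=
    (hV.inter hopen).mem_nhds ⟨hcl (frontier_subset_closure hz), hv⟩
  obtain ⟨R, hR, hball⟩ := Metric.mem_nhds_iff.mp hnb
  have hv1 : 0 < ‖v‖ + 1 := by positivity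
  refine ⟨min (R / 2) (R / 2 / (‖v‖ + 1)), by positivity, fun z hzc hd s hs => ?_⟩
  have hd' : dist z z0 < R / 2 := hd.trans_le (min_le_left _ _)
  have hs2 : s * (‖v‖ + 1) < R / 2 := by
    have := hs.2.trans_le (min_le_right _ _)
    rwa [lt_div_iff₀ hv1] at this
  have hin : ∀ r ∈ Icc (0 : ℝ) s, z + r • v ∈ ball z0 R := by
    intro r hr
    rw [mem_ball, dist_eq_norm]
    have h1 : ‖z - z0‖ < R / 2 := by rwa [← dist_eq_norm]
    have h2 : ‖r • v‖ ≤ s * (‖v‖ + 1) := by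
      rw [norm_smul, Real.norm_eq_abs, abs_of_nonneg hr.1]
      have := norm_nonneg v
      nlinarith [hr.1, hr.2]
    calc ‖z + r • v - z0‖ = ‖(z - z0) + r • v‖ := by congr 1; abel
      _ ≤ ‖z - z0‖ + ‖r • v‖ := norm_add_le _ _
      _ < R := by linarith
  have hder : ∀ r, HasDerivAt (fun r : ℝ => ρ (z + r • v)) (fderiv ℝ ρ (z + r • v) v) r := by
    intro r
    have h1 : HasDerivAt (fun s : ℝ => z + s • v) v r := by
      simpa using ((hasDerivAt_id r).smul_const v).const_add z
    exact ((h.sm.differentiable (by simp)) _).hasFDerivAt.comp_hasDerivAt r h1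
  have hanti : StrictAntiOn (fun r : ℝ => ρ (z + r • v)) (Icc 0 s) := by
    refine strictAntiOn_of_deriv_neg (convex_Icc 0 s)
      (fun r _ => (hder r).continuousAt.continuousWithinAt) fun r hr => ?_
    rw [(hder r).deriv]
    exact (hball (hin r (interior_subset hr))).2
  have hlt := hanti (left_mem_Icc.mpr hs.1.le) (right_mem_Icc.mpr hs.1.le) hs.1
  simp only [zero_smul, add_zero] at hlt
  exact hVΩ _ (hball (hin s (right_mem_Icc.mpr hs.1.le))).1 (hlt.trans_le (h.le hzc))

lemma Dom.inw_span {Ω : Set (Cn n)} {ρ : Cn n → ℝ} {c : ℝ} (h : Dom Ω ρ c) {z0 : Cn n}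
    (hz : z0 ∈ closure Ω) : ∃ ν, Inw Ω z0 ν ∧ ∀ v, ∃ K : ℝ, Inw Ω z0 (v + K • ν) := by
  by_cases hf : z0 ∈ frontier Ω
  · have hg := h.grad z0 hf
    obtain ⟨y, hy⟩ : ∃ y, fderiv ℝ ρ z0 y ≠ 0 := by
      by_contra hcon; push Not at hcon
      exact hg (by ext y; simpa using hcon y)
    obtain ⟨ν, hν⟩ : ∃ ν, fderiv ℝ ρ z0 ν < 0 := by
      rcases lt_or_gt_of_ne hy with h1 | h1
      · exact ⟨y, h1⟩
      · exact ⟨-y, by simpa using h1⟩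
    refine ⟨ν, h.inw_frontier hf hν, fun v => ?_⟩
    refine ⟨(|fderiv ℝ ρ z0 v| + 1) / (-(fderiv ℝ ρ z0 ν)), h.inw_frontier hf ?_⟩
    rw [map_add, map_smul, smul_eq_mul]
    have : (|fderiv ℝ ρ z0 v| + 1) / (-(fderiv ℝ ρ z0 ν)) * fderiv ℝ ρ z0 ν
      = -(|fderiv ℝ ρ z0 v| + 1) := by
      rw [div_neg, neg_mul, div_mul_cancel₀ _ hν.ne]
    rw [this]
    linarith [le_abs_self (fderiv ℝ ρ z0 v)]
  · have hΩ : z0 ∈ Ω := by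
      by_contra hno
      exact hf ⟨hz, by rwa [h.op.interior_eq]⟩
    have key : ∀ v, Inw Ω z0 v := by
      intro v
      have hcont : Continuous fun q : Cn n × ℝ => q.1 + q.2 • v := by fun_prop
      have hn : {q : Cn n × ℝ | q.1 + q.2 • v ∈ Ω} ∈ 𝓝 (z0, (0 : ℝ)) :=
        (h.op.preimage hcont).mem_nhds (by simpa using hΩ)
      obtain ⟨R, hR, hball⟩ := Metric.mem_nhds_iff.mp hn
      refine ⟨R, hR, fun z _ hd s hs => ?_⟩
      have hmem : (z, s) ∈ ball (z0, (0 : ℝ)) R := by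
        rw [mem_ball, Prod.dist_eq, max_lt_iff]
        refine ⟨hd, ?_⟩
        simp only [Real.dist_eq, sub_zero]
        rw [abs_of_pos hs.1]; exact hs.2
      exact hball hmem
    exact ⟨0, key 0, fun v => ⟨0, key _⟩⟩

lemma Inw.cone {Ω : Set (Cn n)} {z0 v : Cn n} (hz : z0 ∈ closure Ω) (h : Inw Ω z0 v) :
    v ∈ tangentConeAt ℝ (closure Ω) z0 := by
  obtain ⟨r, hr, h⟩ := h
  refine mem_tangentConeAt_of_add_smul_mem (l := 𝓝[>] (0 : ℝ)) (c := id)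
    (tendsto_id'.mpr <| nhdsGT_le_nhdsNE 0) ?_
  filter_upwards [Ioo_mem_nhdsGT hr] with s hs
  exact subset_closure (h z0 hz (by simpa using hr) s hs)

lemma Dom.ud {Ω : Set (Cn n)} {ρ : Cn n → ℝ} {c : ℝ} (h : Dom Ω ρ c) :
    UniqueDiffOn ℝ (closure Ω) := by
  intro z hz
  refine ⟨?_, subset_closure hz⟩
  obtain ⟨ν, h1, h2⟩ := h.inw_span hz
  have : Submodule.span ℝ (tangentConeAt ℝ (closure Ω) z) = ⊤ := by
    rw [eq_top_iff]
    intro v _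
    obtain ⟨K, hK⟩ := h2 v
    have h3 := Submodule.subset_span (R := ℝ) (hK.cone hz)
    have h4 := Submodule.subset_span (R := ℝ) (h1.cone hz)
    have h5 := Submodule.sub_mem _ h3 (Submodule.smul_mem _ K h4)
    simpa using h5
  rw [this]
  simp

/-- Spatial derivative up to the boundary. -/
def D1 (Ω : Set (Cn n)) (F : Xn n → ℝ) (p : Xn n) : Cn n →L[ℝ] ℝ :=
  fderivWithin ℝ (fun x => F (x, p.2)) (closure Ω) p.1

/-- Second spatial derivative up to the boundary. -/
def D2 (Ω : Set (Cn n)) (F : Xn n → ℝ) (p : Xn n) : Cn n →L[ℝ] Cn n →L[ℝ] ℝ :=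
  fderivWithin ℝ (fun y => fderivWithin ℝ (fun x => F (x, p.2)) (closure Ω) y) (closure Ω) p.1

/-- Regularity up to the boundary. -/
structure Reg2 (Ω : Set (Cn n)) (T : ℝ) (F : Xn n → ℝ) : Prop where
  c0 : ContinuousOn F (closure Ω ×ˢ Ioo 0 T)
  d : ∀ t ∈ Ioo 0 T, ContDiffOn ℝ 2 (fun z => F (z, t)) (closure Ω)
  c1 : ContinuousOn (D1 Ω F) (closure Ω ×ˢ Ioo 0 T)
  c2 : ∀ v w, ContinuousOn (fun p => D2 Ω F p v w) (closure Ω ×ˢ Ioo 0 T)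

section
variable {Ω : Set (Cn n)} {ρ : Cn n → ℝ} {c T : ℝ}

lemma d1_has {F : Xn n → ℝ} {t : ℝ}
    (hd : ContDiffOn ℝ 2 (fun z => F (z, t)) (closure Ω)) {z : Cn n} (hz : z ∈ closure Ω) :
    HasFDerivWithinAt (fun x => F (x, t)) (D1 Ω F (z, t)) (closure Ω) z :=
  (hd.differentiableOn (by simp) z hz).hasFDerivWithinAt

lemma d2_has (h : Dom Ω ρ c) {F : Xn n → ℝ} {t : ℝ}
    (hd : ContDiffOn ℝ 2 (fun z => F (z, t)) (closure Ω)) {z : Cn n} (hz : z ∈ closure Ω) :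
    HasFDerivWithinAt (fun x => D1 Ω F (x, t)) (D2 Ω F (z, t)) (closure Ω) z := by
  have h1 : ContDiffOn ℝ 1 (fun y => fderivWithin ℝ (fun x => F (x, t)) (closure Ω) y) (closure Ω) :=
    hd.fderivWithin h.ud (by norm_num)
  exact (h1.differentiableOn (by simp) z hz).hasFDerivWithinAt

lemma sd2_has (h : Dom Ω ρ c) {F : Xn n → ℝ} {t : ℝ}
    (hd : ContDiffOn ℝ 2 (fun z => F (z, t)) (closure Ω)) {z : Cn n} (hz : z ∈ closure Ω) (v : Cn n) :
    HasFDerivWithinAt (fun x => D1 Ω F (x, t) v)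
      ((ContinuousLinearMap.apply ℝ ℝ v).comp (D2 Ω F (z, t))) (closure Ω) z :=
  (ContinuousLinearMap.apply ℝ ℝ v).hasFDerivAt.comp_hasFDerivWithinAt z (d2_has h hd hz)

lemma d2_eq (h : Dom Ω ρ c) {F : Xn n → ℝ} {t : ℝ}
    (hd : ContDiffOn ℝ 2 (fun z => F (z, t)) (closure Ω)) {z : Cn n} (hz : z ∈ closure Ω)
    (w v : Cn n) :
    fderivWithin ℝ (fun y => fderivWithin ℝ (fun x => F (x, t)) (closure Ω) y v) (closure Ω) z w
      = D2 Ω F (z, t) w v := by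
  have := (sd2_has h hd hz v).fderivWithin (h.ud z hz)
  exact congrArg (fun L => L w) this

/-- interior identification -/
lemma D1_pd (h : Dom Ω ρ c) {F : Xn n → ℝ} (hF : Sm (Ω ×ˢ Ioo 0 T) F) {p : Xn n}
    (hp : p ∈ Ω ×ˢ Ioo 0 T) (v : Cn n) : D1 Ω F p v = pd (sv v) F p := by
  have hO : IsOpen (Ω ×ˢ Ioo 0 T) := h.op.prod isOpen_Ioo
  have hnb : closure Ω ∈ 𝓝 p.1 := mem_of_superset (h.op.mem_nhds hp.1) subset_closure
  rw [D1, fderivWithin_of_mem_nhds hnb, pd]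
  have h1 : HasFDerivAt (fun x : Cn n => (x, p.2)) (ContinuousLinearMap.inl ℝ (Cn n) ℝ) p.1 :=
    hasFDerivAt_prodMk_left p.1 p.2
  have h2 : HasFDerivAt (fun x => F (x, p.2)) _ p.1 := (hF.da hO hp).hasFDerivAt.comp p.1 h1
  rw [h2.fderiv]
  simp [sv]

lemma Sm.slice (h : Dom Ω ρ c) {F : Xn n → ℝ} (hF : Sm (Ω ×ˢ Ioo 0 T) F) {p : Xn n}
    (hp : p ∈ Ω ×ˢ Ioo 0 T) : ContDiffAt ℝ ((⊤ : ℕ∞) : WithTop ℕ∞) (fun x => F (x, p.2)) p.1 := by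
  have hO : IsOpen (Ω ×ˢ Ioo 0 T) := h.op.prod isOpen_Ioo
  have h1 : ContDiffAt ℝ ((⊤ : ℕ∞) : WithTop ℕ∞) (fun x : Cn n => (x, p.2)) p.1 := by fun_prop
  exact (hF.cda hO hp).comp p.1 h1

lemma D2_fd (h : Dom Ω ρ c) {F : Xn n → ℝ} {p : Xn n}
    (hp : p ∈ Ω ×ˢ Ioo 0 T) : D2 Ω F p = fderiv ℝ (fderiv ℝ (fun x => F (x, p.2))) p.1 := by
  have hnb : ∀ y ∈ Ω, closure Ω ∈ 𝓝 y := fun y hy =>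
    mem_of_superset (h.op.mem_nhds hy) subset_closure
  rw [D2, fderivWithin_of_mem_nhds (hnb _ hp.1)]
  apply Filter.EventuallyEq.fderiv_eq
  filter_upwards [h.op.mem_nhds hp.1] with y hy
  rw [fderivWithin_of_mem_nhds (hnb y hy)]

lemma D2_pd (h : Dom Ω ρ c) {F : Xn n → ℝ} (hF : Sm (Ω ×ˢ Ioo 0 T) F) {p : Xn n}
    (hp : p ∈ Ω ×ˢ Ioo 0 T) (w v : Cn n) : D2 Ω F p w v = pd (sv w) (pd (sv v) F) p := by
  have hO : IsOpen (Ω ×ˢ Ioo 0 T) := h.op.prod isOpen_Ioo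
  have h0 := hF.slice h hp
  have h1 : DifferentiableAt ℝ (fderiv ℝ (fun x => F (x, p.2))) p.1 :=
    (h0.fderiv_right (m := ((⊤ : ℕ∞) : WithTop ℕ∞)) (by simp)).differentiableAt (by simp)
  rw [← D1_pd (T := T) h (hF.pd hO _) hp, D2_fd h hp]
  have hnb : closure Ω ∈ 𝓝 p.1 := mem_of_superset (h.op.mem_nhds hp.1) subset_closure
  rw [D1, fderivWithin_of_mem_nhds hnb]
  have h2 : (fun x => pd (sv v) F (x, p.2)) =ᶠ[𝓝 p.1]
      fun x => fderiv ℝ (fun x => F (x, p.2)) x v := by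
    filter_upwards [h.op.mem_nhds hp.1] with y hy
    have hy' : (y, p.2) ∈ Ω ×ˢ Ioo 0 T := ⟨hy, hp.2⟩
    rw [← D1_pd h hF hy', D1,
      fderivWithin_of_mem_nhds (mem_of_superset (h.op.mem_nhds hy) subset_closure)]
  rw [h2.fderiv_eq]
  have h3 : HasFDerivAt (fun x => fderiv ℝ (fun x => F (x, p.2)) x v) _ p.1 :=
    (ContinuousLinearMap.apply ℝ ℝ v).hasFDerivAt.comp p.1 h1.hasFDerivAt
  rw [h3.fderiv]; simp

lemma Reg2.sub (h : Dom Ω ρ c) {F G : Xn n → ℝ} (hF : Reg2 Ω T F) (hG : Reg2 Ω T G) :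
    Reg2 Ω T (fun p => F p - G p) ∧
    (∀ p ∈ closure Ω ×ˢ Ioo 0 T, D1 Ω (fun p => F p - G p) p = D1 Ω F p - D1 Ω G p) ∧
    (∀ p ∈ closure Ω ×ˢ Ioo 0 T, D2 Ω (fun p => F p - G p) p = D2 Ω F p - D2 Ω G p) := by
  have e1 : ∀ p ∈ closure Ω ×ˢ Ioo 0 T, D1 Ω (fun p => F p - G p) p = D1 Ω F p - D1 Ω G p := by
    intro p hp
    exact ((d1_has (hF.d _ hp.2) hp.1).sub (d1_has (hG.d _ hp.2) hp.1)).fderivWithin (h.ud _ hp.1)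
  have e2 : ∀ p ∈ closure Ω ×ˢ Ioo 0 T, D2 Ω (fun p => F p - G p) p = D2 Ω F p - D2 Ω G p := by
    intro p hp
    have h1 := ((d2_has h (hF.d _ hp.2) hp.1).sub (d2_has h (hG.d _ hp.2) hp.1))
    have h2 : HasFDerivWithinAt
        (fun y => fderivWithin ℝ (fun x => F (x, p.2) - G (x, p.2)) (closure Ω) y)
        (D2 Ω F p - D2 Ω G p) (closure Ω) p.1 :=
      h1.congr (fun y hy => e1 (y, p.2) ⟨hy, hp.2⟩) (e1 p hp)
    exact h2.fderivWithin (h.ud _ hp.1)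
  exact ⟨⟨hF.c0.sub hG.c0, fun t ht => (hF.d t ht).sub (hG.d t ht), (hF.c1.sub hG.c1).congr e1,
    fun v w => ((hF.c2 v w).sub (hG.c2 v w)).congr
      (fun p hp => by simp only [e2 p hp]; rfl)⟩, e1, e2⟩

end


/-! ### Regularity of solutions up to the boundary -/

section
variable {Ω : Set (Cn n)} {ρ : Cn n → ℝ} {c T : ℝ}

/-- time derivative up to the boundary -/
def tdu (T : ℝ) (u : Xn n → ℝ) (p : Xn n) : ℝ := derivWithin (fun s => u (p.1, s)) (Ico (0 : ℝ) T) p.2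

lemma C21.cont (h : Dom Ω ρ c) {u : Xn n → ℝ} (hu : C21 n Ω T u) :
    ContinuousOn u (closure Ω ×ˢ Ico 0 T) := by
  obtain ⟨h1, h2, h3, -⟩ := hu
  rintro ⟨z0, t0⟩ ⟨hz0, ht0⟩
  obtain ⟨t2, ht2, ht2'⟩ := exists_between ht0.2
  have hcomp : IsCompact (closure Ω ×ˢ Icc 0 t2) := h.bd.isCompact_closure.prod isCompact_Icc
  have hsub : Icc 0 t2 ⊆ Ico 0 T := fun s hs => ⟨hs.1, hs.2.trans_lt ht2'⟩
  obtain ⟨M, hM⟩ := hcomp.exists_bound_of_continuousOn (h3.mono (prod_mono_right hsub))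
  have hlip : ∀ z ∈ closure Ω, ∀ t ∈ Icc 0 t2, |u (z, t) - u (z, t0)| ≤ M * |t - t0| := by
    intro z hz t ht
    have := (convex_Icc (0 : ℝ) t2).norm_image_sub_le_of_norm_hasDerivWithin_le
      (f := fun s => u (z, s)) (f' := fun s => derivWithin (fun s => u (z, s)) (Ico (0 : ℝ) T) s)
      (C := M) (x := t0) (y := t)
      (fun s hs => (((h2 z hz).differentiableOn (by simp)) s (hsub hs)).hasDerivWithinAt.mono hsub)
      (fun s hs => hM (z, s) ⟨hz, hs⟩) ⟨ht0.1, ht2.le⟩ ht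
    simpa [Real.norm_eq_abs] using this
  rw [ContinuousWithinAt, tendsto_iff_dist_tendsto_zero]
  have hsl : Tendsto (fun p : Xn n => u (p.1, t0)) (𝓝[closure Ω ×ˢ Ico 0 T] (z0, t0)) (𝓝 (u (z0, t0))) := by
    have := (h1 t0 ht0).continuousOn z0 hz0
    refine this.tendsto.comp ?_
    refine tendsto_nhdsWithin_iff.mpr ⟨(continuous_fst.tendsto _).mono_left nhdsWithin_le_nhds, ?_⟩
    filter_upwards [self_mem_nhdsWithin] with p hp using hp.1
  have hlim : Tendsto (fun p : Xn n => M * |p.2 - t0| + dist (u (p.1, t0)) (u (z0, t0)))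
      (𝓝[closure Ω ×ˢ Ico 0 T] (z0, t0)) (𝓝 0) := by
    have e1 : Tendsto (fun p : Xn n => M * |p.2 - t0|) (𝓝[closure Ω ×ˢ Ico 0 T] (z0, t0)) (𝓝 0) := by
      have : Continuous fun p : Xn n => M * |p.2 - t0| := by fun_prop
      have := (this.tendsto (z0, t0)).mono_left (nhdsWithin_le_nhds (s := closure Ω ×ˢ Ico 0 T))
      simpa using this
    have e2 := tendsto_iff_dist_tendsto_zero.mp hsl
    simpa using e1.add e2
  refine squeeze_zero' (Eventually.of_forall fun _ => dist_nonneg) ?_ hlim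
  have hev : ∀ᶠ p : Xn n in 𝓝[closure Ω ×ˢ Ico 0 T] (z0, t0), p.2 < t2 :=
    (continuous_snd.tendsto (z0, t0)).mono_left nhdsWithin_le_nhds (Iio_mem_nhds ht2)
  filter_upwards [self_mem_nhdsWithin, hev] with p hp hp2
  refine (dist_triangle _ (u (p.1, t0)) _).trans (add_le_add_left ?_ _)
  rw [Real.dist_eq]
  exact hlip p.1 hp.1 p.2 ⟨hp.2.1, hp2.le⟩

lemma taylor_bd {g g' : ℝ → ℝ} {g2 : ℝ → ℝ} {r M : ℝ}
    (h1 : ∀ s ∈ Icc 0 r, HasDerivWithinAt g (g' s) (Icc 0 r) s)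
    (h2 : ∀ s ∈ Icc 0 r, HasDerivWithinAt g' (g2 s) (Icc 0 r) s)
    (hM : ∀ s ∈ Icc 0 r, |g2 s| ≤ M) (hr : 0 ≤ r) : |g r - g 0 - r * g' 0| ≤ M * r ^ 2 := by
  have hM0 : 0 ≤ M := (abs_nonneg _).trans (hM 0 ⟨le_rfl, hr⟩)
  have a1 : ∀ s ∈ Icc 0 r, |g' s - g' 0| ≤ M * r := by
    intro s hs
    have := (convex_Icc (0 : ℝ) r).norm_image_sub_le_of_norm_hasDerivWithin_le h2 hM
      (x := 0) (y := s) ⟨le_rfl, hr⟩ hs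
    simp only [Real.norm_eq_abs, sub_zero] at this
    refine this.trans (mul_le_mul_of_nonneg_left ?_ hM0)
    rw [abs_of_nonneg hs.1]; exact hs.2
  have := (convex_Icc (0 : ℝ) r).norm_image_sub_le_of_norm_hasDerivWithin_le
    (f := fun s => g s - s * g' 0) (f' := fun s => g' s - g' 0) (C := M * r)
    (fun s hs => by
      have h3 := (hasDerivWithinAt_id s (Icc 0 r)).mul_const (g' 0)
      rw [one_mul] at h3
      exact (h1 s hs).sub h3) a1 (x := 0) (y := r) ⟨le_rfl, hr⟩ ⟨hr, le_rfl⟩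
  simp only [Real.norm_eq_abs, sub_zero, zero_mul] at this
  rw [abs_of_nonneg hr] at this
  calc |g r - g 0 - r * g' 0| = |g r - r * g' 0 - g 0| := by congr 1; ring
    _ ≤ M * r * r := this
    _ = _ := by ring

lemma line_has {G : Cn n → ℝ} {S : Set (Cn n)} {L : Cn n →L[ℝ] ℝ} {z v : Cn n} {s r : ℝ}
    (hG : HasFDerivWithinAt G L S (z + s • v)) (hm : ∀ s ∈ Icc 0 r, z + s • v ∈ S) :
    HasDerivWithinAt (fun s : ℝ => G (z + s • v)) (L v) (Icc 0 r) s := by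
  have h1 : HasDerivWithinAt (fun s : ℝ => z + s • v) v (Icc 0 r) s := by
    simpa using (((hasDerivAt_id s).smul_const v).const_add z).hasDerivWithinAt
  exact hG.comp_hasDerivWithinAt s h1 hm

/-- Taylor expansion along a segment in the closure -/
lemma seg_taylor (h : Dom Ω ρ c) {F : Xn n → ℝ} {t : ℝ}
    (hd : ContDiffOn ℝ 2 (fun z => F (z, t)) (closure Ω)) {z v : Cn n} {r M : ℝ} (hr : 0 ≤ r)
    (hm : ∀ s ∈ Icc 0 r, z + s • v ∈ closure Ω)
    (hM : ∀ s ∈ Icc 0 r, |D2 Ω F (z + s • v, t) v v| ≤ M) :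
    |F (z + r • v, t) - F (z, t) - r * D1 Ω F (z, t) v| ≤ M * r ^ 2 := by
  have := taylor_bd (g := fun s : ℝ => F (z + s • v, t)) (g' := fun s : ℝ => D1 Ω F (z + s • v, t) v)
    (g2 := fun s : ℝ => D2 Ω F (z + s • v, t) v v) (r := r) (M := M)
    (fun s hs => line_has (G := fun x => F (x, t)) (d1_has hd (hm s hs)) hm)
    (fun s hs => by
      simpa using line_has (G := fun x => D1 Ω F (x, t) v) (sd2_has h hd (hm s hs) v) hm) hM hr
  simpa using this

lemma reg2_of (h : Dom Ω ρ c) {F : Xn n → ℝ}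
    (c0 : ContinuousOn F (closure Ω ×ˢ Ioo 0 T))
    (d : ∀ t ∈ Ioo 0 T, ContDiffOn ℝ 2 (fun z => F (z, t)) (closure Ω))
    (c2 : ∀ v w, ContinuousOn (fun p => D2 Ω F p v w) (closure Ω ×ˢ Ioo 0 T)) : Reg2 Ω T F := by
  refine ⟨c0, d, ?_, c2⟩
  have key : ∀ p0 ∈ closure Ω ×ˢ Ioo 0 T, ∀ v, Inw Ω p0.1 v →
      ContinuousWithinAt (fun p => D1 Ω F p v) (closure Ω ×ˢ Ioo 0 T) p0 := by
    rintro ⟨z0, t0⟩ ⟨hz0, ht0⟩ v ⟨r, hr, hin⟩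
    set SS := closure Ω ×ˢ Ioo 0 T with hSS
    set M := |D2 Ω F (z0, t0) v v| + 1 with hMdef
    have hMpos : 0 < M := by positivity
    have hnear : ∀ᶠ p in 𝓝[SS] (z0, t0), |D2 Ω F p v v| < M := by
      have := (c2 v v (z0, t0) ⟨hz0, ht0⟩).abs
      exact this.tendsto.eventually_lt_const (by simp [hMdef])
    obtain ⟨R, hR, hball⟩ := Metric.mem_nhdsWithin_iff.mp hnear
    refine continuousWithinAt_of_locally_uniform_approx_of_continuousWithinAt ⟨hz0, ht0⟩ ?_
    intro U hU
    obtain ⟨ε, hε, hεU⟩ := Metric.mem_uniformity_dist.mp hU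
    -- choose s
    have hv1 : 0 < ‖v‖ + 1 := by positivity
    set s := min (min (r / 2) (R / 2 / (‖v‖ + 1))) (ε / (2 * M)) with hs
    have hs0 : 0 < s := by positivity
    have hsr : s < r := by
      have : s ≤ r / 2 := (min_le_left _ _).trans (min_le_left _ _)
      linarith
    have hsv : s * (‖v‖ + 1) ≤ R / 2 := by
      have : s ≤ R / 2 / (‖v‖ + 1) := (min_le_left _ _).trans (min_le_right _ _)
      rwa [le_div_iff₀ hv1] at this
    have hsε : M * s < ε := by
      have : s ≤ ε / (2 * M) := min_le_right _ _
      rw [le_div_iff₀ (by positivity)] at this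
      nlinarith
    refine ⟨SS ∩ ball (z0, t0) (min r (R / 2)), inter_mem self_mem_nhdsWithin
      (mem_nhdsWithin_of_mem_nhds (ball_mem_nhds _ (by positivity))),
      fun p => (F (p.1 + s • v, p.2) - F p) / s, ?_, ?_⟩
    · have hmem : (z0 + s • v, t0) ∈ SS :=
        ⟨subset_closure (hin z0 hz0 (by simpa using hr) s ⟨hs0, hsr⟩), ht0⟩
      have hc1 : ContinuousWithinAt (fun p : Xn n => F (p.1 + s • v, p.2)) SS (z0, t0) := by
        refine (c0 _ hmem).tendsto.comp (tendsto_nhdsWithin_iff.mpr ⟨?_, ?_⟩)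
        · have : Continuous fun p : Xn n => (p.1 + s • v, p.2) := by fun_prop
          exact (this.tendsto (z0, t0)).mono_left nhdsWithin_le_nhds
        · filter_upwards [self_mem_nhdsWithin,
            mem_nhdsWithin_of_mem_nhds (ball_mem_nhds (z0, t0) hr)] with p hp hpb
          rw [mem_ball, Prod.dist_eq, max_lt_iff] at hpb
          exact ⟨subset_closure (hin p.1 hp.1 hpb.1 s ⟨hs0, hsr⟩), hp.2⟩
      exact (hc1.sub (c0 _ ⟨hz0, ht0⟩)).div_const s
    · rintro ⟨z, t⟩ ⟨⟨hz, ht⟩, hpb⟩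
      rw [mem_ball, Prod.dist_eq, max_lt_iff] at hpb
      have hzr : dist z z0 < r := hpb.1.trans_le (min_le_left _ _)
      have hzR : dist z z0 < R / 2 := hpb.1.trans_le (min_le_right _ _)
      have htR : dist t t0 < R / 2 := hpb.2.trans_le (min_le_right _ _)
      have hm : ∀ s' ∈ Icc 0 s, z + s' • v ∈ closure Ω := by
        intro s' hs'
        rcases hs'.1.eq_or_lt with h0 | h0
        · rw [← h0]; simpa using hz
        · exact subset_closure (hin z hz hzr s' ⟨h0, hs'.2.trans_lt hsr⟩)
      have := seg_taylor h (d t ht) hs0.le hm (M := M) (by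
        intro s' hs'
        refine le_of_lt (hball ⟨?_, hm s' hs', ht⟩)
        rw [mem_ball, Prod.dist_eq, max_lt_iff]
        refine ⟨?_, by change dist t t0 < R; linarith⟩
        change dist (z + s' • v) z0 < R
        have e1 : dist (z + s' • v) z ≤ s * (‖v‖ + 1) := by
          rw [dist_eq_norm, add_sub_cancel_left, norm_smul, Real.norm_eq_abs, abs_of_nonneg hs'.1]
          have := norm_nonneg v
          nlinarith [hs'.1, hs'.2]
        linarith [dist_triangle (z + s' • v) z z0])
      apply hεU
      rw [Real.dist_eq]
      change |D1 Ω F (z, t) v - (F (z + s • v, t) - F (z, t)) / s| < ε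
      have e2 : D1 Ω F (z, t) v - (F (z + s • v, t) - F (z, t)) / s
          = - ((F (z + s • v, t) - F (z, t) - s * D1 Ω F (z, t) v) / s) := by
        field_simp; ring
      rw [e2, abs_neg, abs_div, abs_of_pos hs0, div_lt_iff₀ hs0]
      nlinarith
  rw [continuousOn_clm_apply]
  intro v p0 hp0
  obtain ⟨ν, h1, h2⟩ := h.inw_span hp0.1
  obtain ⟨K, hK⟩ := h2 v
  have := (key p0 hp0 _ hK).sub ((key p0 hp0 _ h1).const_smul K)
  refine this.congr (fun p _ => ?_) ?_ <;> simp

lemma C21.reg (h : Dom Ω ρ c) {u : Xn n → ℝ} (hu : C21 n Ω T u) : Reg2 Ω T u := by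
  have hsub : closure Ω ×ˢ Ioo 0 T ⊆ closure Ω ×ˢ Ico 0 T := prod_mono_right Ioo_subset_Ico_self
  have hd : ∀ t ∈ Ioo 0 T, ContDiffOn ℝ 2 (fun z => u (z, t)) (closure Ω) :=
    fun t ht => hu.1 t (Ioo_subset_Ico_self ht)
  refine reg2_of h ((hu.cont h).mono hsub) hd fun v w => ?_
  refine ((hu.2.2.2 w v).mono hsub).congr fun p hp => ?_
  exact (d2_eq h (hd p.2 hp.2) hp.1 v w).symm

/-- functions smooth up to the boundary -/
lemma smD1_has (h : Dom Ω ρ c) {G : Xn n → ℝ} (hG : Sm (closure Ω ×ˢ Ioo 0 T) G) {p : Xn n}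
    (hp : p ∈ closure Ω ×ˢ Ioo 0 T) (v : Cn n) :
    D1 Ω G p v = fderivWithin ℝ G (closure Ω ×ˢ Ioo 0 T) p (sv v) := by
  have h1 : HasFDerivWithinAt (fun x : Cn n => (x, p.2)) (ContinuousLinearMap.inl ℝ (Cn n) ℝ)
    (closure Ω) p.1 := (hasFDerivAt_prodMk_left p.1 p.2).hasFDerivWithinAt
  have h2 : HasFDerivWithinAt (fun x => G (x, p.2)) _ (closure Ω) p.1 :=
    HasFDerivWithinAt.comp (t := closure Ω ×ˢ Ioo 0 T) p.1
      ((hG.differentiableOn (by simp)) p hp).hasFDerivWithinAt h1 (fun x hx => ⟨hx, hp.2⟩)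
  rw [D1, h2.fderivWithin (h.ud _ hp.1)]
  simp [sv]

lemma smD1 (h : Dom Ω ρ c) {G : Xn n → ℝ} (hG : Sm (closure Ω ×ˢ Ioo 0 T) G) (v : Cn n) :
    Sm (closure Ω ×ˢ Ioo 0 T) (fun p => D1 Ω G p v) := by
  have hud : UniqueDiffOn ℝ (closure Ω ×ˢ Ioo 0 T) := h.ud.prod isOpen_Ioo.uniqueDiffOn
  have h1 : ContDiffOn ℝ ((⊤ : ℕ∞) : WithTop ℕ∞)
      (fun p => fderivWithin ℝ G (closure Ω ×ˢ Ioo 0 T) p (sv v)) (closure Ω ×ˢ Ioo 0 T) :=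
    (hG.fderivWithin hud (by simp)).clm_apply contDiffOn_const
  exact h1.congr fun p hp => smD1_has h hG hp v

lemma Sm.slice_cl {G : Xn n → ℝ} (hG : Sm (closure Ω ×ˢ Ioo 0 T) G) {t : ℝ} (ht : t ∈ Ioo 0 T) :
    ContDiffOn ℝ 2 (fun z => G (z, t)) (closure Ω) := by
  have h1 : ContDiffOn ℝ 2 (fun z : Cn n => (z, t)) (closure Ω) := by fun_prop
  exact (hG.of_le (WithTop.coe_le_coe.mpr le_top)).comp h1 (fun x hx => ⟨hx, ht⟩)

lemma smD2 (h : Dom Ω ρ c) {G : Xn n → ℝ} (hG : Sm (closure Ω ×ˢ Ioo 0 T) G) {p : Xn n}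
    (hp : p ∈ closure Ω ×ˢ Ioo 0 T) (w v : Cn n) :
    D1 Ω (fun p => D1 Ω G p v) p w = D2 Ω G p w v := d2_eq h (hG.slice_cl hp.2) hp.1 w v

lemma smD2_sm (h : Dom Ω ρ c) {G : Xn n → ℝ} (hG : Sm (closure Ω ×ˢ Ioo 0 T) G) (w v : Cn n) :
    Sm (closure Ω ×ˢ Ioo 0 T) (fun p => D2 Ω G p w v) :=
  (smD1 h (smD1 h hG v) w).congr fun _ hp => (smD2 h hG hp w v).symm

lemma Sm.reg2 (h : Dom Ω ρ c) {G : Xn n → ℝ} (hG : Sm (closure Ω ×ˢ Ioo 0 T) G) : Reg2 Ω T G :=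
  reg2_of h hG.continuousOn (fun _ ht => hG.slice_cl ht) fun w v => (smD2_sm h hG w v).continuousOn

/-- symmetric second derivatives up to the boundary -/
lemma Reg2.symm (h : Dom Ω ρ c) {F : Xn n → ℝ} (hF : Reg2 Ω T F) (hFs : Sm (Ω ×ˢ Ioo 0 T) F)
    {p : Xn n} (hp : p ∈ closure Ω ×ˢ Ioo 0 T) (v w : Cn n) : D2 Ω F p v w = D2 Ω F p w v := by
  have hsl : ∀ v w, ContinuousOn (fun z => D2 Ω F (z, p.2) v w) (closure Ω) := fun v w =>
    (hF.c2 v w).comp (by fun_prop) (fun z hz => ⟨hz, hp.2⟩)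
  have heq : EqOn (fun z => D2 Ω F (z, p.2) v w) (fun z => D2 Ω F (z, p.2) w v) Ω := by
    intro z hz
    have hq : (z, p.2) ∈ Ω ×ˢ Ioo 0 T := ⟨hz, hp.2⟩
    change D2 Ω F (z, p.2) v w = D2 Ω F (z, p.2) w v
    rw [D2_pd h hFs hq, D2_pd h hFs hq, pd_comm (h.op.prod isOpen_Ioo) hFs hq]
  exact heq.of_subset_closure (hsl v w) (hsl w v) subset_closure (subset_refl _) hp.1

/-- extension of inequalities to the closure -/
lemma ext_le {A B : Xn n → ℝ} {t : ℝ} (hA : ContinuousOn A (closure Ω ×ˢ Ioo 0 T))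
    (hB : ContinuousOn B (closure Ω ×ˢ Ioo 0 T)) (ht : t ∈ Ioo 0 T)
    (hle : ∀ z ∈ Ω, A (z, t) ≤ B (z, t)) : ∀ z ∈ closure Ω, A (z, t) ≤ B (z, t) := by
  intro z hz
  exact ContinuousWithinAt.closure_le (f := fun z => A (z, t)) (g := fun z => B (z, t)) hz
    (((hA (z, t) ⟨hz, ht⟩).comp (f := fun z => (z, t)) (x := z) (by fun_prop)
      (fun y hy => ⟨hy, ht⟩)).mono subset_closure)
    (((hB (z, t) ⟨hz, ht⟩).comp (f := fun z => (z, t)) (x := z) (by fun_prop)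
      (fun y hy => ⟨hy, ht⟩)).mono subset_closure) hle

end


/-! ### Frames and linearization -/

section
variable {O : Set (Xn n)} {F G : Xn n → ℝ} {p : Xn n} {ι : Type} [Fintype ι] {c : ι → Cn n}

lemma Sm.sum {A : ι → Xn n → ℝ} (hA : ∀ i, Sm O (A i)) : Sm O (fun q => ∑ i, A i q) :=
  ContDiffOn.sum fun i _ => hA i

lemma pd_sum (hO : IsOpen O) {A : ι → Xn n → ℝ} (hA : ∀ i, Sm O (A i)) (hp : p ∈ O) (b : Xn n) :
    pd b (fun q => ∑ i, A i q) p = ∑ i, pd b (A i) p := by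
  simp only [pd]
  rw [fderiv_fun_sum fun i _ => (hA i).da hO hp]
  simp

lemma Sm.heat (hO : IsOpen O) (hF : Sm O F) : Sm O (heat c F) :=
  (hF.pd hO _).sub (Sm.sum fun i => (hF.pd hO _).pd hO _)

lemma heat_comm (hO : IsOpen O) (hF : Sm O F) (b : Xn n) :
    EqOn (pd b (heat c F)) (heat c (pd b F)) O := by
  intro q hq
  have h1 : pd b (heat c F) q = pd b (fun q => pd eT F q - ∑ i, pd (sv (c i)) (pd (sv (c i)) F) q) q := rfl
  rw [h1, pd_sub hO (hF.pd hO _) (Sm.sum fun i => (hF.pd hO _).pd hO _) hq,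
    pd_sum hO (fun i => (hF.pd hO _).pd hO _) hq, heat, pd_comm hO hF hq]
  congr 1
  refine Finset.sum_congr rfl fun i _ => ?_
  rw [pd_comm hO (hF.pd hO _) hq]
  exact pd_eqOn hO (pd_eqOn_comm hO hF _ _) _ hq

/-- the real family attached to a complex frame -/
def cc (a : Fin n → Cn n) (i : Fin n × Bool) : Cn n := if i.2 then I • a i.1 else a i.1

lemma sum_cc {M : Type} [AddCommMonoid M] (a : Fin n → Cn n) (g : Cn n → M) :
    ∑ i, g (cc a i) = ∑ k, (g (a k) + g (I • a k)) := by
  rw [Fintype.sum_prod_type]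
  refine Finset.sum_congr rfl fun k _ => ?_
  rw [Fintype.sum_bool]
  simp only [cc, if_true, Bool.false_eq_true, if_false]
  exact add_comm _ _

/-- sum of squares of the frame -/
def SS (c : Fin n × Bool → Cn n) : ℝ := ∑ i, ‖c i‖ ^ 2

lemma SS_nonneg (c : Fin n × Bool → Cn n) : 0 ≤ SS c := Finset.sum_nonneg fun _ _ => by positivity

lemma SS_cc (a : Fin n → Cn n) : SS (cc a) = 2 * ∑ k, ‖a k‖ ^ 2 := by
  rw [SS, sum_cc a (fun x => ‖x‖ ^ 2), Finset.mul_sum]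
  refine Finset.sum_congr rfl fun k _ => ?_
  rw [norm_I_smul]; ring

end

/-- composition of the zeroth order term with the solution -/
def fc (f : ℝ × Cn n × ℝ → ℝ) (u : Xn n → ℝ) (p : Xn n) : ℝ := f (p.2, p.1, u p)

/-- Data extracted from the hypotheses. -/
structure Sol (Ω : Set (Cn n)) (ρ : Cn n → ℝ) (c T Cu Cp Cf : ℝ) (u φ : Xn n → ℝ)
    (f : ℝ × Cn n × ℝ → ℝ) : Prop where
  dom : Dom Ω ρ c
  us : Sm (Ω ×ˢ Ioo 0 T) u
  ur : Reg2 Ω T u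
  uc : ContinuousOn u (closure Ω ×ˢ Ico 0 T)
  tc : ContinuousOn (tdu T u) (closure Ω ×ˢ Ico 0 T)
  td : ∀ z ∈ closure Ω, ∀ t ∈ Ico (0 : ℝ) T, HasDerivWithinAt (fun s => u (z, s)) (tdu T u (z, t)) (Ico 0 T) t
  φs : Sm (closure Ω ×ˢ Ico 0 T) φ
  fs : ContDiffOn ℝ ((⊤ : ℕ∞) : WithTop ℕ∞) f (Ioo (0 : ℝ) T ×ˢ Ω ×ˢ (univ : Set ℝ))
  levi : ∀ p ∈ Ω ×ˢ Ioo 0 T, ∀ x, x ≠ 0 → 0 < lv (rb (D2 Ω u p)) x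
  eqn : ∀ p ∈ Ω ×ˢ Ioo 0 T, pd eT u p = Real.log (HM (rb (D2 Ω u p))).det.re + fc f u p
  bdry : ∀ z ∈ frontier Ω, ∀ t ∈ Ico (0 : ℝ) T, u (z, t) = φ (z, t)
  ini : ∀ z ∈ Ω, |u (z, 0)| ≤ Cu
  fdec : ∀ q ∈ Ioo (0 : ℝ) T ×ˢ Ω ×ˢ (univ : Set ℝ), fderiv ℝ f q (0, 0, 1) ≤ 0
  f0 : ∀ q ∈ Ioo (0 : ℝ) T ×ˢ Ω ×ˢ (univ : Set ℝ), |f q| ≤ Cf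
  f1 : ∀ q ∈ Ioo (0 : ℝ) T ×ˢ Ω ×ˢ (univ : Set ℝ), ‖fderiv ℝ f q‖ ≤ Cf
  f2 : ∀ q ∈ Ioo (0 : ℝ) T ×ˢ Ω ×ˢ (univ : Set ℝ), ‖fderiv ℝ (fderiv ℝ f) q‖ ≤ Cf
  φb : ∀ j l : ℕ, j + 2 * l ≤ 4 → ∀ z ∈ Ω, ∀ t ∈ Ioo (0 : ℝ) T,
    ‖iteratedFDeriv ℝ j (fun w => iteratedDeriv l (fun s => φ (w, s)) t) z‖ ≤ Cp

lemma pd_eT_deriv {O : Set (Xn n)} (hO : IsOpen O) {F : Xn n → ℝ} (hF : Sm O F) {z : Cn n} {t : ℝ}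
    (hp : (z, t) ∈ O) : deriv (fun s => F (z, s)) t = pd eT F (z, t) := by
  have h1 : HasFDerivAt (fun s : ℝ => (z, s)) (ContinuousLinearMap.inr ℝ (Cn n) ℝ) t :=
    hasFDerivAt_prodMk_right z t
  have h2 : HasFDerivAt (fun s => F (z, s)) _ t := (hF.da hO hp).hasFDerivAt.comp t h1
  rw [h2.hasDerivAt.deriv, pd]; simp [eT]

lemma sol_of {Ω : Set (Cn n)} {ρ : Cn n → ℝ} {c T Cu Cp Cf : ℝ} {u φ : Xn n → ℝ}
    {f : ℝ × Cn n × ℝ → ℝ} (h : Dom Ω ρ c) (H : AprioriHyps n Ω T Cu Cp Cf u φ f) :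
    Sol Ω ρ c T Cu Cp Cf u φ f := by
  obtain ⟨hφ, hf, hu, h21, hpsh, heq, hbd, hin, hfd, hfb, hφb⟩ := H
  have hO : IsOpen (Ω ×ˢ Ioo 0 T) := h.op.prod isOpen_Ioo
  have hOf : IsOpen (Ioo (0 : ℝ) T ×ˢ Ω ×ˢ (univ : Set ℝ)) :=
    isOpen_Ioo.prod (h.op.prod isOpen_univ)
  have hfs : ContDiffOn ℝ ((⊤ : ℕ∞) : WithTop ℕ∞) f (Ioo (0 : ℝ) T ×ˢ Ω ×ˢ (univ : Set ℝ)) :=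
    hf.mono (prod_mono Ioo_subset_Ico_self (prod_mono subset_closure subset_rfl))
  have hcH : ∀ p ∈ Ω ×ˢ Ioo 0 T, cHess (fun w => u (w, p.2)) p.1
      = (HM (rb (D2 Ω u p))).transpose := by
    intro p hp
    rw [cHess_eq (Sm.slice (T := T) h hu hp), D2_fd h hp]
  have hsym : ∀ p ∈ Ω ×ˢ Ioo 0 T, ∀ x y, rb (D2 Ω u p) x y = rb (D2 Ω u p) y x := by
    intro p hp x y
    simp only [rb_apply]
    rw [D2_pd h hu hp, D2_pd h hu hp, pd_comm hO hu hp]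
  refine ⟨h, hu, h21.reg h, h21.cont h, h21.2.2.1, ?_, hφ, hfs, ?_, ?_, hbd, hin, ?_, ?_, ?_, ?_, hφb⟩
  · intro z hz t ht
    exact ((h21.2.1 z hz).differentiableOn (by simp) t ht).hasDerivWithinAt
  · intro p hp
    have h1 := hpsh p.2 hp.2 p.1 hp.1
    rw [hcH p hp, Matrix.PosDef.transpose_iff] at h1
    exact lv_pos_of_posDef (hsym p hp) h1
  · rintro ⟨z, t⟩ hp
    have h1 := heq z hp.1 t hp.2
    have h2 := hcH (z, t) hp
    simp only at h2
    rw [h2, Matrix.det_transpose, pd_eT_deriv hO hu hp] at h1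
    exact h1
  · rintro ⟨t, z, r⟩ hq
    have h1 := hfd t hq.1 z hq.2.1 r
    have h2 : HasFDerivAt (fun y : ℝ => (t, z, y)) ((ContinuousLinearMap.inr ℝ ℝ (Cn n × ℝ)).comp
        (ContinuousLinearMap.inr ℝ (Cn n) ℝ)) r :=
      (hasFDerivAt_prodMk_right t (z, r)).comp r (hasFDerivAt_prodMk_right z r)
    have h3 : HasFDerivAt (fun y => f (t, z, y)) _ r :=
      ((hfs.contDiffAt (hOf.mem_nhds hq)).differentiableAt (by simp)).hasFDerivAt.comp r h2
    rw [h3.hasDerivAt.deriv] at h1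
    simpa using h1
  · intro q hq
    have := hfb 0 (by norm_num) q hq
    simpa using this
  · intro q hq
    have := hfb 1 (by norm_num) q hq
    rwa [norm_iteratedFDeriv_one] at this
  · intro q hq
    have := hfb 2 le_rfl q hq
    rwa [← norm_iteratedFDeriv_fderiv, norm_iteratedFDeriv_one] at this

/-- All facts about the frame at a point. -/
structure Fr (Ω : Set (Cn n)) (u : Xn n → ℝ) (f : ℝ × Cn n × ℝ → ℝ) (p : Xn n) (D : ℝ)
    (c : Fin n × Bool → Cn n) : Prop where
  dpos : 0 < D
  dlog : Real.log D = pd eT u p - fc f u p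
  tr : heat c u p = pd eT u p - n
  lin : ∀ b, heat c (pd b u) p = pd b (fc f u) p
  conc : ∀ b, heat c (pd b (pd b u)) p ≤ pd b (pd b (fc f u)) p
  mixed : ∀ (G : Xn n → ℝ) (ν : Cn n) (e : ℝ), 0 < e → |2 * Gam c G (pd (sv ν) u) p| ≤
    2 * |pd (sv ν) G p| + (e * Gam c G G p
      + e⁻¹ * Gam c (pd (sv (I • ν)) u) (pd (sv (I • ν)) u) p)
  gradu : ∀ x, (pd (sv x) u p) ^ 2 ≤ 4 * D * (2 * SS c) ^ (n - 1) * ‖x‖ ^ 2 * Gam c u u p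
  levup : ∀ x, lv (rb (D2 Ω u p)) x ≤ D * (2 * SS c) ^ (n - 1) * ‖x‖ ^ 2
  Slow : ∀ C, 1 ≤ C → D ≤ C → 0 < n → 1 / (2 * C) ≤ SS c
  rho : ∀ (B : Cn n →L[ℝ] Cn n →L[ℝ] ℝ) (m : ℝ), (∀ x, m * ‖x‖ ^ 2 ≤ lv (rb B) x) →
    2 * m * SS c ≤ ∑ i, B (c i) (c i)

section
variable {Ω : Set (Cn n)} {ρ : Cn n → ℝ} {c T Cu Cp Cf : ℝ} {u φ : Xn n → ℝ} {f : ℝ × Cn n × ℝ → ℝ}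

lemma Sol.opQ (S : Sol Ω ρ c T Cu Cp Cf u φ f) : IsOpen (Ω ×ˢ Ioo 0 T) := S.dom.op.prod isOpen_Ioo

lemma Sol.opF (S : Sol Ω ρ c T Cu Cp Cf u φ f) :
    IsOpen (Ioo (0 : ℝ) T ×ˢ Ω ×ˢ (univ : Set ℝ)) :=
  isOpen_Ioo.prod (S.dom.op.prod isOpen_univ)

lemma Sol.fcs (S : Sol Ω ρ c T Cu Cp Cf u φ f) : Sm (Ω ×ˢ Ioo 0 T) (fc f u) :=
  S.fs.comp (t := Ioo (0 : ℝ) T ×ˢ Ω ×ˢ (univ : Set ℝ)) (f := fun p : Xn n => (p.2, p.1, u p))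
    (contDiffOn_snd.prodMk (contDiffOn_fst.prodMk S.us)) (fun p hp => ⟨hp.2, hp.1, trivial⟩)

lemma Sol.symm (S : Sol Ω ρ c T Cu Cp Cf u φ f) {p : Xn n} (hp : p ∈ Ω ×ˢ Ioo 0 T) (x y : Cn n) :
    rb (D2 Ω u p) x y = rb (D2 Ω u p) y x := by
  simp only [rb_apply]
  rw [D2_pd S.dom S.us hp, D2_pd S.dom S.us hp, pd_comm S.opQ S.us hp]

lemma Sol.frame (S : Sol Ω ρ c T Cu Cp Cf u φ f) {p : Xn n} (hp : p ∈ Ω ×ˢ Ioo 0 T) :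
    ∃ D c', Fr Ω u f p D c' := by
  obtain ⟨a, ha⟩ := frame_exists (S.symm hp) (S.levi p hp)
  set B := rb (D2 Ω u p) with hB
  have hO := S.opQ
  have hsum : ∀ q ∈ Ω ×ˢ Ioo 0 T, ∑ i, pd (sv (cc a i)) (pd (sv (cc a i)) u) q
      = ∑ k, hb (rb (D2 Ω u q)) (a k) (a k) := by
    intro q hq
    rw [sum_cc a (fun x => pd (sv x) (pd (sv x) u) q)]
    refine Finset.sum_congr rfl fun k _ => ?_
    rw [hb, rb_apply, rb_apply, D2_pd S.dom S.us hq, D2_pd S.dom S.us hq]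
  have htr : ∑ k, hb B (a k) (a k) = n := by simp [ha.orth]
  have hEmax : ∀ q ∈ Ω ×ˢ Ioo 0 T, heat (cc a) u q - fc f u q ≤ heat (cc a) u p - fc f u p := by
    intro q hq
    rw [heat, heat, hsum q hq, hsum p hp, htr, S.eqn q hq, S.eqn p hp]
    have := ha.concave (rb (D2 Ω u q)) (S.symm hq) (HM_posDef (S.symm hq) (S.levi q hq))
    linarith
  have hEs : Sm (Ω ×ˢ Ioo 0 T) (fun q => heat (cc a) u q - fc f u q) := (S.us.heat hO).sub S.fcs
  have hpm : ∀ b, pd b (fun q => heat (cc a) u q - fc f u q) p = 0 ∧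
      pd b (pd b (fun q => heat (cc a) u q - fc f u q)) p ≤ 0 := by
    intro b
    apply pd_max hO hEs hp
    have hcont : ContinuousAt (fun s : ℝ => p + s • b) 0 := by fun_prop
    have hev : ∀ᶠ s in 𝓝 (0 : ℝ), p + s • b ∈ Ω ×ˢ Ioo 0 T := by
      apply hcont.eventually_mem
      simpa using hO.mem_nhds hp
    filter_upwards [hev] with s hs
    simpa using hEmax _ hs
  have hbexp : ∀ (x y : Cn n), B x y = hb B x y - D2 Ω u p (I • x) (I • y) := by
    intro x y; simp [hb, hB, rb_apply]
  have hexp : ∀ (L : Cn n →ₗ[ℝ] ℝ) x, L x = ∑ i, hb B (cc a i) x * L (cc a i) := by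
    intro L x
    rw [sum_cc a (fun y => hb B y x * L y)]
    conv_lhs => rw [ha.expand x]
    simp
  have hsq : ∀ x, ∑ i, (hb B (cc a i) x) ^ 2 = hb B x x := by
    intro x
    rw [sum_cc a (fun y => (hb B y x) ^ 2), ha.sumsq]
  refine ⟨(HM B).det.re, cc a, ha.det_pos, ?_, ?_, ?_, ?_, ?_, ?_, ?_, ?_, ?_⟩
  · rw [S.eqn p hp]; ring
  · rw [heat, hsum p hp, htr]
  · intro b
    have := (hpm b).1
    rw [pd_sub hO (S.us.heat hO) S.fcs hp, heat_comm hO S.us b hp] at this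
    linarith
  · intro b
    have := (hpm b).2
    rw [pd2_sub hO (S.us.heat hO) S.fcs hp,
      pd_eqOn hO (heat_comm hO S.us b) b hp, heat_comm hO (S.us.pd hO b) b hp] at this
    linarith
  · intro G ν e he
    have e1 : Gam (cc a) G (pd (sv ν) u) p = pd (sv ν) G p
        - ∑ i, pd (sv (cc a i)) G p * D2 Ω u p (I • cc a i) (I • ν) := by
      have hL := hexp ((fderiv ℝ G p).toLinearMap.comp (LinearMap.inl ℝ (Cn n) ℝ)) ν
      have hL' : pd (sv ν) G p = ∑ i, hb B (cc a i) ν * pd (sv (cc a i)) G p := by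
        simpa [pd, sv] using hL
      rw [hL', Gam, ← Finset.sum_sub_distrib]
      refine Finset.sum_congr rfl fun i _ => ?_
      rw [← D2_pd S.dom S.us hp, ← rb_apply, ← hB, hbexp]
      ring
    have e2 : ∑ i, (D2 Ω u p (I • cc a i) (I • ν)) ^ 2
        = Gam (cc a) (pd (sv (I • ν)) u) (pd (sv (I • ν)) u) p := by
      have : ∀ y : Cn n, pd (sv y) (pd (sv (I • ν)) u) p = D2 Ω u p y (I • ν) :=
        fun y => (D2_pd S.dom S.us hp y (I • ν)).symm
      simp only [Gam, this]
      rw [sum_cc a (fun y => (D2 Ω u p (I • y) (I • ν)) ^ 2),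
        sum_cc a (fun y => D2 Ω u p y (I • ν) * D2 Ω u p y (I • ν))]
      refine Finset.sum_congr rfl fun k _ => ?_
      rw [II_smul]; simp; ring
    have e3 : |∑ i, 2 * (pd (sv (cc a i)) G p * D2 Ω u p (I • cc a i) (I • ν))|
        ≤ e * Gam (cc a) G G p + e⁻¹ * Gam (cc a) (pd (sv (I • ν)) u) (pd (sv (I • ν)) u) p := by
      rw [← e2, Gam, Finset.mul_sum, Finset.mul_sum, ← Finset.sum_add_distrib]
      refine (Finset.abs_sum_le_sum_abs _ _).trans (Finset.sum_le_sum fun i _ => ?_)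
      set x := pd (sv (cc a i)) G p
      set y := D2 Ω u p (I • cc a i) (I • ν)
      have hee : e * e⁻¹ = 1 := mul_inv_cancel₀ he.ne'
      have hi : 0 < e⁻¹ := inv_pos.mpr he
      rw [abs_le]
      constructor
      · nlinarith [mul_nonneg hi.le (sq_nonneg (e * x + y))]
      · nlinarith [mul_nonneg hi.le (sq_nonneg (e * x - y))]
    rw [← Finset.mul_sum] at e3
    rw [e1, mul_sub]
    refine (abs_sub _ _).trans ?_
    rw [abs_mul, abs_two]
    linarith
  · intro x
    have hL := hexp ((fderiv ℝ u p).toLinearMap.comp (LinearMap.inl ℝ (Cn n) ℝ)) x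
    have hL' : pd (sv x) u p = ∑ i, hb B (cc a i) x * pd (sv (cc a i)) u p := by
      simpa [pd, sv] using hL
    rw [hL']
    have hcs := Finset.sum_mul_sq_le_sq_mul_sq Finset.univ (fun i => hb B (cc a i) x)
      (fun i => pd (sv (cc a i)) u p)
    have h1 : hb B x x ≤ 4 * (HM B).det.re * (2 * SS (cc a)) ^ (n - 1) * ‖x‖ ^ 2 := by
      have := ha.upper x
      rw [lv] at this
      rw [SS_cc, ← mul_assoc, show (2 : ℝ) * 2 = 4 by norm_num]
      linarith
    rw [hsq] at hcs
    have h2 : ∑ i, pd (sv (cc a i)) u p ^ 2 = Gam (cc a) u u p := by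
      simp only [Gam, sq]
    rw [h2] at hcs
    exact hcs.trans (mul_le_mul_of_nonneg_right h1 Gam_self_nonneg)
  · intro x
    have := ha.upper x
    rwa [SS_cc, ← mul_assoc, show (2 : ℝ) * 2 = 4 by norm_num]
  · intro C h1 h2 h3
    have := ha.Slow C h1 h2 h3
    rw [SS_cc]
    have e : 1 / (2 * C) = 2 * (1 / (4 * C)) := by field_simp; norm_num
    rw [e]; linarith
  · intro B' m hm
    rw [sum_cc a (fun x => B' x x), SS_cc, Finset.mul_sum, Finset.mul_sum]
    refine Finset.sum_le_sum fun k _ => ?_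
    have := hm (a k)
    rw [lv_rb] at this
    linarith

/-- first derivative of the zeroth order term -/
lemma Sol.fc1 (S : Sol Ω ρ c T Cu Cp Cf u φ f) {p : Xn n} (hp : p ∈ Ω ×ˢ Ioo 0 T) :
    ∃ k : ℝ, k ≤ 0 ∧ |k| ≤ Cf ∧
      (∀ b, |pd b (fc f u) p - k * pd b u p| ≤ Cf * (|b.2| + ‖b.1‖)) ∧
      (∀ b, pd b (pd b (fc f u)) p ≤ Cf * (|b.2| + ‖b.1‖ + |pd b u p|) ^ 2 + k * pd b (pd b u) p) := by
  have hO := S.opQ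
  have hq : ∀ q ∈ Ω ×ˢ Ioo 0 T, (q.2, q.1, u q) ∈ Ioo (0 : ℝ) T ×ˢ Ω ×ˢ (univ : Set ℝ) :=
    fun q hq => ⟨hq.2, hq.1, trivial⟩
  set m : Xn n → ℝ × Cn n × ℝ := fun q => (q.2, q.1, u q) with hm
  have hmd : ∀ q ∈ Ω ×ˢ Ioo 0 T, HasFDerivAt m ((ContinuousLinearMap.snd ℝ (Cn n) ℝ).prod
      ((ContinuousLinearMap.fst ℝ (Cn n) ℝ).prod (fderiv ℝ u q))) q := fun q hq =>
    hasFDerivAt_snd.prodMk (hasFDerivAt_fst.prodMk (S.us.da hO hq).hasFDerivAt)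
  have hfd : ∀ q ∈ Ω ×ˢ Ioo 0 T, HasFDerivAt f (fderiv ℝ f (m q)) (m q) := fun q h =>
    ((S.fs.contDiffAt (S.opF.mem_nhds (hq q h))).differentiableAt (by simp)).hasFDerivAt
  have h1 : ∀ b, EqOn (pd b (fc f u)) (fun q => fderiv ℝ f (m q) (b.2, b.1, pd b u q)) (Ω ×ˢ Ioo 0 T) := by
    intro b q hq
    have : HasFDerivAt (fc f u) _ q := (hfd q hq).comp q (hmd q hq)
    simp only [pd]
    rw [this.fderiv]; rfl
  have hsplit : ∀ (q : Xn n) (a : ℝ) (z : Cn n) (r : ℝ), fderiv ℝ f (m q) (a, z, r)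
      = fderiv ℝ f (m q) (a, z, 0) + r * fderiv ℝ f (m q) (0, 0, 1) := by
    intro q a z r
    rw [← smul_eq_mul, ← map_smul, ← map_add]; simp
  have hn3 : ∀ (a : ℝ) (z : Cn n) (r : ℝ), ‖((a, z, r) : ℝ × Cn n × ℝ)‖ ≤ |a| + ‖z‖ + |r| := by
    intro a z r
    rw [Prod.norm_def, Prod.norm_def]
    simp only [Real.norm_eq_abs]
    have := abs_nonneg a; have := abs_nonneg r; have := norm_nonneg z
    refine max_le (by linarith) (max_le (by linarith) (by linarith))
  have hCf : 0 ≤ Cf := (abs_nonneg _).trans (S.f0 _ (hq p hp))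
  have hb1 := S.f1 _ (hq p hp)
  refine ⟨fderiv ℝ f (m p) (0, 0, 1), S.fdec _ (hq p hp), ?_, ?_, ?_⟩
  · have := (fderiv ℝ f (m p)).le_of_opNorm_le hb1 (0, 0, 1)
    simpa [Prod.norm_def] using this
  · intro b
    rw [h1 b hp]
    simp only
    rw [hsplit, mul_comm (pd b u p), add_sub_cancel_right]
    have := (fderiv ℝ f (m p)).le_of_opNorm_le hb1 (b.2, b.1, 0)
    refine this.trans (mul_le_mul_of_nonneg_left ?_ hCf)
    simpa using hn3 b.2 b.1 0
  · intro b
    rw [pd_eqOn hO (h1 b) b hp]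
    have hd2 : HasFDerivAt (fderiv ℝ f) (fderiv ℝ (fderiv ℝ f) (m p)) (m p) :=
      (((S.fs.fderiv_of_isOpen S.opF (m := ((⊤ : ℕ∞) : WithTop ℕ∞)) (by simp)).contDiffAt
        (S.opF.mem_nhds (hq p hp))).differentiableAt (by simp)).hasFDerivAt
    have hA : HasFDerivAt (fun q => fderiv ℝ f (m q)) _ p := hd2.comp p (hmd p hp)
    have hB : HasFDerivAt (fun q : Xn n => ((b.2, b.1, pd b u q) : ℝ × Cn n × ℝ)) _ p :=
      (hasFDerivAt_const b.2 p).prodMk ((hasFDerivAt_const b.1 p).prodMk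
        ((S.us.pd hO b).da hO hp).hasFDerivAt)
    have hC := hA.clm_apply hB
    have hval : pd b (fun q => fderiv ℝ f (m q) (b.2, b.1, pd b u q)) p
        = fderiv ℝ f (m p) (0, 0, pd b (pd b u) p)
          + fderiv ℝ (fderiv ℝ f) (m p) (b.2, b.1, pd b u p) (b.2, b.1, pd b u p) := by
      rw [pd, hC.fderiv]
      simp [pd]
    rw [hval, hsplit p 0 0]
    have hz : fderiv ℝ f (m p) (0, 0, 0) = 0 := map_zero _
    rw [hz, zero_add, mul_comm, add_comm]
    refine add_le_add_left ?_ _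
    set β : ℝ × Cn n × ℝ := (b.2, b.1, pd b u p)
    have h2 : |fderiv ℝ (fderiv ℝ f) (m p) β β| ≤ Cf * ‖β‖ * ‖β‖ := by
      have e1 := (fderiv ℝ (fderiv ℝ f) (m p)).le_opNorm₂ β β
      have e2 := S.f2 _ (hq p hp)
      refine e1.trans ?_
      gcongr
    have h3 : ‖β‖ ≤ |b.2| + ‖b.1‖ + |pd b u p| := hn3 _ _ _
    refine (le_abs_self _).trans (h2.trans ?_)
    rw [mul_assoc, ← sq]
    gcongr

end

set_option maxSynthPendingDepth 3

/-! ### Bounded functions -/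

/-- Functions with bounded derivatives up to second order in space and first order in time. -/
structure B2 (O : Set (Xn n)) (K : ℝ) (F : Xn n → ℝ) : Prop where
  nn : 0 ≤ K
  sm : Sm O F
  b0 : ∀ p ∈ O, |F p| ≤ K
  b1 : ∀ p ∈ O, ∀ v, |pd (sv v) F p| ≤ K * ‖v‖
  b2 : ∀ p ∈ O, ∀ v, |pd (sv v) (pd (sv v) F) p| ≤ K * ‖v‖ ^ 2
  bt : ∀ p ∈ O, |pd eT F p| ≤ K

section
variable {O : Set (Xn n)} {F G : Xn n → ℝ} {K L : ℝ} {p : Xn n}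

lemma B2.mono (h : B2 O K F) (hKL : K ≤ L) : B2 O L F := by
  refine ⟨h.nn.trans hKL, h.sm, fun p hp => (h.b0 p hp).trans hKL,
    fun p hp v => (h.b1 p hp v).trans ?_, fun p hp v => (h.b2 p hp v).trans ?_,
    fun p hp => (h.bt p hp).trans hKL⟩ <;> gcongr

lemma B2.const (O : Set (Xn n)) (r : ℝ) : B2 O |r| (fun _ => r) := by
  have h : ∀ a : Xn n, pd a (fun _ : Xn n => r) = fun _ => 0 := fun a => by ext q; exact pd_const r a
  refine ⟨abs_nonneg _, Sm.const r, fun _ _ => le_rfl, fun p _ v => ?_, fun p _ v => ?_, fun p _ => ?_⟩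
  · rw [h]; simp; positivity
  · rw [h, pd_const]; simp; positivity
  · rw [h]; simp

lemma B2.congr (hO : IsOpen O) (h : B2 O K F) (e : EqOn G F O) : B2 O K G := by
  refine ⟨h.nn, ContDiffOn.congr h.sm e, fun p hp => ?_, fun p hp v => ?_, fun p hp v => ?_, fun p hp => ?_⟩
  · rw [e hp]; exact h.b0 p hp
  · rw [pd_eqOn hO e _ hp]; exact h.b1 p hp v
  · rw [pd_eqOn hO (pd_eqOn hO e _) _ hp]; exact h.b2 p hp v
  · rw [pd_eqOn hO e _ hp]; exact h.bt p hp

lemma B2.add (hO : IsOpen O) (hF : B2 O K F) (hG : B2 O L G) : B2 O (K + L) (fun q => F q + G q) := by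
  refine ⟨add_nonneg hF.nn hG.nn, hF.sm.add hG.sm, fun p hp => ?_, fun p hp v => ?_, fun p hp v => ?_,
    fun p hp => ?_⟩
  · exact (abs_add_le _ _).trans (add_le_add (hF.b0 p hp) (hG.b0 p hp))
  · rw [pd_add hO hF.sm hG.sm hp, add_mul]
    exact (abs_add_le _ _).trans (add_le_add (hF.b1 p hp v) (hG.b1 p hp v))
  · rw [pd2_add hO hF.sm hG.sm hp, add_mul]
    exact (abs_add_le _ _).trans (add_le_add (hF.b2 p hp v) (hG.b2 p hp v))
  · rw [pd_add hO hF.sm hG.sm hp]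
    exact (abs_add_le _ _).trans (add_le_add (hF.bt p hp) (hG.bt p hp))

lemma B2.mul (hO : IsOpen O) (hF : B2 O K F) (hG : B2 O L G) :
    B2 O (4 * (K * L)) (fun q => F q * G q) := by
  have hKL : 0 ≤ K * L := mul_nonneg hF.nn hG.nn
  have hm : ∀ {a b A B : ℝ}, |a| ≤ A → |b| ≤ B → |a * b| ≤ A * B := fun h1 h2 => by
    rw [abs_mul]; exact mul_le_mul h1 h2 (abs_nonneg _) ((abs_nonneg _).trans h1)
  refine ⟨by positivity, hF.sm.mul hG.sm, fun p hp => ?_, fun p hp v => ?_, fun p hp v => ?_,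
    fun p hp => ?_⟩
  · have := hm (hF.b0 p hp) (hG.b0 p hp); linarith
  · rw [pd_mul hO hF.sm hG.sm hp]
    have e1 := hm (hF.b0 p hp) (hG.b1 p hp v)
    have e2 := hm (hF.b1 p hp v) (hG.b0 p hp)
    have e3 : 0 ≤ K * L * ‖v‖ := by positivity
    refine (abs_add_le _ _).trans ?_
    linarith
  · rw [pd2_mul hO hF.sm hG.sm hp]
    have e1 := hm (hF.b0 p hp) (hG.b2 p hp v)
    have e2 := hm (hF.b1 p hp v) (hG.b1 p hp v)
    have e3 := hm (hF.b2 p hp v) (hG.b0 p hp)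
    refine (abs_add_le _ _).trans ?_
    refine (add_le_add_left (abs_add_le _ _) _).trans ?_
    refine (add_le_add_left (add_le_add_left (abs_add_le _ _) _) _).trans ?_
    linarith
  · rw [pd_mul hO hF.sm hG.sm hp]
    have e1 := hm (hF.b0 p hp) (hG.bt p hp)
    have e2 := hm (hF.bt p hp) (hG.b0 p hp)
    refine (abs_add_le _ _).trans ?_
    linarith

lemma B2.cmul (hO : IsOpen O) (hF : B2 O K F) (r : ℝ) : B2 O (|r| * K) (fun q => r * F q) := by
  refine ⟨mul_nonneg (abs_nonneg _) hF.nn, hF.sm.cmul r, fun p hp => ?_, fun p hp v => ?_, fun p hp v => ?_,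
    fun p hp => ?_⟩
  · rw [abs_mul]; exact mul_le_mul_of_nonneg_left (hF.b0 p hp) (abs_nonneg _)
  · rw [pd_cmul hO hF.sm hp, abs_mul, mul_assoc]
    exact mul_le_mul_of_nonneg_left (hF.b1 p hp v) (abs_nonneg _)
  · rw [pd2_cmul hO hF.sm hp, abs_mul, mul_assoc]
    exact mul_le_mul_of_nonneg_left (hF.b2 p hp v) (abs_nonneg _)
  · rw [pd_cmul hO hF.sm hp, abs_mul]
    exact mul_le_mul_of_nonneg_left (hF.bt p hp) (abs_nonneg _)

lemma B2.neg (hO : IsOpen O) (hF : B2 O K F) : B2 O K (fun q => - F q) := by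
  have := hF.cmul hO (-1)
  simpa using this

lemma B2.sub (hO : IsOpen O) (hF : B2 O K F) (hG : B2 O L G) : B2 O (K + L) (fun q => F q - G q) := by
  simpa [sub_eq_add_neg] using hF.add hO (hG.neg hO)

lemma B2.heat (hF : B2 O K F) (hp : p ∈ O) (c : Fin n × Bool → Cn n) :
    |heat c F p| ≤ K * (1 + SS c) := by
  rw [_root_.heat]
  have h1 : |∑ i, pd (sv (c i)) (pd (sv (c i)) F) p| ≤ K * SS c := by
    rw [SS, Finset.mul_sum]
    exact (Finset.abs_sum_le_sum_abs _ _).trans (Finset.sum_le_sum fun i _ => hF.b2 p hp (c i))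
  refine (abs_sub _ _).trans ?_
  have := hF.bt p hp
  linarith

lemma B2.Gam (hF : B2 O K F) (hp : p ∈ O) (c : Fin n × Bool → Cn n) :
    Gam c F F p ≤ K ^ 2 * SS c := Gam_le_norm (hF.b1 p hp)

end

section
variable {Ω : Set (Cn n)} {ρ : Cn n → ℝ} {c T Cu Cp Cf : ℝ} {u φ : Xn n → ℝ} {f : ℝ × Cn n × ℝ → ℝ}

lemma B2.time {q : ℝ → ℝ} {K : ℝ} (hq : ContDiff ℝ ((⊤ : ℕ∞) : WithTop ℕ∞) q) (hK : 0 ≤ K)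
    (h0 : ∀ t ∈ Ioo 0 T, |q t| ≤ K) (h1 : ∀ t ∈ Ioo 0 T, |deriv q t| ≤ K) :
    B2 (Ω ×ˢ Ioo 0 T) K (fun p => q p.2) := by
  have hd : Differentiable ℝ q := hq.differentiable (by simp)
  refine ⟨hK, Sm.time hq, fun p hp => h0 _ hp.2, fun p hp v => ?_, fun p hp v => ?_, fun p hp => ?_⟩
  · rw [pd_time_sv hd]; simp; positivity
  · rw [pd2_time_sv hd]; simp; positivity
  · rw [pd_time_eT hd]; exact h1 _ hp.2

lemma pd_space_sv {g : Cn n → ℝ} (hg : Differentiable ℝ g) (v : Cn n) (p : Xn n) :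
    pd (sv v) (fun x : Xn n => g x.1) p = fderiv ℝ g p.1 v := by
  have h : HasFDerivAt (fun x : Xn n => g x.1) _ p := (hg p.1).hasFDerivAt.comp p hasFDerivAt_fst
  rw [pd, h.fderiv]; simp [sv]

lemma pd_space_eT {g : Cn n → ℝ} (hg : Differentiable ℝ g) (p : Xn n) :
    pd eT (fun x : Xn n => g x.1) p = 0 := by
  have h : HasFDerivAt (fun x : Xn n => g x.1) _ p := (hg p.1).hasFDerivAt.comp p hasFDerivAt_fst
  rw [pd, h.fderiv]; simp [eT]

lemma pd2_space_sv {g : Cn n → ℝ} (hg : ContDiff ℝ ((⊤ : ℕ∞) : WithTop ℕ∞) g) (v w : Cn n) (p : Xn n) :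
    pd (sv w) (pd (sv v) (fun x : Xn n => g x.1)) p = fderiv ℝ (fderiv ℝ g) p.1 w v := by
  have h1 : pd (sv v) (fun x : Xn n => g x.1) = fun x => (fun z => fderiv ℝ g z v) x.1 := by
    ext q; exact pd_space_sv (hg.differentiable (by simp)) v q
  have h2 : ContDiff ℝ ((⊤ : ℕ∞) : WithTop ℕ∞) (fderiv ℝ g) := hg.fderiv_right (by simp)
  have h3 : Differentiable ℝ (fun z => fderiv ℝ g z v) :=
    fun z => (h2.differentiable (by simp) z).clm_apply (differentiableAt_const v)
  rw [h1, pd_space_sv h3]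
  have h4 : HasFDerivAt (fun z => fderiv ℝ g z v) _ p.1 :=
    (ContinuousLinearMap.apply ℝ ℝ v).hasFDerivAt.comp p.1 (h2.differentiable (by simp) p.1).hasFDerivAt
  rw [h4.fderiv]; simp

/-- smooth functions of `z` and their linear images are uniformly bounded -/
lemma smooth_bd {E : Type} [NormedAddCommGroup E] [NormedSpace ℝ E] (hb : IsBounded Ω) {G : Cn n → E}
    (hG : ContDiff ℝ ((⊤ : ℕ∞) : WithTop ℕ∞) G) : ∃ K, 0 ≤ K ∧ (∀ z ∈ closure Ω, ‖G z‖ ≤ K) ∧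
      ∀ (T : ℝ) (L : E →L[ℝ] ℝ), B2 (Ω ×ˢ Ioo 0 T) (K * ‖L‖) (fun p => L (G p.1)) := by
  have hc := hb.isCompact_closure
  have hG1 : ContDiff ℝ ((⊤ : ℕ∞) : WithTop ℕ∞) (fderiv ℝ G) := hG.fderiv_right (by simp)
  have hG2 : ContDiff ℝ ((⊤ : ℕ∞) : WithTop ℕ∞) (fderiv ℝ (fderiv ℝ G)) := hG1.fderiv_right (by simp)
  obtain ⟨K0, h0⟩ := hc.exists_bound_of_continuousOn hG.continuous.continuousOn
  obtain ⟨K1, h1⟩ := hc.exists_bound_of_continuousOn hG1.continuous.continuousOn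
  obtain ⟨K2, h2'⟩ := hc.exists_bound_of_continuousOn
    (f := fun z => ‖fderiv ℝ (fderiv ℝ G) z‖) hG2.continuous.norm.continuousOn
  have h2 : ∀ z ∈ closure Ω, ‖fderiv ℝ (fderiv ℝ G) z‖ ≤ K2 := fun z hz => (le_abs_self _).trans (h2' z hz)
  refine ⟨|K0| + |K1| + |K2|, by positivity, fun z hz => (h0 z hz).trans ?_, fun T L => ?_⟩
  · have := le_abs_self K0; have := abs_nonneg K1; have := abs_nonneg K2; linarith
  set K := |K0| + |K1| + |K2| with hK
  have a0 : ∀ z ∈ Ω, ‖G z‖ ≤ K := fun z hz => (h0 z (subset_closure hz)).trans (by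
    have := le_abs_self K0; have := abs_nonneg K1; have := abs_nonneg K2; linarith)
  have a1 : ∀ z ∈ Ω, ‖fderiv ℝ G z‖ ≤ K := fun z hz => (h1 z (subset_closure hz)).trans (by
    have := le_abs_self K1; have := abs_nonneg K0; have := abs_nonneg K2; linarith)
  have a2 : ∀ z ∈ Ω, ‖fderiv ℝ (fderiv ℝ G) z‖ ≤ K := fun z hz => (h2 z (subset_closure hz)).trans (by
    have := le_abs_self K2; have := abs_nonneg K0; have := abs_nonneg K1; linarith)
  have hK0 : 0 ≤ K := by positivity
  have hLG : ContDiff ℝ ((⊤ : ℕ∞) : WithTop ℕ∞) (fun z => L (G z)) := L.contDiff.comp hG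
  have f1 : ∀ z, fderiv ℝ (fun z => L (G z)) z = L.comp (fderiv ℝ G z) := fun z =>
    (L.hasFDerivAt.comp z (hG.differentiable (by simp) z).hasFDerivAt).fderiv
  have f2 : ∀ z w v, fderiv ℝ (fderiv ℝ (fun z => L (G z))) z w v = L (fderiv ℝ (fderiv ℝ G) z w v) := by
    intro z w v
    have e : fderiv ℝ (fun z => L (G z)) = fun z => L.comp (fderiv ℝ G z) := funext f1
    rw [e]
    have h3 : HasFDerivAt (fun z => L.comp (fderiv ℝ G z)) _ z :=
      ((ContinuousLinearMap.compL ℝ (Cn n) E ℝ L).hasFDerivAt).comp z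
        (hG1.differentiable (by simp) z).hasFDerivAt
    rw [h3.fderiv]; simp
  refine ⟨by positivity, (hLG.comp contDiff_fst).contDiffOn, fun p hp => ?_, fun p hp v => ?_,
    fun p hp v => ?_, fun p hp => ?_⟩
  · refine (L.le_opNorm _).trans ?_
    rw [mul_comm]; gcongr; exact a0 _ hp.1
  · rw [pd_space_sv (hLG.differentiable (by simp)), f1]
    refine (L.le_opNorm _).trans ?_
    have := (fderiv ℝ G p.1).le_of_opNorm_le (a1 _ hp.1) v
    calc ‖L‖ * ‖fderiv ℝ G p.1 v‖ ≤ ‖L‖ * (K * ‖v‖) := by gcongr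
      _ = _ := by ring
  · rw [pd2_space_sv hLG, f2]
    refine (L.le_opNorm _).trans ?_
    have := (fderiv ℝ (fderiv ℝ G) p.1).le_opNorm₂ v v
    calc ‖L‖ * ‖fderiv ℝ (fderiv ℝ G) p.1 v v‖ ≤ ‖L‖ * (K * ‖v‖ * ‖v‖) := by
          gcongr; refine this.trans ?_; gcongr; exact a2 _ hp.1
      _ = _ := by ring
  · rw [pd_space_eT (hLG.differentiable (by simp))]; simp; positivity

lemma apply2_norm {E : Type} [NormedAddCommGroup E] [NormedSpace ℝ E] (v w : E) :
    ‖((ContinuousLinearMap.apply ℝ ℝ w).comp (ContinuousLinearMap.apply ℝ (E →L[ℝ] ℝ) v) :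
      (E →L[ℝ] E →L[ℝ] ℝ) →L[ℝ] ℝ)‖ ≤ ‖v‖ * ‖w‖ :=
  ContinuousLinearMap.opNorm_le_bound _ (by positivity) fun A => by
    have := A.le_opNorm₂ v w
    simp only [ContinuousLinearMap.comp_apply, ContinuousLinearMap.apply_apply]
    linarith

/-- bounds for the defining function -/
lemma Dom.bds (h : Dom Ω ρ c) : ∃ K, 1 ≤ K ∧ (∀ z ∈ closure Ω, |ρ z| ≤ K) ∧
    (∀ z ∈ closure Ω, ‖fderiv ℝ ρ z‖ ≤ K) ∧ (∀ z ∈ closure Ω, ‖fderiv ℝ (fderiv ℝ ρ) z‖ ≤ K) ∧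
    (∀ z ∈ closure Ω, ‖z‖ ≤ K) ∧
    ∀ T, B2 (Ω ×ˢ Ioo 0 T) K (fun p => ρ p.1) ∧
      (∀ v, B2 (Ω ×ˢ Ioo 0 T) (K * ‖v‖) (fun p => fderiv ℝ ρ p.1 v)) ∧
      (∀ v w, B2 (Ω ×ˢ Ioo 0 T) (K * (‖v‖ * ‖w‖)) (fun p => fderiv ℝ (fderiv ℝ ρ) p.1 v w)) ∧
      (∀ z0 ∈ closure Ω, B2 (Ω ×ˢ Ioo 0 T) K (fun p => ‖p.1 - z0‖ ^ 2)) := by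
  have s1 : ContDiff ℝ ((⊤ : ℕ∞) : WithTop ℕ∞) (fderiv ℝ ρ) := h.sm.fderiv_right (by simp)
  have s2 : ContDiff ℝ ((⊤ : ℕ∞) : WithTop ℕ∞) (fderiv ℝ (fderiv ℝ ρ)) := s1.fderiv_right (by simp)
  obtain ⟨K0, hK0, b0, c0⟩ := smooth_bd h.bd h.sm
  obtain ⟨K1, hK1, b1, c1⟩ := smooth_bd h.bd s1
  obtain ⟨K2, hK2, b2, c2⟩ := smooth_bd h.bd s2
  obtain ⟨K3, hK3, b3, c3⟩ := smooth_bd h.bd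
    (contDiff_id : ContDiff ℝ ((⊤ : ℕ∞) : WithTop ℕ∞) (id : Cn n → Cn n))
  obtain ⟨K4, hK4, b4, c4⟩ := smooth_bd h.bd
    (contDiff_norm_sq ℂ : ContDiff ℝ ((⊤ : ℕ∞) : WithTop ℕ∞) (fun x : Cn n => ‖x‖ ^ 2))
  have hsum : 0 ≤ 2 * (K3 * K3) + K3 ^ 2 := by positivity
  set K := 1 + K0 + K1 + K2 + K3 + K4 + (2 * (K3 * K3) + K3 ^ 2) with hK
  refine ⟨K, by linarith, fun z hz => (b0 z hz).trans (by linarith),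
    fun z hz => (b1 z hz).trans (by linarith), fun z hz => (b2 z hz).trans (by linarith),
    fun z hz => (b3 z hz).trans (by linarith), fun T => ⟨?_, fun v => ?_, fun v w => ?_, fun z0 hz0 => ?_⟩⟩
  · have := c0 T (ContinuousLinearMap.id ℝ ℝ)
    refine B2.mono (K := K0 * ‖ContinuousLinearMap.id ℝ ℝ‖) (by simpa using this) ?_
    have : ‖ContinuousLinearMap.id ℝ ℝ‖ ≤ 1 := ContinuousLinearMap.norm_id_le
    nlinarith
  · have := c1 T (ContinuousLinearMap.apply ℝ ℝ v)
    refine B2.mono (F := fun p : Xn n => fderiv ℝ ρ p.1 v) (by simpa using this) ?_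
    have e : ‖ContinuousLinearMap.apply ℝ ℝ v‖ ≤ ‖v‖ :=
      ContinuousLinearMap.opNorm_le_bound _ (norm_nonneg _) fun A => by
        simpa [mul_comm] using A.le_opNorm v
    have := norm_nonneg v
    refine mul_le_mul (by linarith) e (norm_nonneg _) (by linarith)
  · set L : (Cn n →L[ℝ] Cn n →L[ℝ] ℝ) →L[ℝ] ℝ := (ContinuousLinearMap.apply ℝ ℝ w).comp
      (ContinuousLinearMap.apply ℝ (Cn n →L[ℝ] ℝ) v) with hL
    have := c2 T L
    refine B2.mono (F := fun p : Xn n => fderiv ℝ (fderiv ℝ ρ) p.1 v w) (by simpa [hL] using this) ?_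
    refine mul_le_mul (by linarith) (apply2_norm v w) (norm_nonneg _) (by linarith)
  · have hO : IsOpen (Ω ×ˢ Ioo 0 T) := h.op.prod isOpen_Ioo
    set L : Cn n →L[ℝ] ℝ := Complex.reCLM.comp ((innerSL ℂ z0).restrictScalars ℝ) with hL
    have hLn : ‖L‖ ≤ K3 := by
      refine ContinuousLinearMap.opNorm_le_bound _ hK3 fun z => ?_
      have e1 : ‖L z‖ ≤ ‖z0‖ * ‖z‖ := by
        simp only [hL, ContinuousLinearMap.comp_apply, Complex.reCLM_apply]
        refine (Complex.abs_re_le_norm _).trans ?_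
        exact norm_inner_le_norm (𝕜 := ℂ) z0 z
      have e2 := b3 z0 hz0
      refine e1.trans (mul_le_mul_of_nonneg_right e2 (norm_nonneg _))
    have e1 := c4 T (ContinuousLinearMap.id ℝ ℝ)
    have e2 := c3 T L
    have e3 := B2.const (Ω ×ˢ Ioo 0 T) (‖z0‖ ^ 2)
    have e4 := (e1.sub hO (e2.cmul hO 2)).add hO e3
    have e5 : B2 (Ω ×ˢ Ioo 0 T) (K4 * ‖ContinuousLinearMap.id ℝ ℝ‖ + |2| * (K3 * ‖L‖) + |‖z0‖ ^ 2|)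
        (fun p => ‖p.1 - z0‖ ^ 2) := by
      refine e4.congr hO fun p _ => ?_
      simp only [ContinuousLinearMap.id_apply, id, hL, ContinuousLinearMap.comp_apply,
        Complex.reCLM_apply, ContinuousLinearMap.coe_restrictScalars', innerSL_apply_apply]
      rw [norm_sub_sq (𝕜 := ℂ), inner_re_symm (𝕜 := ℂ)]
      simp
    refine e5.mono ?_
    have e6 : ‖ContinuousLinearMap.id ℝ ℝ‖ ≤ 1 := ContinuousLinearMap.norm_id_le
    have e7 := b3 z0 hz0
    simp only [id] at e7
    rw [abs_two, abs_of_nonneg (sq_nonneg _)]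
    have e8 : K3 * ‖L‖ ≤ K3 * K3 := mul_le_mul_of_nonneg_left hLn hK3
    have e9 : ‖z0‖ ^ 2 ≤ K3 ^ 2 := by gcongr
    nlinarith

/-- nested spatial derivatives -/
def nest : (k : ℕ) → (Fin k → Cn n) → (Xn n → ℝ) → Xn n → ℝ
  | 0, _, G => G
  | k + 1, m, G => pd (sv (m 0)) (nest k (Fin.tail m) G)

lemma nest_sm {O : Set (Xn n)} (hO : IsOpen O) {G : Xn n → ℝ} (hG : Sm O G) :
    ∀ (k : ℕ) (m : Fin k → Cn n), Sm O (nest k m G)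
  | 0, _ => hG
  | k + 1, m => (nest_sm hO hG k (Fin.tail m)).pd hO _

lemma nest_eq (h : Dom Ω ρ c) {G : Xn n → ℝ} (hG : Sm (Ω ×ˢ Ioo 0 T) G) :
    ∀ (k : ℕ) (m : Fin k → Cn n), ∀ p ∈ Ω ×ˢ Ioo 0 T,
      iteratedFDeriv ℝ k (fun w => G (w, p.2)) p.1 m = nest k m G p
  | 0, m, p, _ => by simp [nest]
  | k + 1, m, p, hp => by
    have hO : IsOpen (Ω ×ˢ Ioo 0 T) := h.op.prod isOpen_Ioo
    rw [iteratedFDeriv_succ_apply_left, nest]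
    have hs := nest_sm hO hG k (Fin.tail m)
    rw [← D1_pd h hs hp, D1,
      fderivWithin_of_mem_nhds (mem_of_superset (h.op.mem_nhds hp.1) subset_closure)]
    have he : (fun x => nest k (Fin.tail m) G (x, p.2)) =ᶠ[𝓝 p.1]
        fun x => iteratedFDeriv ℝ k (fun w => G (w, p.2)) x (Fin.tail m) := by
      filter_upwards [h.op.mem_nhds hp.1] with x hx
      exact (nest_eq h hG k (Fin.tail m) (x, p.2) ⟨hx, hp.2⟩).symm
    rw [he.fderiv_eq]
    have hd : DifferentiableAt ℝ (iteratedFDeriv ℝ k (fun w => G (w, p.2))) p.1 := by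
      have h1 := hG.slice h hp
      exact h1.differentiableAt_iteratedFDeriv (WithTop.coe_lt_coe.mpr (ENat.natCast_lt_top k))
    have h2 : HasFDerivAt (fun x => iteratedFDeriv ℝ k (fun w => G (w, p.2)) x (Fin.tail m)) _ p.1 :=
      (ContinuousMultilinearMap.apply ℝ (fun _ : Fin k => Cn n) ℝ (Fin.tail m)).hasFDerivAt.comp p.1
        hd.hasFDerivAt
    rw [h2.fderiv]; rfl

lemma Sol.φQ (S : Sol Ω ρ c T Cu Cp Cf u φ f) : Sm (Ω ×ˢ Ioo 0 T) φ :=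
  S.φs.mono (prod_mono subset_closure Ioo_subset_Ico_self)

lemma Sol.φS (S : Sol Ω ρ c T Cu Cp Cf u φ f) : Sm (closure Ω ×ˢ Ioo 0 T) φ :=
  S.φs.mono (prod_mono subset_rfl Ioo_subset_Ico_self)

lemma Sol.nest0 (S : Sol Ω ρ c T Cu Cp Cf u φ f) {k : ℕ} (hk : k ≤ 4) (m : Fin k → Cn n) {p : Xn n}
    (hp : p ∈ Ω ×ˢ Ioo 0 T) : |nest k m φ p| ≤ Cp * ∏ i, ‖m i‖ := by
  have h1 := S.φb k 0 (by omega) p.1 hp.1 p.2 hp.2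
  simp only [iteratedDeriv_zero] at h1
  rw [← nest_eq S.dom S.φQ k m p hp]
  exact ContinuousMultilinearMap.le_of_opNorm_le h1 m

lemma Sol.nest1 (S : Sol Ω ρ c T Cu Cp Cf u φ f) {k : ℕ} (hk : k ≤ 2) (m : Fin k → Cn n) {p : Xn n}
    (hp : p ∈ Ω ×ˢ Ioo 0 T) : |nest k m (pd eT φ) p| ≤ Cp * ∏ i, ‖m i‖ := by
  have h1 := S.φb k 1 (by omega) p.1 hp.1 p.2 hp.2
  simp only [iteratedDeriv_one] at h1
  rw [← nest_eq S.dom (S.φQ.pd S.opQ _) k m p hp]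
  have he : (fun w => deriv (fun s => φ (w, s)) p.2) =ᶠ[𝓝 p.1] fun w => pd eT φ (w, p.2) := by
    filter_upwards [S.dom.op.mem_nhds hp.1] with x hx
    exact pd_eT_deriv S.opQ S.φQ ⟨hx, hp.2⟩
  rw [(he.iteratedFDeriv ℝ k).self_of_nhds] at h1
  exact ContinuousMultilinearMap.le_of_opNorm_le h1 m

lemma Sol.Cp_nonneg (S : Sol Ω ρ c T Cu Cp Cf u φ f) (hT : 0 < T) : 0 ≤ Cp := by
  obtain ⟨z, hz⟩ := S.dom.ne
  exact (norm_nonneg _).trans (S.φb 0 0 (by omega) z hz (T / 2) ⟨by linarith, by linarith⟩)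

lemma Sol.Cf_nonneg (S : Sol Ω ρ c T Cu Cp Cf u φ f) (hT : 0 < T) : 0 ≤ Cf := by
  obtain ⟨z, hz⟩ := S.dom.ne
  exact (abs_nonneg _).trans (S.f0 (T / 2, z, 0) ⟨⟨by linarith, by linarith⟩, hz, trivial⟩)

lemma Sol.phi0 (S : Sol Ω ρ c T Cu Cp Cf u φ f) (hT : 0 < T) : B2 (Ω ×ˢ Ioo 0 T) Cp φ := by
  refine ⟨S.Cp_nonneg hT, S.φQ, fun p hp => ?_, fun p hp v => ?_, fun p hp v => ?_, fun p hp => ?_⟩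
  · simpa [nest] using S.nest0 (k := 0) (by norm_num) ![] hp
  · simpa [nest] using S.nest0 (k := 1) (by norm_num) ![v] hp
  · simpa [nest, Fin.prod_univ_succ, Fin.tail, sq] using S.nest0 (k := 2) (by norm_num) ![v, v] hp
  · simpa [nest] using S.nest1 (k := 0) (by norm_num) ![] hp

lemma Sol.phi1 (S : Sol Ω ρ c T Cu Cp Cf u φ f) (hT : 0 < T) (w : Cn n) :
    B2 (Ω ×ˢ Ioo 0 T) (Cp * ‖w‖) (pd (sv w) φ) := by
  have := S.Cp_nonneg hT
  refine ⟨by positivity, S.φQ.pd S.opQ _, fun p hp => ?_, fun p hp v => ?_, fun p hp v => ?_, fun p hp => ?_⟩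
  · simpa [nest] using S.nest0 (k := 1) (by norm_num) ![w] hp
  · have := S.nest0 (k := 2) (by norm_num) ![v, w] hp
    simp [nest, Fin.prod_univ_succ, Fin.tail] at this
    linarith
  · have := S.nest0 (k := 3) (by norm_num) ![v, v, w] hp
    simp [nest, Fin.prod_univ_succ, Fin.tail] at this
    exact this.trans_eq (by ring)
  · rw [pd_comm S.opQ S.φQ hp]
    simpa [nest] using S.nest1 (k := 1) (by norm_num) ![w] hp

lemma Sol.phi2 (S : Sol Ω ρ c T Cu Cp Cf u φ f) (hT : 0 < T) (x w : Cn n) :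
    B2 (Ω ×ˢ Ioo 0 T) (Cp * (‖x‖ * ‖w‖)) (pd (sv x) (pd (sv w) φ)) := by
  have := S.Cp_nonneg hT
  refine ⟨by positivity, (S.φQ.pd S.opQ _).pd S.opQ _, fun p hp => ?_, fun p hp v => ?_, fun p hp v => ?_,
    fun p hp => ?_⟩
  · have := S.nest0 (k := 2) (by norm_num) ![x, w] hp
    simpa [nest, Fin.prod_univ_succ, Fin.tail] using this
  · have := S.nest0 (k := 3) (by norm_num) ![v, x, w] hp
    simp [nest, Fin.prod_univ_succ, Fin.tail] at this
    exact this.trans_eq (by ring)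
  · have := S.nest0 (k := 4) (by norm_num) ![v, v, x, w] hp
    simp [nest, Fin.prod_univ_succ, Fin.tail] at this
    exact this.trans_eq (by ring)
  · rw [pd_comm S.opQ (S.φQ.pd S.opQ _) hp, pd_eqOn S.opQ (pd_eqOn_comm S.opQ S.φQ _ _) _ hp]
    have := S.nest1 (k := 2) (by norm_num) ![x, w] hp
    simpa [nest, Fin.prod_univ_succ, Fin.tail] using this

end

/-! ### First estimates -/

section
variable {Ω : Set (Cn n)} {ρ : Cn n → ℝ} {c T Cu Cp Cf : ℝ} {u φ : Xn n → ℝ} {f : ℝ × Cn n × ℝ → ℝ}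

lemma Sol.tdu_hd (S : Sol Ω ρ c T Cu Cp Cf u φ f) {z : Cn n} {t : ℝ} (hz : z ∈ closure Ω)
    (ht : t ∈ Ioo 0 T) : HasDerivAt (fun s => u (z, s)) (tdu T u (z, t)) t :=
  (S.td z hz t ⟨ht.1.le, ht.2⟩).hasDerivAt (Ico_mem_nhds ht.1 ht.2)

lemma Sol.tdu_pd (S : Sol Ω ρ c T Cu Cp Cf u φ f) {p : Xn n} (hp : p ∈ Ω ×ˢ Ioo 0 T) :
    tdu T u p = pd eT u p := by
  have h1 := S.tdu_hd (subset_closure hp.1) hp.2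
  rw [← pd_eT_deriv S.opQ S.us (z := p.1) (t := p.2) hp]
  exact h1.deriv.symm

lemma frontier_sub {A : Set (Cn n)} {z : Cn n} (hz : z ∈ frontier A) : z ∈ closure A := hz.1

/-- heat maximum principle -/
lemma Sol.hmax (S : Sol Ω ρ c T Cu Cp Cf u φ f) {t1 t2 : ℝ} (h1 : 0 ≤ t1) (h2 : t2 < T)
    {F : Xn n → ℝ} (hF : Sm (Ω ×ˢ Ioo 0 T) F)
    (hc : ContinuousOn F (closure Ω ×ˢ Icc t1 t2)) {M : ℝ}
    (hfr : ∀ z ∈ frontier Ω, ∀ t ∈ Icc t1 t2, F (z, t) ≤ M)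
    (hini : ∀ z ∈ closure Ω, F (z, t1) ≤ M)
    (hInter : ∀ p ∈ Ω ×ˢ Ioo 0 T, p.2 ∈ Ioc t1 t2 → ∀ D c', Fr Ω u f p D c' →
      (∀ v, pd (sv v) F p = 0) → 0 ≤ heat c' F p → F p ≤ M) :
    ∀ z ∈ closure Ω, ∀ t ∈ Icc t1 t2, F (z, t) ≤ M := by
  refine pmax S.dom.op S.dom.bd h1 h2 hF hc hfr hini fun z hz t ht g1 g2 g3 => ?_
  have hp : (z, t) ∈ Ω ×ˢ Ioo 0 T := ⟨hz, h1.trans_lt ht.1, ht.2.trans_lt h2⟩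
  obtain ⟨D, c', hfr'⟩ := S.frame hp
  refine hInter (z, t) hp ht D c' hfr' g1 ?_
  rw [heat]
  have : ∑ i, pd (sv (c' i)) (pd (sv (c' i)) F) (z, t) ≤ 0 := Finset.sum_nonpos fun i _ => g2 _
  linarith

lemma Sol.phi_cl (S : Sol Ω ρ c T Cu Cp Cf u φ f) (hT : 0 < T) {z : Cn n} {t : ℝ} (hz : z ∈ closure Ω)
    (ht : t ∈ Ioo 0 T) : |φ (z, t)| ≤ Cp :=
  ext_le (T := T) (A := fun p => |φ p|) (B := fun _ => Cp) S.φS.continuousOn.abs continuousOn_const ht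
    (fun y hy => (S.phi0 hT).b0 (y, t) ⟨hy, ht⟩) z hz

lemma Sol.init_cl (S : Sol Ω ρ c T Cu Cp Cf u φ f) (hT : 0 < T) {z : Cn n} (hz : z ∈ closure Ω) :
    |u (z, 0)| ≤ Cu := by
  have hc : ContinuousOn (fun z => |u (z, 0)|) (closure Ω) :=
    (S.uc.comp (f := fun z => (z, (0 : ℝ))) (by fun_prop) (fun y hy => ⟨hy, le_rfl, hT⟩)).abs
  exact ContinuousWithinAt.closure_le (f := fun z => |u (z, 0)|) (g := fun _ => Cu) hz
    ((hc z hz).mono subset_closure) continuousWithinAt_const S.ini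

lemma Sol.D2lv (S : Sol Ω ρ c T Cu Cp Cf u φ f) {F : Xn n → ℝ} (hF : Sm (Ω ×ˢ Ioo 0 T) F) {p : Xn n}
    (hp : p ∈ Ω ×ˢ Ioo 0 T) (x : Cn n) : lv (rb (D2 Ω F p)) x
      = (pd (sv x) (pd (sv x) F) p + pd (sv (I • x)) (pd (sv (I • x)) F) p) / 4 := by
  rw [lv_rb, D2_pd S.dom hF hp, D2_pd S.dom hF hp]

lemma Dom.lv_rho (h : Dom Ω ρ c) {p : Xn n} (hp : p.1 ∈ closure Ω) (x : Cn n) :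
    c * ‖x‖ ^ 2 ≤ (pd (sv x) (pd (sv x) (fun q : Xn n => ρ q.1)) p
      + pd (sv (I • x)) (pd (sv (I • x)) (fun q : Xn n => ρ q.1)) p) / 4 := by
  rw [pd2_space_sv h.sm, pd2_space_sv h.sm]
  exact h.levi p.1 hp x

lemma Dom.rho_sm (h : Dom Ω ρ c) {O : Set (Xn n)} : Sm O (fun q : Xn n => ρ q.1) :=
  (h.sm.comp contDiff_fst).contDiffOn

lemma Sol.det_pos (S : Sol Ω ρ c T Cu Cp Cf u φ f) {p : Xn n} (hp : p ∈ Ω ×ˢ Ioo 0 T) :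
    0 < (HM (rb (D2 Ω u p))).det.re := by
  have h := (HM_posDef (S.symm hp) (S.levi p hp)).det_pos
  exact (Complex.lt_def.1 h).1

lemma Sol.fc_bd (S : Sol Ω ρ c T Cu Cp Cf u φ f) {p : Xn n} (hp : p ∈ Ω ×ˢ Ioo 0 T) :
    |fc f u p| ≤ Cf := S.f0 _ ⟨hp.2, hp.1, trivial⟩

lemma Sol.det_eq (S : Sol Ω ρ c T Cu Cp Cf u φ f) {p : Xn n} (hp : p ∈ Ω ×ˢ Ioo 0 T) :
    (HM (rb (D2 Ω u p))).det.re = Real.exp (pd eT u p - fc f u p) := by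
  rw [S.eqn p hp, add_sub_cancel_right, Real.exp_log (S.det_pos hp)]

end

/-- `|u| ≤ M₀` -/
lemma E1 {Ω : Set (Cn n)} {ρ : Cn n → ℝ} {c T : ℝ} (hn : 0 < n) (h : Dom Ω ρ c) (hT : 0 < T)
    (Cu Cp Cf : ℝ) : ∃ M0, 0 ≤ M0 ∧ ∀ u φ f, Sol Ω ρ c T Cu Cp Cf u φ f →
      ∀ p ∈ closure Ω ×ˢ Ico 0 T, |u p| ≤ M0 := by
  obtain ⟨K, hK1, hK, -⟩ := h.bds
  set B := |n * Real.log c| + |Cf| + 1 with hB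
  have hB0 : 0 < B := by positivity
  refine ⟨K + B * T + |Cp| + |Cu|, by positivity, fun u φ f S => ?_⟩
  have hCu := le_abs_self Cu
  have hCp := le_abs_self Cp
  have hCf := le_abs_self Cf
  have hCu' := abs_nonneg Cu
  have hCp' := abs_nonneg Cp
  have hBT : 0 ≤ B * T := by positivity
  have hup : ∀ z ∈ closure Ω, ∀ t ∈ Ioo 0 T, u (z, t) ≤ |Cp| := by
    intro z hz t ht
    refine emax S.dom.op S.dom.bd ht S.us (S.ur.c0.comp (f := fun z => (z, t)) (by fun_prop)
      (fun y hy => ⟨hy, ht⟩)) (M := |Cp|) ?_ ?_ z hz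
    · intro y hy
      rw [S.bdry y hy t ⟨ht.1.le, ht.2⟩]
      exact (le_abs_self _).trans ((S.phi_cl hT hy.1 ht).trans hCp)
    · intro y hy hle
      exfalso
      have hp : (y, t) ∈ Ω ×ˢ Ioo 0 T := ⟨hy, ht⟩
      have hx : cvec n ⟨0, hn⟩ 1 ≠ 0 := by simp [cvec]
      have := S.levi _ hp _ hx
      rw [S.D2lv S.us hp] at this
      have h1 := hle (cvec n ⟨0, hn⟩ 1)
      have h2 := hle (I • cvec n ⟨0, hn⟩ 1)
      linarith
  have hlow : ∀ t2 ∈ Ioo 0 T, ∀ z ∈ closure Ω, ∀ t ∈ Icc 0 t2,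
      ρ z - u (z, t) - B * t ≤ |Cp| + |Cu| := by
    intro t2 ht2 z hz t ht
    refine pmax (F := fun p => ρ p.1 - u p - B * p.2) S.dom.op S.dom.bd le_rfl ht2.2
      ((h.rho_sm.sub S.us).sub (Sm.time (q := fun t => B * t) (by fun_prop))) ?_ ?_ ?_ ?_ z hz t ht
    · refine ContinuousOn.sub (ContinuousOn.sub ?_ ?_) (by fun_prop)
      · exact (h.sm.continuous.comp continuous_fst).continuousOn
      · exact S.uc.mono (prod_mono_right fun s hs => ⟨hs.1, hs.2.trans_lt ht2.2⟩)
    · intro y hy s hs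
      simp only
      have h3 : -u (y, s) ≤ |Cp| + |Cu| := by
        rcases hs.1.eq_or_lt with h0 | h0
        · rw [← h0]
          have := neg_le_abs (u (y, 0))
          have := S.init_cl hT hy.1
          linarith
        · rw [S.bdry y hy s ⟨hs.1, hs.2.trans_lt ht2.2⟩]
          have := neg_le_abs (φ (y, s))
          have := S.phi_cl hT hy.1 ⟨h0, hs.2.trans_lt ht2.2⟩
          linarith
      rw [h.zero y hy]
      have := mul_nonneg hB0.le hs.1
      linarith
    · intro y hy
      simp only
      have := neg_le_abs (u (y, 0))
      have := S.init_cl hT hy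
      have := h.le hy
      linarith
    · intro y hy s hs g1 g2 g3
      exfalso
      have hp : (y, s) ∈ Ω ×ˢ Ioo 0 T := ⟨hy, hs.1, hs.2.trans_lt ht2.2⟩
      have e2 : ∀ v, pd (sv v) (pd (sv v) fun p : Xn n => ρ p.1) (y, s)
          ≤ pd (sv v) (pd (sv v) u) (y, s) := by
        intro v
        have := g2 v
        rw [pd2_sub S.opQ (h.rho_sm.sub S.us) (Sm.time (q := fun t => B * t) (by fun_prop)) hp,
          pd2_sub S.opQ h.rho_sm S.us hp, pd2_time_sv (q := fun t => B * t) (by fun_prop)] at this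
        linarith
      rw [pd_sub S.opQ (h.rho_sm.sub S.us) (Sm.time (q := fun t => B * t) (by fun_prop)) hp,
          pd_sub S.opQ h.rho_sm S.us hp, pd_time_eT (q := fun t => B * t) (by fun_prop),
          pd_space_eT (h.sm.differentiable (by simp))] at g3
      have e3 : deriv (fun t => B * t) s = B := by simp
      simp only [e3] at g3
      have hl : ∀ x, c * ‖x‖ ^ 2 ≤ lv (rb (D2 Ω u (y, s))) x := by
        intro x
        rw [S.D2lv S.us hp]
        refine (h.lv_rho (p := (y, s)) (subset_closure hy) x).trans ?_
        have := e2 x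
        have := e2 (I • x)
        linarith
      have hd := det_lower (S.symm hp) h.cpos.le hl
      have hd2 := Real.log_le_log (pow_pos h.cpos n) hd
      rw [Real.log_pow] at hd2
      have he := S.eqn _ hp
      have hf := neg_abs_le (fc f u (y, s))
      have hf' := S.fc_bd hp
      have := neg_abs_le (n * Real.log c)
      linarith
  rintro ⟨z, t⟩ ⟨hz, ht⟩
  simp only at hz ht
  rcases ht.1.eq_or_lt with h0 | h0
  · rw [← h0]
    have := S.init_cl hT hz
    linarith
  · have h1 := hup z hz t ⟨h0, ht.2⟩
    have h2 := hlow t ⟨h0, ht.2⟩ z hz t ⟨h0.le, le_rfl⟩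
    have h3 := neg_abs_le (ρ z)
    have h4 := hK z hz
    have h5 : B * t ≤ B * T := by gcongr; exact ht.2.le
    rw [abs_le]; constructor <;> linarith

section
variable {Ω : Set (Cn n)} {ρ : Cn n → ℝ} {c T Cu Cp Cf : ℝ} {u φ : Xn n → ℝ} {f : ℝ × Cn n × ℝ → ℝ}

lemma Sol.tdu_fr (S : Sol Ω ρ c T Cu Cp Cf u φ f) (hT : 0 < T) {z : Cn n} {t : ℝ} (hz : z ∈ frontier Ω)
    (ht : t ∈ Ioo 0 T) : |tdu T u (z, t)| ≤ Cp := by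
  have hlip : ∀ y ∈ Ω, ∀ s ∈ Ioo 0 T, |φ (y, s) - φ (y, t)| ≤ Cp * |s - t| := by
    intro y hy s hs
    have := (convex_Ioo (0 : ℝ) T).norm_image_sub_le_of_norm_hasDerivWithin_le
      (f := fun s => φ (y, s)) (f' := fun s => pd eT φ (y, s)) (C := Cp)
      (fun r hr => by
        have h0 : (y, r) ∈ Ω ×ˢ Ioo 0 T := ⟨hy, hr⟩
        have h1 : HasFDerivAt (fun s : ℝ => (y, s)) (ContinuousLinearMap.inr ℝ (Cn n) ℝ) r :=
          hasFDerivAt_prodMk_right y r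
        have h2 : HasFDerivAt (fun s => φ (y, s)) _ r := (S.φQ.da S.opQ h0).hasFDerivAt.comp r h1
        have h3 := h2.hasDerivAt
        have h4 : ((fderiv ℝ φ (y, r)).comp (ContinuousLinearMap.inr ℝ (Cn n) ℝ)) 1 = pd eT φ (y, r) := by
          simp [pd, eT]
        rw [h4] at h3
        exact h3.hasDerivWithinAt)
      (fun r hr => (S.phi0 hT).bt (y, r) ⟨hy, hr⟩) ht hs
    simpa using this
  have hlip2 : ∀ s ∈ Ioo 0 T, |φ (z, s) - φ (z, t)| ≤ Cp * |s - t| := by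
    intro s hs
    have hcs : ∀ r ∈ Ioo 0 T, ContinuousOn (fun z => φ (z, r)) (closure Ω) := fun r hr =>
      S.φS.continuousOn.comp (f := fun z => (z, r)) (by fun_prop) (fun y hy => ⟨hy, hr⟩)
    exact ContinuousWithinAt.closure_le (f := fun z => |φ (z, s) - φ (z, t)|)
      (g := fun _ => Cp * |s - t|) hz.1
      ((((hcs s hs).sub (hcs t ht)).abs z hz.1).mono subset_closure) continuousWithinAt_const
      (fun y hy => hlip y hy s hs)
  have h1 := S.tdu_hd hz.1 ht
  have := h1.hasFDerivAt.le_of_lip' (C := Cp) (S.Cp_nonneg hT) (by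
    filter_upwards [Ioo_mem_nhds ht.1 ht.2] with s hs
    rw [S.bdry z hz s ⟨hs.1.le, hs.2⟩, S.bdry z hz t ⟨ht.1.le, ht.2⟩]
    exact hlip2 s hs)
  simpa using this

end

/-- `|t u_t| ≤ C` -/
lemma E2 {Ω : Set (Cn n)} {ρ : Cn n → ℝ} {c T : ℝ} (hT : 0 < T)
    (Cu Cp Cf M0 : ℝ) : ∃ M1, 0 ≤ M1 ∧ ∀ u φ f, Sol Ω ρ c T Cu Cp Cf u φ f →
      (∀ p ∈ closure Ω ×ˢ Ico 0 T, |u p| ≤ M0) →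
      ∀ z ∈ closure Ω, ∀ t ∈ Ico 0 T, |t * tdu T u (z, t)| ≤ M1 := by
  set B := n + T * |Cf| + 1 with hB
  have hB0 : 0 < B := by positivity
  set M := |M0| + T * |Cp| with hM
  have hM' : |M0| ≤ M := by
    have : 0 ≤ T * |Cp| := by positivity
    linarith
  refine ⟨M + B * T + |M0|, by positivity, fun u φ f S hu => ?_⟩
  have hCf := le_abs_self Cf
  have hCp := le_abs_self Cp
  have hM0 := le_abs_self M0
  have hO := S.opQ
  set H : Xn n → ℝ := fun p => p.2 * tdu T u p - u p with hH
  set H' : Xn n → ℝ := fun p => p.2 * pd eT u p - u p with hH'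
  have hHH : EqOn H H' (Ω ×ˢ Ioo 0 T) := fun p hp => by
    simp only [hH, hH', S.tdu_pd hp]
  have ht1 : Sm (Ω ×ˢ Ioo 0 T) (fun p => p.2) := Sm.time (q := fun t => t) contDiff_id
  have hH's : Sm (Ω ×ˢ Ioo 0 T) H' := (ht1.mul (S.us.pd hO eT)).sub S.us
  have hHs : Sm (Ω ×ˢ Ioo 0 T) H := ContDiffOn.congr hH's hHH
  have htB : Sm (Ω ×ˢ Ioo 0 T) (fun p => B * p.2) := Sm.time (q := fun t => B * t) (by fun_prop)
  have hheat : ∀ p ∈ Ω ×ˢ Ioo 0 T, ∀ D c', Fr Ω u f p D c' →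
      heat c' H p = p.2 * pd eT (fc f u) p + n := by
    intro p hp D c' hF
    rw [heat_eqOn hO hHH hp, heat_sub hO (ht1.mul (S.us.pd hO eT)) S.us hp, heat_mul hO ht1 (S.us.pd hO eT) hp,
      hF.lin, hF.tr, heat_time (q := fun t => t) differentiable_id]
    have : Gam c' (fun p : Xn n => p.2) (pd eT u) p = 0 := by
      simp [Gam, pd_time_sv (q := fun t => t) differentiable_id]
    rw [this]; simp; ring
  have hhB : ∀ p, ∀ c' : Fin n × Bool → Cn n, heat c' (fun p => B * p.2) p = B := by
    intro p c'
    rw [heat_time (q := fun t => B * t) (by fun_prop)]; simp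
  have hHc : ContinuousOn H (closure Ω ×ˢ Ico 0 T) :=
    (continuousOn_snd.mul S.tc).sub S.uc
  have hfrb : ∀ z ∈ frontier Ω, ∀ t ∈ Ico 0 T, |H (z, t)| ≤ M := by
    intro z hz t ht
    have h1 := hu (z, t) ⟨hz.1, ht⟩
    have h2 : |t * tdu T u (z, t)| ≤ T * |Cp| := by
      rcases ht.1.eq_or_lt with h0 | h0
      · rw [← h0]; simp; positivity
      · rw [abs_mul, abs_of_pos h0]
        have := S.tdu_fr hT hz ⟨h0, ht.2⟩
        exact mul_le_mul ht.2.le (by linarith) (abs_nonneg _) hT.le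
    have := abs_sub (t * tdu T u (z, t)) (u (z, t))
    change |t * tdu T u (z, t) - u (z, t)| ≤ M
    linarith
  have hin : ∀ z ∈ closure Ω, |H (z, 0)| ≤ M := by
    intro z hz
    have h1 := hu (z, 0) ⟨hz, le_rfl, hT⟩
    simp only [hH, zero_mul, zero_sub, abs_neg]
    linarith
  have kU : ∀ t2 ∈ Ioo 0 T, ∀ z ∈ closure Ω, ∀ t ∈ Icc 0 t2, H (z, t) - B * t ≤ M := by
    intro t2 ht2 z hz t ht
    have hsub : Icc 0 t2 ⊆ Ico 0 T := fun s hs => ⟨hs.1, hs.2.trans_lt ht2.2⟩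
    refine S.hmax (F := fun p => H p - B * p.2) le_rfl ht2.2 (hHs.sub htB)
      ((hHc.mono (prod_mono_right hsub)).sub (by fun_prop)) ?_ ?_ ?_ z hz t ht
    · intro y hy s hs
      have := (le_abs_self _).trans (hfrb y hy s (hsub hs))
      have := mul_nonneg hB0.le hs.1
      simp only; linarith
    · intro y hy
      have := (le_abs_self _).trans (hin y hy)
      simp only; linarith
    · intro p hp hpt D c' hF _ hh
      rw [heat_sub hO hHs htB hp, hheat p hp D c' hF, hhB] at hh
      obtain ⟨k, hk, -, hk2, -⟩ := S.fc1 hp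
      have h3 := hk2 eT
      simp only [eT, abs_one, norm_zero, add_zero, mul_one] at h3
      change |pd eT (fc f u) p - k * pd eT u p| ≤ Cf at h3
      have h4 := (abs_le.1 h3).2
      have hp2 := hp.2.1
      have hp3 := hp.2.2
      have h5 : p.2 * pd eT (fc f u) p ≤ p.2 * (k * pd eT u p) + T * |Cf| := by
        have : p.2 * (pd eT (fc f u) p - k * pd eT u p) ≤ T * |Cf| :=
          (mul_le_mul_of_nonneg_left (h4.trans hCf) hp2.le).trans
            (mul_le_mul_of_nonneg_right hp3.le (abs_nonneg _))
        linarith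
      have h6 : 0 < k * (p.2 * pd eT u p) := by nlinarith
      have h7 : p.2 * pd eT u p ≤ 0 := by
        by_contra hcon
        push Not at hcon
        nlinarith
      have h8 := hu p ⟨subset_closure hp.1, hp.2.1.le, hp.2.2⟩
      have h9 := neg_le_abs (u p)
      have h10 : 0 ≤ B * p.2 := by positivity
      change H p - B * p.2 ≤ M
      rw [hHH hp]
      simp only [hH']
      linarith
  have kL : ∀ t2 ∈ Ioo 0 T, ∀ z ∈ closure Ω, ∀ t ∈ Icc 0 t2, -H (z, t) - B * t ≤ M := by
    intro t2 ht2 z hz t ht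
    have hsub : Icc 0 t2 ⊆ Ico 0 T := fun s hs => ⟨hs.1, hs.2.trans_lt ht2.2⟩
    refine S.hmax (F := fun p => -H p - B * p.2) le_rfl ht2.2 (hHs.neg.sub htB)
      ((hHc.mono (prod_mono_right hsub)).neg.sub (by fun_prop)) ?_ ?_ ?_ z hz t ht
    · intro y hy s hs
      have := (neg_le_abs _).trans (hfrb y hy s (hsub hs))
      have := mul_nonneg hB0.le hs.1
      simp only; linarith
    · intro y hy
      have := (neg_le_abs _).trans (hin y hy)
      simp only; linarith
    · intro p hp hpt D c' hF _ hh
      have hneg : heat c' (fun q => -H q) p = - heat c' H p := by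
        have := heat_cmul (c := c') hO hHs hp (-1)
        simpa using this
      rw [heat_sub hO hHs.neg htB hp, hneg, hheat p hp D c' hF, hhB] at hh
      obtain ⟨k, hk, -, hk2, -⟩ := S.fc1 hp
      have h3 := hk2 eT
      simp only [eT, abs_one, norm_zero, add_zero, mul_one] at h3
      change |pd eT (fc f u) p - k * pd eT u p| ≤ Cf at h3
      have h4 := (abs_le.1 h3).1
      have hp2 := hp.2.1
      have hp3 := hp.2.2
      have h5 : p.2 * (k * pd eT u p) - T * |Cf| ≤ p.2 * pd eT (fc f u) p := by
        have : p.2 * (k * pd eT u p - pd eT (fc f u) p) ≤ p.2 * |Cf| :=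
          mul_le_mul_of_nonneg_left (by linarith) hp2.le
        have : p.2 * |Cf| ≤ T * |Cf| := mul_le_mul_of_nonneg_right hp3.le (abs_nonneg _)
        linarith
      have hn0 : (0 : ℝ) ≤ n := Nat.cast_nonneg n
      have h6 : k * (p.2 * pd eT u p) < 0 := by nlinarith
      have h7 : 0 ≤ p.2 * pd eT u p := by
        by_contra hcon
        push Not at hcon
        nlinarith
      have h8 := hu p ⟨subset_closure hp.1, hp.2.1.le, hp.2.2⟩
      have h9 := le_abs_self (u p)
      have h10 : 0 ≤ B * p.2 := by positivity
      change -H p - B * p.2 ≤ M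
      rw [hHH hp]
      simp only [hH']
      linarith
  intro z hz t ht
  rcases ht.1.eq_or_lt with h0 | h0
  · rw [← h0]; simp; positivity
  have h1 := kU t ⟨h0, ht.2⟩ z hz t ⟨h0.le, le_rfl⟩
  have h2 := kL t ⟨h0, ht.2⟩ z hz t ⟨h0.le, le_rfl⟩
  have h3 := abs_le.1 (hu (z, t) ⟨hz, ht⟩)
  have h5 : B * t ≤ B * T := by gcongr; exact ht.2.le
  simp only [hH] at h1 h2
  rw [abs_le]; constructor <;> linarith

/-- two-sided bound by the defining function -/
lemma E3 {Ω : Set (Cn n)} {ρ : Cn n → ℝ} {c T : ℝ} (hn : 0 < n) (h : Dom Ω ρ c) (hT : 0 < T)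
    (Cu Cp Cf M1 : ℝ) : ∃ A, 0 ≤ A ∧ ∀ u φ f, Sol Ω ρ c T Cu Cp Cf u φ f →
      ∀ t ∈ Ioo 0 T, (∀ z ∈ Ω, |pd eT u (z, t)| ≤ M1) →
      ∀ z ∈ closure Ω, |u (z, t) - φ (z, t)| ≤ A * (-ρ z) := by
  have hc := h.cpos
  set A := (|Cp| + Real.exp (M1 + Cf) + 1) / c with hA
  have hA0 : 0 ≤ A := by positivity
  have hAc : A * c = |Cp| + Real.exp (M1 + Cf) + 1 := by rw [hA]; field_simp
  refine ⟨A, hA0, fun u φ f S t ht hut => ?_⟩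
  have hCp := le_abs_self Cp
  have hO := S.opQ
  have hρs : Sm (Ω ×ˢ Ioo 0 T) (fun q : Xn n => A * ρ q.1) := h.rho_sm.cmul A
  have hφ2 : ∀ z ∈ Ω, ∀ x : Cn n, |(pd (sv x) (pd (sv x) φ) (z, t)
      + pd (sv (I • x)) (pd (sv (I • x)) φ) (z, t)) / 4| ≤ |Cp| * ‖x‖ ^ 2 := by
    intro z hz x
    have h1 := abs_le.1 ((S.phi0 hT).b2 (z, t) ⟨hz, ht⟩ x)
    have h2 := abs_le.1 ((S.phi0 hT).b2 (z, t) ⟨hz, ht⟩ (I • x))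
    rw [norm_I_smul] at h2
    have h3 : Cp * ‖x‖ ^ 2 ≤ |Cp| * ‖x‖ ^ 2 := by gcongr
    have h4 : 0 ≤ |Cp| * ‖x‖ ^ 2 := by positivity
    rw [abs_le]; constructor <;> linarith
  have hcs : ContinuousOn (fun z => u (z, t)) (closure Ω) :=
    S.ur.c0.comp (f := fun z => (z, t)) (by fun_prop) (fun y hy => ⟨hy, ht⟩)
  have hcφ : ContinuousOn (fun z => φ (z, t)) (closure Ω) :=
    S.φS.continuousOn.comp (f := fun z => (z, t)) (by fun_prop) (fun y hy => ⟨hy, ht⟩)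
  have hcρ : ContinuousOn (fun z => A * ρ z) (closure Ω) := (h.sm.continuous.const_mul A).continuousOn
  have htI : t ∈ Ico 0 T := ⟨ht.1.le, ht.2⟩
  have k1 : ∀ z ∈ closure Ω, φ (z, t) + A * ρ z - u (z, t) ≤ 0 := by
    refine emax (F := fun p => φ p + A * ρ p.1 - u p) h.op h.bd ht ((S.φQ.add hρs).sub S.us)
      ((hcφ.add hcρ).sub hcs) ?_ ?_
    · intro z hz; simp only; rw [h.zero z hz, S.bdry z hz t htI]; simp
    · intro z hz hle
      exfalso
      have hp : (z, t) ∈ Ω ×ˢ Ioo 0 T := ⟨hz, ht⟩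
      have hl : ∀ x, (Real.exp (M1 + Cf) + 1) * ‖x‖ ^ 2 ≤ lv (rb (D2 Ω u (z, t))) x := by
        intro x
        have e1 := hle x
        have e2 := hle (I • x)
        rw [pd2_sub hO (S.φQ.add hρs) S.us hp, pd2_add hO S.φQ hρs hp, pd2_cmul hO h.rho_sm hp] at e1 e2
        have e3 := mul_le_mul_of_nonneg_left (h.lv_rho (p := (z, t)) (subset_closure hz) x) hA0
        rw [← mul_assoc, hAc] at e3
        have e4 := (abs_le.1 (hφ2 z hz x)).1
        rw [S.D2lv S.us hp]
        linarith
      have hd := det_lower (S.symm hp) (by positivity) hl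
      rw [S.det_eq hp] at hd
      have e5 : Real.exp (M1 + Cf) + 1 ≤ (Real.exp (M1 + Cf) + 1) ^ n :=
        le_self_pow₀ (by have := Real.exp_pos (M1 + Cf); linarith) hn.ne'
      have e6 : Real.exp (pd eT u (z, t) - fc f u (z, t)) ≤ Real.exp (M1 + Cf) := by
        apply Real.exp_le_exp.2
        have := (abs_le.1 (hut z hz)).2
        have := (abs_le.1 (S.fc_bd hp)).1
        linarith
      linarith
  have k2 : ∀ z ∈ closure Ω, u (z, t) - φ (z, t) + A * ρ z ≤ 0 := by
    refine emax (F := fun p => u p - φ p + A * ρ p.1) h.op h.bd ht ((S.us.sub S.φQ).add hρs)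
      ((hcs.sub hcφ).add hcρ) ?_ ?_
    · intro z hz; simp only; rw [h.zero z hz, S.bdry z hz t htI]; simp
    · intro z hz hle
      exfalso
      have hp : (z, t) ∈ Ω ×ˢ Ioo 0 T := ⟨hz, ht⟩
      have hx : cvec n ⟨0, hn⟩ 1 ≠ 0 := by simp [cvec]
      have hx' : 0 < ‖cvec n ⟨0, hn⟩ 1‖ ^ 2 := by positivity
      set x := cvec n ⟨0, hn⟩ 1
      have e1 := hle x
      have e2 := hle (I • x)
      rw [pd2_add hO (S.us.sub S.φQ) hρs hp, pd2_sub hO S.us S.φQ hp, pd2_cmul hO h.rho_sm hp] at e1 e2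
      have e3 := mul_le_mul_of_nonneg_left (h.lv_rho (p := (z, t)) (subset_closure hz) x) hA0
      rw [← mul_assoc, hAc] at e3
      have e4 := (abs_le.1 (hφ2 z hz x)).2
      have e5 := S.levi _ hp _ hx
      rw [S.D2lv S.us hp] at e5
      have e6 : 0 ≤ (Real.exp (M1 + Cf) + 1) * ‖x‖ ^ 2 := by positivity
      linarith
  intro z hz
  have h1 := k1 z hz
  have h2 := k2 z hz
  rw [abs_le]; constructor <;> linarith

/-! ### Boundary gradient and the cut-off lemma -/

section
variable {Ω : Set (Cn n)} {ρ : Cn n → ℝ} {c T Cu Cp Cf : ℝ} {u φ : Xn n → ℝ} {f : ℝ × Cn n × ℝ → ℝ}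

lemma Sol.φR (S : Sol Ω ρ c T Cu Cp Cf u φ f) : Reg2 Ω T φ := S.φS.reg2 S.dom

lemma Sol.D1phi (S : Sol Ω ρ c T Cu Cp Cf u φ f) (hT : 0 < T) {p : Xn n} (hp : p ∈ closure Ω ×ˢ Ioo 0 T)
    (v : Cn n) : |D1 Ω φ p v| ≤ Cp * ‖v‖ :=
  ext_le (T := T) (A := fun p => |D1 Ω φ p v|) (B := fun _ => Cp * ‖v‖)
    (S.φR.c1.clm_apply continuousOn_const).abs continuousOn_const hp.2
    (fun y hy => by
      have hq : (y, p.2) ∈ Ω ×ˢ Ioo 0 T := ⟨hy, hp.2⟩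
      rw [D1_pd S.dom S.φQ hq]; exact (S.phi0 hT).b1 _ hq v) p.1 hp.1

lemma Sol.D2phi (S : Sol Ω ρ c T Cu Cp Cf u φ f) (hT : 0 < T) {p : Xn n} (hp : p ∈ closure Ω ×ˢ Ioo 0 T)
    (w v : Cn n) : |D2 Ω φ p w v| ≤ Cp * (‖w‖ * ‖v‖) :=
  ext_le (T := T) (A := fun p => |D2 Ω φ p w v|) (B := fun _ => Cp * (‖w‖ * ‖v‖))
    (S.φR.c2 w v).abs continuousOn_const hp.2
    (fun y hy => by
      have hq : (y, p.2) ∈ Ω ×ˢ Ioo 0 T := ⟨hy, hp.2⟩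
      rw [D2_pd S.dom S.φQ hq]; exact (S.phi2 hT w v).b0 _ hq) p.1 hp.1

lemma inw_deriv {G : Cn n → ℝ} {L : Cn n →L[ℝ] ℝ} {z v : Cn n} (hz : z ∈ closure Ω)
    (hG : HasFDerivWithinAt G L (closure Ω) z) (hi : Inw Ω z v) :
    Tendsto (fun s : ℝ => (G (z + s • v) - G z) / s) (𝓝[>] 0) (𝓝 (L v)) := by
  obtain ⟨r, hr, hi⟩ := hi
  have hm : ∀ s ∈ Icc 0 (r / 2), z + s • v ∈ closure Ω := by
    intro s hs
    rcases hs.1.eq_or_lt with h0 | h0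
    · rw [← h0]; simpa using hz
    · exact subset_closure (hi z hz (by simpa using hr) s ⟨h0, by linarith [hs.2]⟩)
  have h1 := line_has (G := G) (S := closure Ω) (L := L) (z := z) (v := v) (s := 0) (r := r / 2)
    (by simpa using hG) hm
  have h2 : HasDerivWithinAt (fun s : ℝ => G (z + s • v)) (L v) (Ioi 0) 0 :=
    (h1.mono_of_mem_nhdsWithin (Icc_mem_nhdsGT (by linarith)))
  have h3 := (hasDerivWithinAt_iff_tendsto_slope' (by simp)).1 h2
  refine h3.congr' ?_
  filter_upwards with s
  simp [slope_def_field]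

lemma Sol.bgrad (S : Sol Ω ρ c T Cu Cp Cf u φ f) {t A : ℝ} (ht : t ∈ Ioo 0 T) (hA : 0 ≤ A)
    (h : ∀ z ∈ closure Ω, |u (z, t) - φ (z, t)| ≤ A * (-ρ z)) {z : Cn n} (hz : z ∈ frontier Ω)
    (v : Cn n) : |D1 Ω u (z, t) v - D1 Ω φ (z, t) v| ≤ A * |fderiv ℝ ρ z v| := by
  set L := D1 Ω u (z, t) - D1 Ω φ (z, t) with hL
  have hd : HasFDerivWithinAt (fun x => u (x, t) - φ (x, t)) L (closure Ω) z :=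
    (d1_has (S.ur.d t ht) hz.1).sub (d1_has (S.φR.d t ht) hz.1)
  have hρd : HasFDerivWithinAt ρ (fderiv ℝ ρ z) (closure Ω) z :=
    (S.dom.sm.differentiable (by simp) z).hasFDerivAt.hasFDerivWithinAt
  have key : ∀ v, fderiv ℝ ρ z v < 0 → |L v| ≤ A * |fderiv ℝ ρ z v| := by
    intro v hv
    have hi := S.dom.inw_frontier hz hv
    have l1 := (inw_deriv hz.1 hd hi).abs
    have l2 := ((inw_deriv hz.1 hρd hi).abs.const_mul A)
    refine le_of_tendsto_of_tendsto l1 l2 ?_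
    obtain ⟨r, hr, hi⟩ := hi
    filter_upwards [Ioo_mem_nhdsGT hr] with s hs
    have hm := subset_closure (hi z hz.1 (by simpa using hr) s hs)
    have h1 := h _ hm
    rw [S.bdry z hz t ⟨ht.1.le, ht.2⟩, S.dom.zero z hz]
    have h2 := S.dom.le hm
    rw [abs_div, abs_div, sub_self, sub_zero, sub_zero, abs_of_nonpos h2, ← mul_div_assoc]
    gcongr
  change |L v| ≤ _
  rcases lt_trichotomy (fderiv ℝ ρ z v) 0 with hv | hv | hv
  · exact key v hv
  · obtain ⟨y, hy⟩ : ∃ y, fderiv ℝ ρ z y < 0 := by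
      by_contra hcon
      push Not at hcon
      refine S.dom.grad z hz ?_
      ext y
      have h1 := hcon y
      have h2 := hcon (-y)
      rw [map_neg] at h2
      simp; linarith
    have hs : ∀ s : ℝ, 0 < s → |L (v + s • y)| ≤ A * |fderiv ℝ ρ z (v + s • y)| := by
      intro s hs
      apply key
      rw [map_add, map_smul, hv, smul_eq_mul]
      nlinarith
    have c1 : Continuous (fun s : ℝ => |L (v + s • y)|) := by fun_prop
    have c2 : Continuous (fun s : ℝ => A * |fderiv ℝ ρ z (v + s • y)|) := by fun_prop
    have := le_of_tendsto_of_tendsto ((c1.tendsto 0).mono_left nhdsWithin_le_nhds)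
      ((c2.tendsto 0).mono_left nhdsWithin_le_nhds) (eventually_nhdsWithin_of_forall (s := Ioi 0) hs)
    simpa using this
  · have := key (-v) (by rw [map_neg]; linarith)
    simpa using this

/-- cut-off maximum principle -/
lemma Sol.cut (S : Sol Ω ρ c T Cu Cp Cf u φ f) {t1 C B Ψ : ℝ} {m : ℕ} (hm : 0 < m) (h1 : 0 < t1)
    (hC : 0 ≤ C) (hB : 0 ≤ B) {w ψ : Xn n → ℝ} (hT : 0 < T)
    (hws : Sm (Ω ×ˢ Ioo 0 T) w) (hwc : ContinuousOn w (closure Ω ×ˢ Ioo 0 T))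
    (hψs : Sm (Ω ×ˢ Ioo 0 T) ψ) (hψc : ContinuousOn ψ (closure Ω ×ˢ Ioo 0 T))
    (hψ : ∀ p ∈ closure Ω ×ˢ Ioo 0 T, |ψ p| ≤ Ψ)
    (hfr : ∀ z ∈ frontier Ω, ∀ t ∈ Ico t1 T, w (z, t) ≤ B)
    (P : Xn n → (Fin n × Bool → Cn n) → ℝ)
    (hInter : ∀ p ∈ Ω ×ˢ Ioo 0 T, t1 ≤ p.2 → ∀ D c', Fr Ω u f p D c' → 1 ≤ w p →
      heat c' w p ≤ C * w p ∧ heat c' ψ p + Gam c' ψ ψ p ≤ - P p c' + C ∧ 0 ≤ P p c' ∧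
      w p ≤ C * P p c' ^ m) :
    ∀ z ∈ closure Ω, ∀ t ∈ Ioo t1 T, (t - t1) ^ m * w (z, t)
      ≤ (C * (m + 2 * C * T) ^ m + T ^ m * (B + 1)) * Real.exp (2 * Ψ) := by
  intro z hz t ht
  have hO := S.opQ
  set M := C * (m + 2 * C * T) ^ m + T ^ m * (B + 1) with hM
  have hM1 : 0 ≤ C * (m + 2 * C * T) ^ m := by positivity
  have hM2 : 0 ≤ T ^ m * (B + 1) := by positivity
  have hsub : Icc t1 t ⊆ Ioo 0 T := fun s hs => ⟨h1.trans_le hs.1, hs.2.trans_lt ht.2⟩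
  have hq : ContDiff ℝ ((⊤ : ℕ∞) : WithTop ℕ∞) (fun s : ℝ => (s - t1) ^ m) :=
    (contDiff_id.sub contDiff_const).pow m
  have hqd : Differentiable ℝ (fun s : ℝ => (s - t1) ^ m) := hq.differentiable (by simp)
  have hqs : Sm (Ω ×ˢ Ioo 0 T) (fun p : Xn n => (p.2 - t1) ^ m) := Sm.time hq
  have hwE : Sm (Ω ×ˢ Ioo 0 T) (fun p => w p * Real.exp (ψ p)) := hws.mul hψs.exp
  have bound : ∀ p ∈ closure Ω ×ˢ Icc t1 t, ∀ X, (p.2 - t1) ^ m * w p ≤ X → 0 ≤ X →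
      (p.2 - t1) ^ m * (w p * Real.exp (ψ p)) ≤ X * Real.exp Ψ := by
    intro p hp X hX hX0
    rw [← mul_assoc]
    have e1 : Real.exp (ψ p) ≤ Real.exp Ψ :=
      Real.exp_le_exp.2 ((le_abs_self _).trans (hψ p ⟨hp.1, hsub hp.2⟩))
    calc _ ≤ X * Real.exp (ψ p) := by gcongr
      _ ≤ _ := by gcongr
  have hTm : ∀ p ∈ closure Ω ×ˢ Icc t1 t, 0 ≤ (p.2 - t1) ^ m ∧ (p.2 - t1) ^ m ≤ T ^ m := by
    intro p hp
    have a1 : 0 ≤ p.2 - t1 := sub_nonneg.2 hp.2.1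
    refine ⟨by positivity, pow_le_pow_left₀ a1 ?_ m⟩
    have := (hsub hp.2).2
    linarith
  have main := S.hmax (t1 := t1) (t2 := t) (F := fun p => (p.2 - t1) ^ m * (w p * Real.exp (ψ p)))
    (M := M * Real.exp Ψ) h1.le ht.2 (hqs.mul hwE)
    (ContinuousOn.mul (by fun_prop) ((hwc.mul (Real.continuous_exp.comp_continuousOn hψc)).mono
      (prod_mono_right hsub))) ?_ ?_ ?_ z hz t ⟨ht.1.le, le_rfl⟩
  · have hp : (z, t) ∈ closure Ω ×ˢ Ioo 0 T := ⟨hz, h1.trans ht.1, ht.2⟩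
    have e1 := (abs_le.1 (hψ _ hp)).1
    simp only at main
    have e2 : (t - t1) ^ m * w (z, t) = (t - t1) ^ m * (w (z, t) * Real.exp (ψ (z, t))) * Real.exp (-ψ (z, t)) := by
      rw [mul_assoc, mul_assoc, ← Real.exp_add]; simp
    have e5 : M * Real.exp (2 * Ψ) = M * Real.exp Ψ * Real.exp Ψ := by
      rw [two_mul, Real.exp_add]; ring
    rw [e2, e5]
    have e3 : Real.exp (-ψ (z, t)) ≤ Real.exp Ψ := Real.exp_le_exp.2 (by linarith)
    have e4 : 0 ≤ M * Real.exp Ψ := by positivity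
    exact (mul_le_mul_of_nonneg_right main (Real.exp_pos _).le).trans (mul_le_mul_of_nonneg_left e3 e4)
  · intro y hy s hs
    have hp : (y, s) ∈ closure Ω ×ˢ Icc t1 t := ⟨hy.1, hs⟩
    refine bound (y, s) hp M ?_ (by positivity)
    have e1 := hfr y hy s ⟨hs.1, hs.2.trans_lt ht.2⟩
    obtain ⟨e2, e3⟩ := hTm _ hp
    simp only at e2 e3 ⊢
    calc (s - t1) ^ m * w (y, s) ≤ (s - t1) ^ m * (B + 1) := by gcongr; linarith
      _ ≤ T ^ m * (B + 1) := by gcongr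
      _ ≤ M := by linarith
  · intro y hy
    simp only [sub_self, zero_pow hm.ne', zero_mul]
    positivity
  · intro p hp hpt D c' hF hg hh
    have hp' : p ∈ closure Ω ×ˢ Icc t1 t := ⟨subset_closure hp.1, hpt.1.le, hpt.2⟩
    refine bound p hp' M ?_ (by positivity)
    obtain ⟨e2, e3⟩ := hTm _ hp'
    by_cases hw1 : 1 ≤ w p
    swap
    · push Not at hw1
      calc (p.2 - t1) ^ m * w p ≤ (p.2 - t1) ^ m * (B + 1) := by gcongr; linarith
        _ ≤ T ^ m * (B + 1) := by gcongr
        _ ≤ M := by linarith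
    obtain ⟨i1, i2, i3, i4⟩ := hInter p hp hpt.1.le D c' hF hw1
    set θ := p.2 - t1 with hθ
    have hθ0 : 0 < θ := sub_pos.2 hpt.1
    have hθT : θ ≤ T := by have := hp.2.2; linarith
    set E := Real.exp (ψ p) with hE
    have hE0 : 0 < E := Real.exp_pos _
    have hpdE : ∀ v, pd (sv v) (fun q => Real.exp (ψ q)) p = E * pd (sv v) ψ p := fun v =>
      pd_exp hO hψs hp _
    have hpdw : ∀ v, pd (sv v) w p = - w p * pd (sv v) ψ p := by
      intro v
      have := hg v
      rw [pd_mul hO hqs hwE hp, pd_time_sv hqd, pd_mul hO hws hψs.exp hp, hpdE] at this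
      have h3 : (θ ^ m * E) * (w p * pd (sv v) ψ p + pd (sv v) w p) = 0 := by
        rw [← this]; ring
      have h4 : θ ^ m * E ≠ 0 := by positivity
      have := (mul_eq_zero.1 h3).resolve_left h4
      linarith
    have hGam1 : Gam c' w (fun q => Real.exp (ψ q)) p = - (w p * E * Gam c' ψ ψ p) := by
      simp only [Gam, hpdw, hpdE, Finset.mul_sum, ← Finset.sum_neg_distrib]
      exact Finset.sum_congr rfl fun i _ => by ring
    have hheatE : heat c' (fun q => Real.exp (ψ q)) p = E * (heat c' ψ p - Gam c' ψ ψ p) := by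
      simp only [heat, Gam, pd_exp hO hψs hp, pd2_exp hO hψs hp, ← Finset.mul_sum, Finset.sum_add_distrib, ← sq]
      ring
    have hGam0 : Gam c' (fun q : Xn n => (q.2 - t1) ^ m) (fun q => w q * Real.exp (ψ q)) p = 0 := by
      simp [Gam, pd_time_sv hqd]
    have hder : deriv (fun s : ℝ => (s - t1) ^ m) p.2 = m * θ ^ (m - 1) := by
      have hd := (((hasDerivAt_id p.2).sub_const t1).pow m).deriv
      simp only [id, mul_one] at hd
      exact hd
    rw [heat_mul hO hqs hwE hp, hGam0, heat_time hqd, hder, heat_mul hO hws hψs.exp hp, hheatE, hGam1] at hh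
    have hpow : θ ^ m = θ * θ ^ (m - 1) := by
      rw [← pow_succ']; congr 1; omega
    have hh2 : 0 ≤ (θ ^ (m - 1) * E) * (m * w p + θ * (heat c' w p + w p * (heat c' ψ p + Gam c' ψ ψ p))) := by
      refine hh.trans_eq ?_
      rw [hpow]; ring
    have h5 : 0 ≤ m * w p + θ * (heat c' w p + w p * (heat c' ψ p + Gam c' ψ ψ p)) :=
      nonneg_of_mul_nonneg_right hh2 (by positivity)
    have h6 : heat c' w p + w p * (heat c' ψ p + Gam c' ψ ψ p) ≤ C * w p + w p * (- P p c' + C) := by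
      gcongr
    have h7 : θ * (heat c' w p + w p * (heat c' ψ p + Gam c' ψ ψ p)) ≤ θ * (C * w p + w p * (- P p c' + C)) :=
      mul_le_mul_of_nonneg_left h6 hθ0.le
    have h8 : 0 ≤ w p * (m + 2 * C * θ - θ * P p c') := by nlinarith
    have h9 : 0 ≤ m + 2 * C * θ - θ * P p c' := nonneg_of_mul_nonneg_right h8 (by linarith)
    have h10 : θ * P p c' ≤ m + 2 * C * T := by
      have : 2 * C * θ ≤ 2 * C * T := by gcongr
      linarith
    calc θ ^ m * w p ≤ θ ^ m * (C * P p c' ^ m) := by gcongr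
      _ = C * (θ * P p c') ^ m := by ring
      _ ≤ C * (m + 2 * C * T) ^ m := by gcongr
      _ ≤ M := by linarith

end

/-- First package of estimates. -/
structure Est1 (Ω : Set (Cn n)) (ρ : Cn n → ℝ) (T : ℝ) (u φ : Xn n → ℝ) (f : ℝ × Cn n × ℝ → ℝ)
    (ε M : ℝ) : Prop where
  one : 1 ≤ M
  ub : ∀ p ∈ closure Ω ×ˢ Ioo 0 T, |u p| ≤ M
  ut : ∀ p ∈ Ω ×ˢ Ico ε T, |pd eT u p| ≤ M
  dup : ∀ p ∈ Ω ×ˢ Ico ε T, ∀ D c', Fr Ω u f p D c' → D ≤ M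
  det : ∀ p ∈ Ω ×ˢ Ico ε T, (HM (rb (D2 Ω u p))).det.re ≤ M ∧ M⁻¹ ≤ (HM (rb (D2 Ω u p))).det.re
  bg : ∀ z ∈ frontier Ω, ∀ t ∈ Ico ε T, ∀ v, |D1 Ω u (z, t) v - D1 Ω φ (z, t) v| ≤ M * |fderiv ℝ ρ z v|

lemma est1 {Ω : Set (Cn n)} {ρ : Cn n → ℝ} {c T : ℝ} (hn : 0 < n) (h : Dom Ω ρ c) (hT : 0 < T)
    (Cu Cp Cf : ℝ) {ε : ℝ} (hε : 0 < ε) : ∃ M, ∀ u φ f, Sol Ω ρ c T Cu Cp Cf u φ f →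
      Est1 Ω ρ T u φ f ε M := by
  obtain ⟨M0, hM0, k0⟩ := E1 hn h hT Cu Cp Cf
  obtain ⟨M1, hM1, k1⟩ := E2 (n := n) (Ω := Ω) (ρ := ρ) (c := c) hT Cu Cp Cf M0
  obtain ⟨A, hA, k3⟩ := E3 hn h hT Cu Cp Cf (M1 / ε)
  set M := 1 + M0 + M1 / ε + A + Real.exp (M1 / ε + Cf) with hM
  have hme : 0 ≤ M1 / ε := by positivity
  have hex := Real.exp_pos (M1 / ε + Cf)
  refine ⟨M, fun u φ f S => ?_⟩
  have hu := k0 u φ f S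
  have hut : ∀ p ∈ Ω ×ˢ Ico ε T, |pd eT u p| ≤ M1 / ε := by
    rintro ⟨z, t⟩ ⟨hz, ht⟩
    simp only at hz ht
    have ht0 : 0 < t := hε.trans_le ht.1
    rw [← S.tdu_pd ⟨hz, ht0, ht.2⟩, le_div_iff₀ hε]
    have := k1 u φ f S hu z (subset_closure hz) t ⟨ht0.le, ht.2⟩
    rw [abs_mul, abs_of_pos ht0] at this
    refine le_trans ?_ this
    rw [mul_comm]
    exact mul_le_mul_of_nonneg_right ht.1 (abs_nonneg _)
  have hQ : ∀ p ∈ Ω ×ˢ Ico ε T, p ∈ Ω ×ˢ Ioo 0 T := fun p hp => ⟨hp.1, hε.trans_le hp.2.1, hp.2.2⟩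
  have hexp : ∀ p ∈ Ω ×ˢ Ico ε T, Real.exp (pd eT u p - fc f u p) ≤ M ∧
      M⁻¹ ≤ Real.exp (pd eT u p - fc f u p) := by
    intro p hp
    have e1 := abs_le.1 (hut p hp)
    have e2 := abs_le.1 (S.fc_bd (hQ p hp))
    constructor
    · have : Real.exp (pd eT u p - fc f u p) ≤ Real.exp (M1 / ε + Cf) :=
        Real.exp_le_exp.2 (by linarith)
      linarith
    · have : Real.exp (-(M1 / ε + Cf)) ≤ Real.exp (pd eT u p - fc f u p) :=
        Real.exp_le_exp.2 (by linarith)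
      refine le_trans ?_ this
      rw [Real.exp_neg]
      exact inv_anti₀ hex (by linarith)
  refine ⟨by linarith, fun p hp => (hu p ⟨hp.1, hp.2.1.le, hp.2.2⟩).trans (by linarith),
    fun p hp => (hut p hp).trans (by linarith), fun p hp D c' hF => ?_, fun p hp => ?_, ?_⟩
  · have e := hF.dlog
    rw [← Real.exp_log hF.dpos, e]
    exact (hexp p hp).1
  · rw [S.det_eq (hQ p hp)]; exact hexp p hp
  · intro z hz t ht v
    have ht' : t ∈ Ioo 0 T := ⟨hε.trans_le ht.1, ht.2⟩
    refine (S.bgrad ht' hA (k3 u φ f S t ht' fun y hy => hut (y, t) ⟨hy, ht⟩) hz v).trans ?_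
    gcongr
    linarith


/-! ### Interior gradient estimate -/

section
variable {Ω : Set (Cn n)} {ρ : Cn n → ℝ} {c T Cu Cp Cf : ℝ} {u φ : Xn n → ℝ} {f : ℝ × Cn n × ℝ → ℝ}

lemma Dom.heat_rho (h : Dom Ω ρ c) {p : Xn n} (hp : p.1 ∈ closure Ω) {D : ℝ} {c' : Fin n × Bool → Cn n}
    (hF : Fr Ω u f p D c') : heat c' (fun q : Xn n => ρ q.1) p ≤ - (2 * c * SS c') := by
  have h1 := hF.rho (fderiv ℝ (fderiv ℝ ρ) p.1) c (h.levi p.1 hp)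
  have hd : Differentiable ℝ ρ := h.sm.differentiable (by simp)
  simp only [heat, pd_space_eT hd, pd2_space_sv h.sm]
  linarith

lemma Sol.D1s (S : Sol Ω ρ c T Cu Cp Cf u φ f) (v : Cn n) :
    Sm (Ω ×ˢ Ioo 0 T) (fun p => D1 Ω u p v) ∧ ContinuousOn (fun p => D1 Ω u p v) (closure Ω ×ˢ Ioo 0 T) ∧
    EqOn (fun p => D1 Ω u p v) (pd (sv v) u) (Ω ×ˢ Ioo 0 T) := by
  have e : EqOn (fun p => D1 Ω u p v) (pd (sv v) u) (Ω ×ˢ Ioo 0 T) := fun p hp => D1_pd S.dom S.us hp v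
  exact ⟨(S.us.pd S.opQ _).congr e, S.ur.c1.clm_apply continuousOn_const, e⟩

end

set_option maxHeartbeats 1600000 in
lemma est2 {Ω : Set (Cn n)} {ρ : Cn n → ℝ} {c T : ℝ} (hn : 0 < n) (h : Dom Ω ρ c) (hT : 0 < T)
    (Cu Cp Cf : ℝ) {ε : ℝ} (hε : 0 < ε) : ∃ M, 1 ≤ M ∧ ∀ u φ f, Sol Ω ρ c T Cu Cp Cf u φ f →
      ∀ p ∈ closure Ω ×ˢ Ico ε T, ‖D1 Ω u p‖ ≤ M := by
  obtain ⟨M, kM⟩ := est1 hn h hT Cu Cp Cf (half_pos hε)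
  obtain ⟨R, hR, hR0, hR1, hR2, hR3, hRb⟩ := h.bds
  have hc := h.cpos
  set δ : ℝ := 1 / (8 * (M ^ 2 + 1)) with hδ
  have hδ0 : 0 < δ := by positivity
  set K : ℝ := c / (2 * R ^ 2) with hK
  have hK0 : 0 < K := by positivity
  set C : ℝ := |Cf| + 2 * δ * (|M| * (|M| + n)) + 4 * |M| * 2 ^ (n - 1) / ((K * c) ^ (n - 1) * δ) with hC
  have hCa : 0 ≤ 2 * δ * (|M| * (|M| + n)) := by positivity
  have hCb : 0 ≤ 4 * |M| * 2 ^ (n - 1) / ((K * c) ^ (n - 1) * δ) := by positivity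
  have hC0 : 0 ≤ C := by positivity
  set B : ℝ := |Cp| + |M| * R with hB
  have hB0 : 0 ≤ B := by positivity
  set Ψ : ℝ := δ * M ^ 2 + K * R with hΨ
  set N := (C * (n + 2 * C * T) ^ n + T ^ n * (B + 1)) * Real.exp (2 * Ψ) with hN
  have hN0 : 0 ≤ N := by positivity
  refine ⟨1 + N / (ε / 2) ^ n, by have : 0 ≤ N / (ε / 2) ^ n := (by positivity); linarith, fun u φ f S => ?_⟩
  have E := kM u φ f S
  have hM1 := E.one
  have hMa : |M| = M := abs_of_nonneg (by linarith)
  have hO := S.opQ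
  have hCf : |Cf| = Cf := abs_of_nonneg (S.Cf_nonneg hT)
  have hCp : |Cp| = Cp := abs_of_nonneg (S.Cp_nonneg hT)
  rintro ⟨z, t⟩ ⟨hz, ht⟩
  simp only at hz ht
  have key : ∀ v : Cn n, ‖v‖ = 1 → D1 Ω u (z, t) v ≤ N / (ε / 2) ^ n := by
    intro v hv
    obtain ⟨ws, wc, we⟩ := S.D1s v
    set ψ : Xn n → ℝ := fun p => δ * (u p * u p) + K * ρ p.1 with hψ
    have hrs : Sm (Ω ×ˢ Ioo 0 T) (fun q : Xn n => ρ q.1) := h.rho_sm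
    have hus := S.us
    have hψs : Sm (Ω ×ˢ Ioo 0 T) ψ := ((hus.mul hus).cmul δ).add (hrs.cmul K)
    have main := S.cut (t1 := ε / 2) (C := C) (B := B) (Ψ := Ψ) hn (half_pos hε) hC0 hB0 hT ws wc hψs
      ?_ ?_ ?_ (fun p c' => δ * Gam c' u u p + K * c * SS c') ?_ z hz t ⟨by linarith [ht.1], ht.2⟩
    · rw [le_div_iff₀ (by positivity), mul_comm]
      rcases le_or_gt (D1 Ω u (z, t) v) 0 with h0 | h0
      · exact (mul_nonpos_of_nonneg_of_nonpos (by positivity) h0).trans hN0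
      · refine le_trans ?_ main
        have : ε / 2 ≤ t - ε / 2 := by linarith [ht.1]
        gcongr
    · exact (continuousOn_const.mul (S.ur.c0.mul S.ur.c0)).add
        (continuousOn_const.mul (h.sm.continuous.comp_continuousOn continuousOn_fst))
    · intro p hp
      have e1 := E.ub p hp
      have e2 := hR0 p.1 hp.1
      have e3 : u p * u p ≤ M ^ 2 := by rw [← sq, ← sq_abs]; gcongr
      have e4 : 0 ≤ u p * u p := mul_self_nonneg _
      have e5 := abs_le.1 e2
      simp only [hψ, hΨ, abs_le]
      constructor
      · have : K * (-R) ≤ K * ρ p.1 := by gcongr; exact e5.1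
        have : 0 ≤ δ * (u p * u p) := by positivity
        have : 0 ≤ δ * M ^ 2 := by positivity
        linarith
      · have := e5.2
        gcongr
    · intro y hy s hs
      have hs' : s ∈ Ioo 0 T := ⟨by linarith [hs.1], hs.2⟩
      have e1 := E.bg y hy s hs v
      have e2 := S.D1phi hT (p := (y, s)) ⟨hy.1, hs'⟩ v
      have e3 : |fderiv ℝ ρ y v| ≤ R := by
        have := (fderiv ℝ ρ y).le_opNorm v
        rw [hv, mul_one, Real.norm_eq_abs] at this
        exact this.trans (hR1 y hy.1)
      rw [hv, mul_one] at e2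
      have e4 : M * |fderiv ℝ ρ y v| ≤ M * R := by gcongr
      have e5 := (abs_le.1 e1).2
      have e6 := (abs_le.1 e2).2
      rw [hB, hMa, hCp]
      linarith
    · intro p hp hpt D c' hF hw
      have hpε : p ∈ Ω ×ˢ Ico (ε / 2) T := ⟨hp.1, hpt, hp.2.2⟩
      have hpc : p ∈ closure Ω ×ˢ Ioo 0 T := ⟨subset_closure hp.1, hp.2⟩
      have hS := SS_nonneg c'
      have hG : 0 ≤ Gam c' u u p := Gam_self_nonneg
      have eu := E.ub p hpc
      have et := E.ut p hpε
      have eD := E.dup p hpε D c' hF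
      have ewp : D1 Ω u p v = pd (sv v) u p := we hp
      refine ⟨?_, ?_, by positivity, ?_⟩
      · rw [heat_eqOn hO we hp, hF.lin]
        obtain ⟨k, k1, k2, k3, -⟩ := S.fc1 hp
        have e1 := (abs_le.1 (k3 (sv v))).2
        simp only [sv, abs_zero, zero_add, hv, mul_one] at e1
        change pd (sv v) (fc f u) p - k * pd (sv v) u p ≤ Cf at e1
        rw [← ewp] at e1
        have e2 : k * D1 Ω u p v ≤ 0 := mul_nonpos_of_nonpos_of_nonneg k1 (by linarith)
        have e3 : C * 1 ≤ C * D1 Ω u p v := by gcongr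
        have : Cf ≤ C := by rw [hC, hCf]; linarith
        linarith
      · have e1 : heat c' ψ p = δ * (2 * (u p * (pd eT u p - n)) - 2 * Gam c' u u p)
            + K * heat c' (fun q : Xn n => ρ q.1) p := by
          rw [hψ, heat_add hO ((hus.mul hus).cmul δ) (hrs.cmul K) hp, heat_cmul hO (hus.mul hus) hp,
            heat_cmul hO hrs hp, heat_mul hO hus hus hp, hF.tr]
          ring
        have e2 := h.heat_rho (subset_closure hp.1) hF
        have e3 : Gam c' ψ ψ p ≤ 8 * δ ^ 2 * (u p) ^ 2 * Gam c' u u p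
            + 2 * K ^ 2 * Gam c' (fun q : Xn n => ρ q.1) (fun q : Xn n => ρ q.1) p := by
          simp only [Gam, Finset.mul_sum, ← Finset.sum_add_distrib]
          refine Finset.sum_le_sum fun i _ => ?_
          rw [hψ, pd_add hO ((hus.mul hus).cmul δ) (hrs.cmul K) hp, pd_cmul hO (hus.mul hus) hp,
            pd_cmul hO hrs hp, pd_mul hO hus hus hp]
          set a := pd (sv (c' i)) u p
          set b := pd (sv (c' i)) (fun q : Xn n => ρ q.1) p
          nlinarith [sq_nonneg (2 * δ * u p * a - K * b)]
        have e4 := (hRb T).1.Gam hp c'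
        have e5 : 8 * δ ^ 2 * (u p) ^ 2 ≤ δ := by
          have : (u p) ^ 2 ≤ M ^ 2 := by rw [← sq_abs]; gcongr
          have h8 : 8 * δ * (M ^ 2 + 1) = 1 := by rw [hδ]; field_simp
          have h9 : 8 * δ * (u p) ^ 2 ≤ 1 := by
            rw [← h8]; gcongr; linarith
          calc 8 * δ ^ 2 * (u p) ^ 2 = δ * (8 * δ * (u p) ^ 2) := by ring
            _ ≤ δ * 1 := by gcongr
            _ = δ := mul_one _
        have e6 : 2 * K ^ 2 * (R ^ 2 * SS c') = K * c * SS c' := by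
          rw [hK]; field_simp
        have e7 : 2 * K ^ 2 * Gam c' (fun q : Xn n => ρ q.1) (fun q : Xn n => ρ q.1) p ≤ K * c * SS c' := by
          rw [← e6]; gcongr
        have e8 : 8 * δ ^ 2 * (u p) ^ 2 * Gam c' u u p ≤ δ * Gam c' u u p := by gcongr
        have e9 : K * heat c' (fun q : Xn n => ρ q.1) p ≤ K * (- (2 * c * SS c')) := by gcongr
        have e10 : u p * (pd eT u p - n) ≤ M * (M + n) := by
          refine (le_abs_self _).trans ?_
          rw [abs_mul]
          have : |pd eT u p - n| ≤ M + n := by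
            refine (abs_sub _ _).trans ?_
            rw [Nat.abs_cast]; linarith
          gcongr
        have e11 : δ * (u p * (pd eT u p - n)) ≤ δ * (M * (M + n)) := by gcongr
        have e12 : 2 * δ * (M * (M + n)) ≤ C := by
          rw [hC, hMa]; rw [hMa] at hCb hCa
          have := abs_nonneg Cf
          linarith
        rw [e1]
        linarith
      · have e1 := hF.gradu v
        rw [hv, one_pow, mul_one, ← ewp] at e1
        have e2 : D1 Ω u p v ≤ D1 Ω u p v ^ 2 := by nlinarith
        set P := δ * Gam c' u u p + K * c * SS c' with hP
        have hKc : 0 < K * c := by positivity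
        have g1 : SS c' ≤ P / (K * c) := by
          rw [le_div_iff₀ hKc]
          have : 0 ≤ δ * Gam c' u u p := by positivity
          linarith
        have g2 : Gam c' u u p ≤ P / δ := by
          rw [le_div_iff₀ hδ0]
          have : 0 ≤ K * c * SS c' := by positivity
          linarith
        have hP0 : 0 ≤ P := by positivity
        have hD := hF.dpos
        calc D1 Ω u p v ≤ 4 * D * (2 * SS c') ^ (n - 1) * Gam c' u u p := e2.trans e1
          _ ≤ 4 * |M| * (2 * (P / (K * c))) ^ (n - 1) * (P / δ) := by rw [hMa]; gcongr
          _ = 4 * |M| * 2 ^ (n - 1) / ((K * c) ^ (n - 1) * δ) * P ^ n := by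
            obtain ⟨k, rfl⟩ : ∃ k, n = k + 1 := ⟨n - 1, by omega⟩
            rw [Nat.add_sub_cancel, mul_pow, div_pow, pow_succ]
            field_simp
          _ ≤ C * P ^ n := by
            gcongr
            rw [hC]; have := abs_nonneg Cf; linarith
  refine ContinuousLinearMap.opNorm_le_bound _ (by positivity) fun x => ?_
  rcases eq_or_ne x 0 with rfl | hx
  · simp
  have hx0 : 0 < ‖x‖ := norm_pos_iff.2 hx
  have hk : ∀ y : Cn n, ‖y‖ = ‖x‖ → D1 Ω u (z, t) y ≤ (1 + N / (ε / 2) ^ n) * ‖x‖ := by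
    intro y hy
    have := key (‖x‖⁻¹ • y) (by rw [norm_smul, norm_inv, norm_norm, hy]; field_simp)
    rw [map_smul, smul_eq_mul, inv_mul_le_iff₀ hx0] at this
    linarith
  rw [Real.norm_eq_abs, abs_le']
  refine ⟨hk x rfl, ?_⟩
  have := hk (-x) (norm_neg x)
  rwa [map_neg] at this


/-! ### Boundary geometry and the barrier lemma -/

section
variable {Ω : Set (Cn n)} {ρ : Cn n → ℝ} {c T Cu Cp Cf : ℝ} {u φ : Xn n → ℝ} {f : ℝ × Cn n × ℝ → ℝ}

lemma nu_exists (L : Cn n →L[ℝ] ℝ) : ∃ ν : Cn n, L (I • ν) = 0 ∧ L ν = ‖ν‖ ^ 2 ∧ ∀ x, |L x| ≤ ‖ν‖ * ‖x‖ := by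
  set g : Fin n → ℂ := fun α => (L (cvec n α 1) : ℂ) + (L (cvec n α I) : ℂ) * I with hg
  set ν : Cn n := WithLp.toLp 2 g with hν
  have hL : ∀ x : Cn n, L x = ∑ α, ((x α).re * (g α).re + (x α).im * (g α).im) := by
    intro x
    conv_lhs => rw [sum_cvec x]
    rw [map_sum]
    refine Finset.sum_congr rfl fun α _ => ?_
    have : x α • cvec n α 1 = (x α).re • cvec n α 1 + (x α).im • cvec n α I := by
      ext β
      by_cases hb : β = α
      · subst hb
        simp [cvec]
      · simp [cvec, hb]
    rw [this, map_add, map_smul, map_smul]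
    simp [hg]
  have hνn : ‖ν‖ ^ 2 = ∑ α, ((g α).re * (g α).re + (g α).im * (g α).im) := by
    rw [EuclideanSpace.norm_sq_eq]
    refine Finset.sum_congr rfl fun α _ => ?_
    rw [← Complex.normSq_eq_norm_sq, Complex.normSq_apply]
  refine ⟨ν, ?_, ?_, fun x => ?_⟩
  · rw [hL]
    refine Finset.sum_eq_zero fun α _ => ?_
    simp [hν]; ring
  · rw [hL, hνn]
  · have h1 : L x = (inner ℂ x ν).re := by
      rw [hL, PiLp.inner_apply, Complex.re_sum]
      refine Finset.sum_congr rfl fun α _ => ?_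
      simp [hν, Complex.mul_re]; ring
    rw [h1, mul_comm]
    exact (Complex.abs_re_le_norm _).trans (norm_inner_le_norm x ν)

lemma Dom.nu (h : Dom Ω ρ c) : ∃ b N : ℝ, 0 < b ∧ 1 ≤ N ∧ ∀ z ∈ frontier Ω, ∃ ν : Cn n, ‖ν‖ ≤ N ∧
    fderiv ℝ ρ z (I • ν) = 0 ∧ b ≤ fderiv ℝ ρ z ν := by
  have hcomp : IsCompact (frontier Ω) :=
    h.bd.isCompact_closure.of_isClosed_subset isClosed_frontier frontier_subset_closure
  rcases (frontier Ω).eq_empty_or_nonempty with he | hne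
  · exact ⟨1, 1, one_pos, le_rfl, fun z hz => by rw [he] at hz; exact hz.elim⟩
  have hcont : ContinuousOn (fun z => ‖fderiv ℝ ρ z‖) (frontier Ω) := h.cont_fd.norm.continuousOn
  obtain ⟨z0, hz0, hmin⟩ := hcomp.exists_isMinOn hne hcont
  obtain ⟨z1, hz1, hmax⟩ := hcomp.exists_isMaxOn hne hcont
  have hm0 : 0 < ‖fderiv ℝ ρ z0‖ := norm_pos_iff.2 (h.grad z0 hz0)
  refine ⟨‖fderiv ℝ ρ z0‖ ^ 2, 1 + ‖fderiv ℝ ρ z1‖, by positivity, by linarith [norm_nonneg (fderiv ℝ ρ z1)],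
    fun z hz => ?_⟩
  obtain ⟨ν, h1, h2, h3⟩ := nu_exists (fderiv ℝ ρ z)
  have e1 : ‖fderiv ℝ ρ z‖ ≤ ‖ν‖ := ContinuousLinearMap.opNorm_le_bound _ (norm_nonneg _) h3
  have e2 : ‖fderiv ℝ ρ z0‖ ≤ ‖fderiv ℝ ρ z‖ := hmin hz
  have e3 : ‖fderiv ℝ ρ z‖ ≤ ‖fderiv ℝ ρ z1‖ := hmax hz
  refine ⟨ν, ?_, h1, ?_⟩
  · have e4 := (le_abs_self _).trans ((fderiv ℝ ρ z).le_opNorm ν)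
    rw [h2] at e4
    rcases (norm_nonneg ν).eq_or_lt with h0 | h0
    · rw [← h0]; positivity
    · have : ‖ν‖ ≤ ‖fderiv ℝ ρ z‖ := by
        refine le_of_mul_le_mul_right ?_ h0
        rw [← sq]; exact e4
      linarith
  · rw [h2]; gcongr; exact e2.trans e1

lemma Dom.lip (h : Dom Ω ρ c) : ∃ K, 0 ≤ K ∧ (∀ z ∈ closure Ω, ∀ y ∈ closure Ω, ∀ v,
      |fderiv ℝ ρ z v - fderiv ℝ ρ y v| ≤ K * ‖v‖ * ‖z - y‖) ∧
    (∀ z ∈ closure Ω, ∀ y ∈ closure Ω, ∀ v w,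
      |fderiv ℝ (fderiv ℝ ρ) z v w - fderiv ℝ (fderiv ℝ ρ) y v w| ≤ K * (‖v‖ * ‖w‖) * ‖z - y‖) := by
  obtain ⟨r, hr⟩ := h.bd.closure.subset_closedBall (0 : Cn n)
  have hs1 : ContDiff ℝ ((⊤ : ℕ∞) : WithTop ℕ∞) (fderiv ℝ ρ) := h.sm.fderiv_right (by simp)
  have hs2 : ContDiff ℝ ((⊤ : ℕ∞) : WithTop ℕ∞) (fderiv ℝ (fderiv ℝ ρ)) := hs1.fderiv_right (by simp)
  have hs3 : ContDiff ℝ ((⊤ : ℕ∞) : WithTop ℕ∞) (fderiv ℝ (fderiv ℝ (fderiv ℝ ρ))) := hs2.fderiv_right (by simp)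
  obtain ⟨A, hA⟩ := (isCompact_closedBall (0 : Cn n) r).exists_bound_of_continuousOn hs2.continuous.continuousOn
  obtain ⟨B, hB⟩ := (isCompact_closedBall (0 : Cn n) r).exists_bound_of_continuousOn hs3.continuous.continuousOn
  have l1 : ∀ z ∈ closure Ω, ∀ y ∈ closure Ω, ‖fderiv ℝ ρ z - fderiv ℝ ρ y‖ ≤ A * ‖z - y‖ := fun z hz y hy =>
    (convex_closedBall (0 : Cn n) r).norm_image_sub_le_of_norm_fderiv_le (𝕜 := ℝ)
      (fun x _ => hs1.differentiable (by simp) x) hA (hr hy) (hr hz)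
  have l2 : ∀ z ∈ closure Ω, ∀ y ∈ closure Ω,
      ‖fderiv ℝ (fderiv ℝ ρ) z - fderiv ℝ (fderiv ℝ ρ) y‖ ≤ B * ‖z - y‖ := fun z hz y hy =>
    (convex_closedBall (0 : Cn n) r).norm_image_sub_le_of_norm_fderiv_le (𝕜 := ℝ)
      (fun x _ => hs2.differentiable (by simp) x) hB (hr hy) (hr hz)
  refine ⟨|A| + |B|, by positivity, fun z hz y hy v => ?_, fun z hz y hy v w => ?_⟩
  · have := (fderiv ℝ ρ z - fderiv ℝ ρ y).le_opNorm v
    rw [Real.norm_eq_abs] at this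
    calc _ ≤ _ := this
      _ ≤ (A * ‖z - y‖) * ‖v‖ := by gcongr; exact l1 z hz y hy
      _ ≤ ((|A| + |B|) * ‖z - y‖) * ‖v‖ := by
        gcongr; exact (le_abs_self A).trans (by linarith [abs_nonneg B])
      _ = _ := by ring
  · have := (fderiv ℝ (fderiv ℝ ρ) z - fderiv ℝ (fderiv ℝ ρ) y).le_opNorm₂ v w
    rw [Real.norm_eq_abs] at this
    calc _ ≤ _ := this
      _ ≤ (B * ‖z - y‖) * ‖v‖ * ‖w‖ := by gcongr; exact l2 z hz y hy
      _ ≤ ((|A| + |B|) * ‖z - y‖) * ‖v‖ * ‖w‖ := by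
        gcongr; exact (le_abs_self B).trans (by linarith [abs_nonneg A])
      _ = _ := by ring

/-- tangential derivatives of functions vanishing on the boundary -/
lemma Dom.tan (h : Dom Ω ρ c) {G : Cn n → ℝ} {L : Cn n →L[ℝ] ℝ} {z v : Cn n} (hz : z ∈ frontier Ω)
    (hG : HasFDerivWithinAt G L (closure Ω) z) (h0 : ∀ y ∈ frontier Ω, G y = 0)
    (hv : fderiv ℝ ρ z v = 0) : L v = 0 := by
  obtain ⟨ν, hν⟩ : ∃ ν, 0 < fderiv ℝ ρ z ν := by
    obtain ⟨b, N, hb, -, hN⟩ := h.nu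
    obtain ⟨ν, -, -, h3⟩ := hN z hz
    exact ⟨ν, hb.trans_le h3⟩
  have hη : ∀ η : ℝ, 0 < η → |L v| ≤ η * (|L ν| + 2 * (‖v‖ + ‖ν‖)) ∨ 1 < η := by
    intro η hη
    by_cases h1 : η ≤ 1
    swap
    · exact Or.inr (not_le.1 h1)
    left
    have hin := h.inw_frontier hz (v := v - η • ν) (by
      rw [map_sub, map_smul, hv, smul_eq_mul]; nlinarith)
    obtain ⟨r, hr, hi⟩ := hin
    have hout : ∀ᶠ s in 𝓝[>] (0 : ℝ), 0 < ρ (z + s • (v + η • ν)) := by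
      have hd : HasDerivAt (fun s : ℝ => ρ (z + s • (v + η • ν))) (fderiv ℝ ρ z (v + η • ν)) 0 := by
        have h1 : HasDerivAt (fun s : ℝ => z + s • (v + η • ν)) (v + η • ν) 0 := by
          simpa using ((hasDerivAt_id (0 : ℝ)).smul_const (v + η • ν)).const_add z
        have h2 : HasFDerivAt ρ (fderiv ℝ ρ z) (z + (0 : ℝ) • (v + η • ν)) := by
          simpa using (h.sm.differentiable (by simp) z).hasFDerivAt
        exact h2.comp_hasDerivAt 0 h1
      have hpos : 0 < fderiv ℝ ρ z (v + η • ν) := by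
        rw [map_add, map_smul, hv, smul_eq_mul]; nlinarith
      have h3 := (hasDerivWithinAt_iff_tendsto_slope' (by simp)).1 (hd.hasDerivWithinAt (s := Ioi 0))
      filter_upwards [h3.eventually (lt_mem_nhds hpos), self_mem_nhdsWithin] with s hs hs0
      have hs0 : 0 < s := hs0
      rw [slope_def_field] at hs
      simp only [zero_smul, add_zero, h.zero z hz, sub_zero] at hs
      rcases div_pos_iff.1 hs with h4 | h4
      · exact h4.1
      · linarith [h4.2]
    have hlo := hG.isLittleO.def hη
    obtain ⟨δ, hδ, hball⟩ := Metric.mem_nhdsWithin_iff.1 hlo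
    have hV : 0 < ‖v‖ + ‖ν‖ + 1 := by positivity
    have ev1 : ∀ᶠ s in 𝓝[>] (0 : ℝ), s ∈ Ioo 0 r := Ioo_mem_nhdsGT hr
    have ev2 : ∀ᶠ s in 𝓝[>] (0 : ℝ), s ∈ Ioo 0 (δ / (‖v‖ + ‖ν‖ + 1)) := Ioo_mem_nhdsGT (div_pos hδ hV)
    obtain ⟨s, ⟨hs1, hs2, hs3⟩⟩ := (hout.and (ev1.and ev2)).exists
    have hx1 := hi z hz.1 (by simpa using hr) s hs2
    have hx2 : z + s • (v + η • ν) ∉ Ω := fun hc => by linarith [h.neg _ hc]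
    obtain ⟨y, hy1, hy2⟩ : ∃ y ∈ segment ℝ (z + s • (v - η • ν)) (z + s • (v + η • ν)), y ∈ frontier Ω := by
      by_contra hcon
      push Not at hcon
      have hpre := (convex_segment (𝕜 := ℝ) (z + s • (v - η • ν)) (z + s • (v + η • ν))).isPreconnected
      obtain ⟨y, -, hy1, hy2⟩ := hpre Ω (closure Ω)ᶜ h.op isClosed_closure.isOpen_compl
        (fun y hy => by
          by_cases hyc : y ∈ closure Ω
          · left
            by_contra hyo
            exact hcon y hy (by rw [h.op.frontier_eq]; exact ⟨hyc, hyo⟩)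
          · exact Or.inr hyc)
        ⟨_, left_mem_segment _ _ _, hx1⟩
        ⟨_, right_mem_segment _ _ _, fun hc => hx2 (by
          by_contra hyo
          exact hcon _ (right_mem_segment _ _ _) (by rw [h.op.frontier_eq]; exact ⟨hc, hyo⟩))⟩
      exact hy2 (subset_closure hy1)
    obtain ⟨a, b, ha, hb, hab, rfl⟩ := hy1
    set τ := (b - a) * η with hτ
    have hy : a • (z + s • (v - η • ν)) + b • (z + s • (v + η • ν)) = z + s • (v + τ • ν) := by
      have hz1 : z = (a + b) • z := by rw [hab, one_smul]
      have hv1 : v = (a + b) • v := by rw [hab, one_smul]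
      conv_rhs => rw [hz1, hv1, hτ]
      module
    rw [hy] at hy2
    have hτ1 : |τ| ≤ η := by
      rw [hτ, abs_mul, abs_of_pos hη]
      have : |b - a| ≤ 1 := abs_le.2 ⟨by linarith, by linarith⟩
      nlinarith
    have hs0 : 0 < s := hs2.1
    have hnv : ‖v + τ • ν‖ ≤ ‖v‖ + ‖ν‖ := by
      refine (norm_add_le _ _).trans ?_
      rw [norm_smul, Real.norm_eq_abs]
      have : |τ| * ‖ν‖ ≤ 1 * ‖ν‖ := by gcongr; linarith
      linarith
    have hmem : z + s • (v + τ • ν) ∈ ball z δ ∩ closure Ω := by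
      refine ⟨?_, hy2.1⟩
      rw [mem_ball, dist_eq_norm, add_sub_cancel_left, norm_smul, Real.norm_eq_abs, abs_of_pos hs0]
      have h5 := hs3.2
      rw [lt_div_iff₀ hV] at h5
      nlinarith
    have h6 := hball hmem
    simp only [mem_ofPred_eq, h0 _ hy2, h0 z hz, add_sub_cancel_left, sub_zero, zero_sub,
      map_smul, norm_smul, smul_eq_mul, Real.norm_eq_abs, abs_of_pos hs0, abs_neg, abs_mul] at h6
    have h7 : |L (v + τ • ν)| ≤ η * ‖v + τ • ν‖ := by
      refine le_of_mul_le_mul_left ?_ hs0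
      linarith
    rw [map_add, map_smul, smul_eq_mul] at h7
    have h8 : |L v| ≤ |L v + τ * L ν| + |τ * L ν| := by
      have := abs_sub (L v + τ * L ν) (τ * L ν)
      simpa using this
    rw [abs_mul] at h8
    have h9 : |τ| * |L ν| ≤ η * |L ν| := by gcongr
    have h10 : η * ‖v + τ • ν‖ ≤ η * (2 * (‖v‖ + ‖ν‖)) := by
      gcongr; linarith [norm_nonneg v, norm_nonneg ν]
    linarith
  by_contra hne
  have hpos : 0 < |L v| := abs_pos.2 hne
  set X := |L ν| + 2 * (‖v‖ + ‖ν‖) with hX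
  have hX0 : 0 ≤ X := by positivity
  rcases hη (min 1 (|L v| / (2 * (X + 1)))) (by positivity) with h1 | h1
  · have h2 : min 1 (|L v| / (2 * (X + 1))) * X ≤ |L v| / (2 * (X + 1)) * X := by gcongr; exact min_le_right _ _
    have h3 : |L v| / (2 * (X + 1)) * X < |L v| := by
      rw [div_mul_eq_mul_div, div_lt_iff₀ (by positivity)]
      nlinarith
    linarith
  · exact absurd (min_le_left _ _) (not_le.2 h1)

end

/-- The barrier lemma. -/
lemma barrier {Ω : Set (Cn n)} {ρ : Cn n → ℝ} {c T : ℝ} (hn : 0 < n) (h : Dom Ω ρ c) (hT : 0 < T)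
    {C M : ℝ} (hC : 0 ≤ C) (hM : 1 ≤ M) : ∃ A, 0 ≤ A ∧ ∀ (Cu Cp Cf : ℝ) (u φ : Xn n → ℝ) (f : ℝ × Cn n × ℝ → ℝ),
      Sol Ω ρ c T Cu Cp Cf u φ f → ∀ (t1 t0 : ℝ), 0 < t1 → t1 < t0 → t0 < T →
      (∀ p ∈ Ω ×ˢ Ico t1 T, ∀ D c', Fr Ω u f p D c' → D ≤ M) →
      ∀ z0 ∈ frontier Ω, ∀ W : Xn n → ℝ, Sm (Ω ×ˢ Ioo 0 T) W →
      ContinuousOn W (closure Ω ×ˢ Ioo 0 T) →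
      (∀ p ∈ Ω ×ˢ Ioo 0 T, t1 ≤ p.2 → ∀ D c', Fr Ω u f p D c' → heat c' W p ≤ C * (1 + SS c') ∧ W p ≤ C) →
      (∀ z ∈ frontier Ω, ∀ t ∈ Icc t1 t0, W (z, t) ≤ C * ‖z - z0‖ ^ 2) →
      W (z0, t0) = 0 → ∀ L : Cn n →L[ℝ] ℝ, HasFDerivWithinAt (fun x => W (x, t0)) L (closure Ω) z0 →
      ∀ ν, 0 < fderiv ℝ ρ z0 ν → (t0 - t1) * (- L ν) ≤ A * ‖ν‖ := by
  obtain ⟨R, hR, hR0, hR1, hR2, hR3, hRb⟩ := h.bds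
  have hc := h.cpos
  set X := C + T * C + C * T * R with hX
  have hX0 : 0 ≤ X := by positivity
  set A := (X * (2 * M) + X) / (2 * c) + 1 with hA
  have hA0 : 0 ≤ A := by positivity
  refine ⟨A * R, by positivity, fun Cu Cp Cf u φ f S t1 t0 h1 h2 h3 hD z0 hz0 W hWs hWc hWh hWb hW0 L hL ν hν => ?_⟩
  have hO := S.opQ
  have hrs : Sm (Ω ×ˢ Ioo 0 T) (fun q : Xn n => ρ q.1) := h.rho_sm
  have hqs := ((hRb T).2.2.2 z0 hz0.1).sm
  have hq : ContDiff ℝ ((⊤ : ℕ∞) : WithTop ℕ∞) (fun s : ℝ => s - t1) := contDiff_id.sub contDiff_const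
  have hqd : Differentiable ℝ (fun s : ℝ => s - t1) := hq.differentiable (by simp)
  have hts : Sm (Ω ×ˢ Ioo 0 T) (fun p : Xn n => p.2 - t1) := Sm.time hq
  have hsub : Icc t1 t0 ⊆ Ioo 0 T := fun s hs => ⟨h1.trans_le hs.1, hs.2.trans_lt h3⟩
  have main := S.hmax (t1 := t1) (t2 := t0) h1.le h3 (M := 0)
    (F := fun p => ((p.2 - t1) * W p + A * ρ p.1) - C * T * ‖p.1 - z0‖ ^ 2)
    (((hts.mul hWs).add (hrs.cmul A)).sub (hqs.cmul (C * T))) ?_ ?_ ?_ ?_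
  · have hρd : HasFDerivWithinAt ρ (fderiv ℝ ρ z0) (closure Ω) z0 :=
      (S.dom.sm.differentiable (by simp) z0).hasFDerivAt.hasFDerivWithinAt
    have hi := h.inw_frontier hz0 (v := -ν) (by rw [map_neg]; linarith)
    have l1 := (inw_deriv hz0.1 hL hi).const_mul (t0 - t1)
    have l2 := (inw_deriv hz0.1 hρd hi).const_mul (-A)
    have l3 : Tendsto (fun s : ℝ => C * T * (s * ‖ν‖ ^ 2)) (𝓝[>] 0) (𝓝 0) := by
      have : Continuous (fun s : ℝ => C * T * (s * ‖ν‖ ^ 2)) := by fun_prop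
      simpa using (this.tendsto 0).mono_left nhdsWithin_le_nhds
    have l4 := le_of_tendsto_of_tendsto l1 (l2.add l3) ?_
    · rw [map_neg, map_neg, add_zero] at l4
      have e1 := (le_abs_self _).trans ((fderiv ℝ ρ z0).le_opNorm ν)
      have e2 : ‖fderiv ℝ ρ z0‖ * ‖ν‖ ≤ R * ‖ν‖ := by gcongr; exact hR1 z0 hz0.1
      have e3 : A * fderiv ℝ ρ z0 ν ≤ A * (R * ‖ν‖) := by gcongr; exact e1.trans e2
      linarith
    · obtain ⟨r, hr, hi⟩ := hi
      filter_upwards [Ioo_mem_nhdsGT hr] with s hs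
      have hm := subset_closure (hi z0 hz0.1 (by simpa using hr) s hs)
      have e := main _ hm t0 ⟨h2.le, le_rfl⟩
      have hs0 := hs.1
      simp only [add_sub_cancel_left, norm_smul, norm_neg, Real.norm_eq_abs, abs_of_pos hs0, mul_pow] at e
      rw [hW0, h.zero z0 hz0, sub_zero, sub_zero, ← mul_div_assoc, ← mul_div_assoc, div_add' _ _ _ hs0.ne',
        div_le_div_iff_of_pos_right hs0]
      linarith
  · refine ((ContinuousOn.mul (by fun_prop) (hWc.mono (prod_mono_right hsub))).add
      (continuousOn_const.mul (h.sm.continuous.comp_continuousOn continuousOn_fst))).sub ?_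
    fun_prop
  · intro z hz t ht
    simp only [h.zero z hz, mul_zero, add_zero]
    have e1 := hWb z hz t ht
    have e2 : (t - t1) * W (z, t) ≤ (t - t1) * (C * ‖z - z0‖ ^ 2) :=
      mul_le_mul_of_nonneg_left e1 (sub_nonneg.2 ht.1)
    have e3 : (t - t1) * (C * ‖z - z0‖ ^ 2) ≤ T * (C * ‖z - z0‖ ^ 2) := by
      gcongr; linarith [ht.2]
    linarith
  · intro z hz
    simp only [sub_self, zero_mul, zero_add]
    have e1 := h.le hz
    have : A * ρ z ≤ 0 := mul_nonpos_of_nonneg_of_nonpos hA0 e1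
    have : 0 ≤ C * T * ‖z - z0‖ ^ 2 := by positivity
    linarith
  · intro p hp hpt D c' hF hg hh
    exfalso
    obtain ⟨k1, k2⟩ := hWh p hp hpt.1.le D c' hF
    have hΓ : Gam c' (fun p : Xn n => p.2 - t1) W p = 0 := by
      simp [Gam, pd_time_sv hqd]
    rw [heat_sub hO ((hts.mul hWs).add (hrs.cmul A)) (hqs.cmul (C * T)) hp,
      heat_add hO (hts.mul hWs) (hrs.cmul A) hp, heat_cmul hO hrs hp, heat_cmul hO hqs hp,
      heat_mul hO hts hWs hp, hΓ, heat_time hqd] at hh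
    have hder : deriv (fun s : ℝ => s - t1) p.2 = 1 := by simp
    rw [hder] at hh
    have e1 := h.heat_rho (subset_closure hp.1) hF
    have e2 := (abs_le.1 (((hRb T).2.2.2 z0 hz0.1).heat hp c')).1
    have hS := SS_nonneg c'
    have e3 : (p.2 - t1) * heat c' W p ≤ T * (C * (1 + SS c')) := by
      calc _ ≤ (p.2 - t1) * (C * (1 + SS c')) := mul_le_mul_of_nonneg_left k1 (sub_nonneg.2 hpt.1.le)
        _ ≤ _ := by gcongr; linarith [hp.2.2]
    have e4 : A * heat c' (fun q : Xn n => ρ q.1) p ≤ A * (-(2 * c * SS c')) := by gcongr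
    have e5 : C * T * (-(R * (1 + SS c'))) ≤ C * T * heat c' (fun p : Xn n => ‖p.1 - z0‖ ^ 2) p := by gcongr
    have e6 := hF.Slow M hM (hD p ⟨hp.1, hpt.1.le, hp.2.2⟩ D c' hF) hn
    have e7 : A * (2 * c * SS c') = (X * (2 * M) + X) * SS c' + 2 * c * SS c' := by
      rw [hA]; field_simp
    have e8 : 1 ≤ 2 * M * SS c' := by
      rw [div_le_iff₀ (by positivity)] at e6; linarith
    have e9 : X * 1 ≤ X * (2 * M * SS c') := by gcongr
    have e10 : 0 < SS c' := by
      by_contra hcon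
      have : SS c' = 0 := by linarith
      rw [this] at e8; linarith
    have e11 : 0 < 2 * c * SS c' := by positivity
    have e12 : 0 ≤ C * SS c' := by positivity
    have e13 : X * SS c' = C * SS c' + T * C * SS c' + C * T * R * SS c' := by rw [hX]; ring
    have e14 : X = C + T * C + C * T * R := hX
    linarith


/-! ### Boundary second derivatives: tangential and mixed -/

/-- directional derivative of `u - φ` up to the boundary -/
def gw (Ω : Set (Cn n)) (u φ : Xn n → ℝ) (v : Cn n) (p : Xn n) : ℝ := D1 Ω u p v - D1 Ω φ p v

/-- Second derivative of `u - φ` -/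
def hw (Ω : Set (Cn n)) (u φ : Xn n → ℝ) (p : Xn n) (y v : Cn n) : ℝ := D2 Ω u p y v - D2 Ω φ p y v

structure Est2 (Ω : Set (Cn n)) (ρ : Cn n → ℝ) (T : ℝ) (u φ : Xn n → ℝ) (f : ℝ × Cn n × ℝ → ℝ)
    (ε M : ℝ) : Prop where
  e1 : Est1 Ω ρ T u φ f ε M
  gr : ∀ p ∈ closure Ω ×ˢ Ico ε T, ‖D1 Ω u p‖ ≤ M

lemma est12 {Ω : Set (Cn n)} {ρ : Cn n → ℝ} {c T : ℝ} (hn : 0 < n) (h : Dom Ω ρ c) (hT : 0 < T)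
    (Cu Cp Cf : ℝ) {ε : ℝ} (hε : 0 < ε) : ∃ M, 1 ≤ M ∧ ∀ u φ f, Sol Ω ρ c T Cu Cp Cf u φ f →
      Est2 Ω ρ T u φ f ε M := by
  obtain ⟨M1, k1⟩ := est1 hn h hT Cu Cp Cf hε
  obtain ⟨M2, h2, k2⟩ := est2 hn h hT Cu Cp Cf hε
  refine ⟨|M1| + M2, by linarith [abs_nonneg M1], fun u φ f S => ?_⟩
  have E := k1 u φ f S
  have hM := E.one
  have hle : M1 ≤ |M1| + M2 := by linarith [le_abs_self M1]
  refine ⟨⟨by linarith, fun p hp => (E.ub p hp).trans hle, fun p hp => (E.ut p hp).trans hle,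
    fun p hp D c' hF => (E.dup p hp D c' hF).trans hle, fun p hp => ⟨(E.det p hp).1.trans hle, ?_⟩,
    fun z hz t ht v => (E.bg z hz t ht v).trans (by gcongr)⟩,
    fun p hp => (k2 u φ f S p hp).trans (by linarith [abs_nonneg M1])⟩
  refine le_trans ?_ (E.det p hp).2
  gcongr

section
variable {Ω : Set (Cn n)} {ρ : Cn n → ℝ} {c T Cu Cp Cf ε M : ℝ} {u φ : Xn n → ℝ} {f : ℝ × Cn n × ℝ → ℝ}

lemma gw_add (v w : Cn n) (p : Xn n) : gw Ω u φ (v + w) p = gw Ω u φ v p + gw Ω u φ w p := by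
  simp only [gw, map_add]; ring

lemma gw_smul (r : ℝ) (v : Cn n) (p : Xn n) : gw Ω u φ (r • v) p = r * gw Ω u φ v p := by
  simp only [gw, map_smul, smul_eq_mul]; ring

lemma Sol.gws (S : Sol Ω ρ c T Cu Cp Cf u φ f) (v : Cn n) :
    Sm (Ω ×ˢ Ioo 0 T) (gw Ω u φ v) ∧ ContinuousOn (gw Ω u φ v) (closure Ω ×ˢ Ioo 0 T) ∧
    EqOn (gw Ω u φ v) (fun p => pd (sv v) u p - pd (sv v) φ p) (Ω ×ˢ Ioo 0 T) := by
  have e : EqOn (gw Ω u φ v) (fun p => pd (sv v) u p - pd (sv v) φ p) (Ω ×ˢ Ioo 0 T) := fun p hp => by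
    rw [gw, D1_pd S.dom S.us hp v, D1_pd S.dom S.φQ hp v]
  exact ⟨((S.us.pd S.opQ _).sub (S.φQ.pd S.opQ _)).congr e,
    (S.ur.c1.clm_apply continuousOn_const).sub (S.φR.c1.clm_apply continuousOn_const), e⟩

lemma Sol.gw_has (S : Sol Ω ρ c T Cu Cp Cf u φ f) {z : Cn n} {t : ℝ} (hz : z ∈ closure Ω)
    (ht : t ∈ Ioo 0 T) (v : Cn n) : ∃ L : Cn n →L[ℝ] ℝ, (∀ y, L y = hw Ω u φ (z, t) y v) ∧
      HasFDerivWithinAt (fun x => gw Ω u φ v (x, t)) L (closure Ω) z :=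
  ⟨_, fun y => by simp [hw], (sd2_has S.dom (S.ur.d t ht) hz v).sub (sd2_has S.dom (S.φR.d t ht) hz v)⟩

lemma Dom.rho_has (h : Dom Ω ρ c) (z v : Cn n) : ∃ L : Cn n →L[ℝ] ℝ,
    (∀ y, L y = fderiv ℝ (fderiv ℝ ρ) z y v) ∧
      HasFDerivWithinAt (fun x => fderiv ℝ ρ x v) L (closure Ω) z := by
  have h2 : ContDiff ℝ ((⊤ : ℕ∞) : WithTop ℕ∞) (fderiv ℝ ρ) := h.sm.fderiv_right (by simp)
  have h3 := (h2.differentiable (by simp) z).hasFDerivAt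
  exact ⟨_, fun y => by simp,
    ((ContinuousLinearMap.apply ℝ ℝ v).hasFDerivAt.comp z h3).hasFDerivWithinAt⟩

lemma Sol.gw_bd (S : Sol Ω ρ c T Cu Cp Cf u φ f) (hT : 0 < T) (hε : 0 < ε) (E : Est2 Ω ρ T u φ f ε M) {p : Xn n}
    (hp : p ∈ closure Ω ×ˢ Ico ε T) (v : Cn n) : |gw Ω u φ v p| ≤ (M + Cp) * ‖v‖ := by
  have h1 := S.D1phi hT (p := p) ⟨hp.1, hε.trans_le hp.2.1, hp.2.2⟩ v
  have h2 := (D1 Ω u p).le_of_opNorm_le (E.gr p hp) v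
  rw [Real.norm_eq_abs] at h2
  rw [gw, add_mul]
  exact (abs_sub _ _).trans (add_le_add h2 h1)

/-- linear heat bound for the directional derivatives of `u - φ` -/
lemma Sol.gw_heat (S : Sol Ω ρ c T Cu Cp Cf u φ f) (hT : 0 < T) (hε : 0 < ε) (E : Est2 Ω ρ T u φ f ε M) {p : Xn n}
    (hp : p ∈ Ω ×ˢ Ioo 0 T) (hp2 : ε ≤ p.2) {D : ℝ} {c' : Fin n × Bool → Cn n} (hF : Fr Ω u f p D c') (v : Cn n) :
    |heat c' (gw Ω u φ v) p| ≤ (Cf * (1 + M) + Cp) * ‖v‖ * (1 + SS c') := by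
  have hO := S.opQ
  have hM := E.e1.one
  have hCf := S.Cf_nonneg hT
  rw [heat_eqOn hO (S.gws v).2.2 hp, heat_sub hO (S.us.pd hO _) (S.φQ.pd hO _) hp, hF.lin]
  have h1 := (S.phi1 hT v).heat hp c'
  obtain ⟨k, hk0, hk, hk1, -⟩ := S.fc1 hp
  have h2 := hk1 (sv v)
  simp only [sv, abs_zero, zero_add] at h2
  have h3 : |pd (v, 0) u p| ≤ M * ‖v‖ := by
    have := (D1 Ω u p).le_of_opNorm_le (E.gr p ⟨subset_closure hp.1, hp2, hp.2.2⟩) v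
    rwa [Real.norm_eq_abs, D1_pd S.dom S.us hp v] at this
  have h4 : |k * pd (v, 0) u p| ≤ Cf * (M * ‖v‖) := by
    rw [abs_mul]; exact mul_le_mul hk h3 (abs_nonneg _) hCf
  have h5 : |pd (v, 0) (fc f u) p| ≤ Cf * (1 + M) * ‖v‖ := by
    have := abs_add_le (pd (v, 0) (fc f u) p - k * pd (v, 0) u p) (k * pd (v, 0) u p)
    rw [sub_add_cancel] at this
    linarith
  have hS := SS_nonneg c'
  have h6 : Cf * (1 + M) * ‖v‖ ≤ Cf * (1 + M) * ‖v‖ * (1 + SS c') :=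
    le_mul_of_one_le_right (by positivity) (by linarith)
  refine (abs_sub _ _).trans ?_
  have : |pd (sv v) (fc f u) p| ≤ Cf * (1 + M) * ‖v‖ := h5
  linarith

lemma Est2.gw_tan (E : Est2 Ω ρ T u φ f ε M) {z : Cn n} (hz : z ∈ frontier Ω) {t : ℝ} (ht : t ∈ Ico ε T)
    {v : Cn n} (hv : fderiv ℝ ρ z v = 0) : gw Ω u φ v (z, t) = 0 := by
  have := E.e1.bg z hz t ht v
  rw [hv, abs_zero, mul_zero] at this
  exact abs_nonpos_iff.1 this

lemma Est2.gw_T (E : Est2 Ω ρ T u φ f ε M) {z : Cn n} (hz : z ∈ frontier Ω) {t : ℝ} (ht : t ∈ Ico ε T)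
    (v y : Cn n) : fderiv ℝ ρ z y * gw Ω u φ v (z, t) - fderiv ℝ ρ z v * gw Ω u φ y (z, t) = 0 := by
  have := E.gw_tan hz ht (v := fderiv ℝ ρ z y • v + (-(fderiv ℝ ρ z v)) • y) (by
    simp only [map_add, map_smul, smul_eq_mul]; ring)
  rw [gw_add, gw_smul, gw_smul] at this
  linarith

lemma Sol.tang (S : Sol Ω ρ c T Cu Cp Cf u φ f) (hε : 0 < ε) (E : Est2 Ω ρ T u φ f ε M)
    {z : Cn n} (hz : z ∈ frontier Ω) {t : ℝ} (ht : t ∈ Ico ε T)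
    {v η : Cn n} (hv : fderiv ℝ ρ z v = 0) (hη : fderiv ℝ ρ z η = 0) (y : Cn n) :
    fderiv ℝ ρ z y * hw Ω u φ (z, t) η v = gw Ω u φ y (z, t) * fderiv ℝ (fderiv ℝ ρ) z η v := by
  have ht' : t ∈ Ioo 0 T := ⟨hε.trans_le ht.1, ht.2⟩
  have hzc := frontier_subset_closure hz
  obtain ⟨L1, hL1, k1⟩ := S.gw_has hzc ht' v
  obtain ⟨L2, hL2, k2⟩ := S.gw_has hzc ht' y
  obtain ⟨L3, hL3, k3⟩ := S.dom.rho_has z v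
  obtain ⟨L4, hL4, k4⟩ := S.dom.rho_has z y
  have := S.dom.tan hz ((k4.mul k1).sub (k3.mul k2)) (fun x hx => E.gw_T hx ht v y) hη
  simp only [ContinuousLinearMap.sub_apply, ContinuousLinearMap.add_apply, ContinuousLinearMap.smul_apply,
    smul_eq_mul, hL1, hL2, hL3, hL4, hv, E.gw_tan hz ht hv, zero_mul, add_zero, zero_add] at this
  linarith

end

/-- structure bundling an admissible normal at a boundary point -/
structure Nu (ρ : Cn n → ℝ) (b N : ℝ) (z ν : Cn n) : Prop where
  bpos : 0 < b
  nrm : ‖ν‖ ≤ N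
  tan : fderiv ℝ ρ z (I • ν) = 0
  low : b ≤ fderiv ℝ ρ z ν

lemma norm_II (ν : Cn n) : ‖I • ν‖ = ‖ν‖ := by rw [norm_smul, Complex.norm_I, one_mul]

lemma sq_split (a f : ℝ) : a * a ≤ 2 * (f * f) + 2 * ((a - f) * (a - f)) := by
  nlinarith [sq_nonneg (a - 2 * f)]

lemma E5_arith {H S1 bf af gv gn gi hv hn hi hb ha Gb Gv Ga Gp Gi Gf pa Gbv Gan Gau Gaf gI : ℝ} {σ : ℝ} (hσ : |σ| ≤ 1)
    (hH : 1 ≤ H) (hS : 1 ≤ S1)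
    (b1 : |bf| ≤ H) (b2 : |af| ≤ H) (b3 : |gv| ≤ H) (b4 : |gn| ≤ H) (b5 : |gi| ≤ H)
    (b6 : |hv| ≤ H * S1) (b7 : |hn| ≤ H * S1) (b8 : |hi| ≤ H * S1) (b9 : |hb| ≤ H * S1) (b10 : |ha| ≤ H * S1)
    (c1 : |2 * Gbv| ≤ Gb + Gv) (c2 : |2 * Gau| ≤ 2 * |pa| + (Ga + Gi)) (c3 : |2 * Gaf| ≤ Ga + Gf) (c4 : Gan = Gau - Gaf)
    (c5 : Gi ≤ 2 * Gp + 2 * gI) (d1 : Gb ≤ H * S1) (d2 : Ga ≤ H * S1) (d3 : Gf ≤ H * S1) (d4 : Gp ≤ H * S1)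
    (d5 : |pa| ≤ H) :
    σ * ((bf * hv + gv * hb - 2 * Gbv) - (af * hn + gn * ha - 2 * Gan)) + (gv * hv + gv * hv - 2 * Gv)
      + (gi * hi + gi * hi - 2 * gI) ≤ 17 * H ^ 2 * S1 - Gv := by
  have m : ∀ {a b : ℝ}, |a| ≤ H → |b| ≤ H * S1 → |a * b| ≤ H ^ 2 * S1 := fun {a b} h1 h2 => by
    rw [abs_mul]
    calc _ ≤ H * (H * S1) := mul_le_mul h1 h2 (abs_nonneg _) (by linarith)
      _ = _ := by ring
  have hHH : H ≤ H ^ 2 := by nlinarith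
  have k1 : H * S1 ≤ H ^ 2 * S1 := by gcongr
  have k2 : H ≤ H ^ 2 * S1 := by nlinarith
  have s1 : σ * ((bf * hv + gv * hb - 2 * Gbv) - (af * hn + gn * ha - 2 * Gan)) ≤
      |bf * hv| + |gv * hb| + |2 * Gbv| + |af * hn| + |gn * ha| + |2 * Gau| + |2 * Gaf| := by
    set X := (bf * hv + gv * hb - 2 * Gbv) - (af * hn + gn * ha - 2 * Gan) with hX
    have : σ * X ≤ |X| := by
      calc σ * X ≤ |σ * X| := le_abs_self _
        _ = |σ| * |X| := abs_mul _ _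
        _ ≤ 1 * |X| := by gcongr
        _ = _ := one_mul _
    refine this.trans ?_
    rw [hX, c4, abs_le]
    constructor <;>
    linarith [le_abs_self (bf * hv), le_abs_self (gv * hb), le_abs_self (2 * Gbv), le_abs_self (af * hn),
      le_abs_self (gn * ha), le_abs_self (2 * Gau), le_abs_self (2 * Gaf), neg_abs_le (bf * hv),
      neg_abs_le (gv * hb), neg_abs_le (2 * Gbv), neg_abs_le (af * hn), neg_abs_le (gn * ha),
      neg_abs_le (2 * Gau), neg_abs_le (2 * Gaf)]
  have := m b1 b6
  have := m b3 b9
  have := m b2 b7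
  have := m b4 b10
  have := (le_abs_self _).trans (m b3 b6)
  have := (le_abs_self _).trans (m b5 b8)
  linarith

set_option maxHeartbeats 3200000 in
lemma E5 {Ω : Set (Cn n)} {ρ : Cn n → ℝ} {c T : ℝ} (hn : 0 < n) (h : Dom Ω ρ c) (hT : 0 < T)
    (Cu Cp Cf : ℝ) {ε b N : ℝ} (hε : 0 < ε) (hb : 0 < b) (hN : 1 ≤ N) :
    ∃ M, 1 ≤ M ∧ ∀ u φ f, Sol Ω ρ c T Cu Cp Cf u φ f →
      ∀ z ∈ frontier Ω, ∀ t ∈ Ico ε T, ∀ ν, Nu ρ b N z ν → ∀ v, fderiv ℝ ρ z v = 0 →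
        |D2 Ω u (z, t) ν v| ≤ M * ‖v‖ := by
  obtain ⟨M, hM, kM⟩ := est12 hn h hT Cu Cp Cf (half_pos hε)
  obtain ⟨R, hR, hR0, hR1, hR2, hR3, hRb⟩ := h.bds
  obtain ⟨K, hK, hK1, -⟩ := h.lip
  set H : ℝ := ((M + |Cp|) + (|Cf| * (1 + M) + |Cp|) + R + R * N + R ^ 2 + |Cp| ^ 2 ) * N ^ 2 + (R * N) ^ 2 with hH
  set C : ℝ := 17 * H ^ 2 + 2 * (M * (K * N)) ^ 2 with hC
  have hRp : 0 < R := by linarith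
  have hN2 : 1 ≤ N ^ 2 := by nlinarith
  have hNN : N ≤ N ^ 2 := by nlinarith
  have hC0 : 0 ≤ C := by positivity
  obtain ⟨A, hA, kA⟩ := barrier hn h hT (M := M) hC0 hM
  set B := |Cp| * N + (A * N / (ε / 2) + (M + |Cp|) * N * (R * N)) / b with hB
  have hB0 : 0 ≤ B := by positivity
  refine ⟨1 + B, by linarith, fun u φ f S z0 hz0 t0 ht0 ν hν v hv => ?_⟩
  have E := kM u φ f S
  have hO := S.opQ
  have hCf : |Cf| = Cf := abs_of_nonneg (S.Cf_nonneg hT)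
  have hCp : |Cp| = Cp := abs_of_nonneg (S.Cp_nonneg hT)
  have hCf0 := S.Cf_nonneg hT
  have hCp0 := S.Cp_nonneg hT
  rw [hCf, hCp] at hH
  rw [hCp] at hB
  have ht0' : t0 ∈ Ioo 0 T := ⟨hε.trans_le ht0.1, ht0.2⟩
  have hz0c := frontier_subset_closure hz0
  have hIν : ‖I • ν‖ ≤ N := by rw [norm_II]; exact hν.nrm
  have hνN := hν.nrm
  -- bounds relative to H
  set G : ℝ := (M + Cp) + (Cf * (1 + M) + Cp) + R + R * N + R ^ 2 + Cp ^ 2 with hG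
  have hG1 : 1 ≤ G := by
    have : 0 ≤ Cp + (Cf * (1 + M) + Cp) + R + R * N + R ^ 2 + Cp ^ 2 := by positivity
    linarith
  have hG0 : 0 ≤ G := by linarith
  have hGH : G * N ^ 2 ≤ H := by rw [hH]; linarith [sq_nonneg (R * N)]
  have hGN : G * N ≤ H := (mul_le_mul_of_nonneg_left hNN hG0).trans hGH
  have hGG : G ≤ H := (le_mul_of_one_le_right hG0 hN2).trans hGH
  have hH1 : 1 ≤ H := hG1.trans hGG
  have g1 : M + Cp ≤ G := by
    have : 0 ≤ (Cf * (1 + M) + Cp) + R + R * N + R ^ 2 + Cp ^ 2 := by positivity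
    linarith
  have g2 : Cf * (1 + M) + Cp ≤ G := by
    have : 0 ≤ (M + Cp) + R + R * N + R ^ 2 + Cp ^ 2 := by positivity
    linarith
  have g3 : R * N ≤ G := by
    have : 0 ≤ (M + Cp) + (Cf * (1 + M) + Cp) + R + R ^ 2 + Cp ^ 2 := by positivity
    linarith
  have g4 : R ≤ G := by
    have : 0 ≤ (M + Cp) + (Cf * (1 + M) + Cp) + R * N + R ^ 2 + Cp ^ 2 := by positivity
    linarith
  have g5 : R ^ 2 ≤ G := by
    have : 0 ≤ (M + Cp) + (Cf * (1 + M) + Cp) + R * N + R + Cp ^ 2 := by positivity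
    linarith
  have g6 : Cp ^ 2 ≤ G := by
    have : 0 ≤ (M + Cp) + (Cf * (1 + M) + Cp) + R * N + R + R ^ 2 := by positivity
    linarith
  have key : ∀ v : Cn n, ‖v‖ ≤ 1 → fderiv ℝ ρ z0 v = 0 → ∀ σ : ℝ, |σ| = 1 →
      - (σ * (fderiv ℝ ρ z0 ν * hw Ω u φ (z0, t0) ν v - fderiv ℝ (fderiv ℝ ρ) z0 ν v * gw Ω u φ ν (z0, t0)))
        ≤ A * N / (ε / 2) := by
    intro v hv1 hv σ hσ
    obtain ⟨sv1, sv2, sv3⟩ := S.gws v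
    obtain ⟨sn1, sn2, sn3⟩ := S.gws ν
    obtain ⟨si1, si2, si3⟩ := S.gws (I • ν)
    obtain ⟨Bρ, Bd, Bdd, -⟩ := hRb T
    have Bb := Bd ν
    have Ba := Bd v
    set W : Xn n → ℝ := fun p => σ * (fderiv ℝ ρ p.1 ν * gw Ω u φ v p - fderiv ℝ ρ p.1 v * gw Ω u φ ν p)
      + gw Ω u φ v p * gw Ω u φ v p + gw Ω u φ (I • ν) p * gw Ω u φ (I • ν) p with hW
    have hcd : ∀ x : Cn n, ContinuousOn (fun p : Xn n => fderiv ℝ ρ p.1 x) (closure Ω ×ˢ Ioo 0 T) := fun x =>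
      ((h.cont_fd.comp continuous_fst).clm_apply continuous_const).continuousOn
    have hWs : Sm (Ω ×ˢ Ioo 0 T) W :=
      (((((Bb.sm.mul sv1).sub (Ba.sm.mul sn1)).cmul σ).add (sv1.mul sv1)).add (si1.mul si1))
    have hWc : ContinuousOn W (closure Ω ×ˢ Ioo 0 T) :=
      ((continuousOn_const.mul (((hcd ν).mul sv2).sub ((hcd v).mul sn2))).add (sv2.mul sv2)).add (si2.mul si2)
    obtain ⟨L1, hL1, k1⟩ := S.gw_has hz0c ht0' v
    obtain ⟨L2, hL2, k2⟩ := S.gw_has hz0c ht0' ν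
    obtain ⟨L5, hL5, k5⟩ := S.gw_has hz0c ht0' (I • ν)
    obtain ⟨L3, hL3, k3⟩ := S.dom.rho_has z0 v
    obtain ⟨L4, hL4, k4⟩ := S.dom.rho_has z0 ν
    have ht1 : t0 ∈ Ico (ε / 2) T := ⟨by linarith [ht0.1], ht0.2⟩
    have zv := E.gw_tan hz0 ht1 hv
    have zi := E.gw_tan hz0 ht1 hν.tan
    have hd := ((((k4.mul k1).sub (k3.mul k2)).const_mul σ).add (k1.mul k1)).add (k5.mul k5)
    have main := kA Cu Cp Cf u φ f S (ε / 2) t0 (half_pos hε) (by linarith [ht0.1]) ht0.2 E.e1.dup z0 hz0 W hWs hWc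
      ?_ ?_ ?_ _ hd ν (hν.bpos.trans_le hν.low)
    · simp only [sub_apply, add_apply, smul_apply,
        smul_eq_mul, hL1, hL2, hL3, hL4, hL5, hv, zv, zi, zero_mul, add_zero, zero_add] at main
      rw [le_div_iff₀ (by linarith)]
      set X := -(σ * (fderiv ℝ ρ z0 ν * hw Ω u φ (z0, t0) ν v - fderiv ℝ (fderiv ℝ ρ) z0 ν v * gw Ω u φ ν (z0, t0))) with hX
      have m1 : (t0 - ε / 2) * X ≤ A * ‖ν‖ := by
        rw [hX]; convert main using 4; ring
      have m2 : A * ‖ν‖ ≤ A * N := by gcongr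
      rcases le_or_gt X 0 with h0 | h0
      · have : X * (ε / 2) ≤ 0 := mul_nonpos_of_nonpos_of_nonneg h0 (by linarith)
        have : 0 ≤ A * N := by positivity
        linarith
      · have : X * (ε / 2) ≤ (t0 - ε / 2) * X := by
          rw [mul_comm]; gcongr; linarith [ht0.1]
        linarith
    · intro p hp hp2 D c' hF
      have hpc : p ∈ closure Ω ×ˢ Ico (ε / 2) T := ⟨subset_closure hp.1, hp2, hp.2.2⟩
      have hS := SS_nonneg c'
      set S1 := 1 + SS c' with hS1
      have hS11 : 1 ≤ S1 := by linarith
      have one_v : ∀ {a : ℝ}, 0 ≤ a → a * ‖v‖ ≤ a := fun ha => mul_le_of_le_one_right ha hv1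
      have nn_v : ∀ {a : ℝ}, 0 ≤ a → a * ‖ν‖ ≤ a * N := fun ha => by gcongr
      have nn_i : ∀ {a : ℝ}, 0 ≤ a → a * ‖I • ν‖ ≤ a * N := fun ha => by gcongr
      have b1 : |fderiv ℝ ρ p.1 ν| ≤ H := (Bb.b0 p hp).trans ((nn_v hRp.le).trans (g3.trans hGG))
      have b2 : |fderiv ℝ ρ p.1 v| ≤ H := (Ba.b0 p hp).trans ((one_v hRp.le).trans (g4.trans hGG))
      have hMC : 0 ≤ M + Cp := by positivity
      have b3 : |gw Ω u φ v p| ≤ H := (S.gw_bd hT (half_pos hε) E hpc v).trans ((one_v hMC).trans (g1.trans hGG))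
      have b4 : |gw Ω u φ ν p| ≤ H := (S.gw_bd hT (half_pos hε) E hpc ν).trans ((nn_v hMC).trans
        ((mul_le_mul_of_nonneg_right g1 (by linarith)).trans hGN))
      have b5 : |gw Ω u φ (I • ν) p| ≤ H := (S.gw_bd hT (half_pos hε) E hpc (I • ν)).trans ((nn_i hMC).trans
        ((mul_le_mul_of_nonneg_right g1 (by linarith)).trans hGN))
      have hCC : 0 ≤ Cf * (1 + M) + Cp := by positivity
      have b6 : |heat c' (gw Ω u φ v) p| ≤ H * S1 := (S.gw_heat hT (half_pos hε) E hp hp2 hF v).trans (by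
        gcongr; exact (one_v hCC).trans (g2.trans hGG))
      have b7 : |heat c' (gw Ω u φ ν) p| ≤ H * S1 := (S.gw_heat hT (half_pos hε) E hp hp2 hF ν).trans (by
        gcongr; exact (nn_v hCC).trans ((mul_le_mul_of_nonneg_right g2 (by linarith)).trans hGN))
      have b8 : |heat c' (gw Ω u φ (I • ν)) p| ≤ H * S1 := (S.gw_heat hT (half_pos hε) E hp hp2 hF (I • ν)).trans (by
        gcongr; exact (nn_i hCC).trans ((mul_le_mul_of_nonneg_right g2 (by linarith)).trans hGN))
      have b9 : |heat c' (fun p : Xn n => fderiv ℝ ρ p.1 ν) p| ≤ H * S1 := (Bb.heat hp c').trans (by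
        gcongr; exact (nn_v hRp.le).trans (g3.trans hGG))
      have b10 : |heat c' (fun p : Xn n => fderiv ℝ ρ p.1 v) p| ≤ H * S1 := (Ba.heat hp c').trans (by
        gcongr; exact (one_v hRp.le).trans (g4.trans hGG))
      have hSS : SS c' ≤ S1 := by linarith
      have d1 : Gam c' (fun p : Xn n => fderiv ℝ ρ p.1 ν) (fun p : Xn n => fderiv ℝ ρ p.1 ν) p ≤ H * S1 :=
        (Bb.Gam hp c').trans (by
          gcongr
          have : (R * ‖ν‖) ^ 2 ≤ (R * N) ^ 2 := by gcongr
          have : 0 ≤ G * N ^ 2 := by positivity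
          rw [hH]; linarith)
      have d2 : Gam c' (fun p : Xn n => fderiv ℝ ρ p.1 v) (fun p : Xn n => fderiv ℝ ρ p.1 v) p ≤ H * S1 :=
        (Ba.Gam hp c').trans (by
          gcongr
          have : (R * ‖v‖) ^ 2 ≤ R ^ 2 := by gcongr; exact one_v hRp.le
          linarith)
      have d3 : Gam c' (pd (sv ν) φ) (pd (sv ν) φ) p ≤ H * S1 :=
        ((S.phi1 hT ν).Gam hp c').trans (by
          gcongr
          rw [mul_pow]
          have : Cp ^ 2 * ‖ν‖ ^ 2 ≤ G * N ^ 2 := by gcongr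
          linarith)
      have d4 : Gam c' (pd (sv (I • ν)) φ) (pd (sv (I • ν)) φ) p ≤ H * S1 :=
        ((S.phi1 hT (I • ν)).Gam hp c').trans (by
          gcongr
          rw [mul_pow]
          have : Cp ^ 2 * ‖I • ν‖ ^ 2 ≤ G * N ^ 2 := by gcongr
          linarith)
      have d5 : |pd (sv ν) (fun p : Xn n => fderiv ℝ ρ p.1 v) p| ≤ H := (Ba.b1 p hp ν).trans (by
        have : R * ‖v‖ * ‖ν‖ ≤ R * N := by
          gcongr; exact one_v hRp.le
        linarith)
      have c1 := Gam_le (c := c') (F := fun p : Xn n => fderiv ℝ ρ p.1 ν) (G := gw Ω u φ v) (p := p) 1 one_pos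
      have c2 := hF.mixed (fun p : Xn n => fderiv ℝ ρ p.1 v) ν 1 one_pos
      have c3 := Gam_le (c := c') (F := fun p : Xn n => fderiv ℝ ρ p.1 v) (G := pd (sv ν) φ) (p := p) 1 one_pos
      have c4 : Gam c' (fun p : Xn n => fderiv ℝ ρ p.1 v) (gw Ω u φ ν) p =
          Gam c' (fun p : Xn n => fderiv ℝ ρ p.1 v) (pd (sv ν) u) p
            - Gam c' (fun p : Xn n => fderiv ℝ ρ p.1 v) (pd (sv ν) φ) p := by
        rw [← Gam_sub_right hO (S.us.pd hO _) (S.φQ.pd hO _) hp]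
        simp only [Gam, pd_eqOn hO sn3 _ hp]
      have c5 : Gam c' (pd (sv (I • ν)) u) (pd (sv (I • ν)) u) p ≤ 2 * Gam c' (pd (sv (I • ν)) φ) (pd (sv (I • ν)) φ) p
          + 2 * Gam c' (gw Ω u φ (I • ν)) (gw Ω u φ (I • ν)) p := by
        simp only [Gam, Finset.mul_sum, ← Finset.sum_add_distrib]
        refine Finset.sum_le_sum fun i _ => ?_
        rw [pd_eqOn hO si3 _ hp, pd_sub hO (S.us.pd hO _) (S.φQ.pd hO _) hp]
        exact sq_split _ _
      simp only [inv_one, one_mul] at c1 c2 c3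
      have fin := E5_arith hσ.le hH1 hS11 b1 b2 b3 b4 b5 b6 b7 b8 b9 b10 c1 c2 c3 c4 c5 d1 d2 d3 d4 d5
      have hGv : 0 ≤ Gam c' (gw Ω u φ v) (gw Ω u φ v) p := Gam_self_nonneg
      refine ⟨?_, ?_⟩
      · rw [hW, heat_add hO ((((Bb.sm.mul sv1).sub (Ba.sm.mul sn1)).cmul σ).add (sv1.mul sv1)) (si1.mul si1) hp,
          heat_add hO (((Bb.sm.mul sv1).sub (Ba.sm.mul sn1)).cmul σ) (sv1.mul sv1) hp,
          heat_cmul hO ((Bb.sm.mul sv1).sub (Ba.sm.mul sn1)) hp,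
          heat_sub hO (Bb.sm.mul sv1) (Ba.sm.mul sn1) hp, heat_mul hO Bb.sm sv1 hp, heat_mul hO Ba.sm sn1 hp,
          heat_mul hO sv1 sv1 hp, heat_mul hO si1 si1 hp]
        refine fin.trans ?_
        rw [hC, add_mul]
        have : 0 ≤ 2 * (M * (K * N)) ^ 2 * S1 := by positivity
        linarith
      · have mm : ∀ {a b : ℝ}, |a| ≤ H → |b| ≤ H → |a * b| ≤ H ^ 2 := fun {a b} h1 h2 => by
          rw [abs_mul, sq]; exact mul_le_mul h1 h2 (abs_nonneg _) (by linarith)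
        have w1 : σ * (fderiv ℝ ρ p.1 ν * gw Ω u φ v p - fderiv ℝ ρ p.1 v * gw Ω u φ ν p) ≤ 2 * H ^ 2 := by
          refine (le_abs_self _).trans ?_
          rw [abs_mul, hσ, one_mul]
          refine (abs_sub _ _).trans ?_
          linarith [mm b1 b3, mm b2 b4]
        have w2 := (le_abs_self _).trans (mm b3 b3)
        have w3 := (le_abs_self _).trans (mm b5 b5)
        have : 0 ≤ 2 * (M * (K * N)) ^ 2 := by positivity
        have : 0 ≤ H ^ 2 := by positivity
        rw [hC]; simp only [hW]; linarith
    · intro z hz t ht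
      have ht2 : t ∈ Ico (ε / 2) T := ⟨ht.1, ht.2.trans_lt ht0.2⟩
      have hzc := frontier_subset_closure hz
      have lipv : ∀ x : Cn n, ‖x‖ ≤ N → fderiv ℝ ρ z0 x = 0 → gw Ω u φ x (z, t) * gw Ω u φ x (z, t) ≤
          (M * (K * N)) ^ 2 * ‖z - z0‖ ^ 2 := by
        intro x hx hx0
        have q1 := E.e1.bg z hz t ht2 x
        have q2 := hK1 z hzc z0 hz0c x
        rw [hx0, sub_zero] at q2
        have q3 : |gw Ω u φ x (z, t)| ≤ M * (K * N) * ‖z - z0‖ := by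
          refine q1.trans ?_
          calc M * |fderiv ℝ ρ z x| ≤ M * (K * ‖x‖ * ‖z - z0‖) := by gcongr
            _ ≤ M * (K * N * ‖z - z0‖) := by gcongr
            _ = _ := by ring
        rw [← mul_pow, ← sq, ← sq_abs]
        gcongr
      have q := E.gw_T hz ht2 v ν
      have l1 := lipv v (by linarith) hv
      have l2 := lipv (I • ν) hIν hν.tan
      simp only [hW, q, mul_zero, zero_add, hC]
      have : 0 ≤ 17 * H ^ 2 * ‖z - z0‖ ^ 2 := by positivity
      rw [add_mul]
      linarith
    · simp only [hW, zv, zi, hv]; ring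
  -- conclusion
  have key2 : ∀ v : Cn n, ‖v‖ ≤ 1 → fderiv ℝ ρ z0 v = 0 → |D2 Ω u (z0, t0) ν v| ≤ B := by
    intro v hv1 hv
    have q1 := key v hv1 hv 1 (by simp)
    have q2 := key v hv1 hv (-1) (by simp)
    set β := fderiv ℝ ρ z0 ν with hβ
    set Y := fderiv ℝ (fderiv ℝ ρ) z0 ν v * gw Ω u φ ν (z0, t0) with hY
    have hβb : b ≤ β := hν.low
    have hYb : |Y| ≤ (M + Cp) * N * (R * N) := by
      rw [hY, abs_mul, mul_comm]
      have e1 := S.gw_bd hT (half_pos hε) E (p := (z0, t0)) ⟨hz0c, by linarith [ht0.1], ht0.2⟩ ν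
      have e2 := (fderiv ℝ (fderiv ℝ ρ) z0).le_opNorm₂ ν v
      rw [Real.norm_eq_abs] at e2
      have e3 : |fderiv ℝ (fderiv ℝ ρ) z0 ν v| ≤ R * N := by
        refine e2.trans ?_
        calc _ ≤ R * N * 1 := by gcongr; exact hR2 z0 hz0c
          _ = _ := mul_one _
      have e4 : |gw Ω u φ ν (z0, t0)| ≤ (M + Cp) * N := e1.trans (by gcongr)
      gcongr
    have h3 : |β * hw Ω u φ (z0, t0) ν v| ≤ A * N / (ε / 2) + (M + Cp) * N * (R * N) := by
      have := abs_le.1 hYb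
      rw [abs_le]; constructor <;> linarith
    have hw1 : |hw Ω u φ (z0, t0) ν v| ≤ (A * N / (ε / 2) + (M + Cp) * N * (R * N)) / b := by
      rw [le_div_iff₀ hb]
      rw [abs_mul, abs_of_pos (hb.trans_le hβb)] at h3
      have : |hw Ω u φ (z0, t0) ν v| * b ≤ β * |hw Ω u φ (z0, t0) ν v| := by
        rw [mul_comm]; gcongr
      linarith
    have hφ := S.D2phi hT (p := (z0, t0)) ⟨hz0c, ht0'⟩ ν v
    have hφ2 : Cp * (‖ν‖ * ‖v‖) ≤ Cp * N := by
      have : ‖ν‖ * ‖v‖ ≤ N * 1 := by gcongr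
      rw [mul_one] at this
      gcongr
    have e : D2 Ω u (z0, t0) ν v = hw Ω u φ (z0, t0) ν v + D2 Ω φ (z0, t0) ν v := by simp [hw]
    rw [e, hB]
    refine (abs_add_le _ _).trans ?_
    linarith
  by_cases hv0 : ‖v‖ = 0
  · rw [norm_eq_zero] at hv0
    simp [hv0]
  · have hv1 : 0 < ‖v‖ := lt_of_le_of_ne (norm_nonneg _) (Ne.symm hv0)
    have := key2 (‖v‖⁻¹ • v) (by rw [norm_smul, norm_inv, norm_norm, inv_mul_cancel₀ hv0]) (by
      rw [map_smul, hv, smul_zero])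
    rw [map_smul, smul_eq_mul, abs_mul, abs_inv, abs_norm, inv_mul_le_iff₀ hv1] at this
    refine this.trans ?_
    rw [mul_comm]; gcongr; linarith only


/-! ### Linear algebra at the boundary -/

structure BB (B : Cn n →L[ℝ] Cn n →L[ℝ] ℝ) (l : Cn n →L[ℝ] ℝ) (ν : Cn n) (b N R M : ℝ) : Prop where
  sy : ∀ x y, B x y = B y x
  bpos : 0 < b
  Nn : 0 ≤ N
  Rn : 0 ≤ R
  Mn : 0 ≤ M
  nu : ‖ν‖ ≤ N
  tan : l (I • ν) = 0
  low : b ≤ l ν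
  up : ∀ x, |l x| ≤ R * ‖x‖
  tt : ∀ x y, l x = 0 → l y = 0 → |B x y| ≤ M * (‖x‖ * ‖y‖)
  nt : ∀ y, l y = 0 → |B ν y| ≤ M * ‖y‖

section
variable {B : Cn n →L[ℝ] Cn n →L[ℝ] ℝ} {l : Cn n →L[ℝ] ℝ} {ν : Cn n} {b N R M : ℝ}

lemma BB.aa (h : BB B l ν b N R M) (x : Cn n) : |l x / l ν| ≤ R / b * ‖x‖ := by
  have h0 : 0 < l ν := h.bpos.trans_le h.low
  have hb := h.bpos
  rw [abs_div, abs_of_pos h0, div_mul_eq_mul_div]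
  exact div_le_div₀ (mul_nonneg h.Rn (norm_nonneg _)) (h.up x) hb h.low

lemma BB.LA_up (h : BB B l ν b N R M) {G : ℝ} (hG0 : 0 ≤ G) (hG : B ν ν ≤ G) (x : Cn n) :
    B x x ≤ (M * (1 + R / b * N) ^ 2 + 2 * (R / b) * M * (1 + R / b * N) + (R / b) ^ 2 * G) * ‖x‖ ^ 2 := by
  have h0 : 0 < l ν := h.bpos.trans_le h.low
  have hb := h.bpos
  have hR := h.Rn
  have hM := h.Mn
  have hN := h.Nn
  have ha := h.aa x
  set a := l x / l ν with hadef
  set A := R / b with hA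
  have hA0 : 0 ≤ A := by positivity
  have hy0 : l (x - a • ν) = 0 := by
    rw [map_sub, map_smul, smul_eq_mul, hadef]; field_simp; ring
  have hx : x = (x - a • ν) + a • ν := by abel
  set y := x - a • ν with hy
  have e1 : ‖a • ν‖ ≤ A * ‖x‖ * N := by
    rw [norm_smul, Real.norm_eq_abs]
    exact mul_le_mul ha h.nu (norm_nonneg _) (by positivity)
  have hyn : ‖y‖ ≤ (1 + A * N) * ‖x‖ := (norm_sub_le _ _).trans (by linarith)
  have hX := norm_nonneg x
  have hY := norm_nonneg y
  have e2 : B x x = B y y + 2 * a * B ν y + a ^ 2 * B ν ν := by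
    rw [hx]
    simp only [map_add, map_smul, add_apply, smul_apply, smul_eq_mul]
    rw [h.sy y ν]; ring
  have e3 : B y y ≤ M * ((1 + A * N) * ‖x‖) ^ 2 := by
    refine (le_abs_self _).trans ((h.tt y y hy0 hy0).trans ?_)
    rw [← sq]; gcongr
  have e4 : a * B ν y ≤ A * ‖x‖ * (M * ((1 + A * N) * ‖x‖)) := by
    refine (le_abs_self _).trans ?_
    rw [abs_mul]
    exact mul_le_mul ha ((h.nt y hy0).trans (by gcongr)) (abs_nonneg _) (by positivity)
  have e5 : a ^ 2 * B ν ν ≤ (A * ‖x‖) ^ 2 * G := by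
    have : a ^ 2 ≤ (A * ‖x‖) ^ 2 := by rw [← sq_abs a]; gcongr
    exact (mul_le_mul_of_nonneg_left hG (sq_nonneg _)).trans (mul_le_mul_of_nonneg_right this hG0)
  rw [e2]
  calc _ ≤ M * ((1 + A * N) * ‖x‖) ^ 2 + 2 * (A * ‖x‖ * (M * ((1 + A * N) * ‖x‖))) + (A * ‖x‖) ^ 2 * G := by
        linarith
    _ = _ := by ring

lemma BB.LA_lv (h : BB B l ν b N R M) {G : ℝ} (hG0 : 0 ≤ G) (hG : B ν ν ≤ G) (x : Cn n) :
    lv (rb B) x ≤ (M * (1 + R / b * N) ^ 2 + 2 * (R / b) * M * (1 + R / b * N) + (R / b) ^ 2 * G) * ‖x‖ ^ 2 := by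
  have hb := h.bpos
  have hR := h.Rn
  have hM := h.Mn
  have hN := h.Nn
  have h1 := h.LA_up hG0 hG x
  have h2 := h.LA_up hG0 hG (I • x)
  rw [norm_II] at h2
  rw [lv_rb]
  have : 0 ≤ (M * (1 + R / b * N) ^ 2 + 2 * (R / b) * M * (1 + R / b * N) + (R / b) ^ 2 * G) * ‖x‖ ^ 2 := by
    positivity
  linarith only [h1, h2, this]

lemma low_arith {m X a1 a2 H g p q Z N n4 : ℝ} (hm : 0 < m) 
    (hp : |p| ≤ H * X) (hq : |q| ≤ H * X) (hg : H ^ 2 / m + 4 * N ^ 2 * m ≤ g)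
    (hZ : 0 ≤ Z) (hZ2 : Z ≤ X + (|a1| + |a2|) * N) (h4 : m * X ^ 2 ≤ n4) :
    m / 4 * Z ^ 2 ≤ (4 * n4 + 2 * (a1 * p + a2 * q) + (a1 ^ 2 + a2 ^ 2) * g) / 4 := by
  have k : ∀ a r : ℝ, |r| ≤ H * X → -(m * X ^ 2 + H ^ 2 / m * a ^ 2) ≤ 2 * (a * r) := fun a r hr => by
    have h1 : -(|a| * (H * X)) ≤ a * r := by
      have := neg_abs_le (a * r)
      rw [abs_mul] at this
      have := mul_le_mul_of_nonneg_left hr (abs_nonneg a)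
      linarith
    have h2 : 0 ≤ (m * X - H * |a|) ^ 2 / m := by positivity
    have h3 : (m * X - H * |a|) ^ 2 / m = m * X ^ 2 + H ^ 2 / m * a ^ 2 - 2 * (|a| * (H * X)) := by
      rw [← sq_abs a]; field_simp; ring
    linarith
  have k1 := k a1 p hp
  have k2 := k a2 q hq
  have k3 : Z ^ 2 ≤ 2 * X ^ 2 + 4 * N ^ 2 * (a1 ^ 2 + a2 ^ 2) := by
    calc Z ^ 2 ≤ (X + (|a1| + |a2|) * N) ^ 2 := by gcongr
      _ ≤ 2 * X ^ 2 + 4 * N ^ 2 * (|a1| ^ 2 + |a2| ^ 2) := by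
        nlinarith [sq_nonneg (X - (|a1| + |a2|) * N), mul_nonneg (sq_nonneg N) (sq_nonneg (|a1| - |a2|))]
      _ = _ := by rw [sq_abs, sq_abs]
  have k4 := mul_le_mul_of_nonneg_left hg (add_nonneg (sq_nonneg a1) (sq_nonneg a2))
  have k5 := mul_le_mul_of_nonneg_left k3 hm.le
  linarith

lemma BB.LA_low (h : BB B l ν b N R M) {m : ℝ} (hm : 0 < m)
    (hx : ∀ x, l x = 0 → l (I • x) = 0 → m * ‖x‖ ^ 2 ≤ lv (rb B) x)
    (hG : M * N ^ 2 + (M * (1 + N)) ^ 2 / m + 4 * N ^ 2 * m ≤ B ν ν) (x : Cn n) :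
    m / 4 * ‖x‖ ^ 2 ≤ lv (rb B) x := by
  have h0 : 0 < l ν := h.bpos.trans_le h.low
  have hM := h.Mn
  set a1 := l x / l ν with ha1
  set a2 := -(l (I • x) / l ν) with ha2
  have x0 : x = (x - a1 • ν - a2 • (I • ν)) + (a1 • ν + a2 • (I • ν)) := by abel
  set ξ := x - a1 • ν - a2 • (I • ν) with hξ
  have t1 : l ξ = 0 := by
    rw [hξ, map_sub, map_sub, map_smul, map_smul, h.tan, smul_zero, sub_zero, ha1, smul_eq_mul]
    field_simp; ring
  have t2 : l (I • ξ) = 0 := by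
    rw [hξ, smul_sub, smul_sub, I_smul_real, I_smul_real, II_smul, map_sub, map_sub, map_smul l a1, map_smul l a2, h.tan,
      smul_zero, sub_zero, map_neg, ha2, smul_eq_mul]
    field_simp; ring
  have hsy : ∀ p q, rb B p q = rb B q p := fun p q => h.sy p q
  have en : ‖ν‖ = ‖I • ν‖ := (norm_II ν).symm
  have b1 : ∀ y, l y = 0 → |B y ν| ≤ M * ‖y‖ := fun y hy => by rw [h.sy]; exact h.nt y hy
  have b2 : ∀ y, l y = 0 → |B y (I • ν)| ≤ M * N * ‖y‖ := fun y hy => by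
    refine (h.tt y _ hy h.tan).trans ?_
    rw [norm_II, mul_comm (‖y‖), ← mul_assoc]
    gcongr; exact h.nu
  have p1 : |hb (rb B) ξ ν| ≤ M * (1 + N) * ‖ξ‖ := by
    have h1 := b1 ξ t1
    have h2 := b2 _ t2
    rw [norm_II] at h2
    rw [hb]
    refine (abs_add_le _ _).trans ?_
    change |B ξ ν| + |B (I • ξ) (I • ν)| ≤ _
    linarith
  have p2 : |hb (rb B) ξ (I • ν)| ≤ M * (1 + N) * ‖ξ‖ := by
    have h1 := b1 _ t2
    have h2 := b2 _ t1
    rw [norm_II] at h1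
    rw [hb, II_smul]
    refine (abs_add_le _ _).trans ?_
    change |B ξ (I • ν)| + |B (I • ξ) (-ν)| ≤ _
    rw [map_neg, abs_neg]
    linarith
  have key : lv (rb B) x = (4 * lv (rb B) ξ + 2 * (a1 * hb (rb B) ξ ν + a2 * hb (rb B) ξ (I • ν))
      + (a1 ^ 2 + a2 ^ 2) * hb (rb B) ν ν) / 4 := by
    have s : ∀ p q, hb (rb B) p q = hb (rb B) q p := hb_symm hsy
    have z1 : hb (rb B) ν (I • ν) = 0 := by
      have := s ν (I • ν)
      rw [hb_I_left] at this
      linarith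
    have z2 : hb (rb B) (I • ν) ν = 0 := by rw [s, z1]
    rw [lv, x0]
    simp only [lv, hb_add_left, hb_add_right, hb_smul_left, hb_smul_right, hb_I_I, z1, z2]
    rw [s ν ξ, s (I • ν) ξ]; ring
  rw [key]
  have hN := h.Nn
  have gI : -(M * N ^ 2) ≤ B (I • ν) (I • ν) := by
    have := h.tt _ _ h.tan h.tan
    rw [norm_II] at this
    have h2 : M * (‖ν‖ * ‖ν‖) ≤ M * N ^ 2 := by rw [← sq]; have := h.nu; gcongr
    linarith [neg_abs_le (B (I • ν) (I • ν))]
  refine low_arith hm p1 p2 (N := N) ?_ (norm_nonneg _) ?_ (hx ξ t1 t2)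
  · change _ ≤ B ν ν + B (I • ν) (I • ν)
    linarith
  · have e1 : ‖x‖ ≤ ‖ξ‖ + ‖a1 • ν + a2 • (I • ν)‖ := by
      conv_lhs => rw [x0]
      exact norm_add_le _ _
    have e2 : ‖a1 • ν + a2 • (I • ν)‖ ≤ |a1| * N + |a2| * N := by
      refine (norm_add_le _ _).trans ?_
      rw [norm_smul, norm_smul, norm_II, Real.norm_eq_abs, Real.norm_eq_abs]
      have := h.nu
      gcongr
    linarith

/-- upper bound of the normal-normal entry from the determinant -/
lemma BB.nn_bd (h : BB B l ν b N R M) {m D : ℝ} (hm : 0 < m)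
    (hx : ∀ x, l x = 0 → l (I • x) = 0 → m * ‖x‖ ^ 2 ≤ lv (rb B) x) (hD0 : 0 ≤ D)
    (hD : (HM (rb B)).det.re ≤ D) :
    B ν ν ≤ (M * N ^ 2 + (M * (1 + N)) ^ 2 / m + 4 * N ^ 2 * m) + (4 * (D * N ^ 2) / (m / 4) ^ (n - 1) + M * N ^ 2) := by
  have hM := h.Mn
  have hN := h.Nn
  by_cases hG : M * N ^ 2 + (M * (1 + N)) ^ 2 / m + 4 * N ^ 2 * m ≤ B ν ν
  · have h1 := det_lower' (B := rb B) (fun p q => h.sy p q) (m := m / 4) (by positivity) (h.LA_low hm hx hG) ν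
    have h2 : (HM (rb B)).det.re * ‖ν‖ ^ 2 ≤ D * N ^ 2 := by have := h.nu; gcongr
    have hp : 0 < (m / 4) ^ (n - 1) := by positivity
    have h3 : lv (rb B) ν ≤ D * N ^ 2 / (m / 4) ^ (n - 1) := by
      rw [le_div_iff₀ hp]; linarith
    have gI : -(M * N ^ 2) ≤ B (I • ν) (I • ν) := by
      have := h.tt _ _ h.tan h.tan
      rw [norm_II] at this
      have h2 : M * (‖ν‖ * ‖ν‖) ≤ M * N ^ 2 := by rw [← sq]; have := h.nu; gcongr
      linarith [neg_abs_le (B (I • ν) (I • ν))]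
    rw [lv_rb] at h3
    have h4 : 0 ≤ M * N ^ 2 + (M * (1 + N)) ^ 2 / m + 4 * N ^ 2 * m := by positivity
    rw [mul_div_assoc]
    linarith
  · have h4 : 0 ≤ 4 * (D * N ^ 2) / (m / 4) ^ (n - 1) + M * N ^ 2 := by positivity
    linarith [not_le.1 hG]

end


/-! ### The Hessian on the boundary -/

section
variable {Ω : Set (Cn n)} {ρ : Cn n → ℝ} {c T Cu Cp Cf ε M : ℝ} {u φ : Xn n → ℝ} {f : ℝ × Cn n × ℝ → ℝ}

lemma Sol.D2c (S : Sol Ω ρ c T Cu Cp Cf u φ f) : ContinuousOn (D2 Ω u) (closure Ω ×ˢ Ioo 0 T) := by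
  refine continuousOn_clm_apply.2 fun v => continuousOn_clm_apply.2 fun w => S.ur.c2 v w

lemma Sol.lvc (S : Sol Ω ρ c T Cu Cp Cf u φ f) (x : Cn n) :
    ContinuousOn (fun p => lv (rb (D2 Ω u p)) x) (closure Ω ×ˢ Ioo 0 T) := by
  simp only [lv_rb]
  exact ((S.ur.c2 _ _).add (S.ur.c2 _ _)).div_const _

lemma Sol.detc (S : Sol Ω ρ c T Cu Cp Cf u φ f) :
    ContinuousOn (fun p => (HM (rb (D2 Ω u p))).det.re) (closure Ω ×ˢ Ioo 0 T) := by
  have h1 : ContinuousOn (fun p => HM (rb (D2 Ω u p))) (closure Ω ×ˢ Ioo 0 T) := by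
    refine continuousOn_pi.2 fun α => continuousOn_pi.2 fun β => ?_
    have : ∀ x y, ContinuousOn (fun p => ((hb (rb (D2 Ω u p)) x y : ℝ) : ℂ)) (closure Ω ×ˢ Ioo 0 T) := fun x y =>
      Complex.continuous_ofReal.comp_continuousOn ((S.ur.c2 _ _).add (S.ur.c2 _ _))
    exact ((this _ _).sub (continuousOn_const.mul (this _ _))).div_const _
  exact Complex.continuous_re.comp_continuousOn ((Continuous.matrix_det continuous_id).comp_continuousOn h1)

lemma Sol.detcl (S : Sol Ω ρ c T Cu Cp Cf u φ f) (hε : 0 < ε) (E : Est1 Ω ρ T u φ f ε M) {p : Xn n}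
    (hp : p ∈ closure Ω ×ˢ Ico ε T) : (HM (rb (D2 Ω u p))).det.re ≤ M ∧ M⁻¹ ≤ (HM (rb (D2 Ω u p))).det.re ∧
      ∀ x, 0 ≤ lv (rb (D2 Ω u p)) x := by
  obtain ⟨z, t⟩ := p
  have ht : t ∈ Ioo 0 T := ⟨hε.trans_le hp.2.1, hp.2.2⟩
  refine ⟨ext_le S.detc (B := fun _ => M) continuousOn_const ht (fun z hz => (E.det (z, t) ⟨hz, hp.2⟩).1) z hp.1,
    ext_le (A := fun _ => M⁻¹) continuousOn_const S.detc ht (fun z hz => (E.det (z, t) ⟨hz, hp.2⟩).2) z hp.1,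
    fun x => ext_le (A := fun _ => 0) continuousOn_const (S.lvc x) ht (fun z hz => ?_) z hp.1⟩
  rcases eq_or_ne x 0 with rfl | hx
  · simp [lv_rb]
  · exact (S.levi (z, t) ⟨hz, ht⟩ x hx).le

lemma Sol.lvpos (S : Sol Ω ρ c T Cu Cp Cf u φ f) (hε : 0 < ε) (E : Est1 Ω ρ T u φ f ε M) {p : Xn n}
    (hp : p ∈ closure Ω ×ˢ Ico ε T) {x : Cn n} (hx : x ≠ 0) : 0 < lv (rb (D2 Ω u p)) x := by
  obtain ⟨h1, h2, h3⟩ := S.detcl hε E hp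
  have hM := E.one
  have ht : p ∈ closure Ω ×ˢ Ioo 0 T := ⟨hp.1, hε.trans_le hp.2.1, hp.2.2⟩
  have hle : ∀ y, lv (rb (D2 Ω u p)) y ≤ ‖D2 Ω u p‖ * ‖y‖ ^ 2 := fun y => by
    have k : ∀ y : Cn n, D2 Ω u p y y ≤ ‖D2 Ω u p‖ * ‖y‖ ^ 2 := fun y => by
      refine (le_abs_self _).trans ?_
      rw [← Real.norm_eq_abs, sq, ← mul_assoc]
      exact (D2 Ω u p).le_opNorm₂ y y
    have a := k y
    have b := k (I • y)
    rw [norm_II] at b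
    rw [lv_rb]
    have : 0 ≤ ‖D2 Ω u p‖ * ‖y‖ ^ 2 := by positivity
    linarith
  have := det_upper' (B := rb (D2 Ω u p)) (fun v w => S.ur.symm S.dom S.us ht v w) h3 hle x
  by_contra hc
  have h0 : lv (rb (D2 Ω u p)) x = 0 := le_antisymm (not_lt.1 hc) (h3 x)
  rw [h0, mul_zero] at this
  have h4 : 0 < (HM (rb (D2 Ω u p))).det.re := lt_of_lt_of_le (by positivity) h2
  have h5 : 0 < (HM (rb (D2 Ω u p))).det.re * ‖x‖ ^ 2 := by
    have := norm_pos_iff.2 hx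
    positivity
  linarith

lemma Sol.bb (S : Sol Ω ρ c T Cu Cp Cf u φ f) (hT : 0 < T) (hε : 0 < ε) (E : Est2 Ω ρ T u φ f ε M) {b N R M5 : ℝ}
    (hR1 : ∀ z ∈ closure Ω, ‖fderiv ℝ ρ z‖ ≤ R) (hR2 : ∀ z ∈ closure Ω, ‖fderiv ℝ (fderiv ℝ ρ) z‖ ≤ R)
    {z : Cn n} (hz : z ∈ frontier Ω) {t : ℝ} (ht : t ∈ Ico ε T) {ν : Cn n} (hν : Nu ρ b N z ν) (hM5 : 0 ≤ M5)
    (h5 : ∀ v, fderiv ℝ ρ z v = 0 → |D2 Ω u (z, t) ν v| ≤ M5 * ‖v‖) :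
    BB (D2 Ω u (z, t)) (fderiv ℝ ρ z) ν b N R (M5 + ((M + Cp) * N * R / b + Cp)) := by
  have hzc := frontier_subset_closure hz
  have hp : (z, t) ∈ closure Ω ×ˢ Ioo 0 T := ⟨hzc, hε.trans_le ht.1, ht.2⟩
  have hM := E.e1.one
  have hCp := S.Cp_nonneg hT
  have hN : 0 ≤ N := (norm_nonneg _).trans hν.nrm
  have hR : 0 ≤ R := (norm_nonneg _).trans (hR1 z hzc)
  have hb := hν.bpos
  have hB : 0 < fderiv ℝ ρ z ν := hb.trans_le hν.low
  have h0 : 0 ≤ (M + Cp) * N * R / b + Cp := by positivity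
  refine ⟨fun x y => S.ur.symm S.dom S.us hp x y, hb, hN, hR, by linarith, hν.nrm, hν.tan, hν.low, fun x => ?_,
    fun x y hx hy => ?_, fun y hy => (h5 y hy).trans (mul_le_mul_of_nonneg_right (by linarith) (norm_nonneg _))⟩
  · rw [← Real.norm_eq_abs]; exact (fderiv ℝ ρ z).le_of_opNorm_le (hR1 z hzc) x
  · have h1 := S.tang hε E hz ht hy hx ν
    have h2 := S.gw_bd hT hε E (p := (z, t)) ⟨hzc, ht⟩ ν
    have h3 : |fderiv ℝ (fderiv ℝ ρ) z x y| ≤ R * (‖x‖ * ‖y‖) := by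
      rw [← Real.norm_eq_abs, ← mul_assoc]
      refine ((fderiv ℝ (fderiv ℝ ρ) z).le_opNorm₂ x y).trans ?_
      have := hR2 z hzc
      gcongr
    have h4 : |hw Ω u φ (z, t) x y| ≤ (M + Cp) * N * R / b * (‖x‖ * ‖y‖) := by
      have e : hw Ω u φ (z, t) x y = gw Ω u φ ν (z, t) * fderiv ℝ (fderiv ℝ ρ) z x y / fderiv ℝ ρ z ν := by
        rw [← h1]; field_simp
      rw [e, abs_div, abs_mul, abs_of_pos hB]
      have h6 : |gw Ω u φ ν (z, t)| ≤ (M + Cp) * N := h2.trans (by have := hν.nrm; gcongr)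
      calc _ ≤ (M + Cp) * N * (R * (‖x‖ * ‖y‖)) / b :=
            div_le_div₀ (by positivity) (mul_le_mul h6 h3 (abs_nonneg _) (by positivity)) hb hν.low
        _ = _ := by ring
    have h7 := S.D2phi hT (p := (z, t)) hp x y
    have h8 : D2 Ω u (z, t) x y = hw Ω u φ (z, t) x y + D2 Ω φ (z, t) x y := by rw [hw]; ring
    rw [h8]
    have h9 : 0 ≤ M5 * (‖x‖ * ‖y‖) := by positivity
    refine (abs_add_le _ _).trans ?_
    linarith
end


/-! ### Complex tangential vector fields and the comparison function -/

/-- smooth up to the boundary with controlled norm -/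
structure BC (Ω : Set (Cn n)) (T K : ℝ) (F : Xn n → ℝ) : Prop where
  sm : Sm (closure Ω ×ˢ Ioo 0 T) F
  b2 : B2 (Ω ×ˢ Ioo 0 T) K F

section
variable {Ω : Set (Cn n)} {T K L : ℝ} {F G : Xn n → ℝ}

lemma BC.mono (h : BC Ω T K F) (hK : K ≤ L) : BC Ω T L F := ⟨h.sm, h.b2.mono hK⟩
lemma BC.add (hO : IsOpen (Ω ×ˢ Ioo 0 T)) (h : BC Ω T K F) (h' : BC Ω T L G) : BC Ω T (K + L) (fun p => F p + G p) :=
  ⟨h.sm.add h'.sm, h.b2.add hO h'.b2⟩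
lemma BC.sub (hO : IsOpen (Ω ×ˢ Ioo 0 T)) (h : BC Ω T K F) (h' : BC Ω T L G) : BC Ω T (K + L) (fun p => F p - G p) :=
  ⟨h.sm.sub h'.sm, h.b2.sub hO h'.b2⟩
lemma BC.mul (hO : IsOpen (Ω ×ˢ Ioo 0 T)) (h : BC Ω T K F) (h' : BC Ω T L G) :
    BC Ω T (4 * (K * L)) (fun p => F p * G p) := ⟨h.sm.mul h'.sm, h.b2.mul hO h'.b2⟩
lemma BC.cmul (hO : IsOpen (Ω ×ˢ Ioo 0 T)) (r : ℝ) (h : BC Ω T K F) : BC Ω T (|r| * K) (fun p => r * F p) :=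
  ⟨h.sm.cmul r, h.b2.cmul hO r⟩
lemma BC.const (r : ℝ) : BC Ω T |r| (fun _ => r) := ⟨Sm.const r, B2.const _ r⟩
lemma BC.neg (hO : IsOpen (Ω ×ˢ Ioo 0 T)) (h : BC Ω T K F) : BC Ω T K (fun p => - F p) := ⟨h.sm.neg, h.b2.neg hO⟩

lemma BC.sum4 (hO : IsOpen (Ω ×ˢ Ioo 0 T)) {A : Fin 4 → Xn n → ℝ} (h : ∀ j, BC Ω T K (A j)) :
    BC Ω T (4 * K) (fun p => ∑ j, A j p) := by
  simp only [Fin.sum_univ_four]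
  exact ((((h 0).add hO (h 1)).add hO (h 2)).add hO (h 3)).mono (by linarith)

lemma BC.quad (hO : IsOpen (Ω ×ˢ Ioo 0 T)) {a : Fin 4 → Xn n → ℝ} {g : Fin 4 → Fin 4 → Xn n → ℝ}
    (ha : ∀ j, BC Ω T K (a j)) (hg : ∀ j k, BC Ω T L (g j k)) :
    BC Ω T (|(1 / 4 : ℝ)| * (4 * (4 * (4 * (K * (4 * (K * L)))))))
      (fun p => 1 / 4 * ∑ j, ∑ k, a j p * (a k p * g j k p)) :=
  BC.cmul hO _ (BC.sum4 hO fun j => BC.sum4 hO fun k => (ha j).mul hO ((ha k).mul hO (hg j k)))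

lemma BC.cl {ρ : Cn n → ℝ} {c : ℝ} (h : Dom Ω ρ c) (hF : BC Ω T K F) {p : Xn n} (hp : p ∈ closure Ω ×ˢ Ioo 0 T) :
    |F p| ≤ K ∧ ∀ v, |D1 Ω F p v| ≤ K * ‖v‖ := by
  have hr := hF.sm.reg2 h
  obtain ⟨z, t⟩ := p
  refine ⟨ext_le (B := fun _ => K) hr.c0.abs continuousOn_const hp.2 (fun z hz => hF.b2.b0 (z, t) ⟨hz, hp.2⟩) z hp.1,
    fun v => ext_le (A := fun p => |D1 Ω F p v|) (B := fun _ => K * ‖v‖) (hr.c1.clm_apply continuousOn_const).abs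
      continuousOn_const hp.2 (fun z hz => ?_) z hp.1⟩
  rw [D1_pd h hF.b2.sm (p := (z, t)) ⟨hz, hp.2⟩]
  exact hF.b2.b1 (z, t) ⟨hz, hp.2⟩ v

end

/-- spanning vectors -/
def ev (ξ ν : Cn n) : Fin 4 → Cn n := ![ξ, I • ξ, ν, I • ν]

/-- coefficients of the complex tangential field -/
def av (ρ : Cn n → ℝ) (ξ ν : Cn n) (j : Fin 4) (z : Cn n) : ℝ :=
  ![fderiv ℝ ρ z ν, -fderiv ℝ ρ z (I • ν), -fderiv ℝ ρ z ξ, fderiv ℝ ρ z (I • ξ)] j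

/-- the complex tangential field -/
def XX (ρ : Cn n → ℝ) (ξ ν z : Cn n) : Cn n := ∑ j, av ρ ξ ν j z • ev ξ ν j

/-- quadratic form along the field -/
def qf (ρ : Cn n → ℝ) (ξ ν : Cn n) (B : Xn n → Cn n →L[ℝ] Cn n →L[ℝ] ℝ) (p : Xn n) : ℝ :=
  1 / 4 * ∑ j, ∑ k, av ρ ξ ν j p.1 * (av ρ ξ ν k p.1 * hb (rb (B p)) (ev ξ ν j) (ev ξ ν k))

lemma lv_sum4 (B : RB n) (a : Fin 4 → ℝ) (e : Fin 4 → Cn n) :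
    lv B (∑ j, a j • e j) = 1 / 4 * ∑ j, ∑ k, a j * (a k * hb B (e j) (e k)) := by
  simp only [lv, Fin.sum_univ_four, hb_add_left, hb_add_right, hb_smul_left, hb_smul_right]; ring

lemma qf_eq (ρ : Cn n → ℝ) (ξ ν : Cn n) (B : Xn n → Cn n →L[ℝ] Cn n →L[ℝ] ℝ) (p : Xn n) :
    qf ρ ξ ν B p = lv (rb (B p)) (XX ρ ξ ν p.1) := by
  rw [XX, lv_sum4, qf]

lemma XX_tan (ρ : Cn n → ℝ) (ξ ν z : Cn n) : fderiv ℝ ρ z (XX ρ ξ ν z) = 0 ∧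
    fderiv ℝ ρ z (I • XX ρ ξ ν z) = 0 := by
  have e : XX ρ ξ ν z = (fderiv ℝ ρ z ν) • ξ + (-fderiv ℝ ρ z (I • ν)) • (I • ξ) + (-fderiv ℝ ρ z ξ) • ν
      + (fderiv ℝ ρ z (I • ξ)) • (I • ν) := by
    rw [XX, Fin.sum_univ_four]; rfl
  refine ⟨?_, ?_⟩
  · rw [e]
    simp only [map_add, map_smulₛₗ, smul_eq_mul, RingHom.id_apply]; ring
  · rw [e, smul_add, smul_add, smul_add, I_smul_real, I_smul_real, I_smul_real, I_smul_real, II_smul, II_smul]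
    generalize hα : fderiv ℝ ρ z = l
    simp only [map_add, map_neg, smul_neg, neg_smul]
    rw [l.map_smul (l ν), l.map_smul (l (I • ν)) (ξ), l.map_smul (l ξ), l.map_smul (l (I • ξ)) ν]
    simp only [smul_eq_mul]; ring

lemma XX_at {ρ : Cn n → ℝ} {ξ ν z : Cn n} (h1 : fderiv ℝ ρ z ξ = 0) (h2 : fderiv ℝ ρ z (I • ξ) = 0)
    (h3 : fderiv ℝ ρ z (I • ν) = 0) : XX ρ ξ ν z = fderiv ℝ ρ z ν • ξ := by
  have e : XX ρ ξ ν z = (fderiv ℝ ρ z ν) • ξ + (-fderiv ℝ ρ z (I • ν)) • (I • ξ) + (-fderiv ℝ ρ z ξ) • ν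
      + (fderiv ℝ ρ z (I • ξ)) • (I • ν) := by
    rw [XX, Fin.sum_univ_four]; rfl
  rw [e, h1, h2, h3]; simp

lemma ev_norm {ξ ν : Cn n} {N : ℝ} (hN : 1 ≤ N) (hξ : ‖ξ‖ = 1) (hν : ‖ν‖ ≤ N) (j : Fin 4) : ‖ev ξ ν j‖ ≤ N := by
  fin_cases j
  · change ‖ξ‖ ≤ N; linarith
  · change ‖I • ξ‖ ≤ N; rw [norm_II]; linarith
  · exact hν
  · change ‖I • ν‖ ≤ N; rw [norm_II]; exact hν

lemma lip3 {a b g a' b' g' A G K d : ℝ} (ha : |a| ≤ A) (hb : |b| ≤ A) (ha' : |a'| ≤ A)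
    (hg : |g| ≤ G) (hb' : |b'| ≤ A) (h1 : |a - a'| ≤ K * d) (h2 : |b - b'| ≤ K * d)
    (h3 : |g - g'| ≤ K * d) : |a * (b * g) - a' * (b' * g')| ≤ (2 * (A * G) + A ^ 2) * (K * d) := by
  have hA : 0 ≤ A := (abs_nonneg _).trans ha
  have hG : 0 ≤ G := (abs_nonneg _).trans hg
  have hKd : 0 ≤ K * d := (abs_nonneg _).trans h1
  have e : a * (b * g) - a' * (b' * g') = (a - a') * (b * g) + a' * ((b - b') * g) + a' * (b' * (g - g')) := by ring
  have k1 : |(a - a') * (b * g)| ≤ K * d * (A * G) := by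
    rw [abs_mul, abs_mul]; gcongr
  have k2 : |a' * ((b - b') * g)| ≤ A * (K * d * G) := by
    rw [abs_mul, abs_mul]; gcongr
  have k3 : |a' * (b' * (g - g'))| ≤ A * (A * (K * d)) := by
    rw [abs_mul, abs_mul]; gcongr
  rw [e]
  refine (abs_add_le _ _).trans ((add_le_add (abs_add_le _ _) le_rfl).trans ?_)
  linarith

section
variable {Ω : Set (Cn n)} {ρ : Cn n → ℝ} {c T : ℝ}

lemma qf_lip {K R N : ℝ}
    (hK : 0 ≤ K) (hR : 0 ≤ R) (hN : 1 ≤ N) (hR1 : ∀ z ∈ closure Ω, ‖fderiv ℝ ρ z‖ ≤ R)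
    (hR2 : ∀ z ∈ closure Ω, ‖fderiv ℝ (fderiv ℝ ρ) z‖ ≤ R)
    (hK1 : ∀ z ∈ closure Ω, ∀ y ∈ closure Ω, ∀ v, |fderiv ℝ ρ z v - fderiv ℝ ρ y v| ≤ K * ‖v‖ * ‖z - y‖)
    (hK2 : ∀ z ∈ closure Ω, ∀ y ∈ closure Ω, ∀ v w,
      |fderiv ℝ (fderiv ℝ ρ) z v w - fderiv ℝ (fderiv ℝ ρ) y v w| ≤ K * (‖v‖ * ‖w‖) * ‖z - y‖)
    {ξ ν : Cn n} (hξ : ‖ξ‖ = 1) (hν : ‖ν‖ ≤ N) {z y : Cn n} (hz : z ∈ closure Ω) (hy : y ∈ closure Ω) :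
    |lv (rb (fderiv ℝ (fderiv ℝ ρ) z)) (XX ρ ξ ν z) - lv (rb (fderiv ℝ (fderiv ℝ ρ) y)) (XX ρ ξ ν y)|
      ≤ 4 * ((2 * (R * N * (2 * (R * N ^ 2))) + (R * N) ^ 2) * (2 * K * N ^ 2)) * ‖z - y‖ := by
  have hd := norm_nonneg (z - y)
  have hNN : N ≤ N ^ 2 := by rw [sq]; exact le_mul_of_one_le_left (by linarith) hN
  have a0 : ∀ v : Cn n, ‖v‖ ≤ N → ∀ z ∈ closure Ω, |fderiv ℝ ρ z v| ≤ R * N := fun v hv z hz => by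
    rw [← Real.norm_eq_abs]
    exact ((fderiv ℝ ρ z).le_of_opNorm_le (hR1 z hz) v).trans (by gcongr)
  have a1 : ∀ v : Cn n, ‖v‖ ≤ N → |fderiv ℝ ρ z v - fderiv ℝ ρ y v| ≤ 2 * K * N ^ 2 * ‖z - y‖ := fun v hv => by
    refine (hK1 z hz y hy v).trans ?_
    have : K * ‖v‖ ≤ 2 * K * N ^ 2 := by
      have : K * ‖v‖ ≤ K * N ^ 2 := by gcongr; linarith
      have : 0 ≤ K * N ^ 2 := by positivity
      linarith
    gcongr
  have nξ : ‖ξ‖ ≤ N := by rw [hξ]; exact hN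
  have nIξ : ‖I • ξ‖ ≤ N := by rw [norm_II]; exact nξ
  have nIν : ‖I • ν‖ ≤ N := by rw [norm_II]; exact hν
  have b0 : ∀ j, ∀ z ∈ closure Ω, |av ρ ξ ν j z| ≤ R * N := fun j z hz => by
    fin_cases j
    · exact a0 ν hν z hz
    · change |-_| ≤ _; rw [abs_neg]; exact a0 _ nIν z hz
    · change |-_| ≤ _; rw [abs_neg]; exact a0 _ nξ z hz
    · exact a0 _ nIξ z hz
  have b1 : ∀ j, |av ρ ξ ν j z - av ρ ξ ν j y| ≤ 2 * K * N ^ 2 * ‖z - y‖ := fun j => by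
    fin_cases j
    · exact a1 ν hν
    · change |-_ - -_| ≤ _; rw [← neg_sub', abs_neg]; exact a1 _ nIν
    · change |-_ - -_| ≤ _; rw [← neg_sub', abs_neg]; exact a1 _ nξ
    · exact a1 _ nIξ
  have hb0 : ∀ v w : Cn n, ‖v‖ ≤ N → ‖w‖ ≤ N → |hb (rb (fderiv ℝ (fderiv ℝ ρ) z)) v w| ≤ 2 * (R * N ^ 2) := by
    intro v w hv hw
    have k : ∀ v w : Cn n, ‖v‖ ≤ N → ‖w‖ ≤ N → |fderiv ℝ (fderiv ℝ ρ) z v w| ≤ R * N ^ 2 := fun v w hv hw => by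
      rw [← Real.norm_eq_abs, sq, ← mul_assoc]
      refine ((fderiv ℝ (fderiv ℝ ρ) z).le_opNorm₂ v w).trans ?_
      have := hR2 z hz
      gcongr
    refine (abs_add_le _ _).trans ?_
    have h1 := k v w hv hw
    have h2 := k (I • v) (I • w) (by rwa [norm_II]) (by rwa [norm_II])
    change |fderiv ℝ (fderiv ℝ ρ) z v w| + |fderiv ℝ (fderiv ℝ ρ) z (I • v) (I • w)| ≤ _
    linarith
  have hb1 : ∀ v w : Cn n, ‖v‖ ≤ N → ‖w‖ ≤ N →
      |hb (rb (fderiv ℝ (fderiv ℝ ρ) z)) v w - hb (rb (fderiv ℝ (fderiv ℝ ρ) y)) v w| ≤ 2 * K * N ^ 2 * ‖z - y‖ := by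
    intro v w hv hw
    have k : ∀ v w : Cn n, ‖v‖ ≤ N → ‖w‖ ≤ N →
        |fderiv ℝ (fderiv ℝ ρ) z v w - fderiv ℝ (fderiv ℝ ρ) y v w| ≤ K * N ^ 2 * ‖z - y‖ := fun v w hv hw => by
      refine (hK2 z hz y hy v w).trans ?_
      rw [sq]; gcongr
    have h1 := k v w hv hw
    have h2 := k (I • v) (I • w) (by rwa [norm_II]) (by rwa [norm_II])
    have e : hb (rb (fderiv ℝ (fderiv ℝ ρ) z)) v w - hb (rb (fderiv ℝ (fderiv ℝ ρ) y)) v w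
      = (fderiv ℝ (fderiv ℝ ρ) z v w - fderiv ℝ (fderiv ℝ ρ) y v w)
        + (fderiv ℝ (fderiv ℝ ρ) z (I • v) (I • w) - fderiv ℝ (fderiv ℝ ρ) y (I • v) (I • w)) := by
      simp only [hb, rb_apply]; ring
    rw [e]
    exact (abs_add_le _ _).trans (by linarith)
  rw [XX, lv_sum4, XX, lv_sum4, ← mul_sub, abs_mul, ← Finset.sum_sub_distrib]
  have key : |∑ j : Fin 4, (∑ k, av ρ ξ ν j z * (av ρ ξ ν k z * hb (rb (fderiv ℝ (fderiv ℝ ρ) z)) (ev ξ ν j) (ev ξ ν k))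
      - ∑ k, av ρ ξ ν j y * (av ρ ξ ν k y * hb (rb (fderiv ℝ (fderiv ℝ ρ) y)) (ev ξ ν j) (ev ξ ν k)))|
      ≤ ∑ j : Fin 4, ∑ k : Fin 4, ((2 * (R * N * (2 * (R * N ^ 2))) + (R * N) ^ 2) * (2 * K * N ^ 2 * ‖z - y‖)) := by
    refine (Finset.abs_sum_le_sum_abs _ _).trans (Finset.sum_le_sum fun j _ => ?_)
    rw [← Finset.sum_sub_distrib]
    refine (Finset.abs_sum_le_sum_abs _ _).trans (Finset.sum_le_sum fun k _ => ?_)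
    exact lip3 (b0 j z hz) (b0 k z hz) (b0 j y hy) (hb0 _ _ (ev_norm hN hξ hν j) (ev_norm hN hξ hν k)) (b0 k y hy)
      (b1 j) (b1 k) (hb1 _ _ (ev_norm hN hξ hν j) (ev_norm hN hξ hν k))
  rw [Finset.sum_const, Finset.sum_const, Finset.card_univ, Fintype.card_fin, nsmul_eq_mul, nsmul_eq_mul] at key
  push_cast at key
  rw [abs_of_pos (by norm_num : (0 : ℝ) < 1 / 4)]
  linarith

end

/-- comparison function -/
def Pf (Ω : Set (Cn n)) (ρ : Cn n → ℝ) (φ : Xn n → ℝ) (ξ ν : Cn n) (κ t1 R0 : ℝ) (p : Xn n) : ℝ :=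
  (κ * (p.2 - t1) ^ n - qf ρ ξ ν (D2 Ω φ) p * (2 * R0⁻¹ - (R0 ^ 2)⁻¹ *
    qf ρ ξ ν (fun p => fderiv ℝ (fderiv ℝ ρ) p.1) p)) * fderiv ℝ ρ p.1 ν

lemma theta_bc (Ω : Set (Cn n)) {T t1 : ℝ} (hT : 0 < T) (h1 : t1 ∈ Ioo 0 T) :
    BC Ω T (T ^ n + n * T ^ (n - 1)) (fun p => (p.2 - t1) ^ n) := by
  have hs : ContDiff ℝ ((⊤ : ℕ∞) : WithTop ℕ∞) (fun t : ℝ => (t - t1) ^ n) := by fun_prop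
  have ha : ∀ t ∈ Ioo 0 T, |t - t1| ≤ T := fun t ht => by
    rw [abs_le]; constructor <;> linarith [ht.1, ht.2, h1.1, h1.2]
  have p1 : 0 ≤ T ^ n := by positivity
  have p2 : 0 ≤ n * T ^ (n - 1) := by positivity
  refine ⟨Sm.time hs, B2.time hs (by linarith) (fun t ht => ?_) fun t ht => ?_⟩
  · rw [abs_pow]
    have := pow_le_pow_left₀ (abs_nonneg _) (ha t ht) n
    linarith
  · have e : HasDerivAt (fun t : ℝ => (t - t1) ^ n) (n * (t - t1) ^ (n - 1) * 1) t :=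
      ((hasDerivAt_id t).sub_const t1).pow n
    rw [e.deriv, mul_one, abs_mul, abs_pow, Nat.abs_cast]
    have := mul_le_mul_of_nonneg_left (pow_le_pow_left₀ (abs_nonneg _) (ha t ht) (n - 1)) (Nat.cast_nonneg (α := ℝ) n)
    linarith

section
variable {Ω : Set (Cn n)} {ρ : Cn n → ℝ} {c T : ℝ}

set_option maxHeartbeats 800000 in
lemma P_bc (h : Dom Ω ρ c) (hT : 0 < T) (Cp : ℝ) {N r : ℝ} (hN : 1 ≤ N) (hr : 0 < r) :
    ∃ K, 0 ≤ K ∧ ∀ (Cu Cf : ℝ) (u φ : Xn n → ℝ) (f : ℝ × Cn n × ℝ → ℝ), Sol Ω ρ c T Cu Cp Cf u φ f →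
      ∀ (ξ ν : Cn n) (κ t1 R0 : ℝ), ‖ξ‖ = 1 → ‖ν‖ ≤ N → 0 ≤ κ → κ ≤ 1 → t1 ∈ Ioo 0 T → r ≤ R0 →
        BC Ω T K (Pf Ω ρ φ ξ ν κ t1 R0) ∧ BC Ω T K (qf ρ ξ ν (D2 Ω φ)) := by
  obtain ⟨R, hR, hR0, hR1, hR2, hR3, hRb⟩ := h.bds
  obtain ⟨hb0, hb1, hb2, hb3⟩ := hRb T
  have hO : IsOpen (Ω ×ˢ Ioo 0 T) := h.op.prod isOpen_Ioo
  have s1 : ContDiff ℝ ((⊤ : ℕ∞) : WithTop ℕ∞) (fderiv ℝ ρ) := h.sm.fderiv_right (by simp)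
  have s2 : ContDiff ℝ ((⊤ : ℕ∞) : WithTop ℕ∞) (fderiv ℝ (fderiv ℝ ρ)) := s1.fderiv_right (by simp)
  have c1 : ∀ v : Cn n, ‖v‖ ≤ N → BC Ω T (R * N) (fun p => fderiv ℝ ρ p.1 v) := fun v hv =>
    ⟨((s1.comp contDiff_fst).clm_apply contDiff_const).contDiffOn, (hb1 v).mono (by gcongr)⟩
  have c2 : ∀ v w : Cn n, ‖v‖ ≤ N → ‖w‖ ≤ N → BC Ω T (R * (N * N)) (fun p => fderiv ℝ (fderiv ℝ ρ) p.1 v w) :=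
    fun v w hv hw => ⟨(((s2.comp contDiff_fst).clm_apply contDiff_const).clm_apply contDiff_const).contDiffOn,
      (hb2 v w).mono (by gcongr)⟩
  set K1 := |(1 / 4 : ℝ)| * (4 * (4 * (4 * (R * N * (4 * (R * N * (|Cp| * (N * N) + |Cp| * (N * N)))))))) with hK1
  set K2 := |(1 / 4 : ℝ)| * (4 * (4 * (4 * (R * N * (4 * (R * N * (R * (N * N) + R * (N * N)))))))) with hK2
  set K3 := 4 * ((1 * (T ^ n + n * T ^ (n - 1)) + 4 * (K1 * (2 * r⁻¹ + (r ^ 2)⁻¹ * K2))) * (R * N)) with hK3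
  have k1 : 0 ≤ K1 := by positivity
  have k2 : 0 ≤ K2 := by positivity
  have k3 : 0 ≤ K3 := by positivity
  refine ⟨K1 + K3, by linarith, fun Cu Cf u φ f S ξ ν κ t1 R0 hξ hν hκ0 hκ1 ht1 hR0r => ?_⟩
  have nξ : ‖ξ‖ ≤ N := by rw [hξ]; exact hN
  have nIξ : ‖I • ξ‖ ≤ N := by rw [norm_II]; exact nξ
  have nIν : ‖I • ν‖ ≤ N := by rw [norm_II]; exact hν
  have en := ev_norm hN hξ hν
  have eIn : ∀ j, ‖I • ev ξ ν j‖ ≤ N := fun j => by rw [norm_II]; exact en j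
  have ba : ∀ j, BC Ω T (R * N) (fun p => av ρ ξ ν j p.1) := fun j => by
    fin_cases j
    · exact c1 ν hν
    · exact (c1 _ nIν).neg hO
    · exact (c1 _ nξ).neg hO
    · exact c1 _ nIξ
  have c3 : ∀ v w : Cn n, ‖v‖ ≤ N → ‖w‖ ≤ N → BC Ω T (|Cp| * (N * N)) (fun p => D2 Ω φ p v w) := fun v w hv hw =>
    ⟨smD2_sm h S.φS v w, ((S.phi2 hT v w).congr hO fun p hp => D2_pd h S.φQ hp v w).mono (by
      have := le_abs_self Cp
      gcongr)⟩
  have bφ : BC Ω T K1 (qf ρ ξ ν (D2 Ω φ)) :=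
    BC.quad (g := fun j k p => hb (rb (D2 Ω φ p)) (ev ξ ν j) (ev ξ ν k)) hO ba fun j k =>
      (c3 _ _ (en j) (en k)).add hO (c3 _ _ (eIn j) (eIn k))
  have bρ : BC Ω T K2 (qf ρ ξ ν (fun p => fderiv ℝ (fderiv ℝ ρ) p.1)) :=
    BC.quad (g := fun j k p => hb (rb (fderiv ℝ (fderiv ℝ ρ) p.1)) (ev ξ ν j) (ev ξ ν k)) hO ba fun j k =>
      (c2 _ _ (en j) (en k)).add hO (c2 _ _ (eIn j) (eIn k))
  have hR0p : 0 < R0 := hr.trans_le hR0r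
  have bq : BC Ω T (2 * r⁻¹ + (r ^ 2)⁻¹ * K2)
      (fun p => 2 * R0⁻¹ - (R0 ^ 2)⁻¹ * qf ρ ξ ν (fun p => fderiv ℝ (fderiv ℝ ρ) p.1) p) := by
    refine ((BC.const (2 * R0⁻¹)).sub hO (bρ.cmul hO (R0 ^ 2)⁻¹)).mono ?_
    rw [abs_of_pos (by positivity), abs_of_pos (by positivity)]
    gcongr
  have bθ : BC Ω T (1 * (T ^ n + n * T ^ (n - 1))) (fun p : Xn n => κ * (p.2 - t1) ^ n) := by
    refine ((theta_bc Ω hT ht1).cmul hO κ).mono ?_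
    rw [abs_of_nonneg hκ0]
    gcongr
  exact ⟨((bθ.sub hO (bφ.mul hO bq)).mul hO (c1 ν hν)).mono (by linarith), bφ.mono (by linarith)⟩

end


/-! ### Lower bound for complex tangential second derivatives -/

lemma near_arith {k F Rz R0 β g lu : ℝ} (hβ : 0 < β) (hRz : 0 < Rz) (hR0 : 0 < R0)
    (hm : k * Rz ≤ lu) (ht : β * (lu - F) = g * Rz) :
    (k - F * (2 * R0⁻¹ - (R0 ^ 2)⁻¹ * Rz)) * β - g ≤ β * F * (Rz - R0) ^ 2 / (Rz * R0 ^ 2) := by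
  have e : g = β * (lu - F) / Rz := by rw [ht]; field_simp
  have h1 : β * (k * Rz - F) / Rz ≤ g := by
    rw [e]; gcongr
  have h2 : (k - F * (2 * R0⁻¹ - (R0 ^ 2)⁻¹ * Rz)) * β - β * (k * Rz - F) / Rz
      = β * F * (Rz - R0) ^ 2 / (Rz * R0 ^ 2) := by
    field_simp; ring
  linarith

lemma near_eq {k F R0 β g lu : ℝ} (hR0 : 0 < R0)
    (hm : k * R0 = lu) (ht : β * (lu - F) = g * R0) :
    (k - F * (2 * R0⁻¹ - (R0 ^ 2)⁻¹ * R0)) * β - g = 0 := by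
  have e : g = β * (lu - F) / R0 := by rw [ht]; field_simp
  rw [e, ← hm]; field_simp; ring

lemma near_bd {β F Rz R0 H K Kr d r : ℝ} (hβ : 0 < β) (hβH : β ≤ H) (hF : |F| ≤ K) (hr : 0 < r) (hR0 : r ≤ R0)
    (hRz : R0 / 2 ≤ Rz) (hl : |Rz - R0| ≤ Kr * d) :
    β * F * (Rz - R0) ^ 2 / (Rz * R0 ^ 2) ≤ H * K * Kr ^ 2 / (r / 2 * r ^ 2) * d ^ 2 := by
  have hR0p : 0 < R0 := by linarith
  have hRzp : 0 < Rz := by linarith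
  have hK : 0 ≤ K := (abs_nonneg _).trans hF
  have hH : 0 ≤ H := by linarith
  have h1 : β * F ≤ H * K := by
    refine (mul_le_mul_of_nonneg_left ((le_abs_self F).trans hF) hβ.le).trans ?_
    gcongr
  have h2 : (Rz - R0) ^ 2 ≤ (Kr * d) ^ 2 := by
    rw [← sq_abs (Rz - R0)]; gcongr
  have h3 : r / 2 * r ^ 2 ≤ Rz * R0 ^ 2 := by
    have : r / 2 ≤ Rz := by linarith
    gcongr
  calc _ ≤ (H * K) * (Kr * d) ^ 2 / (r / 2 * r ^ 2) := by
        refine div_le_div₀ (by positivity) ?_ (by positivity) h3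
        exact mul_le_mul h1 h2 (sq_nonneg _) (by positivity)
    _ = _ := by ring

section
variable {Ω : Set (Cn n)} {ρ : Cn n → ℝ} {c T Cu Cp Cf ε M : ℝ} {u φ : Xn n → ℝ} {f : ℝ × Cn n × ℝ → ℝ}

lemma Sol.tan_lv (S : Sol Ω ρ c T Cu Cp Cf u φ f) (hε : 0 < ε) (E : Est2 Ω ρ T u φ f ε M)
    {z : Cn n} (hz : z ∈ frontier Ω) {t : ℝ} (ht : t ∈ Ico ε T)
    {X : Cn n} (h1 : fderiv ℝ ρ z X = 0) (h2 : fderiv ℝ ρ z (I • X) = 0) (y : Cn n) :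
    fderiv ℝ ρ z y * (lv (rb (D2 Ω u (z, t))) X - lv (rb (D2 Ω φ (z, t))) X)
      = gw Ω u φ y (z, t) * lv (rb (fderiv ℝ (fderiv ℝ ρ) z)) X := by
  have k1 := S.tang hε E hz ht h1 h1 y
  have k2 := S.tang hε E hz ht h2 h2 y
  rw [hw] at k1 k2
  rw [lv_rb, lv_rb, lv_rb]
  linear_combination (k1 + k2) / 4

end

lemma far_bd {W d r0 X : ℝ} (hX : 0 ≤ X) (hW : W ≤ X) (hr : 0 < r0) (hd : r0 ≤ d) : W ≤ X / r0 ^ 2 * d ^ 2 := by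
  have : X = X / r0 ^ 2 * r0 ^ 2 := by field_simp
  have h2 : X / r0 ^ 2 * r0 ^ 2 ≤ X / r0 ^ 2 * d ^ 2 := by gcongr
  linarith

lemma fin_arith {Mi Λ θ T R κ r1 : ℝ} {n : ℕ} (hn : 0 < n) (hΛ : 0 < Λ) (hθ : 0 < θ) (hθT : θ ≤ T) (hR : 0 < R)
    (hκ : 0 < κ) (hr : r1 ≤ R) (h : Mi ≤ (Λ / θ) ^ (n - 1) * (κ * θ ^ n * r1)) :
    Mi / (Λ ^ (n - 1) * (T * R)) ≤ κ := by
  obtain ⟨k, rfl⟩ := Nat.exists_eq_succ_of_ne_zero hn.ne'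
  simp only [Nat.succ_eq_add_one, Nat.add_sub_cancel] at *
  have hT : 0 < T := by linarith
  rw [div_le_iff₀ (by positivity)]
  refine h.trans ?_
  have e : (Λ / θ) ^ k * (κ * θ ^ (k + 1) * r1) = κ * (Λ ^ k * (θ * r1)) := by
    rw [div_pow, pow_succ]; field_simp
  rw [e]
  have : θ * r1 ≤ T * R := (mul_le_mul_of_nonneg_left hr hθ.le).trans (by gcongr)
  gcongr

set_option maxHeartbeats 3200000 in
lemma E6core {Ω : Set (Cn n)} {ρ : Cn n → ℝ} {c T : ℝ} (hn : 0 < n) (h : Dom Ω ρ c) (hT : 0 < T)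
    {Cp Cf : ℝ} (Cu : ℝ) (hCp : 0 ≤ Cp) (hCf : 0 ≤ Cf) {t1 : ℝ} (ht1 : 0 < t1) :
    ∃ m, 0 < m ∧ ∀ u φ f, Sol Ω ρ c T Cu Cp Cf u φ f → ∀ z0 ∈ frontier Ω, ∀ t0 ∈ Ioo t1 T, ∀ ξ : Cn n, ‖ξ‖ = 1 →
      fderiv ℝ ρ z0 ξ = 0 → fderiv ℝ ρ z0 (I • ξ) = 0 → ∀ κ, 0 < κ → κ ≤ 1 →
      κ * (t0 - t1) ^ n * lv (rb (fderiv ℝ (fderiv ℝ ρ) z0)) ξ = lv (rb (D2 Ω u (z0, t0))) ξ →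
      (∀ z ∈ frontier Ω, ∀ t ∈ Icc t1 t0, ∀ X, fderiv ℝ ρ z X = 0 → fderiv ℝ ρ z (I • X) = 0 →
        κ * (t - t1) ^ n * lv (rb (fderiv ℝ (fderiv ℝ ρ) z)) X ≤ lv (rb (D2 Ω u (z, t))) X) → m ≤ κ := by
  obtain ⟨M, hM, kM⟩ := est12 hn h hT Cu Cp Cf ht1
  obtain ⟨b, N, hb, hN, kν⟩ := h.nu
  obtain ⟨M5, hM5, k5⟩ := E5 hn h hT Cu Cp Cf ht1 hb hN
  obtain ⟨R, hR, hR0, hR1, hR2, hR3, -⟩ := h.bds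
  obtain ⟨K, hK, hK1, hK2⟩ := h.lip
  have hc := h.cpos
  have hRp : 0 < R := by linarith
  have hNp : 0 < N := by linarith
  obtain ⟨KP, hKP, kP⟩ := P_bc h hT Cp hN (r := c * b ^ 2) (by positivity)
  set r := c * b ^ 2 with hr
  have hrp : 0 < r := by positivity
  set Kr := 4 * ((2 * (R * N * (2 * (R * N ^ 2))) + (R * N) ^ 2) * (2 * K * N ^ 2)) with hKr
  have hKr0 : 0 ≤ Kr := by positivity
  set Y := KP + (M + Cp) * N with hY
  have hY0 : 0 ≤ Y := by positivity
  set Z := KP + (Cf * (1 + M) + Cp) * N with hZ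
  have hZ0 : 0 ≤ Z := by positivity
  set r0 := (1 + 2 * (K * N) / b + 2 * Kr / r)⁻¹ with hr0
  have hr0p : 0 < r0 := by positivity
  set C1 := R * N * KP * Kr ^ 2 / (r / 2 * r ^ 2) with hC1
  have hC10 : 0 ≤ C1 := by positivity
  set C2 := Y / r0 ^ 2 with hC2
  have hC20 : 0 ≤ C2 := by positivity
  set C := Y + Z + C1 + C2 with hC
  have hC0 : 0 ≤ C := by positivity
  obtain ⟨A, hA, kA⟩ := barrier hn h hT hC0 hM
  set G1 := A * N + T * (KP * N) + T * (Cp * N ^ 2) with hG1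
  have hG10 : 0 ≤ G1 := by positivity
  set M2 := M5 + ((M + Cp) * N * R / b + Cp) with hM2
  have hM20 : 0 ≤ M2 := by positivity
  set Λ0 := M2 * (1 + R / b * N) ^ 2 + 2 * (R / b) * M2 * (1 + R / b * N) with hΛ0
  have hΛ00 : 0 ≤ Λ0 := by positivity
  set Λ := T * Λ0 + (R / b) ^ 2 * G1 + 1 with hΛ
  have hΛp : 0 < Λ := by positivity
  refine ⟨M⁻¹ / (Λ ^ (n - 1) * (T * R)), by positivity, fun u φ f S z0 hz0 t0 ht0 ξ hξ hξ1 hξ2 κ hκ hκ1 heq hmax => ?_⟩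
  have E := kM u φ f S
  obtain ⟨ν, hν, hν1, hν2⟩ := kν z0 hz0
  have hNu : Nu ρ b N z0 ν := ⟨hb, hν, hν1, hν2⟩
  have hz0c := frontier_subset_closure hz0
  have ht0' : t0 ∈ Ioo 0 T := ⟨ht1.trans ht0.1, ht0.2⟩
  have ht0I : t0 ∈ Ico t1 T := ⟨ht0.1.le, ht0.2⟩
  have ht1' : t1 ∈ Ioo 0 T := ⟨ht1, ht0.1.trans ht0.2⟩
  have hO := S.opQ
  have hθ : 0 < t0 - t1 := sub_pos.2 ht0.1
  have hθT : t0 - t1 ≤ T := by linarith [ht0.2]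
  have hβ0 : 0 < fderiv ℝ ρ z0 ν := hb.trans_le hν2
  -- the quadratic form of rho along the field
  set Rq : Cn n → ℝ := fun z => lv (rb (fderiv ℝ (fderiv ℝ ρ) z)) (XX ρ ξ ν z) with hRq
  have eX0 : XX ρ ξ ν z0 = fderiv ℝ ρ z0 ν • ξ := XX_at hξ1 hξ2 hν1
  have hR0r : r ≤ Rq z0 := by
    have := h.levi z0 hz0c (XX ρ ξ ν z0)
    rw [eX0, norm_smul, hξ, mul_one, Real.norm_eq_abs, sq_abs] at this
    rw [hRq]; dsimp only
    rw [eX0]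
    refine le_trans ?_ this
    rw [hr]; gcongr
  have hR0p : 0 < Rq z0 := hrp.trans_le hR0r
  obtain ⟨bP, bφ⟩ := kP Cu Cf u φ f S ξ ν κ t1 (Rq z0) hξ hν hκ.le hκ1 ht1' hR0r
  have ePf : ∀ z t, Pf Ω ρ φ ξ ν κ t1 (Rq z0) (z, t) = (κ * (t - t1) ^ n - lv (rb (D2 Ω φ (z, t))) (XX ρ ξ ν z) *
      (2 * (Rq z0)⁻¹ - (Rq z0 ^ 2)⁻¹ * Rq z)) * fderiv ℝ ρ z ν := fun z t => by
    rw [Pf, qf_eq, qf_eq]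
  obtain ⟨gs, gc, -⟩ := S.gws ν
  have hbound : ∀ p ∈ closure Ω ×ˢ Ico t1 T, Pf Ω ρ φ ξ ν κ t1 (Rq z0) p - gw Ω u φ ν p ≤ Y := fun p hp => by
    have h1 := (bP.cl h (p := p) ⟨hp.1, ht1.trans_le hp.2.1, hp.2.2⟩).1
    have h2 := S.gw_bd hT ht1 E hp ν
    have h3 : (M + Cp) * ‖ν‖ ≤ (M + Cp) * N := by gcongr
    rw [hY]
    linarith [le_abs_self (Pf Ω ρ φ ξ ν κ t1 (Rq z0) p), neg_abs_le (gw Ω u φ ν p)]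
  obtain ⟨L2, hL2, kL2⟩ := S.gw_has hz0c ht0' ν
  have kL1 := d1_has ((bP.sm.reg2 h).d t0 ht0') hz0c
  have key := kA Cu Cp Cf u φ f S t1 t0 ht1 ht0.1 ht0.2 E.e1.dup z0 hz0
    (fun p => Pf Ω ρ φ ξ ν κ t1 (Rq z0) p - gw Ω u φ ν p) (bP.b2.sm.sub gs) (bP.sm.continuousOn.sub gc)
    (fun p hp hp2 D c' hF => ⟨?_, ?_⟩) (fun z hz t ht => ?_) ?_ _ (kL1.sub kL2) ν hβ0
  rotate_left
  · have hS := SS_nonneg c'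
    rw [heat_sub hO bP.b2.sm gs hp]
    have h1 := bP.b2.heat hp c'
    have h2 := S.gw_heat hT ht1 E hp hp2 hF ν
    have h3 : (Cf * (1 + M) + Cp) * ‖ν‖ * (1 + SS c') ≤ (Cf * (1 + M) + Cp) * N * (1 + SS c') := by gcongr
    have h4 : Z * (1 + SS c') ≤ C * (1 + SS c') := by
      have : Z ≤ C := by rw [hC]; linarith only [hY0, hC10, hC20]
      gcongr
    have h5 : Z * (1 + SS c') = KP * (1 + SS c') + (Cf * (1 + M) + Cp) * N * (1 + SS c') := by rw [hZ]; ring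
    linarith only [h1, h2, h3, h4, h5, le_abs_self (heat c' (Pf Ω ρ φ ξ ν κ t1 (Rq z0)) p),
      neg_abs_le (heat c' (gw Ω u φ ν) p)]
  · refine (hbound p ⟨subset_closure hp.1, hp2, hp.2.2⟩).trans ?_
    rw [hC]; linarith only [hZ0, hC10, hC20]
  · have hzc := frontier_subset_closure hz
    have htI : t ∈ Ico t1 T := ⟨ht.1, ht.2.trans_lt ht0.2⟩
    have htI' : t ∈ Ioo 0 T := ⟨ht1.trans_le ht.1, htI.2⟩
    rcases le_total r0 ‖z - z0‖ with hd | hd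
    · refine (far_bd hY0 (hbound (z, t) ⟨hzc, htI⟩) hr0p hd).trans ?_
      have : Y / r0 ^ 2 ≤ C := by rw [hC]; linarith only [hY0, hZ0, hC10]
      gcongr
    · have hd0 := norm_nonneg (z - z0)
      have hd1 : ‖z - z0‖ * (1 + 2 * (K * N) / b + 2 * Kr / r) ≤ 1 := by
        have hp : 0 < 1 + 2 * (K * N) / b + 2 * Kr / r := by positivity
        rw [hr0] at hd
        calc _ ≤ (1 + 2 * (K * N) / b + 2 * Kr / r)⁻¹ * (1 + 2 * (K * N) / b + 2 * Kr / r) := by gcongr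
          _ = 1 := inv_mul_cancel₀ hp.ne'
      have hd2 : K * N * ‖z - z0‖ ≤ b / 2 := by
        have e1 : 2 * (K * N) / b * ‖z - z0‖ ≤ 1 := by
          have : 0 ≤ ‖z - z0‖ * (2 * Kr / r) := by positivity
          linarith only [hd1, this, hd0]
        have e2 : K * N * ‖z - z0‖ = 2 * (K * N) / b * ‖z - z0‖ * (b / 2) := by field_simp
        rw [e2]
        exact (mul_le_mul_of_nonneg_right e1 (by positivity)).trans_eq (one_mul _)
      have hd3 : Kr * ‖z - z0‖ ≤ r / 2 := by
        have e1 : 2 * Kr / r * ‖z - z0‖ ≤ 1 := by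
          have : 0 ≤ ‖z - z0‖ * (2 * (K * N) / b) := by positivity
          linarith only [hd1, this, hd0]
        have e2 : Kr * ‖z - z0‖ = 2 * Kr / r * ‖z - z0‖ * (r / 2) := by field_simp
        rw [e2]
        exact (mul_le_mul_of_nonneg_right e1 (by positivity)).trans_eq (one_mul _)
      have hβ : 0 < fderiv ℝ ρ z ν := by
        have h1 := hK1 z hzc z0 hz0c ν
        have h2 : K * ‖ν‖ * ‖z - z0‖ ≤ K * N * ‖z - z0‖ := by gcongr
        have h3 := neg_abs_le (fderiv ℝ ρ z ν - fderiv ℝ ρ z0 ν)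
        linarith only [h1, h2, h3, hd2, hν2, hb]
      have hβH : fderiv ℝ ρ z ν ≤ R * N := by
        refine (le_abs_self _).trans ?_
        rw [← Real.norm_eq_abs]
        exact ((fderiv ℝ ρ z).le_of_opNorm_le (hR1 z hzc) ν).trans (by gcongr)
      have hlip : |Rq z - Rq z0| ≤ Kr * ‖z - z0‖ :=
        qf_lip hK hRp.le hN hR1 hR2 hK1 hK2 hξ hν hzc hz0c
      have hRz : Rq z0 / 2 ≤ Rq z := by
        have := neg_abs_le (Rq z - Rq z0)
        linarith only [this, hlip, hd3, hR0r]
      have hRzp : 0 < Rq z := by linarith only [hRz, hR0p]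
      have hF : |lv (rb (D2 Ω φ (z, t))) (XX ρ ξ ν z)| ≤ KP := by
        have := (bφ.cl h (p := (z, t)) ⟨hzc, htI'⟩).1
        rwa [qf_eq] at this
      obtain ⟨x1, x2⟩ := XX_tan ρ ξ ν z
      rw [ePf]
      refine (near_arith hβ hRzp hR0p (hmax z hz t ht _ x1 x2) (S.tan_lv ht1 E hz htI x1 x2 ν)).trans
        ((near_bd hβ hβH hF hrp hR0r hRz hlip).trans ?_)
      have : C1 ≤ C := by rw [hC]; linarith only [hY0, hZ0, hC20]
      gcongr
  · rw [ePf]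
    obtain ⟨x1, x2⟩ := XX_tan ρ ξ ν z0
    refine near_eq hR0p (lu := lv (rb (D2 Ω u (z0, t0))) (XX ρ ξ ν z0)) ?_ (S.tan_lv ht1 E hz0 ht0I x1 x2 ν)
    rw [hRq]; dsimp only
    rw [eX0, lv_smul, lv_smul, ← heq]; ring
  have hBB := S.bb hT ht1 E hR1 hR2 hz0 ht0I hNu (by linarith only [hM5] : (0 : ℝ) ≤ M5) (k5 u φ f S z0 hz0 t0 ht0I ν hNu)
  have hnn : (t0 - t1) * D2 Ω u (z0, t0) ν ν ≤ G1 := by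
    rw [sub_apply, hL2, hw] at key
    have h1 := (bP.cl h (p := (z0, t0)) ⟨hz0c, ht0'⟩).2 ν
    have h2 := S.D2phi hT (p := (z0, t0)) ⟨hz0c, ht0'⟩ ν ν
    have h3 : (t0 - t1) * |D1 Ω (Pf Ω ρ φ ξ ν κ t1 (Rq z0)) (z0, t0) ν| ≤ T * (KP * N) := by
      have : KP * ‖ν‖ ≤ KP * N := by gcongr
      exact mul_le_mul hθT (h1.trans this) (abs_nonneg _) hT.le
    have h4 : (t0 - t1) * |D2 Ω φ (z0, t0) ν ν| ≤ T * (Cp * N ^ 2) := by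
      have : Cp * (‖ν‖ * ‖ν‖) ≤ Cp * N ^ 2 := by rw [sq]; gcongr
      exact mul_le_mul hθT (h2.trans this) (abs_nonneg _) hT.le
    have h5 : A * ‖ν‖ ≤ A * N := by gcongr
    have h6 := mul_le_mul_of_nonneg_left (le_abs_self (D1 Ω (Pf Ω ρ φ ξ ν κ t1 (Rq z0)) (z0, t0) ν)) hθ.le
    have h7 := mul_le_mul_of_nonneg_left (le_abs_self (D2 Ω φ (z0, t0) ν ν)) hθ.le
    have e : (t0 - t1) * D2 Ω u (z0, t0) ν ν = (t0 - t1) * -(D1 Ω (Pf Ω ρ φ ξ ν κ t1 (Rq z0)) (z0, t0) ν -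
        (D2 Ω u (z0, t0) ν ν - D2 Ω φ (z0, t0) ν ν)) + (t0 - t1) * D1 Ω (Pf Ω ρ φ ξ ν κ t1 (Rq z0)) (z0, t0) ν
        + (t0 - t1) * D2 Ω φ (z0, t0) ν ν := by ring
    rw [e, hG1]
    linarith only [key, h3, h4, h5, h6, h7]
  have hnn2 : D2 Ω u (z0, t0) ν ν ≤ G1 / (t0 - t1) := by
    rw [le_div_iff₀ hθ]; linarith only [hnn]
  have hlv : ∀ x, lv (rb (D2 Ω u (z0, t0))) x ≤ Λ / (t0 - t1) * ‖x‖ ^ 2 := fun x => by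
    refine (hBB.LA_lv (by positivity) hnn2 x).trans ?_
    refine mul_le_mul_of_nonneg_right ?_ (sq_nonneg _)
    rw [le_div_iff₀ hθ]
    have e : (Λ0 + (R / b) ^ 2 * (G1 / (t0 - t1))) * (t0 - t1) = (t0 - t1) * Λ0 + (R / b) ^ 2 * G1 := by
      field_simp
    have e2 : (t0 - t1) * Λ0 ≤ T * Λ0 := by gcongr
    rw [e, hΛ]
    linarith only [e2]
  obtain ⟨d1, d2, d3⟩ := S.detcl ht1 E.e1 (p := (z0, t0)) ⟨hz0c, ht0I⟩
  have hdet := det_upper' (B := rb (D2 Ω u (z0, t0))) hBB.sy d3 hlv ξ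
  rw [hξ, one_pow, mul_one, ← heq] at hdet
  refine fin_arith hn hΛp hθ hθT hRp hκ ?_ (d2.trans hdet)
  rw [lv_rb]
  have k : ∀ x : Cn n, ‖x‖ = 1 → fderiv ℝ (fderiv ℝ ρ) z0 x x ≤ R := fun x hx => by
    have := (fderiv ℝ (fderiv ℝ ρ) z0).le_opNorm₂ x x
    rw [hx, mul_one, mul_one, Real.norm_eq_abs] at this
    exact (le_abs_self _).trans (this.trans (hR2 z0 hz0c))
  have k1 := k ξ hξ
  have k2 := k (I • ξ) (by rw [norm_II, hξ])
  linarith only [k1, k2, hRp]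


lemma tan_scale {B B' : RB n} {l : Cn n →L[ℝ] ℝ} {k : ℝ}
    (h : ∀ ξ : Cn n, ‖ξ‖ = 1 → l ξ = 0 → l (I • ξ) = 0 → k * lv B ξ ≤ lv B' ξ) :
    ∀ X : Cn n, l X = 0 → l (I • X) = 0 → k * lv B X ≤ lv B' X := by
  intro X h1 h2
  rcases eq_or_ne X 0 with rfl | hX
  · simp [lv, hb]
  · have hp := norm_pos_iff.2 hX
    have e : X = ‖X‖ • (‖X‖⁻¹ • X) := by rw [smul_smul, mul_inv_cancel₀ hp.ne', one_smul]
    have := h (‖X‖⁻¹ • X) (by rw [norm_smul, norm_inv, norm_norm, inv_mul_cancel₀ hp.ne'])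
      (by rw [map_smul, h1, smul_zero]) (by rw [I_smul_real, l.map_smul (‖X‖⁻¹), h2, smul_zero])
    have e1 : lv B X = ‖X‖ ^ 2 * lv B (‖X‖⁻¹ • X) := by rw [← lv_smul, ← e]
    have e2 : lv B' X = ‖X‖ ^ 2 * lv B' (‖X‖⁻¹ • X) := by rw [← lv_smul, ← e]
    rw [e1, e2]
    have := mul_le_mul_of_nonneg_left this (sq_nonneg ‖X‖)
    linarith

set_option maxHeartbeats 800000 in
lemma E6 {Ω : Set (Cn n)} {ρ : Cn n → ℝ} {c T : ℝ} (hn : 0 < n) (h : Dom Ω ρ c) (hT : 0 < T)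
    {Cp Cf : ℝ} (Cu : ℝ) (hCp : 0 ≤ Cp) (hCf : 0 ≤ Cf) {ε : ℝ} (hε : 0 < ε) :
    ∃ m, 0 < m ∧ ∀ u φ f, Sol Ω ρ c T Cu Cp Cf u φ f → ∀ z ∈ frontier Ω, ∀ t ∈ Ico ε T, ∀ X : Cn n,
      fderiv ℝ ρ z X = 0 → fderiv ℝ ρ z (I • X) = 0 → m * ‖X‖ ^ 2 ≤ lv (rb (D2 Ω u (z, t))) X := by
  have hc := h.cpos
  obtain ⟨m, hm, km⟩ := E6core hn h hT Cu hCp hCf (half_pos hε)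
  obtain ⟨M, hM, kM⟩ := est12 hn h hT Cu Cp Cf (half_pos hε)
  set t1 := ε / 2 with ht1d
  have ht1 : 0 < t1 := half_pos hε
  have hm1 : 0 < min m 1 := lt_min hm one_pos
  refine ⟨min m 1 * t1 ^ n * c, by positivity, fun u φ f S z hz t ht X hX1 hX2 => ?_⟩
  have E := kM u φ f S
  have hlt : t1 < t := by linarith [ht.1]
  -- it suffices to compare with the Levi form of rho
  suffices H : min m 1 * (t - t1) ^ n * lv (rb (fderiv ℝ (fderiv ℝ ρ) z)) X ≤ lv (rb (D2 Ω u (z, t))) X by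
    refine le_trans ?_ H
    have h1 := h.levi z (frontier_subset_closure hz) X
    have h2 : t1 ≤ t - t1 := by linarith [ht.1]
    rw [mul_assoc]
    gcongr
  refine tan_scale (B := rb (fderiv ℝ (fderiv ℝ ρ) z)) (B' := rb (D2 Ω u (z, t))) (l := fderiv ℝ ρ z)
    (fun ξ hξ hξ1 hξ2 => ?_) X hX1 hX2
  clear hX1 hX2 X
  have s1 : ContDiff ℝ ((⊤ : ℕ∞) : WithTop ℕ∞) (fderiv ℝ ρ) := h.sm.fderiv_right (by simp)
  have cf1 : Continuous (fderiv ℝ ρ) := s1.continuous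
  have cf2 : Continuous (fderiv ℝ (fderiv ℝ ρ)) :=
    (s1.fderiv_right (m := ((⊤ : ℕ∞) : WithTop ℕ∞)) (by simp)).continuous
  let Kc : Set (Cn n × ℝ × Cn n) := (frontier Ω ×ˢ Icc t1 t ×ˢ sphere (0 : Cn n) 1) ∩
    {q | fderiv ℝ ρ q.1 q.2.2 = 0 ∧ fderiv ℝ ρ q.1 (I • q.2.2) = 0}
  have cI : Continuous fun q : Cn n × ℝ × Cn n => I • q.2.2 := by fun_prop
  have c22 : Continuous fun q : Cn n × ℝ × Cn n => q.2.2 := by fun_prop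
  have hKc : IsCompact Kc := by
    have hfr : IsCompact (frontier Ω) :=
      h.bd.isCompact_closure.of_isClosed_subset isClosed_frontier frontier_subset_closure
    refine (hfr.prod (isCompact_Icc.prod (isCompact_sphere _ _))).inter_right ?_
    exact (isClosed_eq ((cf1.comp continuous_fst).clm_apply c22) continuous_const).inter
      (isClosed_eq ((cf1.comp continuous_fst).clm_apply cI) continuous_const)
  have hmem : ∀ q ∈ Kc, (q.1, q.2.1) ∈ closure Ω ×ˢ Ico t1 T := fun q hq =>
    ⟨frontier_subset_closure hq.1.1, hq.1.2.1.1, hq.1.2.1.2.trans_lt ht.2⟩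
  have hpos : ∀ q ∈ Kc, 0 < lv (rb (D2 Ω u (q.1, q.2.1))) q.2.2 := fun q hq => by
    refine S.lvpos ht1 E.e1 (hmem q hq) ?_
    have : ‖q.2.2‖ = 1 := by simpa using hq.1.2.2
    exact norm_pos_iff.1 (by rw [this]; exact one_pos)
  let g : Cn n × ℝ × Cn n → ℝ := fun q => (q.2.1 - t1) ^ n * lv (rb (fderiv ℝ (fderiv ℝ ρ) q.1)) q.2.2 /
    lv (rb (D2 Ω u (q.1, q.2.1))) q.2.2
  have hg : ContinuousOn g Kc := by
    have cu : ContinuousOn (fun q : Cn n × ℝ × Cn n => D2 Ω u (q.1, q.2.1)) Kc :=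
      S.D2c.comp (f := fun q : Cn n × ℝ × Cn n => (q.1, q.2.1)) (by fun_prop)
        (fun q hq => ⟨(hmem q hq).1, ht1.trans_le (hmem q hq).2.1, (hmem q hq).2.2⟩)
    refine ContinuousOn.div (ContinuousOn.mul (by fun_prop) ?_) ?_ fun q hq => (hpos q hq).ne'
    · simp only [lv_rb]
      exact ((((cf2.comp continuous_fst).clm_apply c22).clm_apply c22).add
        (((cf2.comp continuous_fst).clm_apply cI).clm_apply cI)).div_const _ |>.continuousOn
    · simp only [lv_rb]
      exact (((cu.clm_apply c22.continuousOn).clm_apply c22.continuousOn).add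
        ((cu.clm_apply cI.continuousOn).clm_apply cI.continuousOn)).div_const _
  have hin : (z, t, ξ) ∈ Kc := ⟨⟨hz, ⟨hlt.le, le_rfl⟩, by simpa using hξ⟩, hξ1, hξ2⟩
  obtain ⟨q0, hq0, hq0m⟩ := hKc.exists_isMaxOn ⟨_, hin⟩ hg
  obtain ⟨z0, t0, ξ0⟩ := q0
  set g0 := g (z0, t0, ξ0) with hg0
  have hall : ∀ y ∈ frontier Ω, ∀ s ∈ Icc t1 t, ∀ η : Cn n, ‖η‖ = 1 → fderiv ℝ ρ y η = 0 →
      fderiv ℝ ρ y (I • η) = 0 →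
      (s - t1) ^ n * lv (rb (fderiv ℝ (fderiv ℝ ρ) y)) η ≤ g0 * lv (rb (D2 Ω u (y, s))) η := by
    intro y hy s hs η hη h1 h2
    have hk : (y, s, η) ∈ Kc := ⟨⟨hy, hs, by simpa using hη⟩, h1, h2⟩
    have := hq0m hk
    exact (div_le_iff₀ (hpos _ hk)).1 this
  have hfin := hall z hz t ⟨hlt.le, le_rfl⟩ ξ hξ hξ1 hξ2
  have hlvu := hpos _ hin
  have hr0 : 0 ≤ (t - t1) ^ n * lv (rb (fderiv ℝ (fderiv ℝ ρ) z)) ξ := by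
    have := h.levi z (frontier_subset_closure hz) ξ
    have h2 : 0 ≤ c * ‖ξ‖ ^ 2 := by positivity
    exact mul_nonneg (pow_nonneg (by linarith) _) (h2.trans this)
  rw [mul_assoc]
  rcases le_or_gt g0 1 with h1 | h1
  · calc _ ≤ 1 * ((t - t1) ^ n * lv (rb (fderiv ℝ (fderiv ℝ ρ) z)) ξ) :=
          mul_le_mul_of_nonneg_right (min_le_right _ _) hr0
      _ ≤ g0 * lv (rb (D2 Ω u (z, t))) ξ := by rw [one_mul]; exact hfin
      _ ≤ 1 * lv (rb (D2 Ω u (z, t))) ξ := by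
          exact mul_le_mul_of_nonneg_right h1 hlvu.le
      _ = _ := one_mul _
  · have hg0p : 0 < g0 := by linarith
    have hq1 : z0 ∈ frontier Ω := hq0.1.1
    have hq2 : t0 ∈ Icc t1 t := hq0.1.2.1
    have hq3 : ‖ξ0‖ = 1 := by simpa using hq0.1.2.2
    have ht0 : t1 < t0 := by
      rcases eq_or_lt_of_le hq2.1 with he | hl
      · exfalso
        have : g0 = 0 := by
          rw [hg0]
          change (t0 - t1) ^ n * _ / _ = 0
          rw [← he, sub_self, zero_pow hn.ne', zero_mul, zero_div]
        linarith
      · exact hl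
    have heq : g0⁻¹ * (t0 - t1) ^ n * lv (rb (fderiv ℝ (fderiv ℝ ρ) z0)) ξ0 = lv (rb (D2 Ω u (z0, t0))) ξ0 := by
      have hp := hpos _ hq0
      have : g0 * lv (rb (D2 Ω u (z0, t0))) ξ0 = (t0 - t1) ^ n * lv (rb (fderiv ℝ (fderiv ℝ ρ) z0)) ξ0 :=
        div_mul_cancel₀ _ hp.ne'
      rw [mul_assoc, ← this, ← mul_assoc, inv_mul_cancel₀ hg0p.ne', one_mul]
    have hκ := km u φ f S z0 hq1 t0 ⟨ht0, hq2.2.trans_lt ht.2⟩ ξ0 hq3 hq0.2.1 hq0.2.2 g0⁻¹ (inv_pos.2 hg0p)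
      (inv_le_one_of_one_le₀ h1.le) heq (fun y hy s hs => tan_scale fun η hη k1 k2 => by
        have := hall y hy s ⟨hs.1, hs.2.trans hq2.2⟩ η hη k1 k2
        rw [mul_assoc, inv_mul_le_iff₀ hg0p]; exact this)
    calc _ ≤ g0⁻¹ * ((t - t1) ^ n * lv (rb (fderiv ℝ (fderiv ℝ ρ) z)) ξ) :=
          mul_le_mul_of_nonneg_right ((min_le_left _ _).trans hκ) hr0
      _ ≤ _ := by rw [inv_mul_le_iff₀ hg0p]; exact hfin

lemma E7 {Ω : Set (Cn n)} {ρ : Cn n → ℝ} {c T : ℝ} (hn : 0 < n) (h : Dom Ω ρ c) (hT : 0 < T)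
    {Cp Cf : ℝ} (Cu : ℝ) (hCp : 0 ≤ Cp) (hCf : 0 ≤ Cf) {ε : ℝ} (hε : 0 < ε) :
    ∃ Λ, 0 ≤ Λ ∧ ∀ u φ f, Sol Ω ρ c T Cu Cp Cf u φ f → ∀ z ∈ frontier Ω, ∀ t ∈ Ico ε T, ∀ x : Cn n,
      D2 Ω u (z, t) x x ≤ Λ * ‖x‖ ^ 2 := by
  obtain ⟨M, hM, kM⟩ := est12 hn h hT Cu Cp Cf hε
  obtain ⟨b, N, hb, hN, kν⟩ := h.nu
  obtain ⟨M5, hM5, k5⟩ := E5 hn h hT Cu Cp Cf hε hb hN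
  obtain ⟨R, hR, hR0, hR1, hR2, hR3, -⟩ := h.bds
  obtain ⟨m, hm, km⟩ := E6 hn h hT Cu hCp hCf hε
  set M2 := M5 + ((M + Cp) * N * R / b + Cp) with hM2
  have hM20 : 0 ≤ M2 := by positivity
  set G := (M2 * N ^ 2 + (M2 * (1 + N)) ^ 2 / m + 4 * N ^ 2 * m) + (4 * (M * N ^ 2) / (m / 4) ^ (n - 1) + M2 * N ^ 2)
    with hG
  have hG0 : 0 ≤ G := by positivity
  refine ⟨M2 * (1 + R / b * N) ^ 2 + 2 * (R / b) * M2 * (1 + R / b * N) + (R / b) ^ 2 * G, by positivity,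
    fun u φ f S z hz t ht x => ?_⟩
  have E := kM u φ f S
  obtain ⟨ν, hν, hν1, hν2⟩ := kν z hz
  have hNu : Nu ρ b N z ν := ⟨hb, hν, hν1, hν2⟩
  have hBB := S.bb hT hε E hR1 hR2 hz ht hNu (by linarith only [hM5] : (0 : ℝ) ≤ M5) (k5 u φ f S z hz t ht ν hNu)
  have hD := (S.detcl hε E.e1 (p := (z, t)) ⟨frontier_subset_closure hz, ht⟩).1
  exact hBB.LA_up hG0 (hBB.nn_bd hm (km u φ f S z hz t ht) (by linarith) hD) x


/-! ### Interior second order estimate -/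

set_option maxHeartbeats 1600000 in
lemma E8 {Ω : Set (Cn n)} {ρ : Cn n → ℝ} {c T : ℝ} (hn : 0 < n) (h : Dom Ω ρ c) (hT : 0 < T)
    {Cp Cf : ℝ} (Cu : ℝ) (hCp : 0 ≤ Cp) (hCf : 0 ≤ Cf) {ε : ℝ} (hε : 0 < ε) :
    ∃ N, 0 ≤ N ∧ ∀ u φ f, Sol Ω ρ c T Cu Cp Cf u φ f → ∀ z ∈ Ω, ∀ t ∈ Ico ε T, ∀ v : Cn n, ‖v‖ = 1 →
      D2 Ω u (z, t) v v + D2 Ω u (z, t) (I • v) (I • v) ≤ N := by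
  obtain ⟨M, hM, kM⟩ := est12 hn h hT Cu Cp Cf (half_pos hε)
  obtain ⟨Λ, hΛ, kΛ⟩ := E7 hn h hT Cu hCp hCf (half_pos hε)
  obtain ⟨R, hR, hR0, hR1, hR2, hR3, hRb⟩ := h.bds
  have hc := h.cpos
  set K : ℝ := c / R ^ 2 with hK
  have hK0 : 0 < K := by positivity
  set C1 : ℝ := 2 * (Cf * (1 + M) ^ 2) with hC1
  set C2 : ℝ := 8 * M ^ 2 * 2 ^ (n - 1) / (K * c) ^ n with hC2
  have hC10 : 0 ≤ C1 := by positivity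
  have hC20 : 0 ≤ C2 := by positivity
  set C : ℝ := C1 + C2 with hC
  have hC0 : 0 ≤ C := by positivity
  set N := (C * (n + 2 * C * T) ^ n + T ^ n * (2 * Λ + 1)) * Real.exp (2 * (K * R)) with hN
  have hN0 : 0 ≤ N := by positivity
  refine ⟨N / (ε / 2) ^ n, by positivity, fun u φ f S z hz t ht v hv => ?_⟩
  have E := kM u φ f S
  have hO := S.opQ
  have hIv : ‖I • v‖ = 1 := by rw [norm_smul, norm_I, one_mul, hv]
  have hus := S.us
  have hps : ∀ b, Sm (Ω ×ˢ Ioo 0 T) (pd b (pd b u)) := fun b => (hus.pd hO b).pd hO b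
  have we : EqOn (fun p => D2 Ω u p v v + D2 Ω u p (I • v) (I • v))
      (fun p => pd (sv v) (pd (sv v) u) p + pd (sv (I • v)) (pd (sv (I • v)) u) p) (Ω ×ˢ Ioo 0 T) := by
    intro p hp
    simp only [D2_pd h hus hp]
  have ws := ((hps (sv v)).add (hps (sv (I • v)))).congr we
  have wc : ContinuousOn (fun p => D2 Ω u p v v + D2 Ω u p (I • v) (I • v)) (closure Ω ×ˢ Ioo 0 T) :=
    (S.ur.c2 _ _).add (S.ur.c2 _ _)
  have hrs : Sm (Ω ×ˢ Ioo 0 T) (fun q : Xn n => ρ q.1) := h.rho_sm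
  set ψ : Xn n → ℝ := fun p => K * ρ p.1 with hψ
  have hψs : Sm (Ω ×ˢ Ioo 0 T) ψ := hrs.cmul K
  have main := S.cut (t1 := ε / 2) (C := C) (B := 2 * Λ) (Ψ := K * R) hn (half_pos hε) hC0 (by positivity) hT ws wc hψs
      ?_ ?_ ?_ (fun p c' => K * c * SS c') ?_ z (subset_closure hz) t ⟨by linarith [ht.1], ht.2⟩
  · rw [le_div_iff₀ (by positivity), mul_comm]
    rcases le_or_gt (D2 Ω u (z, t) v v + D2 Ω u (z, t) (I • v) (I • v)) 0 with h0 | h0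
    · exact (mul_nonpos_of_nonneg_of_nonpos (by positivity) h0).trans hN0
    · refine le_trans ?_ main
      have : ε / 2 ≤ t - ε / 2 := by linarith [ht.1]
      gcongr
  · exact continuousOn_const.mul (h.sm.continuous.comp_continuousOn continuousOn_fst)
  · intro p hp
    rw [hψ]
    simp only [abs_mul, abs_of_pos hK0]
    have := hR0 p.1 hp.1
    gcongr
  · intro y hy s hs
    have e1 := kΛ u φ f S y hy s hs v
    have e2 := kΛ u φ f S y hy s hs (I • v)
    rw [hv] at e1
    rw [hIv] at e2
    linarith only [e1, e2]
  · intro p hp hpt D c' hF hw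
    have hpε : p ∈ Ω ×ˢ Ico (ε / 2) T := ⟨hp.1, hpt, hp.2.2⟩
    have hpc : p ∈ closure Ω ×ˢ Ico (ε / 2) T := ⟨subset_closure hp.1, hpt, hp.2.2⟩
    have hS := SS_nonneg c'
    have eD := E.e1.dup p hpε D c' hF
    have hD := hF.dpos
    have ewp := we hp
    simp only at ewp hw ⊢
    refine ⟨?_, ?_, by positivity, ?_⟩
    · rw [heat_eqOn hO we hp, heat_add hO (hps _) (hps _) hp]
      obtain ⟨k, k1, k2, -, k3⟩ := S.fc1 hp
      have gb : ∀ x : Cn n, ‖x‖ = 1 → heat c' (pd (sv x) (pd (sv x) u)) p ≤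
          Cf * (1 + M) ^ 2 + k * pd (sv x) (pd (sv x) u) p := by
        intro x hx
        have a1 := (hF.conc (sv x)).trans (k3 (sv x))
        have a2 : |pd (sv x) u p| ≤ M := by
          rw [← D1_pd h hus hp]
          have := (D1 Ω u p).le_opNorm x
          rw [hx, mul_one, Real.norm_eq_abs] at this
          exact this.trans (E.gr p hpc)
        have a3 : |(sv x).2| + ‖(sv x).1‖ + |pd (sv x) u p| ≤ 1 + M := by
          simp only [sv, abs_zero, zero_add, hx] at a2 ⊢
          linarith only [a2]
        have a4 : Cf * (|(sv x).2| + ‖(sv x).1‖ + |pd (sv x) u p|) ^ 2 ≤ Cf * (1 + M) ^ 2 := by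
          gcongr
        linarith only [a1, a4]
      have g1 := gb v hv
      have g2 := gb _ hIv
      have g3 : k * (D2 Ω u p v v + D2 Ω u p (I • v) (I • v)) ≤ 0 :=
        mul_nonpos_of_nonpos_of_nonneg k1 (by linarith only [hw])
      have g4 : C * 1 ≤ C * (D2 Ω u p v v + D2 Ω u p (I • v) (I • v)) :=
        mul_le_mul_of_nonneg_left hw hC0
      rw [ewp, mul_add] at g3
      linarith only [g1, g2, g3, g4, hC, hC1, hC20]
    · have e1 : heat c' ψ p = K * heat c' (fun q : Xn n => ρ q.1) p := by
        rw [hψ, heat_cmul hO hrs hp]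
      have e2 := h.heat_rho (subset_closure hp.1) hF
      have e3 : Gam c' ψ ψ p = K ^ 2 * Gam c' (fun q : Xn n => ρ q.1) (fun q : Xn n => ρ q.1) p := by
        simp only [Gam, Finset.mul_sum]
        refine Finset.sum_congr rfl fun i _ => ?_
        rw [hψ, pd_cmul hO hrs hp]
        ring
      have e4 := (hRb T).1.Gam hp c'
      have e6 : K ^ 2 * (R ^ 2 * SS c') = K * c * SS c' := by
        rw [hK]; field_simp
      have e7 : K ^ 2 * Gam c' (fun q : Xn n => ρ q.1) (fun q : Xn n => ρ q.1) p ≤ K * c * SS c' := by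
        rw [← e6]; gcongr
      have e9 : K * heat c' (fun q : Xn n => ρ q.1) p ≤ K * (- (2 * c * SS c')) := by gcongr
      rw [e1, e3]
      linarith only [e7, e9, hC0]
    · have e1 := hF.levup v
      rw [lv_rb, hv, one_pow, mul_one] at e1
      have e2 := hF.Slow M hM eD hn
      have e3 : 1 ≤ 2 * M * SS c' := by
        rw [div_le_iff₀ (by positivity)] at e2
        linarith only [e2]
      calc D2 Ω u p v v + D2 Ω u p (I • v) (I • v) ≤ 4 * (D * (2 * SS c') ^ (n - 1)) * 1 := by
            linarith only [e1]
        _ ≤ 4 * (M * (2 * SS c') ^ (n - 1)) * (2 * M * SS c') := by gcongr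
        _ = C2 * (K * c * SS c') ^ n := by
            obtain ⟨m, rfl⟩ : ∃ m, n = m + 1 := ⟨n - 1, by omega⟩
            rw [hC2, Nat.add_sub_cancel, div_mul_eq_mul_div, mul_pow (K * c), mul_pow 2]
            field_simp
            ring
        _ ≤ C * (K * c * SS c') ^ n := by
            gcongr
            linarith only [hC, hC10]


/-! ### Assembly -/

lemma zero_case (Ω : Set (Cn 0)) (T Cu Cφv Cf : ℝ) (hT : 0 < T)
    {u φ : Cn 0 × ℝ → ℝ} {f : ℝ × Cn 0 × ℝ → ℝ} (H : AprioriHyps 0 Ω T Cu Cφv Cf u φ f) :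
    (∀ z ∈ Ω, ∀ t ∈ Ioo (0 : ℝ) T, |u (z, t)| ≤ Cu + |Cf| * T) ∧
    (∀ z ∈ Ω, ∀ t ∈ Ioo (0 : ℝ) T,
      ‖fderiv ℝ (fun w => u (w, t)) z‖ + |deriv (fun s => u (z, s)) t|
        + lap (fun w => u (w, t)) z ≤ |Cf|) := by
  obtain ⟨hφ, hf, hu, h21, hpsh, heq, hbd, hin, hfd, hfb, hφb⟩ := H
  have hd : ∀ z ∈ Ω, ∀ t ∈ Ioo (0 : ℝ) T, |deriv (fun s => u (z, s)) t| ≤ |Cf| := by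
    intro z hz t ht
    have h1 := hfb 0 (by norm_num) (t, z, u (z, t)) ⟨ht, hz, mem_univ _⟩
    rw [norm_iteratedFDeriv_zero, Real.norm_eq_abs] at h1
    rw [heq z hz t ht]
    simp only [Matrix.det_isEmpty, one_re, Real.log_one, zero_add]
    exact h1.trans (le_abs_self _)
  refine ⟨fun z hz t ht => ?_, fun z hz t ht => ?_⟩
  · have h1 := h21.2.1 z (subset_closure hz)
    have hc : ContinuousOn (fun s => u (z, s)) (Icc 0 t) :=
      h1.continuousOn.mono fun s hs => ⟨hs.1, hs.2.trans_lt ht.2⟩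
    have hdf : DifferentiableOn ℝ (fun s => u (z, s)) (Ioo 0 t) :=
      (h1.differentiableOn one_ne_zero).mono fun s hs => ⟨hs.1.le, hs.2.trans ht.2⟩
    obtain ⟨s, hs, e⟩ := exists_deriv_eq_slope _ ht.1 hc hdf
    have h2 := hd z hz s ⟨hs.1, hs.2.trans ht.2⟩
    rw [e, sub_zero, abs_div, abs_of_pos ht.1, div_le_iff₀ ht.1] at h2
    have h3 := hin z hz
    have h4 : |Cf| * t ≤ |Cf| * T := mul_le_mul_of_nonneg_left ht.2.le (abs_nonneg _)
    have h5 : |u (z, t)| - |u (z, 0)| ≤ |u (z, t) - u (z, 0)| := abs_sub_abs_le_abs_sub _ _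
    linarith
  · have e1 : fderiv ℝ (fun w => u (w, t)) z = 0 := by
      ext x
      rw [Subsingleton.elim x 0, map_zero, map_zero]
    have e2 : lap (fun w => u (w, t)) z = 0 := by simp [lap, lapW]
    rw [e1, e2, norm_zero, zero_add, add_zero]
    exact hd z hz t ht

lemma lap_eq {Ω : Set (Cn n)} {ρ : Cn n → ℝ} {c T : ℝ} (h : Dom Ω ρ c) {F : Xn n → ℝ}
    (hF : Sm (Ω ×ˢ Ioo 0 T) F) {z : Cn n} {t : ℝ} (hp : (z, t) ∈ Ω ×ˢ Ioo 0 T) :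
    lap (fun w => F (w, t)) z = ∑ α : Fin n, (D2 Ω F (z, t) (cvec n α 1) (cvec n α 1)
      + D2 Ω F (z, t) (I • cvec n α 1) (I • cvec n α 1)) := by
  have h1 : DifferentiableAt ℝ (fderiv ℝ (fun x => F (x, t))) z :=
    ((Sm.slice (T := T) h hF hp).fderiv_right (m := ((⊤ : ℕ∞) : WithTop ℕ∞)) (by simp)).differentiableAt (by simp)
  have h2 : ∀ v w : Cn n, fderiv ℝ (fun y => fderiv ℝ (fun x => F (x, t)) y v) z w = D2 Ω F (z, t) w v := by
    intro v w
    rw [D2_fd h hp, fderiv_clm_apply h1 (differentiableAt_const v)]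
    simp
  simp only [lap, lapW, fderivWithin_univ, h2, cvec_I]

lemma pos_case {Ω : Set (Cn n)} {ρ : Cn n → ℝ} {c T : ℝ} (hn : 0 < n) (h : Dom Ω ρ c) (hT : 0 < T)
    {Cp Cf : ℝ} (Cu : ℝ) (hCp : 0 ≤ Cp) (hCf : 0 ≤ Cf) {ε : ℝ} (hε : 0 < ε) :
    ∃ C : ℝ, ∀ u φ f, Sol Ω ρ c T Cu Cp Cf u φ f → ∀ z ∈ Ω, ∀ t ∈ Ioo ε T,
      ‖fderiv ℝ (fun w => u (w, t)) z‖ + |deriv (fun s => u (z, s)) t|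
        + lap (fun w => u (w, t)) z ≤ C := by
  obtain ⟨M, hM, kM⟩ := est12 hn h hT Cu Cp Cf hε
  obtain ⟨N, hN, kN⟩ := E8 hn h hT Cu hCp hCf hε
  refine ⟨M + M + ∑ _α : Fin n, N, fun u φ f S z hz t ht => ?_⟩
  have E := kM u φ f S
  have ht' : t ∈ Ico ε T := ⟨ht.1.le, ht.2⟩
  have hp : (z, t) ∈ Ω ×ˢ Ioo 0 T := ⟨hz, hε.trans ht.1, ht.2⟩
  have e1 : fderiv ℝ (fun w => u (w, t)) z = D1 Ω u (z, t) := by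
    rw [D1, fderivWithin_of_mem_nhds (mem_of_superset (h.op.mem_nhds hz) subset_closure)]
  rw [e1, pd_eT_deriv S.opQ S.us hp, lap_eq h S.us hp]
  refine add_le_add (add_le_add (E.gr _ ⟨subset_closure hz, ht'⟩) (E.e1.ut _ ⟨hz, ht'⟩)) ?_
  refine Finset.sum_le_sum fun α _ => kN u φ f S z hz t ht' _ ?_
  simp [cvec]

/-- **A priori estimates** (Theorem 2 of the paper): there is `M₀` depending only on
`Ω, T, Cu, Cφv, Cf` and, for each `0 < ε < T`, a constant `C` depending only on
`Ω, ε, T, Cu, Cφv, Cf`, such that every solution `u` as above satisfies `|u| ≤ M₀` on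
`Ω×(0,T)` and `|∇u| + |∂u/∂t| + Δu ≤ C` on `Ω×(ε,T)`. -/
theorem stmt_1 (n : ℕ) (Ω : Set (Cn n)) (T Cu Cφv Cf : ℝ)
    (hΩ : IsSPCDomain Ω) (hT : 0 < T) :
    ∃ M₀ : ℝ, ∀ ε : ℝ, 0 < ε → ε < T → ∃ C : ℝ,
      ∀ (u φ : Cn n × ℝ → ℝ) (f : ℝ × Cn n × ℝ → ℝ),
        AprioriHyps n Ω T Cu Cφv Cf u φ f →
        (∀ z ∈ Ω, ∀ t ∈ Ioo (0 : ℝ) T, |u (z, t)| ≤ M₀) ∧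
        (∀ z ∈ Ω, ∀ t ∈ Ioo ε T,
          ‖fderiv ℝ (fun w => u (w, t)) z‖ + |deriv (fun s => u (z, s)) t|
            + lap (fun w => u (w, t)) z ≤ C) := by
  obtain ⟨ρ, c, h⟩ := exists_dom hΩ
  rcases Nat.eq_zero_or_pos n with rfl | hn
  · refine ⟨Cu + |Cf| * T, fun ε hε _ => ⟨|Cf|, fun u φ f H => ?_⟩⟩
    obtain ⟨h1, h2⟩ := zero_case Ω T Cu Cφv Cf hT H
    exact ⟨h1, fun z hz t ht => h2 z hz t ⟨hε.trans ht.1, ht.2⟩⟩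
  · obtain ⟨M₀, -, k0⟩ := E1 hn h hT Cu Cφv Cf
    refine ⟨M₀, fun ε hε _ => ?_⟩
    by_cases hC : 0 ≤ Cφv ∧ 0 ≤ Cf
    · obtain ⟨C, kC⟩ := pos_case hn h hT Cu hC.1 hC.2 hε
      refine ⟨C, fun u φ f H => ?_⟩
      have S := sol_of h H
      exact ⟨fun z hz t ht => k0 u φ f S (z, t) ⟨subset_closure hz, ht.1.le, ht.2⟩, kC u φ f S⟩
    · refine ⟨0, fun u φ f H => ?_⟩
      have S := sol_of h H
      exact absurd ⟨S.Cp_nonneg hT, S.Cf_nonneg hT⟩ hC
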